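/- Let n ∈ ℕ and let K be a field. If K is a P_n-field, then the Laurent series field K((t)) is a P_n-field. -/

import Mathlib

open scoped Pointwise

universe u

namespace SosPaper

/-- The set of sums of `k` squares in a commutative ring. -/
def sumSq (A : Type*) [CommRing A] (k : ℕ) : Set A :=
  {x | ∃ f : Fin k → A, x = ∑ i, f i ^ 2}

/-- The set of sums of squares in a commutative ring. -/
def sums (A : Type*) [CommRing A] : Set A := ⋃ k, sumSq A k

/-- The Pythagoras number of a commutative ring, as an extended natural number:
the least `k` such that every sum of squares is a sum of `k` squares. -/
noncomputable def pyth (A : Type*) [CommRing A] : ℕ∞ :=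
  sInf ((fun k : ℕ => (k : ℕ∞)) '' {k : ℕ | sums A ⊆ sumSq A k})

/-- The level of a commutative ring: the least `k` such that `-1` is a sum of
`k` squares. -/
noncomputable def level (A : Type*) [CommRing A] : ℕ∞ :=
  sInf ((fun k : ℕ => (k : ℕ∞)) '' {k : ℕ | (-1 : A) ∈ sumSq A k})

/-- A subring `H` of a field (or commutative ring) `A` has `A` as its field of
fractions: every element of `A` is a quotient of two elements of `H`. -/
def IsFractionSubring {A : Type*} [CommRing A] (H : Subring A) : Prop :=
  ∀ x : A, ∃ a b : H, b ≠ 0 ∧ x * b = a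

/-- The invariant `p*(H)`: the least `k` such that every unit of `H` that is a
sum of squares in the ambient ring is a sum of `k` squares in the ambient ring. -/
noncomputable def pstar {A : Type*} [CommRing A] (H : Subring A) : ℕ∞ :=
  sInf ((fun k : ℕ => (k : ℕ∞)) '' {k : ℕ | ∀ h : H, IsUnit h → (h : A) ∈ sums A → (h : A) ∈ sumSq A k})

/-- A commutative ring is semilocal if it has only finitely many maximal ideals. -/
def Semilocal (A : Type*) [CommRing A] : Prop := {I : Ideal A | I.IsMaximal}.Finite

/-- The `H`-submodule `f·H` of the ambient ring, as a set. -/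
def mulSet {A : Type*} [CommRing A] (H : Subring A) (f : A) : Set A :=
  {x | ∃ h ∈ H, x = f * h}

/-- A subring `H` of a field `F` (with fraction field `F`) is square-effective if
every sum of two squares of elements of `F` can be rewritten as `g₁² + g₂²` with
`f₁H + f₂H = g₁H ⊇ g₂H`. -/
def SquareEffective {A : Type*} [CommRing A] (H : Subring A) : Prop :=
  ∀ f₁ f₂ : A, ∃ g₁ g₂ : A, f₁ ^ 2 + f₂ ^ 2 = g₁ ^ 2 + g₂ ^ 2 ∧
    mulSet H f₁ + mulSet H f₂ = mulSet H g₁ ∧ mulSet H g₂ ⊆ mulSet H g₁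

/-- The two defining conditions for a (semilocal Bézout) domain `H` to be
square-effective of order `n`:
`1 + Σ_{2ⁿ−1} H² ⊆ H^×` and `(1 + Σ_{2ⁿ} H²) ∩ Jac(H) ≠ ∅`. -/
def SqEffOrder {A : Type*} [CommRing A] (H : Subring A) (n : ℕ) : Prop :=
  (∀ x : H, x ∈ sumSq H (2 ^ n - 1) → IsUnit (1 + x)) ∧
  ∃ x : H, x ∈ sumSq H (2 ^ n) ∧ 1 + x ∈ Ideal.jacobson (⊥ : Ideal H)

/-- A field `F` is `n`-effective if it has a semilocal Bézout subring `H` with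
fraction field `F` which is square-effective of order `n` and with `p*(H) ≤ 2ⁿ`. -/
def IsNEffective (n : ℕ) (F : Type*) [Field F] : Prop :=
  ∃ H : Subring F, IsFractionSubring H ∧ Semilocal H ∧ IsBezout H ∧
    SqEffOrder H n ∧ pstar H ≤ ((2 ^ n : ℕ) : ℕ∞)

/-- A subring `H` of `F` characterises sums of `k` squares in `F` if every unit
of `H` which is a sum of squares in `F` and whose residue modulo every maximal
ideal of `H` is a sum of `k` squares is itself a sum of `k` squares in `F`. -/
def Characterises {A : Type*} [CommRing A] (H : Subring A) (k : ℕ) : Prop :=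
  ∀ h : H, IsUnit h → (h : A) ∈ sums A →
    (∀ m : Ideal H, m.IsMaximal → Ideal.Quotient.mk m h ∈ sumSq (H ⧸ m) k) →
    (h : A) ∈ sumSq A k

/-- A function field in one variable over `K`: a finitely generated field
extension of transcendence degree 1, equivalently a finite extension of a
subfield `K(x)` with `x` transcendental over `K`. -/
def IsFunctionFieldOneVar (K F : Type*) [Field K] [Field F] [Algebra K F] : Prop :=
  ∃ x : F, Transcendental K x ∧ FiniteDimensional (IntermediateField.adjoin K {x}) F

/-- A `𝒫ₙ`-field: `p(K(X)) ≤ 2^{n+1}` and every function field in one variable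
over `K` with Pythagoras number `> 2^{n+1}` is `(n+1)`-effective. -/
def IsPnField (n : ℕ) (K : Type u) [Field K] : Prop :=
  pyth (RatFunc K) ≤ ((2 ^ (n + 1) : ℕ) : ℕ∞) ∧
  ∀ (F : Type u) [Field F] [Algebra K F], IsFunctionFieldOneVar K F →
    ((2 ^ (n + 1) : ℕ) : ℕ∞) < pyth F → IsNEffective (n + 1) F

section SumsOfSquares

variable {A B : Type*} [CommRing A] [CommRing B]

theorem mem_sumSq_of_fintype {ι : Type*} [Fintype ι] {k : ℕ} (h : Fintype.card ι ≤ k)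
    (f : ι → A) : ∑ i, f i ^ 2 ∈ sumSq A k := by
  classical
  obtain ⟨e⟩ : Nonempty (ι ↪ Fin k) :=
    Function.Embedding.nonempty_of_card_le (by simpa using h)
  refine ⟨Function.extend e f 0, ?_⟩
  rw [← Finset.sum_subset (Finset.subset_univ (Finset.univ.map e))]
  · simp [e.injective.extend_apply]
  · intro x _ hx
    rw [Function.extend_apply']
    · simp
    · rintro ⟨i, rfl⟩
      simp at hx

theorem sumSq_mono {k l : ℕ} (h : k ≤ l) : sumSq A k ⊆ sumSq A l := by
  rintro _ ⟨f, rfl⟩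
  exact mem_sumSq_of_fintype (by simpa using h) f

theorem add_mem_sumSq {k l : ℕ} {x y : A} (hx : x ∈ sumSq A k) (hy : y ∈ sumSq A l) :
    x + y ∈ sumSq A (k + l) := by
  obtain ⟨f, rfl⟩ := hx
  obtain ⟨g, rfl⟩ := hy
  have := mem_sumSq_of_fintype (A := A) (k := k + l) (ι := Fin k ⊕ Fin l) (by simp)
    (Sum.elim f g)
  simpa using this

theorem sq_mul_mem_sumSq {k : ℕ} {x : A} (a : A) (hx : x ∈ sumSq A k) :
    a ^ 2 * x ∈ sumSq A k := by
  obtain ⟨f, rfl⟩ := hx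
  exact ⟨fun i => a * f i, by simp [mul_pow, Finset.mul_sum]⟩

theorem map_mem_sumSq {k : ℕ} {x : A} (φ : A →+* B) (hx : x ∈ sumSq A k) :
    φ x ∈ sumSq B k := by
  obtain ⟨f, rfl⟩ := hx
  exact ⟨fun i => φ (f i), by simp⟩

theorem sq_mem_sumSq {k : ℕ} (hk : 1 ≤ k) (a : A) : a ^ 2 ∈ sumSq A k :=
  sumSq_mono hk ⟨fun _ => a, by simp⟩

theorem zero_mem_sumSq (k : ℕ) : (0 : A) ∈ sumSq A k :=
  sumSq_mono (Nat.zero_le k) ⟨fun _ => 0, by simp⟩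

theorem mem_sums {x : A} : x ∈ sums A ↔ ∃ k, x ∈ sumSq A k := by
  simp [sums]

theorem sumSq_subset_sums (k : ℕ) : sumSq A k ⊆ sums A := fun _ hx => mem_sums.2 ⟨k, hx⟩

theorem add_mem_sums {x y : A} (hx : x ∈ sums A) (hy : y ∈ sums A) : x + y ∈ sums A := by
  obtain ⟨k, hk⟩ := mem_sums.1 hx
  obtain ⟨l, hl⟩ := mem_sums.1 hy
  exact mem_sums.2 ⟨_, add_mem_sumSq hk hl⟩

theorem sq_mem_sums (a : A) : a ^ 2 ∈ sums A := sumSq_subset_sums 1 (sq_mem_sumSq le_rfl a)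

theorem sum_sq_mem_sums {ι : Type*} (s : Finset ι) (f : ι → A) : ∑ i ∈ s, f i ^ 2 ∈ sums A := by
  rw [← Finset.sum_coe_sort]
  exact sumSq_subset_sums _ (mem_sumSq_of_fintype le_rfl fun i : s => f i)

theorem mul_mem_sums {x y : A} (hx : x ∈ sums A) (hy : y ∈ sums A) : x * y ∈ sums A := by
  obtain ⟨k, f, rfl⟩ := mem_sums.1 hx
  obtain ⟨l, g, rfl⟩ := mem_sums.1 hy
  rw [Finset.sum_mul_sum, ← Finset.sum_product']
  simp_rw [← mul_pow]
  exact sum_sq_mem_sums _ _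

theorem map_mem_sums {x : A} (φ : A →+* B) (hx : x ∈ sums A) : φ x ∈ sums B := by
  obtain ⟨k, hk⟩ := mem_sums.1 hx
  exact mem_sums.2 ⟨k, map_mem_sumSq φ hk⟩

theorem sInf_image_cast_le_iff {S : Set ℕ} (hS : IsUpperSet S) {k : ℕ} :
    sInf ((fun k : ℕ => (k : ℕ∞)) '' S) ≤ (k : ℕ∞) ↔ k ∈ S := by
  refine ⟨fun h => ?_, fun h => sInf_le ⟨k, h, rfl⟩⟩
  rcases S.eq_empty_or_nonempty with rfl | hne
  · simp at h
  obtain ⟨l, hl, hl'⟩ := csInf_mem (hne.image fun k : ℕ => (k : ℕ∞))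
  exact hS (Nat.cast_le.mp (hl'.trans_le h)) hl

theorem pyth_le_iff {k : ℕ} : pyth A ≤ (k : ℕ∞) ↔ sums A ⊆ sumSq A k :=
  sInf_image_cast_le_iff fun _ _ h h' => h'.trans (sumSq_mono h)

theorem pstar_le_iff {k : ℕ} {H : Subring A} : pstar H ≤ (k : ℕ∞) ↔
    ∀ h : H, IsUnit h → (h : A) ∈ sums A → (h : A) ∈ sumSq A k := by
  refine sInf_image_cast_le_iff ?_
  exact fun _ _ h h' x hx hx' => sumSq_mono h (h' x hx hx')

end SumsOfSquares

section Pfister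

open Matrix

variable {F : Type*} [Field F]

/-- Every sum of squares indexed by `ι` is the multiplier of a similarity of the sum of squares
form indexed by `ι`. -/
def HasSimilarities (F : Type*) [Field F] (ι : Type*) [Fintype ι] [DecidableEq ι] : Prop :=
  ∀ c : ι → F, ∃ T : Matrix ι ι F, T * Tᵀ = (∑ i, c i ^ 2) • (1 : Matrix ι ι F) ∧
    Tᵀ * T = (∑ i, c i ^ 2) • (1 : Matrix ι ι F)

section

variable {ι κ : Type*} [Fintype ι] [DecidableEq ι] [Fintype κ] [DecidableEq κ]

theorem transpose_mul_self_of_mul_transpose {T : Matrix ι ι F} {γ : F} (hγ : γ ≠ 0)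
    (h : T * Tᵀ = γ • (1 : Matrix ι ι F)) : Tᵀ * T = γ • (1 : Matrix ι ι F) := by
  have h1 : T * (γ⁻¹ • Tᵀ) = 1 := by
    rw [Matrix.mul_smul, h, smul_smul, inv_mul_cancel₀ hγ, one_smul]
  have h2 := mul_eq_one_comm.1 h1
  rw [Matrix.smul_mul] at h2
  rw [← h2, smul_smul, mul_inv_cancel₀ hγ, one_smul]

theorem HasSimilarities.sum (h : HasSimilarities F ι) :
    HasSimilarities F (ι ⊕ ι) := by
  intro c
  set a : ι → F := fun i => c (Sum.inl i) with ha
  set b : ι → F := fun i => c (Sum.inr i) with hb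
  have hsum : ∑ i, c i ^ 2 = ∑ i, a i ^ 2 + ∑ i, b i ^ 2 := by simp [ha, hb]
  by_cases hγ : ∑ i, c i ^ 2 = 0
  · exact ⟨0, by simp [hγ], by simp [hγ]⟩
  suffices H : ∃ T : Matrix (ι ⊕ ι) (ι ⊕ ι) F,
      T * Tᵀ = (∑ i, c i ^ 2) • (1 : Matrix (ι ⊕ ι) (ι ⊕ ι) F) by
    obtain ⟨T, h2⟩ := H
    exact ⟨T, h2, transpose_mul_self_of_mul_transpose hγ h2⟩
  obtain ⟨P, hP1, hP2⟩ := h a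
  obtain ⟨Q, hQ1, hQ2⟩ := h b
  rw [hsum] at hγ ⊢
  set α := ∑ i, a i ^ 2
  set β := ∑ i, b i ^ 2
  have key : ∀ X Y : Matrix ι ι F, P * Xᵀ + Q * Yᵀ = 0 →
      X * Xᵀ + Y * Yᵀ = (α + β) • (1 : Matrix ι ι F) →
      (fromBlocks P Q X Y) * (fromBlocks P Q X Y)ᵀ =
        (α + β) • (1 : Matrix (ι ⊕ ι) (ι ⊕ ι) F) := by
    intro X Y h1 h2
    have h3 : X * Pᵀ + Y * Qᵀ = 0 := by
      have := congrArg Matrix.transpose h1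
      simpa using this
    rw [fromBlocks_transpose, fromBlocks_multiply, h1, h2, h3, hP1, hQ1, ← add_smul,
      ← fromBlocks_one, fromBlocks_smul]
    simp
  by_cases hα : α = 0
  · have hβ : β ≠ 0 := by simpa [hα] using hγ
    refine ⟨_, key Q (-(β⁻¹ • (Q * Pᵀ * Q))) ?_ ?_⟩
    · have e : Q * (Qᵀ * (P * Qᵀ)) = β • (P * Qᵀ) := by
        rw [← Matrix.mul_assoc, hQ1, Matrix.smul_mul, Matrix.one_mul]
      simp [Matrix.mul_assoc, e, smul_smul, hβ]
    · have e : Q * (Pᵀ * (Q * (Qᵀ * (P * Qᵀ)))) = (β * α) • (β • (1 : Matrix ι ι F)) := by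
        rw [← Matrix.mul_assoc Q Qᵀ, hQ1, Matrix.smul_mul, Matrix.one_mul, Matrix.mul_smul,
          ← Matrix.mul_assoc Pᵀ, hP2, Matrix.smul_mul, Matrix.one_mul, Matrix.mul_smul,
          Matrix.mul_smul, hQ1, smul_smul]
      simp [Matrix.mul_assoc, e, hQ1, smul_smul, hα]
  · refine ⟨_, key (-(α⁻¹ • (P * Qᵀ * P))) P ?_ ?_⟩
    · have e : P * (Pᵀ * (Q * Pᵀ)) = α • (Q * Pᵀ) := by
        rw [← Matrix.mul_assoc, hP1, Matrix.smul_mul, Matrix.one_mul]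
      simp [Matrix.mul_assoc, e, smul_smul, hα]
    · have e : P * (Qᵀ * (P * (Pᵀ * (Q * Pᵀ)))) = (α * β) • (α • (1 : Matrix ι ι F)) := by
        rw [← Matrix.mul_assoc P Pᵀ, hP1, Matrix.smul_mul, Matrix.one_mul, Matrix.mul_smul,
          ← Matrix.mul_assoc Qᵀ, hQ2, Matrix.smul_mul, Matrix.one_mul, Matrix.mul_smul,
          Matrix.mul_smul, hP1, smul_smul]
      simp only [Matrix.mul_assoc, transpose_neg, transpose_smul, transpose_mul,
        transpose_transpose, Matrix.mul_neg, Matrix.neg_mul, neg_neg, Matrix.smul_mul,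
        Matrix.mul_smul, e, hP1, smul_smul, smul_neg]
      rw [← add_smul]
      congr 1
      field_simp
      ring

theorem HasSimilarities.congr (h : HasSimilarities F ι) (e : ι ≃ κ) :
    HasSimilarities F κ := by
  intro c
  obtain ⟨T, h1, h2⟩ := h (c ∘ e)
  have hs : ∑ i, (c ∘ e) i ^ 2 = ∑ i, c i ^ 2 := Equiv.sum_comp e fun i => c i ^ 2
  rw [hs] at h1 h2
  refine ⟨T.submatrix e.symm e.symm, ?_, ?_⟩
  · rw [transpose_submatrix, submatrix_mul_equiv, h1]
    ext i j
    simp [Matrix.one_apply]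
  · rw [transpose_submatrix, submatrix_mul_equiv, h2]
    ext i j
    simp [Matrix.one_apply]

end

theorem hasSimilarities_two_pow (m : ℕ) : HasSimilarities F (Fin (2 ^ m)) := by
  induction m with
  | zero =>
    have : Subsingleton (Fin (2 ^ 0)) := inferInstanceAs (Subsingleton (Fin 1))
    refine fun c => ⟨Matrix.of fun _ => c, ?_, ?_⟩ <;>
    · ext i j
      rw [Subsingleton.elim i 0, Subsingleton.elim j 0]
      simp [Matrix.mul_apply, sq]
  | succ m ih =>
    have e : Fin (2 ^ m) ⊕ Fin (2 ^ m) ≃ Fin (2 ^ (m + 1)) :=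
      finSumFinEquiv.trans (finCongr (by rw [pow_succ]; ring))
    exact ih.sum.congr e

theorem exists_mul_eq_sum_sq {m : ℕ} (c b : Fin (2 ^ m) → F) :
    ∃ d : Fin (2 ^ m) → F, (∑ i, c i ^ 2) * (∑ i, b i ^ 2) = ∑ i, d i ^ 2 := by
  obtain ⟨T, -, h2⟩ := hasSimilarities_two_pow m c
  refine ⟨T *ᵥ b, ?_⟩
  have : (T *ᵥ b) ⬝ᵥ (T *ᵥ b) = (∑ i, c i ^ 2) * (b ⬝ᵥ b) := by
    rw [Matrix.dotProduct_mulVec, ← Matrix.mulVec_transpose, Matrix.mulVec_mulVec, h2,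
      Matrix.smul_mulVec, Matrix.one_mulVec, smul_dotProduct, smul_eq_mul]
  simpa [dotProduct, sq] using this.symm

theorem mul_mem_sumSq_two_pow {m : ℕ} {x y : F} (hx : x ∈ sumSq F (2 ^ m))
    (hy : y ∈ sumSq F (2 ^ m)) : x * y ∈ sumSq F (2 ^ m) := by
  obtain ⟨c, rfl⟩ := hx
  obtain ⟨b, rfl⟩ := hy
  exact exists_mul_eq_sum_sq c b

theorem inv_mem_sumSq {k : ℕ} {x : F} (hx : x ∈ sumSq F k) : x⁻¹ ∈ sumSq F k := by
  by_cases h : x = 0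
  · subst h
    simpa using hx
  · have := sq_mul_mem_sumSq x⁻¹ hx
    rwa [sq, mul_assoc, inv_mul_cancel₀ h, mul_one] at this

theorem div_mem_sumSq_two_pow {m : ℕ} {x y : F} (hx : x ∈ sumSq F (2 ^ m))
    (hy : y ∈ sumSq F (2 ^ m)) : x / y ∈ sumSq F (2 ^ m) := by
  rw [div_eq_mul_inv]
  exact mul_mem_sumSq_two_pow hx (inv_mem_sumSq hy)

theorem inv_mem_sums {x : F} (hx : x ∈ sums F) : x⁻¹ ∈ sums F := by
  obtain ⟨k, hk⟩ := mem_sums.1 hx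
  exact mem_sums.2 ⟨k, inv_mem_sumSq hk⟩

theorem div_mem_sums {x y : F} (hx : x ∈ sums F) (hy : y ∈ sums F) : x / y ∈ sums F := by
  rw [div_eq_mul_inv]
  exact mul_mem_sums hx (inv_mem_sums hy)

/-- An isotropic Pfister form is hyperbolic, for sums of squares. -/
theorem neg_one_mem_sumSq_of_isotropic {n : ℕ} (a : Fin (2 ^ (n + 1)) → F)
    (ha : ∃ i, a i ≠ 0) (h : ∑ i, a i ^ 2 = 0) : (-1 : F) ∈ sumSq F (2 ^ n) := by
  induction n with
  | zero =>
    change ∑ i : Fin 2, a i ^ 2 = 0 at h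
    rw [Fin.sum_univ_two] at h
    have key : ∀ x y : F, x ≠ 0 → x ^ 2 + y ^ 2 = 0 → (-1 : F) ∈ sumSq F 1 := by
      intro x y hx hxy
      refine ⟨fun _ => y / x, ?_⟩
      simp only [Finset.univ_unique, Finset.sum_const, Finset.card_singleton, one_smul]
      field_simp
      linear_combination -hxy
    obtain ⟨i, hi⟩ := ha
    by_cases h0 : a (0 : Fin 2) = 0
    · refine key (a (1 : Fin 2)) (a (0 : Fin 2)) ?_ (by rw [add_comm]; exact h)
      intro h1
      apply hi
      change Fin 2 at i
      fin_cases i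
      · exact h0
      · exact h1
    · exact key _ _ h0 h
  | succ n ih =>
    let e : Fin (2 ^ (n + 1)) ⊕ Fin (2 ^ (n + 1)) ≃ Fin (2 ^ (n + 1 + 1)) :=
      finSumFinEquiv.trans (finCongr (by rw [pow_succ _ (n + 1)]; ring))
    set b := fun i => a (e (Sum.inl i)) with hb
    set c := fun i => a (e (Sum.inr i)) with hc
    have hsum : ∑ i, b i ^ 2 + ∑ i, c i ^ 2 = 0 := by
      rw [← h, ← Equiv.sum_comp e, Fintype.sum_sum_type]
    by_cases hβ : ∑ i, b i ^ 2 = 0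
    · have hγ : ∑ i, c i ^ 2 = 0 := by simpa [hβ] using hsum
      obtain ⟨i, hi⟩ := ha
      obtain ⟨j, rfl⟩ := e.surjective i
      have : (2 : ℕ) ^ n ≤ 2 ^ (n + 1) := Nat.pow_le_pow_right (by norm_num) (by omega)
      rcases j with j | j
      · exact sumSq_mono this (ih b ⟨j, hi⟩ hβ)
      · exact sumSq_mono this (ih c ⟨j, hi⟩ hγ)
    · have : (-1 : F) = (∑ i, c i ^ 2) / (∑ i, b i ^ 2) := by
        field_simp
        linear_combination -hsum
      rw [this]
      exact div_mem_sumSq_two_pow ⟨c, rfl⟩ ⟨b, rfl⟩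

theorem mem_sumSq_of_neg_one_mem {n : ℕ} (h2 : (2 : F) ≠ 0) (h : (-1 : F) ∈ sumSq F (2 ^ n))
    (x : F) : x ∈ sumSq F (2 ^ (n + 1)) := by
  have h1 : (1 : ℕ) ≤ 2 ^ n := Nat.one_le_two_pow
  have : x = ((x + 1) / 2) ^ 2 + ((x - 1) / 2) ^ 2 * (-1) := by
    field_simp
    ring
  rw [this]
  refine sumSq_mono ?_ (add_mem_sumSq (sq_mem_sumSq le_rfl _) (sq_mul_mem_sumSq _ h))
  rw [pow_succ]
  omega

theorem add_mem_sumSq_succ {n : ℕ} {x y : F} (hx : x ∈ sumSq F (2 ^ n))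
    (hy : y ∈ sumSq F (2 ^ n)) : x + y ∈ sumSq F (2 ^ (n + 1)) := by
  have := add_mem_sumSq hx hy
  rwa [← two_mul, ← pow_succ'] at this

end Pfister

section Residues

/-- The condition on a residue field which is inherited from a discretely valued field whose
Pythagoras number is at most `2 ^ (n + 1)`. -/
def Good (n : ℕ) (κ : Type*) [Field κ] : Prop :=
  ((-1 : κ) ∈ sums κ → (-1 : κ) ∈ sumSq κ (2 ^ n)) ∧ sums κ ⊆ sumSq κ (2 ^ (n + 1))

variable {E κ : Type*} [Field E] [Field κ]

theorem exists_scaling (W : ValuationSubring E) {ι : Type*} [Finite ι]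
    (c : ι → E) (hc : ∃ i, c i ≠ 0) :
    ∃ e : E, e ≠ 0 ∧ ∃ b : ι → W, (∃ i, b i = 1) ∧ ∀ i, c i = e * b i := by
  obtain ⟨j, hj⟩ := hc
  have : Nonempty ι := ⟨j⟩
  obtain ⟨i₀, h⟩ := Finite.exists_max fun i => W.valuation (c i)
  have h0 : c i₀ ≠ 0 := by
    intro h0
    have := h j
    rw [h0, map_zero, le_zero_iff, map_eq_zero] at this
    exact hj this
  have hv : W.valuation (c i₀) ≠ 0 := (Valuation.ne_zero_iff _).2 h0
  have hb (i) : c i / c i₀ ∈ W := by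
    rw [← W.valuation_le_one_iff, map_div₀]
    exact div_le_one_of_le₀ (h i) zero_le
  exact ⟨c i₀, h0, fun i => ⟨c i / c i₀, hb i⟩, ⟨i₀, Subtype.ext (div_self h0)⟩,
    fun i => by field_simp⟩

theorem exists_eq_sq_mul_sum (W : ValuationSubring E) {k : ℕ} {z : E} (hz : z ∈ sumSq E k)
    (h0 : z ≠ 0) : ∃ e : E, e ≠ 0 ∧ ∃ b : Fin k → W, (∃ i, b i = 1) ∧
      z = e ^ 2 * (∑ i, b i ^ 2 : W) := by
  obtain ⟨c, rfl⟩ := hz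
  have : ∃ i, c i ≠ 0 := by
    by_contra! h
    exact h0 (by simp [h])
  obtain ⟨e, he, b, hb, hcb⟩ := exists_scaling W c this
  refine ⟨e, he, b, hb, ?_⟩
  simp [hcb, mul_pow, Finset.mul_sum]

theorem neg_one_mem_sumSq_of_map_eq_zero {A : Type*} [CommRing A] (φ : A →+* κ) {n : ℕ}
    (b : Fin (2 ^ (n + 1)) → A) (hb : ∃ i, b i = 1) (h : φ (∑ i, b i ^ 2) = 0) :
    (-1 : κ) ∈ sumSq κ (2 ^ n) := by
  obtain ⟨i, hi⟩ := hb
  refine neg_one_mem_sumSq_of_isotropic (fun i => φ (b i)) ⟨i, by simp [hi]⟩ ?_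
  simpa using h

theorem neg_one_mem_sums_of_map_eq_zero {A : Type*} [CommRing A] (φ : A →+* κ) {k : ℕ}
    (b : Fin k → A) (hb : ∃ i, b i = 1) (h : φ (∑ i, b i ^ 2) = 0) :
    (-1 : κ) ∈ sums κ := by
  classical
  obtain ⟨i, hi⟩ := hb
  have : (-1 : κ) = ∑ j ∈ Finset.univ.erase i, φ (b j) ^ 2 := by
    rw [map_sum, ← Finset.add_sum_erase _ _ (Finset.mem_univ i), hi] at h
    simp only [map_pow, map_one, one_pow] at h
    linear_combination -h
  rw [this]
  exact sum_sq_mem_sums _ _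

theorem mem_of_sq_mem (W : ValuationSubring E) {e : E} (h : e ^ 2 ∈ W) :
    e ∈ W := by
  rcases W.mem_or_inv_mem e with h' | h'
  · exact h'
  · by_cases he : e = 0
    · simp [he, W.zero_mem]
    have := W.mul_mem _ _ h h'
    rwa [sq, mul_assoc, mul_inv_cancel₀ he, mul_one] at this

theorem residue_mem_sumSq (W : ValuationSubring E) (φ : W →+* κ)
    (hφ : ∀ z : W, φ z ≠ 0 → IsUnit z) {k : ℕ} {z : W} (hz : (z : E) ∈ sumSq E k)
    (hz0 : φ z ≠ 0) :
    φ z ∈ sumSq κ k ∨ ∃ b : Fin k → W, (∃ i, b i = 1) ∧ φ (∑ i, b i ^ 2) = 0 := by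
  obtain ⟨e, he, b, hb, hzb⟩ := exists_eq_sq_mul_sum W hz (by
    intro h
    have : z = 0 := by exact_mod_cast h
    simp [this] at hz0)
  by_cases hs : φ (∑ i, b i ^ 2) = 0
  · exact Or.inr ⟨b, hb, hs⟩
  left
  obtain ⟨s, hs'⟩ := hφ _ hs
  have hse : ((s : W) : E) * ((s⁻¹ : Wˣ) : W) = 1 := by exact_mod_cast s.mul_inv
  have he2 : e ^ 2 = z * ((s⁻¹ : Wˣ) : W) := by
    rw [hzb, ← hs', mul_assoc, hse, mul_one]
  have heW : e ∈ W := mem_of_sq_mem W (by rw [he2]; exact (z * ((s⁻¹ : Wˣ) : W) : W).2)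
  lift e to W using heW
  have : z = ∑ i, (e * b i) ^ 2 := by
    apply Subtype.ext
    rw [hzb]
    push_cast
    rw [Finset.mul_sum]
    simp [mul_pow]
  rw [this]
  exact ⟨fun i => φ (e * b i), by simp⟩

/-- A uniformizer times a unit is not a sum of squares unless the residue field is nonreal. -/
theorem exists_isotropic_of_uniformizer (W : ValuationSubring E) (φ : W →+* κ)
    (hφ : ∀ z : W, φ z ≠ 0 → IsUnit z) {k : ℕ} {π w : W} (hπ : π ≠ 0) (hπ0 : φ π = 0)
    (hdvd : ∀ z : W, φ z = 0 → ∃ w : W, z = π * w) (hw : φ w ≠ 0)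
    (hz : ((π * w : W) : E) ∈ sumSq E k) :
    ∃ b : Fin k → W, (∃ i, b i = 1) ∧ φ (∑ i, b i ^ 2) = 0 := by
  have hw0 : w ≠ 0 := by rintro rfl; simp at hw
  obtain ⟨e, he, b, hb, hzb⟩ := exists_eq_sq_mul_sum W hz (by exact_mod_cast mul_ne_zero hπ hw0)
  by_cases hs : φ (∑ i, b i ^ 2) = 0
  · exact ⟨b, hb, hs⟩
  exfalso
  obtain ⟨s, hs'⟩ := hφ _ hs
  rw [← hs'] at hzb hs
  have hse : ((s : W) : E) * ((s⁻¹ : Wˣ) : W) = 1 := by exact_mod_cast s.mul_inv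
  rcases W.mem_or_inv_mem e with h' | h'
  · lift e to W using h'
    have hzb : π * w = e ^ 2 * s := by exact_mod_cast hzb
    have h1 : φ e = 0 := by
      have := congrArg φ hzb
      simp only [map_mul, map_pow, hπ0, zero_mul] at this
      simpa [hs] using this.symm
    obtain ⟨d, hd⟩ := hdvd e h1
    have : w = π * (d ^ 2 * s) := mul_left_cancel₀ hπ (by rw [hzb, hd]; ring)
    exact hw (by rw [this, map_mul, hπ0, zero_mul])
  · obtain ⟨d, hd⟩ : ∃ d : W, (d : E) = e⁻¹ := ⟨⟨_, h'⟩, rfl⟩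
    have : (d ^ 2 * (π * w) : W) = s := by
      apply Subtype.ext
      rw [W.toSubring.coe_mul, hzb]
      push_cast
      rw [hd]
      field_simp
    apply hs
    rw [← this, map_mul, map_mul, hπ0, zero_mul, mul_zero]

theorem good_of_discrete {n : ℕ} (hE : sums E ⊆ sumSq E (2 ^ (n + 1))) (W : ValuationSubring E)
    (φ : W →+* κ) (hφ : ∀ z : W, φ z ≠ 0 → IsUnit z) (hsurj : Function.Surjective φ)
    (π : W) (hπ : π ≠ 0) (hπ0 : φ π = 0) (hdvd : ∀ z : W, φ z = 0 → ∃ w : W, z = π * w)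
    (h2 : (2 : κ) ≠ 0) : Good n κ := by
  refine ⟨fun h => ?_, fun a ha => ?_⟩
  · obtain ⟨k, a, ha⟩ := mem_sums.1 h
    choose A hA using fun i => hsurj (a i)
    obtain ⟨w, hz, hw⟩ : ∃ w : W, ((π * w : W) : E) ∈ sums E ∧ φ w ≠ 0 := by
      obtain ⟨w, hw⟩ := hdvd (1 + ∑ i, A i ^ 2) (by simp [hA, ← ha])
      have hs (c : W) : ((c ^ 2 + ∑ i, A i ^ 2 : W) : E) ∈ sums E := by
        have := add_mem_sums (sq_mem_sums (c : E)) (sum_sq_mem_sums Finset.univ fun i => (A i : E))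
        simpa using this
      by_cases h0 : φ w = 0
      · refine ⟨w + 2 + π, ?_, by simpa [h0, hπ0, map_ofNat] using h2⟩
        have := hs (1 + π)
        rwa [show (1 + π) ^ 2 + ∑ i, A i ^ 2 = π * (w + 2 + π) by linear_combination hw] at this
      · exact ⟨w, by rw [← hw]; simpa using hs 1, h0⟩
    obtain ⟨b, hb, hs⟩ := exists_isotropic_of_uniformizer W φ hφ hπ hπ0 hdvd hw (hE hz)
    exact neg_one_mem_sumSq_of_map_eq_zero φ b hb hs
  · by_cases ha0 : a = 0
    · rw [ha0]
      exact zero_mem_sumSq _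
    obtain ⟨k, c, rfl⟩ := mem_sums.1 ha
    choose A hA using fun i => hsurj (c i)
    have hφA : φ (∑ i, A i ^ 2) = ∑ i, c i ^ 2 := by simp [hA]
    rw [← hφA] at ha0 ⊢
    have hzs : ((∑ i, A i ^ 2 : W) : E) ∈ sums E := by
      push_cast
      exact sum_sq_mem_sums _ _
    rcases residue_mem_sumSq W φ hφ (hE hzs) ha0 with h | ⟨b, hb, hs⟩
    · exact h
    · exact mem_sumSq_of_neg_one_mem h2 (neg_one_mem_sumSq_of_map_eq_zero φ b hb hs) _

end Residues

section RationalFunctions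

open Polynomial

/-- Pulling back a valuation ring along a homomorphism of fields. -/
theorem exists_valuationSubring_comap {E K' A : Type*} [Field E] [Field K'] [CommRing A]
    [IsDomain A] [ValuationRing A] [Algebra A K'] [IsFractionRing A K'] (j : E →+* K') :
    ∃ (W : ValuationSubring E) (ψ : W →+* A), (∀ z : W, algebraMap A K' (ψ z) = j z) ∧
      ∀ z : E, z ∈ W ↔ ∃ a, algebraMap A K' a = j z := by
  set V := (ValuationRing.valuation A K').valuationSubring with hV
  have hmem (z : E) : z ∈ V.comap j ↔ ∃ a, algebraMap A K' a = j z := by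
    rw [ValuationSubring.mem_comap, ← ValuationRing.mem_integer_iff A K']
    rfl
  choose g hg using fun z : V.comap j => (hmem z).1 z.2
  have inj : Function.Injective (algebraMap A K') := IsFractionRing.injective A K'
  exact ⟨V.comap j,
    { toFun := g
      map_one' := inj (by simp [hg])
      map_zero' := inj (by simp [hg])
      map_add' := fun x y => inj (by simp [hg])
      map_mul' := fun x y => inj (by simp [hg]) }, hg, hmem⟩

theorem exists_residue_at {M l : Type*} [Field M] [Field l] [Algebra M l] (θ : l) :
    ∃ (W : ValuationSubring (RatFunc M)) (φ : W →+* l), (∀ z, φ z ≠ 0 → IsUnit z) ∧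
      (∀ f : M[X], ∃ h : algebraMap M[X] (RatFunc M) f ∈ W, φ ⟨_, h⟩ = aeval θ f) ∧
      ∀ p : M[X], aeval θ p = 0 → aeval θ (derivative p) ≠ 0 → ∀ z : W, φ z = 0 →
        ∃ w : W, (z : RatFunc M) = algebraMap M[X] (RatFunc M) p * w := by
  set g₀ : M[X] →+* PowerSeries l := Polynomial.coeToPowerSeries.ringHom.comp
    ((taylorAlgHom θ).toRingHom.comp (mapRingHom (algebraMap M l))) with hg₀
  have hcoe : ∀ f : M[X], g₀ f = ((taylor θ (f.map (algebraMap M l)) : l[X]) : PowerSeries l) :=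
    fun f => rfl
  have hg₀inj : Function.Injective g₀ := by
    intro f g hfg
    rw [hcoe, hcoe] at hfg
    exact Polynomial.map_injective _ (algebraMap M l).injective
      (taylor_injective θ (Polynomial.coe_injective l hfg))
  have h0 (f : M[X]) : PowerSeries.constantCoeff (g₀ f) = aeval θ f := by
    rw [hcoe, Polynomial.constantCoeff_coe, taylor_coeff_zero, eval_map_algebraMap]
  have h1 (f : M[X]) : PowerSeries.coeff 1 (g₀ f) = aeval θ (derivative f) := by
    rw [hcoe, Polynomial.coeff_coe, taylor_coeff_one, derivative_map, eval_map_algebraMap]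
  have inj : Function.Injective (algebraMap (PowerSeries l) (LaurentSeries l)) :=
    IsFractionRing.injective _ _
  have hg : Function.Injective ((algebraMap (PowerSeries l) (LaurentSeries l)).comp g₀) :=
    inj.comp hg₀inj
  set j : RatFunc M →+* LaurentSeries l := IsFractionRing.lift hg with hj
  have hjf : ∀ f, j (algebraMap M[X] (RatFunc M) f) = algebraMap _ (LaurentSeries l) (g₀ f) :=
    fun f => IsFractionRing.lift_algebraMap hg f
  obtain ⟨W, ψ, hψ, hW⟩ := exists_valuationSubring_comap (A := PowerSeries l) j
  have hψf : ∀ (f : M[X]) (h : algebraMap M[X] (RatFunc M) f ∈ W), ψ ⟨_, h⟩ = g₀ f :=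
    fun f h => inj (by rw [hψ, hjf])
  have hfW : ∀ f : M[X], algebraMap M[X] (RatFunc M) f ∈ W := fun f => (hW _).2 ⟨g₀ f, (hjf f).symm⟩
  refine ⟨W, PowerSeries.constantCoeff.comp ψ, ?_, fun f => ⟨hfW f, ?_⟩, ?_⟩
  · intro z hz
    have hu : IsUnit (ψ z) := PowerSeries.isUnit_iff_constantCoeff.2 (isUnit_iff_ne_zero.2 hz)
    obtain ⟨u, hu⟩ := hu
    have hz0 : (z : RatFunc M) ≠ 0 := by
      intro h
      apply hz
      rw [show z = 0 by exact_mod_cast h, map_zero]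
    have hinv : (z : RatFunc M)⁻¹ ∈ W := by
      refine (hW _).2 ⟨(u⁻¹ : (PowerSeries l)ˣ), ?_⟩
      rw [map_inv₀, ← hψ, ← hu]
      refine eq_inv_of_mul_eq_one_left ?_
      rw [← map_mul, Units.inv_mul, map_one]
    exact IsUnit.of_mul_eq_one ⟨_, hinv⟩ (Subtype.ext (mul_inv_cancel₀ hz0))
  · rw [RingHom.comp_apply, hψf, h0]
  · intro p hp hp' z hz
    obtain ⟨a, ha⟩ := PowerSeries.X_dvd_iff.2 ((h0 p).trans hp)
    obtain ⟨b, hb⟩ := (PowerSeries.X_dvd_iff (φ := ψ z)).2 hz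
    have hau : IsUnit a := by
      rw [PowerSeries.isUnit_iff_constantCoeff, isUnit_iff_ne_zero]
      rw [← h1, ha, show (1 : ℕ) = 0 + 1 from rfl, PowerSeries.coeff_succ_X_mul] at hp'
      simpa using hp'
    obtain ⟨u, rfl⟩ := hau
    have hp0 : algebraMap M[X] (RatFunc M) p ≠ 0 := by
      intro h
      rw [map_eq_zero_iff _ (IsFractionRing.injective M[X] (RatFunc M))] at h
      simp [h] at hp'
    have hjp : j (algebraMap M[X] (RatFunc M) p) ≠ 0 := (map_ne_zero j).2 hp0
    have hmem : (z : RatFunc M) / algebraMap M[X] (RatFunc M) p ∈ W := by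
      refine (hW _).2 ⟨b * (u⁻¹ : (PowerSeries l)ˣ), ?_⟩
      rw [map_div₀, eq_div_iff hjp, hjf, ← hψ, hb, ha, ← map_mul]
      congr 1
      have := u.inv_mul
      linear_combination PowerSeries.X * b * this
    exact ⟨⟨_, hmem⟩, by field_simp⟩

/-- Every nonreal algebraic extension of `k` has level at most `2 ^ n`. -/
def LevelBound (n : ℕ) (k : Type u) [Field k] : Prop :=
  ∀ (l : Type u) [Field l] [Algebra k l] [Algebra.IsAlgebraic k l],
    (-1 : l) ∈ sums l → (-1 : l) ∈ sumSq l (2 ^ n)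

theorem LevelBound.of_isAlgebraic {n : ℕ} {k l : Type u} [Field k] [Field l] [Algebra k l]
    [Algebra.IsAlgebraic k l] (h : LevelBound n k) : LevelBound n l := by
  intro l' _ _ _ hl'
  algebraize [(algebraMap l l').comp (algebraMap k l)]
  have : Algebra.IsAlgebraic k l' := Algebra.IsAlgebraic.trans k l l'
  exact h l' hl'

theorem good_of_adjoin_eq_top {n : ℕ} {k l : Type*} [Field k] [Field l] [Algebra k l]
    (h : sums (RatFunc k) ⊆ sumSq (RatFunc k) (2 ^ (n + 1))) {θ : l} (hint : IsIntegral k θ)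
    (hsep : (minpoly k θ).Separable) (hθ : IntermediateField.adjoin k {θ} = ⊤)
    (h2 : (2 : l) ≠ 0) : Good n l := by
  obtain ⟨W, φ, hu, hf, hπ⟩ := exists_residue_at (M := k) θ
  obtain ⟨hp, hp0⟩ := hf (minpoly k θ)
  rw [minpoly.aeval] at hp0
  have hpne : algebraMap k[X] (RatFunc k) (minpoly k θ) ≠ 0 := by
    rw [Ne, map_eq_zero_iff _ (IsFractionRing.injective k[X] (RatFunc k))]
    exact minpoly.ne_zero hint
  refine good_of_discrete h W φ hu ?_ ⟨_, hp⟩ (fun h => hpne (congrArg Subtype.val h)) hp0 ?_ h2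
  · intro x
    have hx : x ∈ Algebra.adjoin k {θ} := by
      rw [← IntermediateField.adjoin_simple_toSubalgebra_of_isAlgebraic hint.isAlgebraic, hθ]
      trivial
    rw [Algebra.adjoin_singleton_eq_range_aeval] at hx
    obtain ⟨f, rfl⟩ := hx
    obtain ⟨h, h'⟩ := hf f
    exact ⟨_, h'⟩
  · intro z hz
    obtain ⟨w, hw⟩ := hπ _ (minpoly.aeval k θ)
      (hsep.aeval_derivative_ne_zero (minpoly.aeval k θ)) z hz
    exact ⟨w, Subtype.ext hw⟩

theorem good_of_sums_ratFunc_subset {n : ℕ} {k : Type*} [Field k]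
    (h : sums (RatFunc k) ⊆ sumSq (RatFunc k) (2 ^ (n + 1))) (h2 : (2 : k) ≠ 0) : Good n k :=
  good_of_adjoin_eq_top h (isIntegral_zero (R := k)) (by simpa using separable_X)
    (eq_top_iff.mpr fun x _ => IntermediateField.algebraMap_mem _ x) h2

theorem levelBound_of_sums_subset {n : ℕ} {k : Type u} [Field k] [CharZero k]
    (h : sums (RatFunc k) ⊆ sumSq (RatFunc k) (2 ^ (n + 1))) : LevelBound n k := by
  intro l _ _ _ hl
  obtain ⟨r, a, ha⟩ := mem_sums.1 hl
  set k' := IntermediateField.adjoin k (Set.range a) with hk'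
  have : FiniteDimensional k k' :=
    IntermediateField.finiteDimensional_adjoin fun x _ => Algebra.IsIntegral.isIntegral x
  have hk'1 : (-1 : k') ∈ sums k' := by
    refine mem_sums.2 ⟨r, fun i => ⟨a i, IntermediateField.subset_adjoin _ _ ⟨i, rfl⟩⟩, ?_⟩
    apply Subtype.ext
    simpa using ha
  obtain ⟨θ, hθ⟩ := Field.exists_primitive_element k k'
  have hint : IsIntegral k θ := Algebra.IsIntegral.isIntegral θ
  have : CharZero k' := charZero_of_injective_algebraMap (algebraMap k k').injective
  have hG : Good n k' :=
    good_of_adjoin_eq_top h hint (minpoly.irreducible hint).separable hθ two_ne_zero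
  have := map_mem_sumSq (algebraMap k' l) (hG.1 hk'1)
  simpa using this

end RationalFunctions

section LevelBound

open Polynomial

variable {n : ℕ} {M : Type u} [Field M]

theorem mem_sumSq_of_mul_sum_sq {a : M} (b c : Fin (2 ^ n) → M)
    (h1 : a * ∑ i, c i ^ 2 = 1 + ∑ i, b i ^ 2) (h3 : ∑ i, c i ^ 2 ≠ 0) :
    a ∈ sumSq M (2 ^ (n + 1)) := by
  obtain ⟨d, hd⟩ := exists_mul_eq_sum_sq c b
  set s := ∑ i, c i ^ 2
  have hs : s ∈ sumSq M (2 ^ n) := ⟨c, rfl⟩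
  have hd' : s * ∑ i, b i ^ 2 ∈ sumSq M (2 ^ n) := ⟨d, hd⟩
  have : a = (s⁻¹) ^ 2 * (s + s * ∑ i, b i ^ 2) := by
    field_simp
    linear_combination h1
  rw [this]
  exact sq_mul_mem_sumSq _ (add_mem_sumSq_succ hs hd')

theorem LevelBound.sums_subset [CharZero M] (h : LevelBound n M) :
    sums M ⊆ sumSq M (2 ^ (n + 1)) := by
  intro a ha
  by_cases hr : (-1 : M) ∈ sums M
  · exact mem_sumSq_of_neg_one_mem two_ne_zero (h M hr) a
  by_cases ha0 : a = 0
  · rw [ha0]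
    exact zero_mem_sumSq _
  have hirr : Irreducible (X ^ 2 + C a : M[X]) := by
    have hd : (X ^ 2 + C a : M[X]).natDegree = 2 := natDegree_X_pow_add_C
    rw [irreducible_iff_roots_eq_zero_of_degree_le_three (by omega) (by omega)]
    by_contra h0
    obtain ⟨r, hr'⟩ := Multiset.exists_mem_of_ne_zero h0
    have hr2 : r ^ 2 + a = 0 := by simpa using isRoot_of_mem_roots hr'
    apply hr
    have : (-1 : M) = r ^ 2 / a := by
      field_simp
      linear_combination -hr2
    rw [this]
    exact div_mem_sums (sq_mem_sums r) ha
  have : Fact (Irreducible (X ^ 2 + C a : M[X])) := ⟨hirr⟩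
  set l := AdjoinRoot (X ^ 2 + C a : M[X]) with hl
  set ρ : l := AdjoinRoot.root _ with hρ
  have hρ2 : ρ ^ 2 = -algebraMap M l a := by
    have := AdjoinRoot.eval₂_root (X ^ 2 + C a : M[X])
    simp only [eval₂_add, eval₂_X_pow, eval₂_C] at this
    exact eq_neg_of_add_eq_zero_left this
  have hmonic : (X ^ 2 + C a : M[X]).Monic := monic_X_pow_add_C a two_ne_zero
  have hrep (x : l) : ∃ b c : M, x = algebraMap M l b + algebraMap M l c * ρ := by
    obtain ⟨f, rfl⟩ := AdjoinRoot.mk_surjective x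
    refine ⟨(f %ₘ (X ^ 2 + C a)).coeff 0, (f %ₘ (X ^ 2 + C a)).coeff 1, ?_⟩
    have h1 : AdjoinRoot.mk (X ^ 2 + C a) f = AdjoinRoot.mk (X ^ 2 + C a) (f %ₘ (X ^ 2 + C a)) := by
      conv_lhs => rw [← modByMonic_add_div f (X ^ 2 + C a)]
      simp
    have hdeg : (f %ₘ (X ^ 2 + C a)).natDegree ≤ 1 := by
      have := natDegree_modByMonic_lt f hmonic (by
        intro h
        have := congrArg natDegree h
        rw [natDegree_X_pow_add_C] at this
        simp at this)
      rw [natDegree_X_pow_add_C] at this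
      omega
    rw [h1]
    conv_lhs => rw [eq_X_add_C_of_natDegree_le_one hdeg]
    simp only [map_add, map_mul, AdjoinRoot.mk_X, AdjoinRoot.mk_C]
    rw [add_comm]
    rfl
  have hind : ∀ b c : M, algebraMap M l b + algebraMap M l c * ρ = 0 → b = 0 ∧ c = 0 := by
    intro b c hbc
    have hmk : AdjoinRoot.mk (X ^ 2 + C a) (C c * X + C b) = 0 := by
      simp only [map_add, map_mul, AdjoinRoot.mk_X, AdjoinRoot.mk_C]
      exact (add_comm _ _).trans hbc
    rw [AdjoinRoot.mk_eq_zero] at hmk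
    have hz : C c * X + C b = 0 := by
      by_contra hne
      have := natDegree_le_of_dvd hmk hne
      rw [natDegree_X_pow_add_C] at this
      have := natDegree_linear_le (a := c) (b := b)
      omega
    constructor
    · simpa using congrArg (fun p => coeff p 0) hz
    · simpa using congrArg (fun p => coeff p 1) hz
  have : FiniteDimensional M l := hmonic.finite_adjoinRoot
  have hlneg : (-1 : l) ∈ sums l := by
    have h1 : (-1 : l) = ρ ^ 2 / algebraMap M l a := by
      rw [hρ2, neg_div, div_self]
      simpa using ha0
    rw [h1]
    exact div_mem_sums (sq_mem_sums ρ) (map_mem_sums _ ha)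
  obtain ⟨f, hf⟩ := h l hlneg
  choose b c hbc using fun i => hrep (f i)
  have key : algebraMap M l (1 + ∑ i, b i ^ 2 - a * ∑ i, c i ^ 2) +
      algebraMap M l (2 * ∑ i, c i * b i) * ρ = 0 := by
    have : ∑ i, f i ^ 2 = algebraMap M l (∑ i, b i ^ 2 - a * ∑ i, c i ^ 2) +
        algebraMap M l (2 * ∑ i, c i * b i) * ρ := by
      simp only [map_sub, map_mul, map_sum, map_pow, Finset.mul_sum, Finset.sum_mul,
        ← Finset.sum_sub_distrib, ← Finset.sum_add_distrib]
      refine Finset.sum_congr rfl fun i _ => ?_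
      rw [hbc]
      simp only [map_ofNat]
      linear_combination (algebraMap M l (c i)) ^ 2 * hρ2
    rw [this] at hf
    simp only [map_sub, map_add, map_one] at hf ⊢
    linear_combination -hf
  obtain ⟨e1, -⟩ := hind _ _ key
  have e1' : a * ∑ i, c i ^ 2 = 1 + ∑ i, b i ^ 2 := by linear_combination -e1
  refine mem_sumSq_of_mul_sum_sq b c e1' ?_
  intro h0
  rw [h0, mul_zero] at e1'
  apply hr
  rw [show (-1 : M) = ∑ i, b i ^ 2 by linear_combination e1']
  exact sum_sq_mem_sums _ _

end LevelBound

section RationalFunctionField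

open Polynomial

variable {n : ℕ} {M : Type u} [Field M]

local notation "ι" => algebraMap M[X] (RatFunc M)

theorem neg_one_mem_sums_adjoinRoot [CharZero M] {p g : M[X]} [hp : Fact (Irreducible p)]
    (hg : ¬ p ∣ g) (h : ι (p * g) ∈ sums (RatFunc M)) :
    (-1 : AdjoinRoot p) ∈ sums (AdjoinRoot p) := by
  obtain ⟨W, φ, hu, hf, hπ⟩ := exists_residue_at (M := M) (AdjoinRoot.root p)
  have haev : ∀ f : M[X], aeval (AdjoinRoot.root p) f = AdjoinRoot.mk p f :=
    fun f => AdjoinRoot.aeval_eq f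
  obtain ⟨hpW, hp0⟩ := hf p
  obtain ⟨hgW, hg0⟩ := hf g
  have hp1 : aeval (AdjoinRoot.root p) p = 0 := by rw [haev, AdjoinRoot.mk_self]
  rw [hp1] at hp0
  have hder : aeval (AdjoinRoot.root p) (derivative p) ≠ 0 :=
    hp.out.separable.aeval_derivative_ne_zero hp1
  have hpne : ι p ≠ 0 := by
    rw [Ne, map_eq_zero_iff _ (IsFractionRing.injective M[X] (RatFunc M))]
    exact hp.out.ne_zero
  obtain ⟨k, hk⟩ := mem_sums.1 h
  obtain ⟨b, hb, hs⟩ := exists_isotropic_of_uniformizer W φ hu (π := ⟨_, hpW⟩) (w := ⟨_, hgW⟩)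
    (fun h => hpne (congrArg Subtype.val h)) hp0 (fun z hz => by
      obtain ⟨w, hw⟩ := hπ p hp1 hder z hz
      exact ⟨w, Subtype.ext hw⟩)
    (by rwa [hg0, haev, Ne, AdjoinRoot.mk_eq_zero]) (k := k) (by
      rw [map_mul] at hk
      exact hk)
  exact neg_one_mem_sums_of_map_eq_zero φ b hb hs

theorem mem_sums_of_C_mem_sums (hM : (-1 : M) ∉ sums M) {c : M}
    (h : ι (C c) ∈ sums (RatFunc M)) : c ∈ sums M := by
  by_cases hc : c = 0
  · rw [hc]
    exact sumSq_subset_sums 0 (zero_mem_sumSq 0)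
  obtain ⟨W, φ, hu, hf, -⟩ := exists_residue_at (M := M) (0 : M)
  obtain ⟨hcW, hc0⟩ := hf (C c)
  rw [aeval_C, Algebra.algebraMap_self_apply] at hc0
  obtain ⟨k, hk⟩ := mem_sums.1 h
  rcases residue_mem_sumSq W φ hu (z := ⟨_, hcW⟩) hk (by rwa [hc0]) with h' | ⟨b, hb, hs⟩
  · rw [hc0] at h'
    exact sumSq_subset_sums _ h'
  · exact absurd (neg_one_mem_sums_of_map_eq_zero φ b hb hs) hM

theorem LevelBound.exists_C_mul_mem_sumSq [CharZero M] (h : LevelBound n M)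
    (hM : (-1 : M) ∉ sums M) (p : M[X]) (hp : Irreducible p)
    (hnr : (-1 : AdjoinRoot p) ∈ sums (AdjoinRoot p)) :
    ∃ c : M, c ≠ 0 ∧ ι (C c * p) ∈ sumSq (RatFunc M) (2 ^ (n + 1)) := by
  induction hd : p.natDegree using Nat.strong_induction_on generalizing p with
  | _ d ih =>
  subst hd
  have : Fact (Irreducible p) := ⟨hp⟩
  have : Algebra.IsAlgebraic M (AdjoinRoot p) := by
    have : Module.Finite M (AdjoinRoot p) := (AdjoinRoot.powerBasis hp.ne_zero).finite
    infer_instance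
  obtain ⟨a, ha⟩ := h (AdjoinRoot p) hnr
  choose f₀ hf₀ using fun i => AdjoinRoot.mk_surjective (a i)
  set f := fun i => f₀ i % p with hfdef
  have hf (i) : AdjoinRoot.mk p (f i) = a i := by
    rw [← hf₀ i]
    conv_rhs => rw [← EuclideanDomain.mod_add_div (f₀ i) p]
    simp [hfdef]
  obtain ⟨g, hg⟩ : p ∣ 1 + ∑ i, f i ^ 2 := by
    rw [← AdjoinRoot.mk_eq_zero]
    simp [hf, ← ha]
  have hne : 1 + ∑ i, f i ^ 2 ≠ 0 := by
    intro h0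
    apply hM
    have := congrArg (eval 0) h0
    simp only [eval_add, eval_one, eval_finsetSum, eval_pow, eval_zero] at this
    rw [show (-1 : M) = ∑ i, eval 0 (f i) ^ 2 by linear_combination -this]
    exact sum_sq_mem_sums _ _
  have hg0 : g ≠ 0 := by
    rintro rfl
    exact hne (by rw [hg, mul_zero])
  have hdp := hp.natDegree_pos
  have hdf (i) : (f i ^ 2).natDegree ≤ 2 * (p.natDegree - 1) := by
    have h1 : (f i).natDegree ≤ p.natDegree - 1 :=
      Nat.le_sub_one_of_lt (natDegree_mod_lt _ hdp.ne')
    exact (natDegree_pow_le).trans (Nat.mul_le_mul_left 2 h1)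
  have hdg : g.natDegree < p.natDegree := by
    have h1 : (1 + ∑ i, f i ^ 2).natDegree ≤ 2 * (p.natDegree - 1) :=
      natDegree_add_le_of_degree_le (by simp) (natDegree_sum_le_of_forall_le _ _ fun i _ => hdf i)
    rw [hg, natDegree_mul hp.ne_zero hg0] at h1
    omega
  have key : ∀ g : M[X], g ≠ 0 → g.natDegree < p.natDegree → g ∣ 1 + ∑ i, f i ^ 2 →
      ∃ c : M, c ≠ 0 ∧ ι (C c * g) ∈ sumSq (RatFunc M) (2 ^ (n + 1)) := by
    intro g
    induction g using UniqueFactorizationMonoid.induction_on_prime with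
    | h₁ => exact fun h => absurd rfl h
    | h₂ u hu =>
      intro _ _ _
      obtain ⟨c, hc, rfl⟩ := Polynomial.isUnit_iff.1 hu
      refine ⟨c⁻¹, inv_ne_zero hc.ne_zero, ?_⟩
      rw [← C_mul, inv_mul_cancel₀ hc.ne_zero, C_1, map_one]
      simpa using sq_mem_sumSq (Nat.one_le_two_pow (n := n + 1)) (1 : RatFunc M)
    | h₃ g q hg0 hq ihg =>
      intro _ hdeg hdvd
      rw [natDegree_mul hq.ne_zero hg0] at hdeg
      obtain ⟨c, hc, hcg⟩ := ihg hg0 (by omega) (dvd_of_mul_left_dvd hdvd)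
      obtain ⟨c', hc', hcq⟩ := ih q.natDegree (by omega) q hq.irreducible (by
        have hq' : AdjoinRoot.mk q (1 + ∑ i, f i ^ 2) = 0 :=
          AdjoinRoot.mk_eq_zero.2 (dvd_of_mul_right_dvd hdvd)
        have : (-1 : AdjoinRoot q) = ∑ i, AdjoinRoot.mk q (f i) ^ 2 := by
          simp only [map_add, map_one, map_sum, map_pow] at hq'
          linear_combination -hq'
        rw [this]
        exact sum_sq_mem_sums _ _) rfl
      refine ⟨c' * c, mul_ne_zero hc' hc, ?_⟩
      have := mul_mem_sumSq_two_pow hcq hcg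
      rwa [← map_mul, show C c' * q * (C c * g) = C (c' * c) * (q * g) by rw [C_mul]; ring] at this
  obtain ⟨c, hc, hcg⟩ := key g hg0 hdg ⟨p, by rw [hg, mul_comm]⟩
  refine ⟨c⁻¹, inv_ne_zero hc, ?_⟩
  have hpg : ι (p * g) ∈ sumSq (RatFunc M) (2 ^ (n + 1)) := by
    rw [← hg, map_add, map_one, map_sum]
    simp only [map_pow]
    refine add_mem_sumSq_succ ?_ ⟨_, rfl⟩
    simpa using sq_mem_sumSq (Nat.one_le_two_pow (n := n)) (1 : RatFunc M)
  have := div_mem_sumSq_two_pow hpg hcg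
  convert this using 1
  have hCg : ι (C c * g) ≠ 0 := by
    rw [Ne, map_eq_zero_iff _ (IsFractionRing.injective M[X] (RatFunc M))]
    exact mul_ne_zero (C_ne_zero.2 hc) hg0
  rw [eq_div_iff hCg, ← map_mul]
  congr 1
  have : C c⁻¹ * C c = (1 : M[X]) := by rw [← C_mul, inv_mul_cancel₀ hc, C_1]
  linear_combination p * g * this

theorem LevelBound.sums_ratFunc_subset [CharZero M] (h : LevelBound n M) :
    sums (RatFunc M) ⊆ sumSq (RatFunc M) (2 ^ (n + 1)) := by
  have inj : Function.Injective ι := IsFractionRing.injective M[X] (RatFunc M)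
  have : CharZero (RatFunc M) := charZero_of_injective_algebraMap (algebraMap M (RatFunc M)).injective
  by_cases hM : (-1 : M) ∈ sums M
  · intro x _
    refine mem_sumSq_of_neg_one_mem two_ne_zero ?_ x
    simpa using map_mem_sumSq (algebraMap M (RatFunc M)) (h M hM)
  have key : ∀ S : M[X], S ≠ 0 → ι S ∈ sums (RatFunc M) →
      ι S ∈ sumSq (RatFunc M) (2 ^ (n + 1)) := by
    intro S
    induction hd : S.natDegree using Nat.strong_induction_on generalizing S with
    | _ d ih =>
    subst hd
    intro hS0 hS
    by_cases hdeg : S.natDegree = 0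
    · rw [eq_C_of_natDegree_eq_zero hdeg] at hS ⊢
      exact map_mem_sumSq ((algebraMap M[X] (RatFunc M)).comp C)
        (h.sums_subset (mem_sums_of_C_mem_sums hM hS))
    obtain ⟨p, hp, g, hg⟩ := exists_irreducible_of_natDegree_ne_zero hdeg
    have hg0 : g ≠ 0 := by
      rintro rfl
      exact hS0 (by rw [hg, mul_zero])
    have hdS : S.natDegree = p.natDegree + g.natDegree := by rw [hg, natDegree_mul hp.ne_zero hg0]
    have hdp := hp.natDegree_pos
    have hp0 : ι p ≠ 0 := by
      rw [Ne, map_eq_zero_iff _ inj]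
      exact hp.ne_zero
    by_cases hpg : p ∣ g
    · obtain ⟨g', rfl⟩ := hpg
      have hg'0 := right_ne_zero_of_mul hg0
      rw [natDegree_mul hp.ne_zero hg'0] at hdS
      have e : ι S = ι p ^ 2 * ι g' := by rw [hg, map_mul, map_mul]; ring
      have : ι g' ∈ sums (RatFunc M) := by
        have := div_mem_sums hS (sq_mem_sums (ι p))
        rwa [e, mul_div_cancel_left₀ _ (pow_ne_zero 2 hp0)] at this
      rw [e]
      exact sq_mul_mem_sumSq _ (ih g'.natDegree (by omega) g' rfl hg'0 this)
    · have : Fact (Irreducible p) := ⟨hp⟩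
      obtain ⟨c, hc, hcp⟩ := h.exists_C_mul_mem_sumSq hM p hp
        (neg_one_mem_sums_adjoinRoot hpg (by rwa [← hg]))
      have e : ι S = ι (C c * p) * ι (C c⁻¹ * g) := by
        rw [← map_mul, hg]
        congr 1
        have : C c⁻¹ * C c = (1 : M[X]) := by rw [← C_mul, inv_mul_cancel₀ hc, C_1]
        linear_combination -p * g * this
      have hcp0 : ι (C c * p) ≠ 0 := by
        rw [Ne, map_eq_zero_iff _ inj]
        exact mul_ne_zero (C_ne_zero.2 hc) hp.ne_zero
      have : ι (C c⁻¹ * g) ∈ sums (RatFunc M) := by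
        have := div_mem_sums hS (sumSq_subset_sums _ hcp)
        rwa [e, mul_div_cancel_left₀ _ hcp0] at this
      rw [e]
      refine mul_mem_sumSq_two_pow hcp (ih _ ?_ _ rfl ?_ this)
      · rw [natDegree_C_mul (inv_ne_zero hc)]
        omega
      · exact mul_ne_zero (C_ne_zero.2 (inv_ne_zero hc)) hg0
  intro z hz
  obtain ⟨a, b, hb, rfl⟩ := IsFractionRing.div_surjective (A := M[X]) z
  have hb0 : ι b ≠ 0 := by
    rw [Ne, map_eq_zero_iff _ inj]
    exact nonZeroDivisors.ne_zero hb
  by_cases ha : a = 0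
  · rw [ha, map_zero, zero_div]
    exact zero_mem_sumSq _
  have e : ι a / ι b = (ι b)⁻¹ ^ 2 * ι (b * a) := by
    rw [map_mul]
    field_simp
  have hs : ι (b * a) ∈ sums (RatFunc M) := by
    have := mul_mem_sums (sq_mem_sums (ι b)) hz
    rw [map_mul]
    convert this using 1
    field_simp
  rw [e]
  exact sq_mul_mem_sumSq _ (key _ (mul_ne_zero (nonZeroDivisors.ne_zero hb) ha) hs)

end RationalFunctionField

section Seidenberg

open Polynomial

variable {F : Type*} [Field F]

/-- Seidenberg's lemma: over a local integrally closed subring `C` of a field, a root of a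
polynomial with a unit coefficient lies in `C`, or its inverse does. -/
theorem mem_or_inv_mem_of_isRoot (C : Subring F) [IsLocalRing C]
    (hC : ∀ z : F, IsIntegral C z → z ∈ C) {z : F} (P : C[X]) (hz : aeval z P = 0)
    (hP : ∃ i, IsUnit (P.coeff i)) : z ∈ C ∨ z⁻¹ ∈ C := by
  induction hd : P.natDegree using Nat.strong_induction_on generalizing P with
  | _ d ih =>
  subst hd
  by_cases hlead : IsUnit P.leadingCoeff
  · left
    have h := isIntegral_leadingCoeff_smul P z hz
    obtain ⟨u, hu⟩ := hlead
    have h2 := hC _ (h.smul ((u⁻¹ : Cˣ) : C))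
    rwa [← hu, smul_smul, Units.inv_mul, one_smul] at h2
  have hbC : P.leadingCoeff • z ∈ C := hC _ (isIntegral_leadingCoeff_smul P z hz)
  set b : C := ⟨_, hbC⟩ with hb
  have hbz : (b : F) = P.leadingCoeff * z := rfl
  by_cases hbu : IsUnit b
  · right
    obtain ⟨u, hu⟩ := hbu
    have h1 : ((u⁻¹ : Cˣ) : C) * b = 1 := by rw [← hu, Units.inv_mul]
    have h2 : (((u⁻¹ : Cˣ) : C) : F) * (P.leadingCoeff * z) = 1 := by
      rw [← hbz]
      exact_mod_cast h1
    rw [inv_eq_of_mul_eq_one_left (show (((u⁻¹ : Cˣ) : C) : F) * P.leadingCoeff * z = 1 by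
      rw [mul_assoc]; exact h2)]
    exact (((u⁻¹ : Cˣ) : C) * P.leadingCoeff : C).2
  obtain ⟨i, hi⟩ := hP
  have hP0 : P ≠ 0 := by
    rintro rfl
    simp at hi
  have hid : i < P.natDegree := by
    refine lt_of_le_of_ne (le_natDegree_of_ne_zero hi.ne_zero) ?_
    rintro rfl
    exact hlead hi
  obtain ⟨d, hd⟩ : ∃ d, P.natDegree = d + 1 := ⟨P.natDegree - 1, by omega⟩
  have hco : ∀ j < P.natDegree, (P.eraseLead + monomial d b).coeff j =
      P.coeff j + if d = j then b else 0 := by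
    intro j hj
    rw [coeff_add, coeff_monomial, eraseLead_coeff_of_ne _ hj.ne]
  refine ih (P.eraseLead + monomial d b).natDegree ?_ _ ?_ ⟨i, ?_⟩ rfl
  · have h1 : P.eraseLead.natDegree ≤ d := by
      have := eraseLead_natDegree_le P
      omega
    have := natDegree_add_le_of_degree_le h1 (natDegree_monomial_le b (m := d))
    omega
  · have h1 := hz
    rw [← eraseLead_add_monomial_natDegree_leadingCoeff P, map_add, aeval_monomial, hd] at h1
    rw [map_add, aeval_monomial, ← h1]
    congr 1
    change (b : F) * z ^ d = (P.leadingCoeff : F) * z ^ (d + 1)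
    rw [hbz]
    ring
  · rw [hco i hid]
    by_contra hcon
    split_ifs at hcon with h
    · have hmem := (IsLocalRing.nonunits_add (a := P.coeff i + b) (b := -b) hcon
        (by simpa using hbu))
      rw [add_neg_cancel_right] at hmem
      exact hmem hi
    · exact hcon (by simpa using hi)

end Seidenberg

section Hensel

open Polynomial IsLocalRing

lemma exists_sq_eq_one_add_X {V : Type*} [CommRing V] (h2 : IsUnit (2 : V)) :
    ∃ s : PowerSeries V, s ^ 2 = 1 + PowerSeries.X := by
  have h := HenselianRing.is_henselian (R := PowerSeries V) (I := Ideal.span {PowerSeries.X})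
    (X ^ 2 - C (1 + PowerSeries.X)) (monic_X_pow_sub_C _ two_ne_zero) 1
    (by simp) (by
      simp only [derivative_sub, derivative_X_pow, derivative_C, sub_zero, eval_mul, eval_pow,
        eval_X, one_pow, mul_one]
      refine IsUnit.map _ ?_
      simpa [map_ofNat] using h2.map (PowerSeries.C (R := V)))
  obtain ⟨a, ha, -⟩ := h
  refine ⟨a, ?_⟩
  simpa [IsRoot, sub_eq_zero] using ha

/-- Over an adically complete ring, `1 + z` is a square when `z` is a root of a distinguished
polynomial. -/
theorem exists_sq_eq_one_add {V : Type*} [CommRing V] {I : Ideal V} [IsAdicComplete I V]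
    (h2 : IsUnit (2 : V)) {P : V[X]} (hP : P.IsDistinguishedAt I) {A : Type*} [CommRing A]
    [Algebra V A] {z : A} (hz : aeval z P = 0) :
    ∃ r ∈ Algebra.adjoin V {z}, r ^ 2 = 1 + z := by
  obtain ⟨s, hs⟩ := exists_sq_eq_one_add_X h2
  let e := hP.algEquivQuotient
  have heX : e (Ideal.Quotient.mk _ X) = Ideal.Quotient.mk _ PowerSeries.X := by
    simp [e]
  obtain ⟨p, hp⟩ := Ideal.Quotient.mk_surjective (e.symm (Ideal.Quotient.mk _ s))
  have hp2 : Ideal.Quotient.mk (Ideal.span {P}) (p ^ 2) = Ideal.Quotient.mk _ (1 + X) := by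
    apply e.injective
    rw [map_pow, map_pow, hp, e.apply_symm_apply, ← map_pow, hs, map_add, map_add, map_add, heX,
      map_one, map_one, map_one]
  rw [Ideal.Quotient.eq, Ideal.mem_span_singleton] at hp2
  obtain ⟨q, hq⟩ := hp2
  refine ⟨aeval z p, aeval_mem_adjoin_singleton _ _, ?_⟩
  have := congrArg (aeval z) hq
  rw [map_mul, hz, zero_mul] at this
  simpa [sub_eq_zero] using this

variable {V : Type*} [CommRing V] [IsLocalRing V] [IsAdicComplete (maximalIdeal V) V]

lemma exists_isDistinguishedAt_mul {P : V[X]} (hP : ∃ i, IsUnit (P.coeff i)) :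
    ∃ D Q : V[X], P = D * Q ∧ D.IsDistinguishedAt (maximalIdeal V) ∧
      IsUnit (Q.coeff 0) := by
  obtain ⟨i, hi⟩ := hP
  have hne : (P : PowerSeries V).map (residue V) ≠ 0 := by
    intro h
    have := congrArg (PowerSeries.coeff i) h
    simp only [PowerSeries.coeff_map, coeff_coe, map_zero] at this
    exact (hi.map (residue V)).ne_zero this
  obtain ⟨D, h, hD, hh, hPD⟩ := PowerSeries.exists_isWeierstrassFactorization hne
  obtain ⟨Q, hQ⟩ : D ∣ P := by
    rw [← Ideal.mem_span_singleton, ← Ideal.Quotient.eq_zero_iff_mem]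
    apply hD.algEquivQuotient.injective
    rw [map_zero, hD.algEquivQuotient_apply]
    simp [hPD]
  have h1 : (Q : PowerSeries V) = h := by
    refine (hD.isWeierstrassDivisorAt'.eq_of_mul_add_eq_mul_add (r := 0) (r' := 0) ?_ ?_ ?_).1
    · simp
    · simp
    · rw [← coe_mul, ← hQ, ← hPD]
  refine ⟨D, Q, hQ, hD, ?_⟩
  rw [← coeff_coe, h1, PowerSeries.coeff_zero_eq_constantCoeff_apply]
  exact hh.map PowerSeries.constantCoeff

variable {A : Type*} [CommRing A] [IsDomain A] [Algebra V A]

/-- An integral element over a complete local ring is either a unit or a root of a distinguished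
polynomial. -/
theorem exists_mul_eq_one_or_isDistinguishedAt {z : A} (hz : IsIntegral V z) :
    (∃ w ∈ Algebra.adjoin V {z}, z * w = 1) ∨
      ∃ D : V[X], D.IsDistinguishedAt (maximalIdeal V) ∧ aeval z D = 0 := by
  obtain ⟨P, hP, hPz⟩ := hz
  obtain ⟨D, Q, rfl, hD, hQ⟩ := exists_isDistinguishedAt_mul
    (P := P) ⟨P.natDegree, by rw [coeff_natDegree, hP.leadingCoeff]; exact isUnit_one⟩
  rw [← aeval_def, map_mul, mul_eq_zero] at hPz
  refine hPz.symm.imp (fun hQz => ?_) fun hDz => ⟨D, hD, hDz⟩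
  obtain ⟨u, hu⟩ := hQ
  refine ⟨-aeval z (C ((u⁻¹ : Vˣ) : V) * Q.divX), neg_mem (aeval_mem_adjoin_singleton _ _), ?_⟩
  have h := congrArg (aeval z) (X_mul_divX_add Q)
  rw [hQz, map_add, map_mul, aeval_X, aeval_C, ← hu] at h
  rw [map_mul, aeval_C, mul_neg, mul_left_comm, eq_neg_of_add_eq_zero_left h, mul_neg, neg_neg,
    ← map_mul, Units.inv_mul, map_one]

/-- The integral closure of a complete local ring in a domain is local. -/
theorem isLocalRing_integralClosure : IsLocalRing (integralClosure V A) := by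
  refine of_isUnit_or_isUnit_one_sub_self fun z => ?_
  have hz : IsIntegral V z := by
    rw [← isIntegral_algebraMap_iff (B := A) Subtype.val_injective]
    exact z.2
  rcases exists_mul_eq_one_or_isDistinguishedAt hz with ⟨w, -, hw⟩ | ⟨D, hD, hDz⟩
  · exact .inl (.of_mul_eq_one w hw)
  right
  have hu : IsUnit (D.eval 1) := by
    by_contra hu
    have hu1 : D.eval 1 ∈ maximalIdeal V := hu
    rw [eval_eq_sum_range, Finset.sum_range_succ, coeff_natDegree, hD.monic.leadingCoeff, one_pow,
      one_mul] at hu1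
    rw [Ideal.add_mem_iff_right _ (Ideal.sum_mem _ fun i hi =>
      Ideal.mul_mem_right _ _ (hD.mem (Finset.mem_range.1 hi)))] at hu1
    exact (Ideal.ne_top_iff_one _).1 (Ideal.IsMaximal.ne_top inferInstance) hu1
  have h1 : aeval (1 : integralClosure V A) D = algebraMap V _ (D.eval 1) := by
    rw [← map_one (algebraMap V (integralClosure V A)), aeval_algebraMap_apply, aeval_def,
      Algebra.algebraMap_self, eval₂_id]
  have hdvd : 1 - z ∣ aeval 1 D - aeval z D := by
    simpa only [eval_map_algebraMap] using sub_dvd_eval_sub 1 z (D.map (algebraMap V _))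
  rw [hDz, sub_zero, h1] at hdvd
  exact isUnit_of_dvd_unit hdvd (hu.map _)

lemma exists_sq_eq_one_add_of_not_isUnit (h2 : IsUnit (2 : V)) {z : integralClosure V A}
    (hz : ¬IsUnit z) : ∃ r : integralClosure V A, r ^ 2 = 1 + z := by
  have hz' : IsIntegral V z := by
    rw [← isIntegral_algebraMap_iff (B := A) Subtype.val_injective]
    exact z.2
  rcases exists_mul_eq_one_or_isDistinguishedAt hz' with ⟨w, -, hw⟩ | ⟨D, hD, hDz⟩
  · exact absurd (.of_mul_eq_one w hw) hz
  · obtain ⟨r, -, hr⟩ := exists_sq_eq_one_add h2 hD hDz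
    exact ⟨r, hr⟩

end Hensel

section LaurentLevel

open Polynomial IsLocalRing

instance {k : Type*} [Field k] [CharZero k] : CharZero (LaurentSeries k) :=
  charZero_of_injective_ringHom (f := HahnSeries.C) HahnSeries.C_injective

/-- An algebraic element over a valuation ring satisfies a polynomial equation having `1` among
its coefficients. -/
lemma exists_aeval_eq_zero_coeff_eq_one {R A : Type*} [CommRing R] [IsDomain R] [ValuationRing R]
    [CommRing A] [IsDomain A] [Algebra R A] [FaithfulSMul R A] {z : A} (hz : IsAlgebraic R z) :
    ∃ Q : R[X], aeval z Q = 0 ∧ ∃ i, Q.coeff i = 1 := by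
  obtain ⟨P, hP0, hP⟩ := hz
  have key : ∀ s : Finset ℕ, s.Nonempty → ∃ i ∈ s, ∀ j ∈ s, P.coeff i ∣ P.coeff j := by
    intro s hs
    induction hs using Finset.Nonempty.cons_induction with
    | singleton a => exact ⟨a, by simp, by simp⟩
    | cons a s ha hs ih =>
      obtain ⟨i, hi, h⟩ := ih
      rcases ValuationRing.dvd_total (P.coeff a) (P.coeff i) with h1 | h1
      · refine ⟨a, by simp, fun j hj => ?_⟩
        rcases Finset.mem_cons.1 hj with rfl | hj
        · exact dvd_rfl
        · exact h1.trans (h j hj)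
      · refine ⟨i, by simp [hi], fun j hj => ?_⟩
        rcases Finset.mem_cons.1 hj with rfl | hj
        · exact h1
        · exact h j hj
  obtain ⟨i, hi, h⟩ := key P.support (Polynomial.support_nonempty.2 hP0)
  have hi0 : P.coeff i ≠ 0 := Polynomial.mem_support_iff.1 hi
  obtain ⟨Q, hQ⟩ : C (P.coeff i) ∣ P := by
    rw [C_dvd_iff_dvd_coeff]
    intro j
    by_cases hj : P.coeff j = 0
    · simp [hj]
    · exact h j (Polynomial.mem_support_iff.2 hj)
  refine ⟨Q, ?_, i, ?_⟩
  · rw [hQ, map_mul, aeval_C, mul_eq_zero] at hP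
    exact hP.resolve_left fun h => hi0 (FaithfulSMul.algebraMap_injective R A (by simpa using h))
  · have := congrArg (fun p => coeff p i) hQ
    simp only [coeff_C_mul] at this
    exact (mul_right_injective₀ hi0 (by simpa using this)).symm

theorem LevelBound.laurentSeries {n : ℕ} {k : Type u} [Field k] [CharZero k]
    (h : LevelBound n k) : LevelBound n (LaurentSeries k) := by
  intro L₁ _ _ _ hL₁
  algebraize [(algebraMap (LaurentSeries k) L₁).comp (algebraMap (PowerSeries k) (LaurentSeries k))]
  have hcomp : IsAdicComplete (maximalIdeal (PowerSeries k)) (PowerSeries k) := by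
    rw [PowerSeries.maximalIdeal_eq_span_X]; infer_instance
  have : FaithfulSMul (PowerSeries k) L₁ := by
    rw [faithfulSMul_iff_algebraMap_injective]
    exact (algebraMap (LaurentSeries k) L₁).injective.comp
      (IsFractionRing.injective (PowerSeries k) (LaurentSeries k))
  have halg : Algebra.IsAlgebraic (PowerSeries k) L₁ :=
    (IsFractionRing.comap_isAlgebraic_iff (K := LaurentSeries k)).2 inferInstance
  have hloc : IsLocalRing (integralClosure (PowerSeries k) L₁) := isLocalRing_integralClosure
  let C₀ : Subring L₁ := (integralClosure (PowerSeries k) L₁).toSubring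
  have : IsLocalRing C₀ := hloc
  let O : ValuationSubring L₁ := { C₀ with
    mem_or_inv_mem' := by
      intro z
      obtain ⟨Q, hQ, i, hi⟩ := exists_aeval_eq_zero_coeff_eq_one
        (Algebra.IsAlgebraic.isAlgebraic (R := PowerSeries k) z)
      refine mem_or_inv_mem_of_isRoot C₀ ?_ (z := z)
        (Q.map (algebraMap (PowerSeries k) (integralClosure (PowerSeries k) L₁))) ?_
        ⟨i, by rw [coeff_map, hi, map_one]; exact isUnit_one⟩
      · intro z hz
        exact isIntegral_trans (A := integralClosure (PowerSeries k) L₁) z hz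
      · rw [← hQ]
        exact aeval_map_algebraMap (integralClosure (PowerSeries k) L₁) z Q }
  set C := integralClosure (PowerSeries k) L₁
  set κ := ResidueField C
  let res : C →+* κ := residue C
  have hX : res (algebraMap (PowerSeries k) C PowerSeries.X) = 0 := by
    rw [residue_eq_zero_iff, mem_maximalIdeal]
    intro hu
    exact PowerSeries.X_prime.not_isUnit (isUnit_of_map_unit (algebraMap (PowerSeries k) C) _ hu)
  let j : k →+* κ := res.comp ((algebraMap (PowerSeries k) C).comp PowerSeries.C)
  have hj : ∀ a : PowerSeries k, res (algebraMap (PowerSeries k) C a) =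
      j (PowerSeries.constantCoeff a) := by
    intro a
    obtain ⟨b, hb⟩ := PowerSeries.X_dvd_iff.2
      (show PowerSeries.constantCoeff (a - PowerSeries.C (PowerSeries.constantCoeff a)) = 0 by simp)
    rw [sub_eq_iff_eq_add.1 hb, map_add, map_mul, map_add, map_mul, hX]
    simp [j]
  let _ : Algebra k κ := j.toAlgebra
  have : Algebra.IsAlgebraic k κ := by
    refine ⟨fun x => ?_⟩
    obtain ⟨z, rfl⟩ := residue_surjective x
    obtain ⟨P, hP, hPz⟩ := (IsIntegralClosure.isIntegral (PowerSeries k) L₁ z)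
    refine ⟨P.map PowerSeries.constantCoeff, (hP.map _).ne_zero, ?_⟩
    have := congrArg res hPz
    rw [hom_eval₂, map_zero] at this
    rw [aeval_def, eval₂_map, ← this]
    congr 1
    ext1 a
    exact (hj a).symm
  have hκ : (-1 : κ) ∈ sums κ := by
    obtain ⟨r, a, ha⟩ := mem_sums.1 hL₁
    obtain ⟨e, he, b, hb, hab⟩ := exists_scaling O (Fin.cons 1 a : Fin (r + 1) → L₁) ⟨0, by simp⟩
    have hsum : ∑ i, (b i : L₁) ^ 2 = 0 := by
      have h1 : ∑ i, ((Fin.cons 1 a : Fin (r + 1) → L₁) i) ^ 2 = 0 := by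
        rw [Fin.sum_univ_succ]
        simp [← ha]
      simp only [hab, mul_pow, ← Finset.mul_sum] at h1
      exact (mul_eq_zero.1 h1).resolve_left (pow_ne_zero 2 he)
    let b' : Fin (r + 1) → C := fun i => ⟨b i, (b i).2⟩
    refine neg_one_mem_sums_of_map_eq_zero res b' (hb.imp fun i hi => ?_) ?_
    · exact Subtype.ext (congrArg Subtype.val hi)
    · rw [show ∑ i, b' i ^ 2 = 0 from Subtype.ext (by push_cast; exact hsum), map_zero]
  obtain ⟨c, hc⟩ := h κ hκ
  choose b hb using fun i => residue_surjective (c i)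
  have hnu : ¬IsUnit (-(1 + ∑ i, b i ^ 2)) := by
    change -(1 + ∑ i, b i ^ 2) ∈ maximalIdeal C
    rw [← residue_eq_zero_iff]
    simp [hb, ← hc]
  have h2 : IsUnit (2 : PowerSeries k) := by
    rw [PowerSeries.isUnit_iff_constantCoeff, map_ofNat]
    exact (two_ne_zero (α := k)).isUnit
  obtain ⟨r, hr⟩ := exists_sq_eq_one_add_of_not_isUnit h2 hnu
  have hr' : (r : L₁) ^ 2 = -∑ i, (b i : L₁) ^ 2 := by
    have := congrArg (Subtype.val) hr
    push_cast at this
    rw [this]; ring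
  have hr0 : (r : L₁) ≠ 0 := by
    intro h0
    have h1 : r = 0 := Subtype.ext h0
    apply hnu
    rw [h1] at hr
    refine .of_mul_eq_one (-1) ?_
    linear_combination hr
  refine ⟨fun i => b i / r, ?_⟩
  simp only [div_pow, ← Finset.sum_div]
  rw [eq_div_iff (pow_ne_zero 2 hr0), hr']
  ring

end LaurentLevel

section Patching

/-- A complete filtered ring together with two subrings which, additively, fill up the
filtration. -/
structure Patching (B : Type*) [CommRing B] where
  G : ℤ → AddSubgroup B
  G_anti : Antitone G
  mul_mem_G : ∀ {i j : ℤ} {x y : B}, x ∈ G i → y ∈ G j → x * y ∈ G (i + j)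
  exists_mem : ∀ x : B, ∃ j : ℤ, x ∈ G j
  eq_zero : ∀ x : B, (∀ j, x ∈ G j) → x = 0
  exists_inv : ∀ h ∈ G 1, ∃ h' ∈ G 1, (1 + h) * (1 + h') = 1
  S : Fin 2 → Subring B
  M : Fin 2 → ℤ → AddSubgroup B
  M_le : ∀ i j, M i j ≤ G j
  exists_add : ∀ {j : ℤ} {x : B}, x ∈ G j → ∃ y ∈ M 0 j, ∃ z ∈ M 1 j, x = 2 * (y + z)
  exists_lim : ∀ (i : Fin 2) (J : ℤ) (η : ℕ → B), (∀ n : ℕ, η n ∈ M i (J + n)) →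
    ∃ ε ∈ S i, ∀ n : ℕ, ε - ∑ m ∈ Finset.range n, η m ∈ G (J + n)
  inv_mem : ∀ i (x y : B), x ∈ S i → x * y = 1 → y ∈ S i
  dense : ∀ (x : B) (j : ℤ), ∃ y ∈ S 0, x - y ∈ G j

namespace Patching

variable {B : Type*} [CommRing B] (P : Patching B) {ι : Type*} [Fintype ι]

lemma mem_mono {i j : ℤ} (h : i ≤ j) {x : B} (hx : x ∈ P.G j) : x ∈ P.G i := P.G_anti h hx

lemma mul_mem' {i j l : ℤ} {x y : B} (hx : x ∈ P.G i) (hy : y ∈ P.G j) (h : l ≤ i + j) :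
    x * y ∈ P.G l := P.mem_mono h (P.mul_mem_G hx hy)

lemma two_mul_mem {i : ℤ} {x : B} (hx : x ∈ P.G i) : 2 * x ∈ P.G i := by
  rw [two_mul]; exact add_mem hx hx

lemma sum_mul_mem {i j l : ℤ} {x y : ι → B} (hx : ∀ a, x a ∈ P.G i) (hy : ∀ a, y a ∈ P.G j)
    (h : l ≤ i + j) : ∑ a, x a * y a ∈ P.G l :=
  sum_mem fun a _ => P.mul_mem' (hx a) (hy a) h

lemma exists_inv_of_le {m : ℤ} (hm : 1 ≤ m) {h : B} (hh : h ∈ P.G m) :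
    ∃ h' ∈ P.G m, (1 + h) * (1 + h') = 1 := by
  obtain ⟨h', hh', e⟩ := P.exists_inv h (P.mem_mono hm hh)
  refine ⟨h', ?_, e⟩
  rw [show h' = -h - h * h' by linear_combination e]
  exact sub_mem (neg_mem hh) (P.mul_mem' hh hh' (by omega))

lemma exists_bound (s : Finset B) : ∃ r : ℤ, 0 ≤ r ∧ ∀ x ∈ s, x ∈ P.G (-r) := by
  classical
  induction s using Finset.induction_on with
  | empty => exact ⟨0, le_rfl, by simp⟩
  | insert a s _ ih =>
    obtain ⟨r, hr, h⟩ := ih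
    obtain ⟨j, hj⟩ := P.exists_mem a
    refine ⟨max r (-j), le_max_of_le_left hr, fun x hx => ?_⟩
    rcases Finset.mem_insert.1 hx with rfl | hx
    · exact P.mem_mono (by omega) hj
    · exact P.mem_mono (by omega) (h x hx)

lemma dotProduct_mem {i j l : ℤ} {x y : ι → B} (hx : ∀ a, x a ∈ P.G i) (hy : ∀ a, y a ∈ P.G j)
    (h : l ≤ i + j) : x ⬝ᵥ y ∈ P.G l :=
  P.sum_mul_mem hx hy h

/-- The point of the quadric `∑ xᵢ² = ∑ cᵢ²` opposite to the reflection of `c` in `c + ε`. -/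
noncomputable def refl (c ε : ι → B) : ι → B := fun i =>
  -c i + 2 * ((c + ε) ⬝ᵥ c) * Ring.inverse ((c + ε) ⬝ᵥ (c + ε)) * (c + ε) i

lemma refl_dotProduct_refl {c ε : ι → B} (h : IsUnit ((c + ε) ⬝ᵥ (c + ε))) :
    refl c ε ⬝ᵥ refl c ε = c ⬝ᵥ c := by
  have e := Ring.mul_inverse_cancel _ h
  have : refl c ε = -c + (2 * ((c + ε) ⬝ᵥ c) * Ring.inverse ((c + ε) ⬝ᵥ (c + ε))) • (c + ε) := by
    ext i; simp [refl, mul_add, add_assoc]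
  rw [this]
  generalize c + ε = u at *
  simp only [dotProduct_add, add_dotProduct, dotProduct_smul, smul_dotProduct, neg_dotProduct,
    dotProduct_neg, smul_eq_mul, dotProduct_comm c u]
  linear_combination (4 * (u ⬝ᵥ c) ^ 2 * Ring.inverse (u ⬝ᵥ u)) * e

/-- A vector on the quadric `∑ xᵢ² = f` with `f` invertible, with bounds on all the data. -/
structure Bounded (r : ℤ) (c : ι → B) (f f' : B) : Prop where
  nonneg : 0 ≤ r
  mem : ∀ i, c i ∈ P.G (-r)
  mem_f : f ∈ P.G (-r)
  mem_f' : f' ∈ P.G (-r)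
  mul_eq : f * f' = 1
  dot_eq : c ⬝ᵥ c = f

namespace Bounded

variable {P} {r : ℤ} {c : ι → B} {f f' : B} (hc : P.Bounded r c f f') {e : ℤ}
include hc

lemma exists_inverse (he : 20 * r + 1 ≤ e) {ε : ι → B} (hε : ∀ i, ε i ∈ P.G e) :
    IsUnit ((c + ε) ⬝ᵥ (c + ε)) ∧
      Ring.inverse ((c + ε) ⬝ᵥ (c + ε)) - f' ∈ P.G (e - 3 * r) := by
  obtain ⟨hr, h1, h2, h3, h4, h5⟩ := hc
  have hh : f' * (2 * (c ⬝ᵥ ε) + ε ⬝ᵥ ε) ∈ P.G (e - 2 * r) :=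
    P.mul_mem' h3 (add_mem (P.two_mul_mem (P.dotProduct_mem h1 hε le_rfl))
      (P.dotProduct_mem hε hε (by omega))) (by omega)
  obtain ⟨h', hh', e'⟩ := P.exists_inv_of_le (by omega) hh
  have key : ((c + ε) ⬝ᵥ (c + ε)) * (f' * (1 + h')) = 1 := by
    simp only [dotProduct_add, add_dotProduct, h5, dotProduct_comm ε c]
    linear_combination e' + (1 + h') * h4
  have hu : IsUnit ((c + ε) ⬝ᵥ (c + ε)) := .of_mul_eq_one _ key
  refine ⟨hu, ?_⟩
  have : Ring.inverse ((c + ε) ⬝ᵥ (c + ε)) = f' * (1 + h') := by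
    have := Ring.inverse_mul_cancel _ hu
    calc _ = Ring.inverse ((c + ε) ⬝ᵥ (c + ε)) * (((c + ε) ⬝ᵥ (c + ε)) * (f' * (1 + h'))) := by
          rw [key, mul_one]
      _ = _ := by rw [← mul_assoc, this, one_mul]
  rw [this, mul_add, mul_one, add_sub_cancel_left]
  exact P.mul_mem' h3 hh' (by omega)

lemma mul_refl_add (he : 20 * r + 1 ≤ e) {ε : ι → B} (hε : ∀ i, ε i ∈ P.G e) (i : ι) :
    ((c + ε) ⬝ᵥ (c + ε)) * (refl c ε i + c i) = 2 * (c ⬝ᵥ (c + ε)) * (c i + ε i) := by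
  have := Ring.mul_inverse_cancel _ (hc.exists_inverse he hε).1
  simp only [refl, Pi.add_apply, dotProduct_comm (c + ε) c]
  linear_combination (2 * (c ⬝ᵥ (c + ε)) * (c i + ε i)) * this

lemma inverse_mem (he : 20 * r + 1 ≤ e) {ε : ι → B} (hε : ∀ i, ε i ∈ P.G e) :
    Ring.inverse ((c + ε) ⬝ᵥ (c + ε)) ∈ P.G (-r) := by
  have := (hc.exists_inverse he hε).2
  have h0 := hc.nonneg
  simpa using add_mem (P.mem_mono (i := -r) (by omega) this) hc.mem_f'

lemma refl_sub_mem (he : 20 * r + 1 ≤ e) {ε : ι → B} (hε : ∀ i, ε i ∈ P.G e) (i : ι) :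
    refl c ε i - c i ∈ P.G (e - 3 * r) := by
  have e1 := Ring.inverse_mul_cancel _ (hc.exists_inverse he hε).1
  have e2 := hc.mul_refl_add he hε i
  have e3 := hc.inverse_mem he hε
  obtain ⟨hr, h1, h2, h3, h4, h5⟩ := hc
  have e4 : (c + ε) ⬝ᵥ (c + ε) = f + 2 * (c ⬝ᵥ ε) + ε ⬝ᵥ ε := by
    simp only [dotProduct_add, add_dotProduct, h5, dotProduct_comm ε c]; ring
  have e5 : c ⬝ᵥ (c + ε) = f + c ⬝ᵥ ε := by rw [dotProduct_add, h5]
  rw [e5, e4] at e2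
  rw [e4] at e1 e3
  generalize Ring.inverse (f + 2 * (c ⬝ᵥ ε) + ε ⬝ᵥ ε) = g at e1 e3
  have key : refl c ε i - c i = g * (2 * (f * ε i + (c ⬝ᵥ ε) * ε i - (c ⬝ᵥ ε) * c i
      - (ε ⬝ᵥ ε) * c i)) := by
    linear_combination -(refl c ε i - c i) * e1 + g * e2
  rw [key]
  have h6 : c ⬝ᵥ ε ∈ P.G (e - r) := P.dotProduct_mem h1 hε (by omega)
  have h7 : ε ⬝ᵥ ε ∈ P.G (e - r) := P.dotProduct_mem hε hε (by omega)
  exact P.mul_mem' e3 (i := -r) (j := e - 2 * r) (P.two_mul_mem (sub_mem (sub_mem (add_mem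
    (P.mul_mem' h2 (hε i) (by omega)) (P.mul_mem' h6 (hε i) (by omega)))
    (P.mul_mem' h6 (h1 i) (by omega))) (P.mul_mem' h7 (h1 i) (by omega)))) (by omega)

lemma refl_sub_refl_mem (he : 20 * r + 1 ≤ e) {j : ℤ} (hj : e ≤ j) {ε η : ι → B}
    (hε : ∀ i, ε i ∈ P.G e) (hη : ∀ i, η i ∈ P.G j) (i : ι) :
    refl c (ε + η) i - refl c ε i - 2 * (η i - f' * (c ⬝ᵥ η) * c i) ∈ P.G (j + e - 5 * r) := by
  have hε' : ∀ i, (ε + η) i ∈ P.G e := fun i => add_mem (hε i) (P.mem_mono hj (hη i))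
  have e1 := Ring.inverse_mul_cancel _ (hc.exists_inverse he hε').1
  have e2 := hc.mul_refl_add he hε' i
  have e2' := hc.mul_refl_add he hε i
  have e3 := hc.inverse_mem he hε'
  have e3' := (hc.exists_inverse he hε').2
  have hα := hc.refl_sub_mem he hε i
  obtain ⟨hr, h1, h2, h3, h4, h5⟩ := hc
  have d1 : (c + (ε + η)) ⬝ᵥ (c + (ε + η)) = f + 2 * (c ⬝ᵥ ε) + ε ⬝ᵥ ε + 2 * (c ⬝ᵥ η) +
      2 * (ε ⬝ᵥ η) + η ⬝ᵥ η := by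
    simp only [dotProduct_add, add_dotProduct, h5, dotProduct_comm ε c, dotProduct_comm η c,
      dotProduct_comm η ε]; ring
  have d2 : (c + ε) ⬝ᵥ (c + ε) = f + 2 * (c ⬝ᵥ ε) + ε ⬝ᵥ ε := by
    simp only [dotProduct_add, add_dotProduct, h5, dotProduct_comm ε c]; ring
  have d3 : c ⬝ᵥ (c + (ε + η)) = f + c ⬝ᵥ ε + c ⬝ᵥ η := by
    rw [dotProduct_add, dotProduct_add, h5]; ring
  have d4 : c ⬝ᵥ (c + ε) = f + c ⬝ᵥ ε := by rw [dotProduct_add, h5]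
  rw [d1, d3, Pi.add_apply] at e2
  rw [d2, d4] at e2'
  rw [d1] at e1 e3 e3'
  generalize Ring.inverse (f + 2 * (c ⬝ᵥ ε) + ε ⬝ᵥ ε + 2 * (c ⬝ᵥ η) +
      2 * (ε ⬝ᵥ η) + η ⬝ᵥ η) = g at e1 e3 e3'
  have hb : c ⬝ᵥ ε ∈ P.G (e - r) := P.dotProduct_mem h1 hε (by omega)
  have hb' : c ⬝ᵥ η ∈ P.G (j - r) := P.dotProduct_mem h1 hη (by omega)
  have hq : ε ⬝ᵥ η ∈ P.G (e + j) := P.dotProduct_mem hε hη (by omega)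
  have hq' : η ⬝ᵥ η ∈ P.G (e + j) := P.dotProduct_mem hη hη (by omega)
  generalize refl c (ε + η) i = a' at *
  generalize refl c ε i = a at *
  have ha : a + c i ∈ P.G (-r) := by
    rw [show a + c i = (a - c i) + 2 * c i by ring]
    exact add_mem (P.mem_mono (by omega) hα) (P.two_mul_mem (h1 i))
  have key : a' - a - 2 * (η i - f' * (c ⬝ᵥ η) * c i) =
      (g - f') * (2 * (f * η i - (c ⬝ᵥ η) * c i)) +
      g * (2 * ((c ⬝ᵥ ε) * η i + (c ⬝ᵥ η) * ε i + (c ⬝ᵥ η) * η i - (c ⬝ᵥ η) * (a - c i)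
        - (ε ⬝ᵥ η) * (a + c i)) - (η ⬝ᵥ η) * (a + c i)) := by
    linear_combination -(a' - a) * e1 + g * e2 - g * e2' + 2 * η i * h4
  rw [key]
  refine add_mem (P.mul_mem' e3' (j := j - 2 * r) (P.two_mul_mem (sub_mem
    (P.mul_mem' h2 (hη i) (by omega)) (P.mul_mem' hb' (h1 i) (by omega)))) (by omega))
    (P.mul_mem' e3 (j := j + e - 4 * r) (sub_mem (P.two_mul_mem (sub_mem (sub_mem (add_mem (add_mem
      (P.mul_mem' hb (hη i) (by omega)) (P.mul_mem' hb' (hε i) (by omega)))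
      (P.mul_mem' hb' (hη i) (by omega))) (P.mul_mem' hb' hα (by omega)))
      (P.mul_mem' hq ha (by omega)))) (P.mul_mem' hq' ha (by omega))) (by omega))

lemma refl_sub_refl_mem' (he : 20 * r + 1 ≤ e) {j : ℤ} (hj : e ≤ j) {ε η : ι → B}
    (hε : ∀ i, ε i ∈ P.G e) (hη : ∀ i, η i ∈ P.G j) (i : ι) :
    refl c (ε + η) i - refl c ε i ∈ P.G (j - 3 * r) := by
  have h := hc.refl_sub_refl_mem he hj hε hη i
  obtain ⟨hr, h1, h2, h3, h4, h5⟩ := hc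
  have hb' : c ⬝ᵥ η ∈ P.G (j - r) := P.dotProduct_mem h1 hη (by omega)
  rw [← sub_add_cancel (refl c (ε + η) i - refl c ε i) (2 * (η i - f' * (c ⬝ᵥ η) * c i))]
  exact add_mem (P.mem_mono (by omega) h) (P.two_mul_mem (sub_mem (P.mem_mono (by omega) (hη i))
    (P.mul_mem' (P.mul_mem' h3 hb' (l := j - 2 * r) (by omega)) (h1 i) (by omega))))

end Bounded

lemma inverse_mem_S {i : Fin 2} {x : B} (hx : x ∈ P.S i) (hu : IsUnit x) :
    Ring.inverse x ∈ P.S i :=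
  P.inv_mem i x _ hx (Ring.mul_inverse_cancel _ hu)

lemma dotProduct_mem_S {i : Fin 2} {x y : ι → B} (hx : ∀ a, x a ∈ P.S i) (hy : ∀ a, y a ∈ P.S i) :
    x ⬝ᵥ y ∈ P.S i :=
  sum_mem fun a _ => mul_mem (hx a) (hy a)

lemma refl_mem_S {i : Fin 2} {c ε : ι → B} (hc : ∀ a, c a ∈ P.S i) (hε : ∀ a, ε a ∈ P.S i)
    (hu : IsUnit ((c + ε) ⬝ᵥ (c + ε))) (a : ι) : refl c ε a ∈ P.S i := by
  have h : ∀ a, (c + ε) a ∈ P.S i := fun a => add_mem (hc a) (hε a)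
  have h2 : (2 : B) ∈ P.S i := by rw [← one_add_one_eq_two]; exact add_mem (one_mem _) (one_mem _)
  exact add_mem (neg_mem (hc a)) (mul_mem (mul_mem (mul_mem h2 (P.dotProduct_mem_S h hc))
    (P.inverse_mem_S (P.dotProduct_mem_S h h) hu)) (h a))

/-- One step of the approximation: if the error is split into corrections on both sides, the new
error is smaller. -/
lemma Bounded.step_mem {r : ℤ} {c₁ c₂ : ι → B} {f f' : B} (h₁ : P.Bounded r c₁ f f')
    (h₂ : P.Bounded r c₂ f f') {half : B} (hhalf : 2 * half = 1) (hh : half ∈ P.G (-r))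
    {e : ℤ} (he : 20 * r + 1 ≤ e) (hc : ∀ i, c₁ i - c₂ i ∈ P.G e) {j : ℤ} (hj : e ≤ j)
    {ε₁ ε₂ y z : ι → B} (hε₁ : ∀ i, ε₁ i ∈ P.G e) (hε₂ : ∀ i, ε₂ i ∈ P.G e)
    (hδ : ∀ i, refl c₂ ε₂ i - refl c₁ ε₁ i ∈ P.G j)
    (hy : ∀ i, y i ∈ P.G j) (hz : ∀ i, z i ∈ P.G j)
    (hyz : ∀ i, refl c₂ ε₂ i - refl c₁ ε₁ i = 2 * (y i + z i)) (i : ι) :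
    refl c₂ (ε₂ + -z) i - refl c₁ (ε₁ + y) i ∈ P.G (j + 1) := by
  have hz' : ∀ i, (-z) i ∈ P.G j := fun i => neg_mem (hz i)
  have a1 := h₁.refl_sub_refl_mem he hj hε₁ hy i
  have a2 := h₂.refl_sub_refl_mem he hj hε₂ hz' i
  have b1 := refl_dotProduct_refl (h₁.exists_inverse he hε₁).1
  have b2 := refl_dotProduct_refl (h₂.exists_inverse he hε₂).1
  have a3 : ∀ i, (refl c₂ ε₂ - c₂) i ∈ P.G (e - 3 * r) := h₂.refl_sub_mem he hε₂
  rw [h₁.dot_eq] at b1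
  rw [h₂.dot_eq] at b2
  obtain ⟨hr, h1, h2, h3, h4, h5⟩ := h₂
  have h1' := h₁.mem
  set δ : ι → B := refl c₂ ε₂ - refl c₁ ε₁ with hδdef
  have hδ' : ∀ i, δ i ∈ P.G j := hδ
  have hyz' : δ = (2 : B) • (y + z) := by ext i; simpa [hδdef] using hyz i
  have e1 : 2 * (refl c₂ ε₂ ⬝ᵥ δ) = δ ⬝ᵥ δ := by
    have : refl c₁ ε₁ = refl c₂ ε₂ - δ := by simp [hδdef]
    rw [this] at b1
    simp only [dotProduct_sub, sub_dotProduct, b2, dotProduct_comm δ (refl c₂ ε₂)] at b1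
    linear_combination -b1
  have e2 : c₂ ⬝ᵥ δ ∈ P.G (j + e - 3 * r) := by
    have : c₂ ⬝ᵥ δ = half * (δ ⬝ᵥ δ) - (refl c₂ ε₂ - c₂) ⬝ᵥ δ := by
      rw [sub_dotProduct (refl c₂ ε₂) c₂ δ]; linear_combination half * e1 - (refl c₂ ε₂ ⬝ᵥ δ) * hhalf
    rw [this]
    exact sub_mem (P.mul_mem' hh (P.dotProduct_mem hδ' hδ' le_rfl) (by omega))
      (P.dotProduct_mem a3 hδ' (by omega))
  have e3 : c₂ ⬝ᵥ δ = 2 * (c₂ ⬝ᵥ y + c₂ ⬝ᵥ z) := by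
    rw [hyz', dotProduct_smul, dotProduct_add, smul_eq_mul]
  have e4 : c₁ ⬝ᵥ y - c₂ ⬝ᵥ y ∈ P.G (j + e) := by
    rw [← sub_dotProduct]; exact P.dotProduct_mem hc hy (by omega)
  have e5 : c₁ ⬝ᵥ y ∈ P.G (j - r) := P.dotProduct_mem h1' hy (by omega)
  have key : refl c₂ (ε₂ + -z) i - refl c₁ (ε₁ + y) i =
      (refl c₂ (ε₂ + -z) i - refl c₂ ε₂ i - 2 * ((-z) i - f' * (c₂ ⬝ᵥ (-z)) * c₂ i))
      - (refl c₁ (ε₁ + y) i - refl c₁ ε₁ i - 2 * (y i - f' * (c₁ ⬝ᵥ y) * c₁ i))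
      + (f' * (c₂ ⬝ᵥ δ) * c₂ i + 2 * (f' * ((c₁ ⬝ᵥ y - c₂ ⬝ᵥ y) * c₂ i + (c₁ ⬝ᵥ y) *
        (c₁ i - c₂ i)))) := by
    have := hyz i
    rw [e3, dotProduct_neg, Pi.neg_apply]
    linear_combination this
  rw [key]
  refine add_mem (sub_mem (P.mem_mono (by omega) a2) (P.mem_mono (by omega) a1)) (add_mem
    (P.mul_mem' (P.mul_mem' h3 e2 (l := j + e - 4 * r) (by omega)) (h1 i) (by omega))
    (P.two_mul_mem (P.mul_mem' h3 (j := j + e - r) (add_mem (P.mul_mem' e4 (h1 i) (by omega))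
      (P.mul_mem' e5 (hc i) (by omega))) (by omega))))

/-- Two sufficiently close points of the quadric, one over each of the two subrings, can be moved
to a common point. -/
lemma exists_common_of_near {c₂ : ι → B} {f f' half : B} (hf : f * f' = 1) (hhalf : 2 * half = 1)
    (hc₂ : ∀ i, c₂ i ∈ P.S 1) (h₂ : c₂ ⬝ᵥ c₂ = f) :
    ∃ J : ℤ, ∀ c₁ : ι → B, (∀ i, c₁ i ∈ P.S 0) → c₁ ⬝ᵥ c₁ = f → (∀ i, c₁ i - c₂ i ∈ P.G J) →
      ∃ a : ι → B, (∀ i, a i ∈ P.S 0 ∧ a i ∈ P.S 1) ∧ a ⬝ᵥ a = f := by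
  classical
  obtain ⟨r, hr, hb⟩ := P.exists_bound (Finset.univ.image c₂ ∪ {f, f', half})
  have hB₂ : P.Bounded r c₂ f f' :=
    ⟨hr, fun i => hb _ (by simp), hb _ (by simp), hb _ (by simp), hf, h₂⟩
  have hh : half ∈ P.G (-r) := hb _ (by simp)
  refine ⟨20 * r + 1, fun c₁ hc₁ h₁ hc => ?_⟩
  set J := 20 * r + 1 with hJ
  have hB₁ : P.Bounded r c₁ f f' :=
    ⟨hr, fun i => by
      simpa using add_mem (P.mem_mono (i := -r) (by omega) (hc i)) (hB₂.mem i), hB₂.mem_f,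
      hB₂.mem_f', hf, h₁⟩
  choose! y hy z hz hyz using fun j x => P.exists_add (j := j) (x := x)
  let δ : (ι → B) × (ι → B) → ι → B := fun p => refl c₂ p.2 - refl c₁ p.1
  let s : ℕ → (ι → B) × (ι → B) := fun n => Nat.rec (0, 0) (fun n p =>
    (p.1 + (fun i => y (J + n) (δ p i)), p.2 + -(fun i => z (J + n) (δ p i)))) n
  have s_succ : ∀ n, s (n + 1) = ((s n).1 + (fun i => y (J + n) (δ (s n) i)),
    (s n).2 + -(fun i => z (J + n) (δ (s n) i))) := fun n => rfl
  have zero_mem' : ∀ i, (0 : ι → B) i ∈ P.G J := fun i => zero_mem _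
  have refl_zero : ∀ {c : ι → B}, P.Bounded r c f f' → refl c 0 = c := fun {c} h => by
    ext i
    have := h.mul_refl_add le_rfl zero_mem' i
    rw [add_zero, h.dot_eq, Pi.zero_apply] at this
    linear_combination f' * this - (refl c 0 i - c i) * hf
  have inv : ∀ n : ℕ, (∀ i, (s n).1 i ∈ P.G J) ∧ (∀ i, (s n).2 i ∈ P.G J) ∧
      ∀ i, δ (s n) i ∈ P.G (J + n) := fun n => by
    induction n with
    | zero =>
      refine ⟨zero_mem', zero_mem', fun i => ?_⟩
      have : δ (s 0) i = c₂ i - c₁ i := by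
        change refl c₂ 0 i - refl c₁ 0 i = _
        rw [refl_zero hB₁, refl_zero hB₂]
      rw [this, ← neg_sub, Nat.cast_zero, add_zero]
      exact neg_mem (hc i)
    | succ n ih =>
      obtain ⟨i1, i2, i3⟩ := ih
      have y1 := fun i => P.M_le 0 _ (hy _ _ (i3 i))
      have z1 := fun i => P.M_le 1 _ (hz _ _ (i3 i))
      have w := hB₁.step_mem P hB₂ hhalf hh le_rfl hc (j := J + n) (by omega) i1 i2 i3 y1 z1
        (fun i => hyz _ _ (i3 i))
      refine ⟨fun i => add_mem (i1 i) (P.mem_mono (by omega) (y1 i)),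
        fun i => add_mem (i2 i) (neg_mem (P.mem_mono (by omega) (z1 i))), fun i => ?_⟩
      have := w i
      rw [add_assoc] at this
      push_cast
      exact this
  choose ε₁ hε₁ hl₁ using fun i => P.exists_lim 0 J (fun n => y (J + n) (δ (s n) i))
    (fun n => hy _ _ ((inv n).2.2 i))
  choose ε₂ hε₂ hl₂ using fun i => P.exists_lim 1 J (fun n => -z (J + n) (δ (s n) i))
    (fun n => neg_mem (hz _ _ ((inv n).2.2 i)))
  have sum₁ : ∀ n i, ∑ m ∈ Finset.range n, y (J + m) (δ (s m) i) = (s n).1 i := fun n i => by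
    induction n with
    | zero => rfl
    | succ n ih => rw [Finset.sum_range_succ, ih, s_succ]; rfl
  have sum₂ : ∀ n i, ∑ m ∈ Finset.range n, -z (J + m) (δ (s m) i) = (s n).2 i := fun n i => by
    induction n with
    | zero => rfl
    | succ n ih => rw [Finset.sum_range_succ, ih, s_succ]; rfl
  simp only [sum₁] at hl₁
  simp only [sum₂] at hl₂
  have m₁ : ∀ i, ε₁ i ∈ P.G J := fun i => by
    have := hl₁ i 0
    simpa [s] using this
  have m₂ : ∀ i, ε₂ i ∈ P.G J := fun i => by
    have := hl₂ i 0
    simpa [s] using this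
  have heq : ∀ i, refl c₂ ε₂ i = refl c₁ ε₁ i := fun i => by
    refine sub_eq_zero.1 (P.eq_zero _ fun j => ?_)
    obtain ⟨n, hn⟩ : ∃ n : ℕ, j + 3 * r ≤ J + n := ⟨(j + 3 * r - J).toNat, by omega⟩
    obtain ⟨i1, i2, i3⟩ := inv n
    have d1 := hB₁.refl_sub_refl_mem' le_rfl (j := J + n) (by omega) i1
      (η := fun i => ε₁ i - (s n).1 i) (fun i => hl₁ i n) i
    have d2 := hB₂.refl_sub_refl_mem' le_rfl (j := J + n) (by omega) i2
      (η := fun i => ε₂ i - (s n).2 i) (fun i => hl₂ i n) i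
    rw [show (s n).1 + (fun i => ε₁ i - (s n).1 i) = ε₁ by ext; simp] at d1
    rw [show (s n).2 + (fun i => ε₂ i - (s n).2 i) = ε₂ by ext; simp] at d2
    have d3 : refl c₂ (s n).2 i - refl c₁ (s n).1 i ∈ P.G (J + n) := i3 i
    have : refl c₂ ε₂ i - refl c₁ ε₁ i = (refl c₂ ε₂ i - refl c₂ (s n).2 i) -
      (refl c₁ ε₁ i - refl c₁ (s n).1 i) + (refl c₂ (s n).2 i - refl c₁ (s n).1 i) := by ring
    rw [this]
    exact P.mem_mono (by omega) (add_mem (sub_mem d2 d1) (P.mem_mono (by omega) d3))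
  have u₁ := (hB₁.exists_inverse le_rfl m₁).1
  have u₂ := (hB₂.exists_inverse le_rfl m₂).1
  refine ⟨refl c₁ ε₁, fun i => ⟨P.refl_mem_S hc₁ hε₁ u₁ i, ?_⟩, ?_⟩
  · rw [← heq]; exact P.refl_mem_S hc₂ hε₂ u₂ i
  · rw [refl_dotProduct_refl u₁, h₁]

omit [Fintype ι] in
lemma isUnit_natCast [Algebra ℚ B] {n : ℕ} (hn : n ≠ 0) : IsUnit (n : B) := by
  have : IsUnit (algebraMap ℚ B n) := (IsUnit.mk0 (n : ℚ) (by exact_mod_cast hn)).map _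
  simpa using this

omit [Fintype ι] in
/-- A quadratic polynomial `α s² + β s + γ` with `α + γ` invertible takes an invertible value at
some natural number. -/
lemma exists_isUnit_quadratic [Algebra ℚ B] [Finite (MaximalSpectrum B)] (α β γ : B)
    (h : IsUnit (α + γ)) : ∃ s : ℕ, IsUnit (α * s ^ 2 + β * s + γ) := by
  by_contra! hs
  have : ∀ s : ℕ, ∃ m : MaximalSpectrum B, α * s ^ 2 + β * s + γ ∈ m.asIdeal := fun s => by
    obtain ⟨m, hm, h⟩ := exists_max_ideal_of_mem_nonunits (hs s)
    exact ⟨⟨m, hm⟩, h⟩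
  choose m hm using this
  obtain ⟨I, hI⟩ := Finite.exists_infinite_fiber m
  have hinf : (m ⁻¹' {I}).Infinite := Set.infinite_coe_iff.1 hI
  have hmax := I.isMaximal
  let := Ideal.Quotient.field I.asIdeal
  let φ := Ideal.Quotient.mk I.asIdeal
  have : Algebra ℚ (B ⧸ I.asIdeal) := (φ.comp (algebraMap ℚ B)).toAlgebra
  have : CharZero (B ⧸ I.asIdeal) := algebraRat.charZero _
  let p : Polynomial (B ⧸ I.asIdeal) := Polynomial.C (φ α) * Polynomial.X ^ 2 +
    Polynomial.C (φ β) * Polynomial.X + Polynomial.C (φ γ)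
  have hp : p = 0 := by
    refine Polynomial.eq_zero_of_infinite_isRoot p
      ((hinf.image (f := fun s : ℕ => (s : B ⧸ I.asIdeal)) (by simp)).mono ?_)
    rintro _ ⟨s, hs, rfl⟩
    have h1 := hm s
    rw [show m s = I from hs, ← Ideal.Quotient.eq_zero_iff_mem] at h1
    simpa [p, φ] using h1
  have h0 : p.coeff 0 = 0 := by rw [hp, Polynomial.coeff_zero]
  have h2 : p.coeff 2 = 0 := by rw [hp, Polynomial.coeff_zero]
  simp only [p, Polynomial.coeff_add, Polynomial.coeff_C_mul, Polynomial.coeff_X_pow,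
    Polynomial.coeff_X, Polynomial.coeff_C] at h0 h2
  norm_num at h0 h2
  have h3 : α + γ ∈ I.asIdeal := by
    rw [← Ideal.Quotient.eq_zero_iff_mem]
    change φ (α + γ) = 0
    rw [map_add, h0, h2, add_zero]
  exact hmax.ne_top (Ideal.eq_top_of_isUnit_mem _ h3 h)

/-- If `c + c'` is anisotropic, every point of the quadric close to `c'` can be obtained by
reflecting `c` in a vector defined over the dense subring. -/
lemma exists_refl_near {c c' : ι → B} {f : B} (hc : c ⬝ᵥ c = f) (hc' : c' ⬝ᵥ c' = f)
    (hu : IsUnit ((c + c') ⬝ᵥ (c + c'))) (j : ℤ) :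
    ∃ ε : ι → B, (∀ i, ε i ∈ P.S 0) ∧ IsUnit ((c + ε) ⬝ᵥ (c + ε)) ∧
      ∀ i, refl c ε i - c' i ∈ P.G j := by
  classical
  obtain ⟨g, hg⟩ := hu.exists_right_inv
  obtain ⟨r, hr, hb⟩ := P.exists_bound (Finset.univ.image c ∪ Finset.univ.image c' ∪
    {(c + c') ⬝ᵥ (c + c'), g, 1})
  have b1 : ∀ i, c i ∈ P.G (-r) := fun i => hb _ (by simp)
  have b2 : ∀ i, c' i ∈ P.G (-r) := fun i => hb _ (by simp)
  have b3 : (c + c') ⬝ᵥ (c + c') ∈ P.G (-r) := hb _ (by simp)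
  have b4 : g ∈ P.G (-r) := hb _ (by simp)
  have b6 : (1 : B) ∈ P.G (-r) := hb _ (by simp)
  have b5 : ∀ i, (c + c') i ∈ P.G (-r) := fun i => add_mem (b1 i) (b2 i)
  obtain ⟨e, he1, he2⟩ : ∃ e : ℤ, 2 * r + 1 ≤ e ∧ j + 4 * r ≤ e :=
    ⟨max (2 * r + 1) (j + 4 * r), le_max_left _ _, le_max_right _ _⟩
  choose ε hε hd using fun i => P.dense (c' i) e
  have hx : ∀ i, (ε - c') i ∈ P.G e := fun i => by
    rw [Pi.sub_apply, ← neg_sub]; exact neg_mem (hd i)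
  obtain ⟨x, rfl⟩ : ∃ x, ε = c' + x := ⟨ε - c', by simp⟩
  rw [add_sub_cancel_left] at hx
  set u := c + c' with hudef
  have e0 : (c + (c' + x)) ⬝ᵥ (c + (c' + x)) = u ⬝ᵥ u + 2 * (u ⬝ᵥ x) + x ⬝ᵥ x := by
    rw [← add_assoc, ← hudef]
    simp only [dotProduct_add, add_dotProduct, dotProduct_comm x u]; ring
  have e1 : u ⬝ᵥ u = 2 * (u ⬝ᵥ c) := by
    simp only [hudef, dotProduct_add, add_dotProduct, dotProduct_comm c' c, hc, hc']; ring
  have h1 : u ⬝ᵥ x ∈ P.G (e - r) := P.dotProduct_mem b5 hx (by omega)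
  have h2 : x ⬝ᵥ x ∈ P.G (e - r) := P.dotProduct_mem hx hx (by omega)
  have h3 : x ⬝ᵥ c ∈ P.G (e - r) := P.dotProduct_mem hx b1 (by omega)
  have hh : g * (2 * (u ⬝ᵥ x) + x ⬝ᵥ x) ∈ P.G (e - 2 * r) :=
    P.mul_mem' b4 (add_mem (P.two_mul_mem h1) h2) (by omega)
  obtain ⟨h', hh', e'⟩ := P.exists_inv_of_le (by omega) hh
  have key : (u ⬝ᵥ u + 2 * (u ⬝ᵥ x) + x ⬝ᵥ x) * (g * (1 + h')) = 1 := by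
    linear_combination e' + (1 + h') * hg
  have hunit : IsUnit ((c + (c' + x)) ⬝ᵥ (c + (c' + x))) := e0 ▸ .of_mul_eq_one _ key
  refine ⟨c' + x, hε, hunit, fun i => ?_⟩
  have hinv : Ring.inverse ((c + (c' + x)) ⬝ᵥ (c + (c' + x))) = g * (1 + h') := by
    rw [e0]
    have := Ring.inverse_mul_cancel _ (e0 ▸ hunit)
    linear_combination (g * (1 + h')) * this -
      Ring.inverse (u ⬝ᵥ u + 2 * (u ⬝ᵥ x) + x ⬝ᵥ x) * key
  have hval : refl c (c' + x) i - c' i = (g * (1 + h')) * ((u ⬝ᵥ u) * x i +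
      2 * ((x ⬝ᵥ c) * (u i + x i)) - (2 * (u ⬝ᵥ x) + x ⬝ᵥ x) * u i) := by
    rw [refl, hinv, ← add_assoc, ← hudef, add_dotProduct, Pi.add_apply,
      show c' i = u i - c i by simp [hudef]]
    linear_combination (u i) * key - (g * (1 + h')) * (u i + x i) * e1
  rw [hval]
  have hg' : g * (1 + h') ∈ P.G (-2 * r) :=
    P.mul_mem' b4 (add_mem b6 (P.mem_mono (by omega) hh')) (by omega)
  exact P.mul_mem' hg' (j := e - 2 * r) (sub_mem (add_mem (P.mul_mem' b3 (hx i) (by omega))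
    (P.two_mul_mem (P.mul_mem' h3 (j := -r) (add_mem (b5 i) (P.mem_mono (by omega) (hx i)))
      (by omega)))) (P.mul_mem' (add_mem (P.two_mul_mem h1) h2) (b5 i) (by omega))) (by omega)

/-- **Patching for sums of squares**: a unit which is a sum of an even number of squares in both
subrings is a sum of the same number of squares in their intersection. -/
theorem exists_common [Algebra ℚ B] [Finite (MaximalSpectrum B)] {c₁ c₂ : ι ⊕ ι → B} {f : B}
    (hf : IsUnit f) (hc₁ : ∀ i, c₁ i ∈ P.S 0) (hc₂ : ∀ i, c₂ i ∈ P.S 1)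
    (h₁ : c₁ ⬝ᵥ c₁ = f) (h₂ : c₂ ⬝ᵥ c₂ = f) :
    ∃ a : ι ⊕ ι → B, (∀ i, a i ∈ P.S 0 ∧ a i ∈ P.S 1) ∧ a ⬝ᵥ a = f := by
  obtain ⟨f', hf'⟩ := hf.exists_right_inv
  have h2 : IsUnit (2 : B) := by simpa using isUnit_natCast (B := B) two_ne_zero
  obtain ⟨half, hhalf⟩ := h2.exists_right_inv
  obtain ⟨J, hJ⟩ := P.exists_common_of_near hf' hhalf hc₂ h₂
  let d : ι ⊕ ι → B := Sum.elim (fun i => -c₁ (.inr i)) (fun i => c₁ (.inl i))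
  have d1 : c₁ ⬝ᵥ d = 0 := by
    simp only [dotProduct, d, Fintype.sum_sum_type, Sum.elim_inl, Sum.elim_inr,
      ← Finset.sum_add_distrib]
    exact Finset.sum_eq_zero fun i _ => by ring
  have d2 : d ⬝ᵥ d = f := by
    rw [← h₁]
    simp only [dotProduct, d, Fintype.sum_sum_type, Sum.elim_inl, Sum.elim_inr]
    rw [add_comm]
    congr 1
    exact Finset.sum_congr rfl fun i _ => by ring
  obtain ⟨s, hs⟩ := exists_isUnit_quadratic (f - c₁ ⬝ᵥ c₂) (2 * (d ⬝ᵥ c₂)) (f + c₁ ⬝ᵥ c₂)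
    (by rw [sub_add_add_cancel, ← two_mul]; exact h2.mul hf)
  have hs1 : IsUnit (1 + s ^ 2 : B) := by
    have := isUnit_natCast (B := B) (n := 1 + s ^ 2) (by positivity)
    simpa using this
  have hq : (c₁ + (s : B) • d) ⬝ᵥ (c₁ + (s : B) • d) = (1 + s ^ 2) * f := by
    simp only [dotProduct_add, add_dotProduct, dotProduct_smul, smul_dotProduct, smul_eq_mul,
      dotProduct_comm d c₁, d1, d2, h₁]
    ring
  have hqu : IsUnit ((c₁ + (s : B) • d) ⬝ᵥ (c₁ + (s : B) • d)) := hq ▸ hs1.mul hf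
  obtain ⟨v, hv⟩ := hs1.exists_right_inv
  have hinv : Ring.inverse ((c₁ + (s : B) • d) ⬝ᵥ (c₁ + (s : B) • d)) = v * f' := by
    have := Ring.inverse_mul_cancel _ hqu
    rw [hq] at this ⊢
    linear_combination (v * f') * this - Ring.inverse ((1 + (s : B) ^ 2) * f) *
      ((1 + (s : B) ^ 2) * v * hf' + hv)
  set c : ι ⊕ ι → B := refl c₁ ((s : B) • d) with hcdef
  have hcS : ∀ i, c i ∈ P.S 0 := by
    refine P.refl_mem_S hc₁ (fun i => mul_mem (natCast_mem _ s) ?_) hqu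
    rcases i with i | i
    · exact neg_mem (hc₁ _)
    · exact hc₁ _
  have hcq : c ⬝ᵥ c = f := by rw [hcdef, refl_dotProduct_refl hqu, h₁]
  have hcc : c = -c₁ + (2 * v) • (c₁ + (s : B) • d) := by
    ext i
    rw [hcdef, refl, hinv, add_dotProduct, smul_dotProduct, dotProduct_comm d, d1, h₁]
    simp only [Pi.add_apply, Pi.neg_apply, Pi.smul_apply, smul_eq_mul]
    linear_combination (2 * v * (c₁ i + s * d i)) * hf'
  have hu : IsUnit ((c + c₂) ⬝ᵥ (c + c₂)) := by
    have : (c + c₂) ⬝ᵥ (c + c₂) = 2 * v * ((f - c₁ ⬝ᵥ c₂) * s ^ 2 + 2 * (d ⬝ᵥ c₂) * s +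
        (f + c₁ ⬝ᵥ c₂)) := by
      rw [dotProduct_add, add_dotProduct, add_dotProduct, hcq, h₂, dotProduct_comm c₂ c, hcc]
      simp only [add_dotProduct, neg_dotProduct, smul_dotProduct, smul_eq_mul]
      linear_combination (-2 * f + 2 * (c₁ ⬝ᵥ c₂)) * hv
    rw [this]
    exact (h2.mul (.of_mul_eq_one (1 + (s : B) ^ 2) (by rw [mul_comm, hv]))).mul hs
  obtain ⟨ε, hε, hεu, hn⟩ := P.exists_refl_near hcq h₂ hu J
  exact hJ _ (P.refl_mem_S hcS hε hεu) (by rw [refl_dotProduct_refl hεu, hcq]) hn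

end Patching

end Patching

section LaurentPatching

/-- The Laurent series of order at least `j` with coefficients in `A`. -/
def laurentAddSubgroup {κ : Type*} [Ring κ] (A : AddSubgroup κ) (j : ℤ) :
    AddSubgroup (LaurentSeries κ) where
  carrier := {x | (∀ n < j, x.coeff n = 0) ∧ ∀ n, x.coeff n ∈ A}
  zero_mem' := ⟨fun _ _ => rfl, fun _ => zero_mem _⟩
  add_mem' := fun {x y} hx hy => ⟨fun n hn => by
    rw [HahnSeries.coeff_add, hx.1 n hn, hy.1 n hn, add_zero], fun n => add_mem (hx.2 n) (hy.2 n)⟩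
  neg_mem' := fun {x} hx => ⟨fun n hn => by
    rw [HahnSeries.coeff_neg, hx.1 n hn, neg_zero], fun n => neg_mem (hx.2 n)⟩

variable {κ : Type*} [Field κ]

lemma laurentAddSubgroup_anti (A : AddSubgroup κ) : Antitone (laurentAddSubgroup A) :=
  fun _ _ h _ hx => ⟨fun n hn => hx.1 n (lt_of_lt_of_le hn h), hx.2⟩

lemma mem_laurentAddSubgroup_top {j : ℤ} {x : LaurentSeries κ} :
    x ∈ laurentAddSubgroup ⊤ j ↔ ∀ n < j, x.coeff n = 0 :=
  ⟨fun h => h.1, fun h => ⟨h, fun _ => trivial⟩⟩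

lemma laurentAddSubgroup_le_top (A : AddSubgroup κ) (j : ℤ) :
    laurentAddSubgroup A j ≤ laurentAddSubgroup ⊤ j := fun _ hx => ⟨hx.1, fun _ => trivial⟩

lemma exists_mem_laurentAddSubgroup_top (x : LaurentSeries κ) :
    ∃ j, x ∈ laurentAddSubgroup (⊤ : AddSubgroup κ) j :=
  ⟨x.order, mem_laurentAddSubgroup_top.2 fun _ hn => HahnSeries.coeff_eq_zero_of_lt_order hn⟩

lemma mul_mem_laurentAddSubgroup_top {i j : ℤ} {x y : LaurentSeries κ}
    (hx : x ∈ laurentAddSubgroup ⊤ i) (hy : y ∈ laurentAddSubgroup ⊤ j) :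
    x * y ∈ laurentAddSubgroup ⊤ (i + j) := by
  refine mem_laurentAddSubgroup_top.2 fun n hn => ?_
  rw [HahnSeries.coeff_mul]
  refine Finset.sum_eq_zero fun p hp => ?_
  have hp' := (Finset.mem_antidiagonal.1 hp).2.2
  by_cases h : p.1 < i
  · rw [hx.1 _ h, zero_mul]
  · rw [hy.1 _ (by omega), mul_zero]

/-- A Laurent series with prescribed coefficients vanishing below `j`. -/
def laurentMk (j : ℤ) (f : ℤ → κ) : LaurentSeries κ where
  coeff n := if n < j then 0 else f n
  isPWO_support' := by
    have h : BddBelow (Function.support fun n => if n < j then 0 else f n) :=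
      ⟨j, fun n hn => not_lt.1 fun h => hn (if_pos h)⟩
    exact h.isWF.isPWO

lemma coeff_laurentMk (j : ℤ) (f : ℤ → κ) (n : ℤ) :
    (laurentMk j f).coeff n = if n < j then 0 else f n := rfl

lemma exists_limit_laurentAddSubgroup (A : AddSubgroup κ) (J : ℤ) (η : ℕ → LaurentSeries κ)
    (hη : ∀ n : ℕ, η n ∈ laurentAddSubgroup A (J + n)) :
    ∃ ε ∈ laurentAddSubgroup A J,
      ∀ n : ℕ, ε - ∑ m ∈ Finset.range n, η m ∈ laurentAddSubgroup ⊤ (J + n) := by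
  refine ⟨laurentMk J fun l => ∑ m ∈ Finset.range ((l - J).toNat + 1), (η m).coeff l,
    ⟨fun n hn => by rw [coeff_laurentMk, if_pos hn], fun n => ?_⟩, fun n => ?_⟩
  · rw [coeff_laurentMk]
    split_ifs
    · exact zero_mem _
    · exact sum_mem fun m _ => (hη m).2 n
  · refine mem_laurentAddSubgroup_top.2 fun l hl => ?_
    rw [HahnSeries.coeff_sub, HahnSeries.coeff_sum, coeff_laurentMk]
    split_ifs with h
    · rw [Finset.sum_eq_zero fun m _ => (hη m).1 l (by omega), sub_zero]
    · rw [sub_eq_zero]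
      refine Finset.sum_subset (fun m hm => ?_) fun m _ hm => (hη m).1 l ?_
      · rw [Finset.mem_range] at hm ⊢; omega
      · rw [Finset.mem_range] at hm; omega

lemma eq_zero_of_forall_mem_laurentAddSubgroup {x : LaurentSeries κ}
    (h : ∀ j, x ∈ laurentAddSubgroup (⊤ : AddSubgroup κ) j) : x = 0 :=
  HahnSeries.ext (funext fun n => (h (n + 1)).1 n (by omega))

lemma exists_add_laurentAddSubgroup (h2 : (2 : κ) ≠ 0) {A A' : AddSubgroup κ}
    (hA : ∀ a, ∃ a₀ ∈ A, ∃ a₁ ∈ A', a = a₀ + a₁) {j : ℤ} {x : LaurentSeries κ}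
    (hx : x ∈ laurentAddSubgroup ⊤ j) :
    ∃ y ∈ laurentAddSubgroup A j, ∃ z ∈ laurentAddSubgroup A' j, x = 2 * (y + z) := by
  choose a ha a' ha' e using hA
  have hm : ∀ (A : AddSubgroup κ) (f : ℤ → κ), (∀ n, f n ∈ A) →
      laurentMk j f ∈ laurentAddSubgroup A j := fun A f hf =>
    ⟨fun n hn => if_pos hn, fun n => by
      rw [coeff_laurentMk]; split_ifs; exacts [zero_mem _, hf n]⟩
  refine ⟨laurentMk j fun n => a (x.coeff n / 2), hm _ _ fun n => ha _,
    laurentMk j fun n => a' (x.coeff n / 2), hm _ _ fun n => ha' _, ?_⟩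
  ext n
  rw [two_mul, HahnSeries.coeff_add, HahnSeries.coeff_add, coeff_laurentMk, coeff_laurentMk]
  split_ifs with h
  · rw [hx.1 n h]; simp
  · rw [← e]; field

variable {B : Type*} [CommRing B] [Algebra (LaurentSeries κ) B] {J : Type*} [Fintype J]
  (b : Module.Basis J (LaurentSeries κ) B)

/-- The elements of `B` whose coordinates are Laurent series of order at least `j` with
coefficients in `A`. -/
def coordAddSubgroup (A : AddSubgroup κ) (j : ℤ) : AddSubgroup B where
  carrier := {x | ∀ l, b.repr x l ∈ laurentAddSubgroup A j}
  zero_mem' := fun l => by simp [zero_mem]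
  add_mem' := fun {x y} hx hy l => by
    rw [map_add, Finsupp.add_apply]; exact add_mem (hx l) (hy l)
  neg_mem' := fun {x} hx l => by
    rw [map_neg, Finsupp.neg_apply]; exact neg_mem (hx l)

lemma repr_sum_smul (c : J → LaurentSeries κ) (l : J) : b.repr (∑ i, c i • b i) l = c l := by
  rw [b.repr_sum_self]

lemma mul_mem_coordAddSubgroup
    (hb : ∀ i j l, b.repr (b i * b j) l ∈ laurentAddSubgroup (⊤ : AddSubgroup κ) 0) {i j : ℤ}
    {x y : B} (hx : x ∈ coordAddSubgroup b ⊤ i) (hy : y ∈ coordAddSubgroup b ⊤ j) :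
    x * y ∈ coordAddSubgroup b ⊤ (i + j) := by
  rw [← b.sum_repr x, ← b.sum_repr y, Finset.sum_mul_sum]
  refine sum_mem fun p _ => sum_mem fun q _ => fun l => ?_
  rw [smul_mul_smul_comm, map_smul, Finsupp.smul_apply, smul_eq_mul]
  simpa using mul_mem_laurentAddSubgroup_top
    (mul_mem_laurentAddSubgroup_top (hx p) (hy q)) (hb p q l)

lemma exists_limit_coordAddSubgroup (A : AddSubgroup κ) (s : ℤ) (η : ℕ → B)
    (hη : ∀ n : ℕ, η n ∈ coordAddSubgroup b A (s + n)) :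
    ∃ ε ∈ coordAddSubgroup b A s,
      ∀ n : ℕ, ε - ∑ m ∈ Finset.range n, η m ∈ coordAddSubgroup b ⊤ (s + n) := by
  choose ε hε hl using fun l => exists_limit_laurentAddSubgroup A s (fun n => b.repr (η n) l)
    (fun n => hη n l)
  refine ⟨∑ l, ε l • b l, fun l => by rw [repr_sum_smul]; exact hε l, fun n l => ?_⟩
  rw [map_sub, Finsupp.sub_apply, repr_sum_smul, map_sum, Finsupp.finsetSum_apply]
  exact hl l n

lemma exists_inv_coordAddSubgroup
    (hb : ∀ i j l, b.repr (b i * b j) l ∈ laurentAddSubgroup (⊤ : AddSubgroup κ) 0) {h : B}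
    (hh : h ∈ coordAddSubgroup b ⊤ 1) :
    ∃ h' ∈ coordAddSubgroup b ⊤ 1, (1 + h) * (1 + h') = 1 := by
  have hp : ∀ n : ℕ, (-h) ^ (n + 1) ∈ coordAddSubgroup b ⊤ (1 + n) := fun n => by
    induction n with
    | zero => simpa using neg_mem hh
    | succ n ih =>
      rw [pow_succ]
      push_cast
      rw [← add_assoc]
      exact mul_mem_coordAddSubgroup b hb ih (neg_mem hh)
  obtain ⟨h', hh', hl⟩ := exists_limit_coordAddSubgroup b ⊤ 1 _ hp
  refine ⟨h', hh', sub_eq_zero.1 (b.ext_elem fun l => ?_)⟩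
  rw [map_zero, Finsupp.zero_apply]
  refine eq_zero_of_forall_mem_laurentAddSubgroup fun j => ?_
  suffices ∀ n : ℕ, (1 + h) * (1 + h') - 1 ∈ coordAddSubgroup b ⊤ (1 + n) from
    laurentAddSubgroup_anti _ (by omega) (this j.toNat l)
  intro n
  have e : (1 + h) * (1 + h') - 1 = (-h) ^ (n + 1) * -1 +
      ((h' - ∑ m ∈ Finset.range n, (-h) ^ (m + 1)) +
      h * (h' - ∑ m ∈ Finset.range n, (-h) ^ (m + 1))) := by
    have := geom_sum_mul_neg (-h) (n + 1)
    rw [Finset.sum_range_succ'] at this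
    simp only [pow_zero] at this
    linear_combination this
  rw [e]
  refine add_mem ?_ (add_mem (hl n) ?_)
  · rw [mul_neg, mul_one]; exact neg_mem (hp n)
  · have := mul_mem_coordAddSubgroup b hb hh (hl n)
    exact fun l => laurentAddSubgroup_anti _ (by omega) (this l)

/-- The patching datum attached to a finite algebra over a field of Laurent series. -/
def Patching.ofBasis (h2 : (2 : κ) ≠ 0)
    (hb : ∀ i j l, b.repr (b i * b j) l ∈ laurentAddSubgroup (⊤ : AddSubgroup κ) 0)
    (A : Fin 2 → AddSubgroup κ) (hA : ∀ a, ∃ a₀ ∈ A 0, ∃ a₁ ∈ A 1, a = a₀ + a₁)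
    (E : Fin 2 → Subfield (LaurentSeries κ))
    (hE : ∀ i j x, x ∈ laurentAddSubgroup (A i) j → x ∈ E i)
    (hdense : ∀ x j, ∃ y ∈ E 0, x - y ∈ laurentAddSubgroup (⊤ : AddSubgroup κ) j)
    (S : Fin 2 → Subring B) (hS : ∀ i x, x ∈ S i ↔ ∀ l, b.repr x l ∈ E i)
    (hinv : ∀ i (x y : B), x ∈ S i → x * y = 1 → y ∈ S i) : Patching B where
  G := coordAddSubgroup b ⊤
  G_anti := fun _ _ h _ hx l => laurentAddSubgroup_anti _ h (hx l)
  mul_mem_G := mul_mem_coordAddSubgroup b hb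
  exists_mem := fun x => by
    choose j hj using fun l => exists_mem_laurentAddSubgroup_top (b.repr x l)
    rcases isEmpty_or_nonempty J with h | h
    · exact ⟨0, fun l => h.elim l⟩
    · refine ⟨Finset.univ.inf' Finset.univ_nonempty j, fun l =>
        laurentAddSubgroup_anti _ (Finset.inf'_le _ (Finset.mem_univ l)) (hj l)⟩
  eq_zero := fun x h => b.ext_elem fun l => by
    rw [map_zero, Finsupp.zero_apply]
    exact eq_zero_of_forall_mem_laurentAddSubgroup fun j => h j l
  exists_inv := fun _ hh => exists_inv_coordAddSubgroup b hb hh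
  S := S
  M := fun i => coordAddSubgroup b (A i)
  M_le := fun _ _ _ hx l => laurentAddSubgroup_le_top _ _ (hx l)
  exists_add := fun {j x} hx => by
    choose y hy z hz e using fun l => exists_add_laurentAddSubgroup h2 hA (hx l)
    refine ⟨∑ l, y l • b l, fun l => by rw [repr_sum_smul]; exact hy l,
      ∑ l, z l • b l, fun l => by rw [repr_sum_smul]; exact hz l, b.ext_elem fun l => ?_⟩
    rw [e, two_mul, two_mul, map_add, map_add, Finsupp.add_apply, Finsupp.add_apply,
      repr_sum_smul, repr_sum_smul]
  exists_lim := fun i s η hη => by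
    obtain ⟨ε, hε, hl⟩ := exists_limit_coordAddSubgroup b (A i) s η hη
    exact ⟨ε, (hS i ε).2 fun l => hE i s _ (hε l), hl⟩
  inv_mem := hinv
  dense := fun x j => by
    choose y hy hd using fun l => hdense (b.repr x l) j
    refine ⟨∑ l, y l • b l, (hS 0 _).2 fun l => by rw [repr_sum_smul]; exact hy l, fun l => ?_⟩
    rw [map_sub, Finsupp.sub_apply, repr_sum_smul]
    exact hd l

end LaurentPatching

section Intersection

open Polynomial PowerSeries

section Correction

variable {A : Type*} [CommRing A]

/-- The coefficients of a multiplier correcting those of `q`, where `b` is the remainder of a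
division by the constant coefficient. -/
noncomputable def multiplierCoeff (q : A⟦X⟧) (v₀ : A) (b : A → A) : ℕ → A
  | 0 => v₀
  | n + 1 => -b (∑ i : Fin (n + 1), coeff (n + 1 - i) q * multiplierCoeff q v₀ b i)

lemma exists_mul_coeff_mem (W : Set A) (q : A⟦X⟧) (v₀ : A) (hv₀ : constantCoeff q * v₀ ∈ W)
    (hW : ∀ a, ∃ b, a - constantCoeff q * b ∈ W) :
    ∃ v : A⟦X⟧, constantCoeff v = v₀ ∧ ∀ n, coeff n (q * v) ∈ W := by
  choose b hb using hW
  refine ⟨PowerSeries.mk (multiplierCoeff q v₀ b), ?_, fun n => ?_⟩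
  · rw [← coeff_zero_eq_constantCoeff_apply, coeff_mk, multiplierCoeff]
  rw [mul_comm, PowerSeries.coeff_mul, Finset.Nat.sum_antidiagonal_eq_sum_range_succ_mk,
    Finset.sum_range_succ]
  cases n with
  | zero => simpa [multiplierCoeff, mul_comm] using hv₀
  | succ n =>
    simp only [coeff_mk, Nat.sub_self, coeff_zero_eq_constantCoeff]
    rw [multiplierCoeff]
    convert hb (∑ i : Fin (n + 1), coeff (n + 1 - i) q * multiplierCoeff q v₀ b i) using 1
    rw [Finset.sum_range]
    simp only [mul_comm (multiplierCoeff q v₀ b _)]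
    ring

end Correction

/-- The ring homomorphism from power series over `A` to Laurent series over `κ`. -/
noncomputable def toLaurent {A κ : Type*} [CommRing A] [CommRing κ] (φ : A →+* κ) :
    A⟦X⟧ →+* LaurentSeries κ :=
  (HahnSeries.ofPowerSeries ℤ κ).comp (PowerSeries.map φ)

lemma coeff_toLaurent {A κ : Type*} [CommRing A] [CommRing κ] (φ : A →+* κ) (f : A⟦X⟧) (n : ℕ) :
    (toLaurent φ f).coeff n = φ (coeff n f) := by
  rw [toLaurent, RingHom.comp_apply, HahnSeries.ofPowerSeries_apply_coeff, PowerSeries.coeff_map]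

lemma coeff_toLaurent_neg {A κ : Type*} [CommRing A] [CommRing κ] (φ : A →+* κ) (f : A⟦X⟧) {n : ℤ}
    (hn : n < 0) : (toLaurent φ f).coeff n = 0 := by
  rw [toLaurent, RingHom.comp_apply, HahnSeries.ofPowerSeries_apply]
  exact HahnSeries.embDomain_of_notMem_range
    (by rintro ⟨m, rfl⟩; exact absurd hn (by simp))

lemma toLaurent_injective {A κ : Type*} [CommRing A] [CommRing κ] {φ : A →+* κ}
    (hφ : Function.Injective φ) : Function.Injective (toLaurent φ) := fun f g h => by
  ext n
  exact hφ (by rw [← coeff_toLaurent, ← coeff_toLaurent, h])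

variable (k : Type*) [Field k]

/-- Constants, as Laurent series. -/
noncomputable abbrev constHom : k →+* LaurentSeries k := HahnSeries.C

/-- Power series, as Laurent series. -/
noncomputable abbrev powHom : k⟦X⟧ →+* LaurentSeries k := HahnSeries.ofPowerSeries ℤ k

/-- Polynomials in the inverse of the variable, as Laurent series. -/
noncomputable def polyHom : k[X] →+* LaurentSeries k :=
  eval₂RingHom HahnSeries.C (HahnSeries.single (-1) 1)

variable {k}

lemma polyHom_monomial (n : ℕ) (a : k) :
    polyHom k (monomial n a) = HahnSeries.single (-(n : ℤ)) a := by
  simp only [polyHom, coe_eval₂RingHom, eval₂_monomial, HahnSeries.single_pow, HahnSeries.C_apply,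
    HahnSeries.single_mul_single]
  simp

lemma coeff_polyHom (P : k[X]) (n : ℕ) : (polyHom k P).coeff (-n) = P.coeff n := by
  induction P using Polynomial.induction_on' with
  | add p q hp hq => rw [map_add, HahnSeries.coeff_add, hp, hq, Polynomial.coeff_add]
  | monomial m a =>
    rw [polyHom_monomial, HahnSeries.coeff_single, Polynomial.coeff_monomial]
    simp [eq_comm]

lemma coeff_polyHom_pos (P : k[X]) {n : ℤ} (hn : 0 < n) : (polyHom k P).coeff n = 0 := by
  induction P using Polynomial.induction_on' with
  | add p q hp hq => rw [map_add, HahnSeries.coeff_add, hp, hq, add_zero]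
  | monomial m a =>
    rw [polyHom_monomial, HahnSeries.coeff_single, if_neg (by omega)]

lemma polyHom_injective : Function.Injective (polyHom k) := fun P Q h => by
  ext n
  rw [← coeff_polyHom, ← coeff_polyHom, h]

lemma coeff_powHom_neg (f : k⟦X⟧) {n : ℤ} (hn : n < 0) : (powHom k f).coeff n = 0 := by
  rw [HahnSeries.ofPowerSeries_apply]
  exact HahnSeries.embDomain_of_notMem_range
    (by rintro ⟨m, rfl⟩; exact absurd hn (by simp))

lemma coeff_mul_const {κ : Type*} [CommRing κ] (x : LaurentSeries κ) (a : κ) (n : ℤ) :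
    (x * HahnSeries.C a).coeff n = x.coeff n * a := by
  have := HahnSeries.coeff_mul_single_add (x := x) (r := a) (a := n) (b := 0)
  rwa [add_zero] at this

lemma laurent_ext {A A' κ : Type*} [CommRing A] [CommRing A'] [CommRing κ] {φ : A →+* κ}
    {φ' : A' →+* κ} {f : A⟦X⟧} {g : A'⟦X⟧} {a : κ}
    (h : ∀ n, φ (coeff n f) * a = φ' (coeff n g)) :
    toLaurent φ f * HahnSeries.C a = toLaurent φ' g := by
  ext n
  rw [coeff_mul_const]
  rcases lt_or_ge n 0 with hn | hn
  · rw [coeff_toLaurent_neg _ _ hn, coeff_toLaurent_neg _ _ hn, zero_mul]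
  · lift n to ℕ using hn
    rw [coeff_toLaurent, coeff_toLaurent, h]

lemma coeff_polyHom_mul (P : k[X]) (D : ℕ) (n : ℤ) :
    (polyHom k P * HahnSeries.single 1 1 ^ D).coeff n = (polyHom k P).coeff (n - D) := by
  have := HahnSeries.coeff_mul_single_add (x := polyHom k P) (r := (1 : k)) (a := n - D)
    (b := (D : ℤ))
  rw [sub_add_cancel, mul_one] at this
  rw [HahnSeries.single_pow, one_pow, ← this]
  simp

lemma polyHom_mul_eq {P : k[X]} {D : ℕ} (hP : P.natDegree ≤ D) :
    polyHom k P * HahnSeries.single 1 1 ^ D = powHom k (reflect D P : k[X]) := by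
  ext n
  rw [coeff_polyHom_mul]
  rcases lt_or_ge n 0 with hn | hn
  · rw [coeff_powHom_neg _ hn]
    obtain ⟨m, hm⟩ : ∃ m : ℕ, n - D = -(m : ℤ) := ⟨(D - n).toNat, by omega⟩
    rw [hm, coeff_polyHom, Polynomial.coeff_eq_zero_of_natDegree_lt (by omega)]
  · lift n to ℕ using hn
    rw [HahnSeries.ofPowerSeries_apply_coeff, Polynomial.coeff_coe, Polynomial.coeff_reflect]
    rcases le_or_gt n D with h | h
    · rw [Polynomial.revAt_le h, ← coeff_polyHom]
      congr 1; omega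
    · rw [coeff_polyHom_pos _ (by omega), Polynomial.revAt_eq_self_of_lt h,
        Polynomial.coeff_eq_zero_of_natDegree_lt (by omega)]

lemma natDegree_le_of_polyHom_mul {P : k[X]} {D : ℕ} {f : k⟦X⟧}
    (h : polyHom k P * HahnSeries.single 1 1 ^ D = powHom k f) : P.natDegree ≤ D := by
  refine Polynomial.natDegree_le_iff_coeff_eq_zero.2 fun i hi => ?_
  have := congrArg (fun x => HahnSeries.coeff x (D - i : ℤ)) h
  simp only [coeff_polyHom_mul] at this
  rwa [coeff_powHom_neg _ (by omega), show (D : ℤ) - i - D = -(i : ℕ) by ring,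
    coeff_polyHom] at this

/-- The power series with polynomial coefficients of degree at most `D`. -/
def BddDegree (D : ℕ) (Q : k[X]⟦X⟧) : Prop := ∀ n, (coeff n Q).natDegree ≤ D

lemma BddDegree.toLaurent_mem {D : ℕ} {Q : k[X]⟦X⟧} (hQ : BddDegree D Q)
    (E : Subfield (LaurentSeries (LaurentSeries k)))
    (hR : ∀ f : k⟦X⟧, toLaurent (constHom k) f ∈ E)
    (hx : HahnSeries.C (HahnSeries.single (-1) 1) ∈ E) : toLaurent (polyHom k) Q ∈ E := by
  have e : Q = ∑ i ∈ Finset.range (D + 1),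
      PowerSeries.map Polynomial.C (PowerSeries.mk fun n => (coeff n Q).coeff i) *
        PowerSeries.C (Polynomial.X ^ i) := by
    refine PowerSeries.ext fun n => ?_
    rw [map_sum]
    conv_lhs => rw [(coeff n Q).as_sum_range_C_mul_X_pow' (Nat.lt_succ_of_le (hQ n))]
    refine Finset.sum_congr rfl fun i _ => ?_
    rw [PowerSeries.coeff_mul_C, PowerSeries.coeff_map, coeff_mk]
  rw [e, map_sum]
  refine sum_mem fun i _ => ?_
  rw [map_mul]
  refine mul_mem ?_ ?_
  · have : toLaurent (polyHom k) (PowerSeries.map Polynomial.C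
        (PowerSeries.mk fun n => (coeff n Q).coeff i)) =
        toLaurent (constHom k) (PowerSeries.mk fun n => (coeff n Q).coeff i) := by
      have := laurent_ext (φ := polyHom k) (φ' := constHom k) (a := 1)
        (f := PowerSeries.map Polynomial.C (PowerSeries.mk fun n => (coeff n Q).coeff i))
        (g := PowerSeries.mk fun n => (coeff n Q).coeff i) (fun n => by simp [polyHom])
      simpa using this
    rw [this]; exact hR _
  · rw [map_pow, map_pow]
    refine pow_mem ?_ i
    simpa [toLaurent, polyHom] using hx

lemma BddDegree.exists_powHom {D : ℕ} {Q : k[X]⟦X⟧} (hQ : BddDegree D Q) :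
    ∃ V : k⟦X⟧⟦X⟧, toLaurent (polyHom k) Q * HahnSeries.C (HahnSeries.single 1 1 ^ D) =
      toLaurent (powHom k) V :=
  ⟨PowerSeries.mk fun n => (reflect D (coeff n Q) : k[X]), laurent_ext fun n => by
    rw [coeff_mk, polyHom_mul_eq (hQ n)]⟩

lemma exists_bddDegree_of_powHom {D : ℕ} {V : k⟦X⟧⟦X⟧}
    (hV : ∀ n, ∃ P : k[X], P.natDegree ≤ D ∧ coeff n V = P) :
    ∃ Q : k[X]⟦X⟧, BddDegree D Q ∧
      toLaurent (polyHom k) Q * HahnSeries.C (HahnSeries.single 1 1 ^ D) =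
        toLaurent (powHom k) V := by
  choose P hP e using hV
  have hd : ∀ n, (reflect D (P n)).natDegree ≤ D := fun n =>
    (Polynomial.natDegree_reflect_le).trans (max_le le_rfl (hP n))
  refine ⟨PowerSeries.mk fun n => reflect D (P n), fun n => by rw [coeff_mk]; exact hd n,
    laurent_ext fun n => ?_⟩
  rw [coeff_mk, polyHom_mul_eq (hd n), e, Polynomial.reflect_reflect]

lemma bddDegree_of_mul_eq {D : ℕ} {Q : k[X]⟦X⟧} {V : k⟦X⟧⟦X⟧}
    (h : toLaurent (polyHom k) Q * HahnSeries.C (HahnSeries.single 1 1 ^ D) =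
      toLaurent (powHom k) V) : BddDegree D Q := fun n => by
  have := congrArg (fun x => HahnSeries.coeff x (n : ℤ)) h
  simp only [coeff_mul_const, coeff_toLaurent] at this
  exact natDegree_le_of_polyHom_mul this

lemma exists_X_pow_mul {A : Type*} [CommRing A] {q : A⟦X⟧} (hq : q ≠ 0) :
    ∃ (e : ℕ) (q' : A⟦X⟧), q = PowerSeries.X ^ e * q' ∧ constantCoeff q' ≠ 0 :=
  ⟨q.order.toNat, q.divXPowOrder, PowerSeries.X_pow_order_mul_divXPowOrder.symm,
    fun h => hq (PowerSeries.constantCoeff_divXPowOrder_eq_zero_iff.1 h)⟩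

lemma exists_mul_coeff_mem' {A : Type*} [CommRing A] [IsDomain A] (W : Set A) (h0 : 0 ∈ W)
    {q' : A⟦X⟧} (e : ℕ) (hq : constantCoeff q' ≠ 0) {v₀ : A} (hv : v₀ ≠ 0)
    (hv₀ : constantCoeff q' * v₀ ∈ W) (hW : ∀ a, ∃ b, a - constantCoeff q' * b ∈ W) :
    ∃ v : A⟦X⟧, PowerSeries.X ^ e * q' * v ≠ 0 ∧
      ∀ n, PowerSeries.coeff n (PowerSeries.X ^ e * q' * v) ∈ W := by
  obtain ⟨v, hv1, hv2⟩ := exists_mul_coeff_mem W q' v₀ hv₀ hW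
  refine ⟨v, mul_ne_zero (mul_ne_zero (pow_ne_zero _ PowerSeries.X_ne_zero) ?_) ?_, fun n => ?_⟩
  · rintro rfl; simp at hq
  · rintro rfl; exact hv (by rw [← hv1, map_zero])
  · rw [mul_assoc, PowerSeries.coeff_X_pow_mul']
    split_ifs
    exacts [hv2 _, h0]

/-- Every nonzero power series has a multiple with polynomial coefficients of bounded degree. -/
lemma exists_bddDegree_mul {q : k[X]⟦X⟧} (hq : q ≠ 0) :
    ∃ v : k[X]⟦X⟧, q * v ≠ 0 ∧ ∃ D, BddDegree D (q * v) := by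
  obtain ⟨e, q', rfl, hc⟩ := exists_X_pow_mul hq
  obtain ⟨v, h1, h2⟩ := exists_mul_coeff_mem'
    {P : k[X] | P.natDegree ≤ (constantCoeff q').natDegree} (by simp) e hc (v₀ := 1) one_ne_zero
    (by simp) fun a => ⟨a / constantCoeff q', by
      have : a - constantCoeff q' * (a / constantCoeff q') = a % constantCoeff q' := by
        rw [sub_eq_iff_eq_add, EuclideanDomain.mod_add_div]
      rw [this]
      exact Polynomial.natDegree_le_natDegree (Polynomial.degree_mod_lt a hc).le⟩
  exact ⟨v, h1, _, h2⟩

lemma exists_polynomial_mul {q : k⟦X⟧⟦X⟧} (hq : q ≠ 0) :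
    ∃ v : k⟦X⟧⟦X⟧, q * v ≠ 0 ∧
      ∃ D, ∀ n, ∃ P : k[X], P.natDegree ≤ D ∧ coeff n (q * v) = (P : k⟦X⟧) := by
  obtain ⟨e, q', rfl, hc⟩ := exists_X_pow_mul hq
  obtain ⟨d, u, hu⟩ := IsDiscreteValuationRing.eq_unit_mul_pow_irreducible hc
    PowerSeries.X_irreducible
  obtain ⟨v, h1, h2⟩ := exists_mul_coeff_mem'
    {f : k⟦X⟧ | ∃ P : k[X], P.natDegree ≤ d ∧ f = P} ⟨0, by simp⟩ e hc
    (v₀ := ((u⁻¹ : (k⟦X⟧)ˣ) : k⟦X⟧)) (Units.ne_zero _)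
    ⟨Polynomial.X ^ d, by simp, by rw [hu]; simp [mul_right_comm]⟩ fun a => by
      refine ⟨((u⁻¹ : (k⟦X⟧)ˣ) : k⟦X⟧) * PowerSeries.mk fun i => coeff (i + d) a, trunc d a, ?_, ?_⟩
      · exact (Polynomial.natDegree_le_iff_degree_le.2 (PowerSeries.degree_trunc_lt a d).le)
      · rw [hu, sub_eq_iff_eq_add]
        have h : (u : k⟦X⟧) * PowerSeries.X ^ d * (((u⁻¹ : (k⟦X⟧)ˣ) : k⟦X⟧) *
            PowerSeries.mk fun i => coeff (i + d) a) =
            PowerSeries.mk (fun i => coeff (i + d) a) * PowerSeries.X ^ d := by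
          have := u.mul_inv
          linear_combination (PowerSeries.X ^ d * PowerSeries.mk fun i => coeff (i + d) a) * this
        rw [h, add_comm]
        exact PowerSeries.eq_shift_mul_X_pow_add_trunc d a
  exact ⟨v, h1, _, h2⟩

/-- The field of fractions of `A⟦X⟧` inside the field of Laurent series. -/
noncomputable def fracSubfield {A κ : Type*} [CommRing A] [Field κ] (φ : A →+* κ) :
    Subfield (LaurentSeries κ) := Subfield.closure (toLaurent φ).range

lemma mem_fracSubfield {A κ : Type*} [CommRing A] [Field κ] {φ : A →+* κ} {z : LaurentSeries κ} :
    z ∈ fracSubfield φ ↔ ∃ a b, toLaurent φ b ≠ 0 ∧ z * toLaurent φ b = toLaurent φ a := by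
  rw [fracSubfield, Subfield.mem_closure_iff]
  simp only [Subring.closure_eq]
  constructor
  · rintro ⟨_, ⟨a, rfl⟩, _, ⟨b, rfl⟩, rfl⟩
    by_cases h : toLaurent φ b = 0
    · exact ⟨0, 1, by simp, by simp [h]⟩
    · exact ⟨a, b, h, div_mul_cancel₀ _ h⟩
  · rintro ⟨a, b, h, e⟩
    exact ⟨_, ⟨a, rfl⟩, _, ⟨b, rfl⟩, by rw [← e, mul_div_cancel_right₀ _ h]⟩

/-- The intersection of the two fields of fractions is generated by constants and `y⁻¹`. -/
theorem fracSubfield_inf_le (E : Subfield (LaurentSeries (LaurentSeries k)))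
    (hR : ∀ f : k⟦X⟧, toLaurent (constHom k) f ∈ E)
    (hx : HahnSeries.C (HahnSeries.single (-1) 1) ∈ E) :
    fracSubfield (powHom k) ⊓ fracSubfield (polyHom k) ≤ E := by
  rintro z ⟨hz1, hz2⟩
  obtain ⟨a, b, hb, e1⟩ := mem_fracSubfield.1 hz1
  obtain ⟨c, d, hd, e2⟩ := mem_fracSubfield.1 hz2
  obtain ⟨v, hv, D, hD⟩ := exists_polynomial_mul (q := b) (by rintro rfl; simp at hb)
  obtain ⟨w, hw, D', hD'⟩ := exists_bddDegree_mul (q := d) (by rintro rfl; simp at hd)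
  obtain ⟨Q, hQ, eQ⟩ := exists_bddDegree_of_powHom hD
  obtain ⟨V, eV⟩ := hD'.exists_powHom
  have inj₁ := toLaurent_injective (φ := powHom k) HahnSeries.ofPowerSeries_injective
  have inj₂ := toLaurent_injective (φ := polyHom k) polyHom_injective
  have hQ0 : toLaurent (polyHom k) Q ≠ 0 := fun h => by
    rw [h, zero_mul] at eQ
    exact hv (inj₁ (by rw [map_zero, ← eQ]))
  have hd0 : toLaurent (polyHom k) (d * w) ≠ 0 := fun h => hw (inj₂ (by rw [h, map_zero]))
  have hB : BddDegree (D + D') (c * w * Q) := bddDegree_of_mul_eq (V := a * v * V) <| by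
    rw [map_mul] at eQ eV
    simp only [map_mul, pow_add]
    rw [← eV, ← e1, ← e2]
    linear_combination (z * toLaurent (polyHom k) d * toLaurent (polyHom k) w *
      HahnSeries.C (HahnSeries.single 1 1 ^ D')) * eQ
  have key : z * (toLaurent (polyHom k) (d * w) * toLaurent (polyHom k) Q) =
      toLaurent (polyHom k) (c * w * Q) := by
    simp only [map_mul]
    rw [← e2]; ring
  rw [eq_div_of_mul_eq (mul_ne_zero hd0 hQ0) key]
  exact div_mem (hB.toLaurent_mem E hR hx)
    (mul_mem (hD'.toLaurent_mem E hR hx) (hQ.toLaurent_mem E hR hx))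

end Intersection

section PatchingFields

open scoped TensorProduct

lemma mem_sumSq_of_quotients {S : Type*} [CommRing S] [IsArtinianRing S] [IsReduced S] {f : S}
    {N : ℕ} (h : ∀ m : Ideal S, m.IsMaximal → Ideal.Quotient.mk m f ∈ sumSq (S ⧸ m) N) :
    f ∈ sumSq S N := by
  choose g hg using fun I : MaximalSpectrum S => h I.asIdeal I.isMaximal
  let e := IsArtinianRing.equivPi S
  have : e f ∈ sumSq (∀ I : MaximalSpectrum S, S ⧸ I.asIdeal) N :=
    ⟨fun j I => g I j, by
      ext I
      rw [IsArtinianRing.equivPi_apply, Finset.sum_apply]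
      exact hg I⟩
  simpa using map_mem_sumSq (e.symm : _ →+* S) this

section CoordSubalgebra

variable {Ê B J : Type*} [Field Ê] [CommRing B] [Algebra Ê B] [Fintype J] (b : Module.Basis J Ê B)
  (E : Subfield Ê)

/-- The elements of an algebra whose coordinates lie in a subfield that contains the structure
constants. -/
def coordSubalgebra (hb : ∀ i j l, b.repr (b i * b j) l ∈ E) (h1 : ∀ l, b.repr 1 l ∈ E) :
    Subalgebra E B where
  carrier := {x | ∀ l, b.repr x l ∈ E}
  mul_mem' := fun {x y} hx hy l => by
    rw [← b.sum_repr x, ← b.sum_repr y, Finset.sum_mul_sum]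
    simp only [map_sum, Finsupp.finsetSum_apply]
    refine sum_mem fun i _ => sum_mem fun j _ => ?_
    rw [smul_mul_smul_comm, map_smul, Finsupp.smul_apply, smul_eq_mul]
    exact mul_mem (mul_mem (hx i) (hy j)) (hb i j l)
  add_mem' := fun {x y} hx hy l => by
    rw [map_add, Finsupp.add_apply]; exact add_mem (hx l) (hy l)
  algebraMap_mem' := fun r l => by
    have : algebraMap E B r = (r : Ê) • (1 : B) := by
      rw [Algebra.algebraMap_eq_smul_one]; rfl
    rw [this, map_smul, Finsupp.smul_apply, smul_eq_mul]
    exact mul_mem r.2 (h1 l)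

variable (hb : ∀ i j l, b.repr (b i * b j) l ∈ E) (h1 : ∀ l, b.repr 1 l ∈ E)

instance finite_coordSubalgebra : Module.Finite E (coordSubalgebra b E hb h1) := by
  let φ : coordSubalgebra b E hb h1 →ₗ[E] (J → E) :=
    { toFun := fun x l => ⟨b.repr x l, x.2 l⟩
      map_add' := fun x y => by ext l; simp
      map_smul' := fun r x => by
        ext l
        have : ((r • x : coordSubalgebra b E hb h1) : B) = (r : Ê) • (x : B) := rfl
        simp [this] }
  refine Module.Finite.of_injective φ fun x y h => ?_
  refine Subtype.ext (b.repr.injective (Finsupp.ext fun l => ?_))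
  exact congrArg Subtype.val (congrFun h l)

instance isArtinianRing_coordSubalgebra : IsArtinianRing (coordSubalgebra b E hb h1) :=
  IsArtinianRing.of_finite E _

end CoordSubalgebra

variable {κ E F : Type u} [Field κ] [Field E] [Field F] [Algebra E F] [CharZero E]
  [FiniteDimensional E F] [Algebra E (LaurentSeries κ)]

lemma exists_basis_structureConstants (s : E)
    (hs : algebraMap E (LaurentSeries κ) s = HahnSeries.single 1 1) :
    ∃ b : Module.Basis (Fin (Module.finrank E F)) E F, ∀ i j l,
      algebraMap E (LaurentSeries κ) (b.repr (b i * b j) l) ∈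
        laurentAddSubgroup (⊤ : AddSubgroup κ) 0 := by
  let b := Module.finBasis E F
  have hs0 : s ≠ 0 := fun h => by
    rw [h, map_zero] at hs
    exact HahnSeries.single_ne_zero one_ne_zero hs.symm
  choose J hJ using fun p : Fin (Module.finrank E F) × Fin (Module.finrank E F) ×
    Fin (Module.finrank E F) => exists_mem_laurentAddSubgroup_top
      (algebraMap E (LaurentSeries κ) (b.repr (b p.1 * b p.2.1) p.2.2))
  obtain ⟨N, hN⟩ : ∃ N : ℕ, ∀ p, -(N : ℤ) ≤ J p := by
    obtain ⟨N, hN⟩ := (Set.finite_range fun p => (-J p).toNat).bddAbove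
    exact ⟨N, fun p => by have := hN ⟨p, rfl⟩; simp only at this; omega⟩
  refine ⟨b.unitsSMul fun _ => Units.mk0 s hs0 ^ N, fun i j l => ?_⟩
  have e : (b.unitsSMul fun _ => Units.mk0 s hs0 ^ N).repr
      ((b.unitsSMul fun _ => Units.mk0 s hs0 ^ N) i *
        (b.unitsSMul fun _ => Units.mk0 s hs0 ^ N) j) l = s ^ N * b.repr (b i * b j) l := by
    rw [Module.Basis.repr_unitsSMul, Module.Basis.unitsSMul_apply, Module.Basis.unitsSMul_apply,
      smul_mul_smul_comm, Units.smul_def (_ * _), map_smul, Finsupp.smul_apply, Units.smul_def]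
    simp only [Units.val_mul, Units.val_pow_eq_pow_val, Units.val_mk0, smul_eq_mul,
      Units.val_inv_eq_inv_val]
    field_simp
  rw [e, map_mul, map_pow, hs, HahnSeries.single_pow, one_pow]
  have h1 : (HahnSeries.single (N • (1 : ℤ)) (1 : κ)) ∈
      laurentAddSubgroup (⊤ : AddSubgroup κ) N :=
    ⟨fun n hn => by rw [HahnSeries.coeff_single, if_neg (by simp; omega)], fun _ => trivial⟩
  have := mul_mem_laurentAddSubgroup_top h1 (hJ (i, j, l))
  exact laurentAddSubgroup_anti _ (by have := hN (i, j, l); omega) this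

/-- Patching of representations as sums of squares over fields. -/
theorem mem_sumSq_of_patching [CharZero κ] (s : E)
    (hs : algebraMap E (LaurentSeries κ) s = HahnSeries.single 1 1)
    (A : Fin 2 → AddSubgroup κ) (hA : ∀ a, ∃ a₀ ∈ A 0, ∃ a₁ ∈ A 1, a = a₀ + a₁)
    (U : Fin 2 → Subfield (LaurentSeries κ))
    (hU : ∀ i j x, x ∈ laurentAddSubgroup (A i) j → x ∈ U i)
    (hdense : ∀ x j, ∃ y ∈ U 0, x - y ∈ laurentAddSubgroup (⊤ : AddSubgroup κ) j)
    (hEU : ∀ i e, algebraMap E (LaurentSeries κ) e ∈ U i)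
    (hUE : ∀ z, z ∈ U 0 → z ∈ U 1 → z ∈ (algebraMap E (LaurentSeries κ)).range) {f : F} {n : ℕ}
    (h : ∀ i (F' : Type u) [Field F'] (g : F →+* F') (ψ : U i →+* F'),
      (∀ e : E, ψ ⟨algebraMap E _ e, hEU i e⟩ = g (algebraMap E F e)) →
      g f ∈ sumSq F' (2 ^ (n + 1))) : f ∈ sumSq F (2 ^ (n + 1)) := by
  rcases eq_or_ne f 0 with rfl | hf
  · exact zero_mem_sumSq _
  obtain ⟨b₀, hb₀⟩ := exists_basis_structureConstants (F := F) s hs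
  let B := LaurentSeries κ ⊗[E] F
  let b : Module.Basis _ (LaurentSeries κ) B := Algebra.TensorProduct.basis (LaurentSeries κ) b₀
  have hrepr : ∀ z : F, ∀ l, b.repr ((1 : LaurentSeries κ) ⊗ₜ[E] z) l =
      algebraMap E (LaurentSeries κ) (b₀.repr z l) := fun z l => by
    have := Algebra.TensorProduct.basis_repr_tmul b₀ (1 : LaurentSeries κ) z
    refine (DFunLike.congr_fun this l).trans ?_
    rw [one_smul, Finsupp.mapRange_apply]
  have hbm : ∀ i j, b i * b j = (1 : LaurentSeries κ) ⊗ₜ[E] (b₀ i * b₀ j) := fun i j => by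
    have := fun i => Algebra.TensorProduct.basis_apply (A := LaurentSeries κ) b₀ i
    change Algebra.TensorProduct.basis _ b₀ i * Algebra.TensorProduct.basis _ b₀ j = _
    rw [this, this, Algebra.TensorProduct.tmul_mul_tmul, one_mul]
  have hbU : ∀ r i j l, b.repr (b i * b j) l ∈ U r := fun r i j l => by
    rw [hbm, hrepr]; exact hEU r _
  have h1U : ∀ r l, b.repr 1 l ∈ U r := fun r l => by
    rw [Algebra.TensorProduct.one_def, hrepr]; exact hEU r _
  let S : ∀ r, Subalgebra (U r) B := fun r => coordSubalgebra b (U r) (hbU r) (h1U r)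
  have hinv : ∀ r (x y : B), x ∈ S r → x * y = 1 → y ∈ S r := fun r x y hx hxy => by
    have : (⟨x, hx⟩ : S r) ∈ nonZeroDivisors (S r) := mem_nonZeroDivisors_iff_right.2 fun z hz => by
      have hz' : (z : B) * x = 0 := congrArg Subtype.val hz
      refine Subtype.ext ?_
      calc (z : B) = z * x * y := by rw [mul_assoc, hxy, mul_one]
        _ = 0 := by rw [hz', zero_mul]
    obtain ⟨w, hw⟩ := (IsArtinianRing.isUnit_of_mem_nonZeroDivisors this).exists_right_inv
    have hw' : x * (w : B) = 1 := congrArg Subtype.val hw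
    rw [← left_inv_eq_right_inv (by rw [mul_comm]; exact hw') hxy]
    exact w.2
  let P : Patching B := Patching.ofBasis b two_ne_zero
    (fun i j l => by rw [hbm, hrepr]; exact hb₀ i j l) A hA U hU hdense
    (fun r => (S r).toSubring) (fun r x => Iff.rfl) hinv
  have : Module.Finite (LaurentSeries κ) B := Module.Finite.of_basis b
  have : IsArtinianRing B := IsArtinianRing.of_finite (LaurentSeries κ) B
  have : Algebra.FormallyUnramified E F := Algebra.FormallyUnramified.of_isSeparable E F
  have : IsReduced B := Algebra.FormallyUnramified.isReduced_of_field (LaurentSeries κ) B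
  let ι : F →+* B := Algebra.TensorProduct.includeRight.toRingHom
  have hι : ∀ z, ι z = (1 : LaurentSeries κ) ⊗ₜ[E] z := fun z => rfl
  have hιS : ∀ r z, ι z ∈ S r := fun r z l => by rw [hι, hrepr]; exact hEU r _
  have key (r) : ∃ c : Fin (2 ^ n) ⊕ Fin (2 ^ n) → B, (∀ i, c i ∈ S r) ∧ c ⬝ᵥ c = ι f := by
    have hred : IsReduced (S r) := isReduced_of_injective (S r).subtype Subtype.val_injective
    obtain ⟨c, hc⟩ : (⟨ι f, hιS r f⟩ : S r) ∈ sumSq (S r) (2 ^ (n + 1)) := by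
      refine mem_sumSq_of_quotients fun m hm => ?_
      let := Ideal.Quotient.field m
      refine h r (S r ⧸ m) ((Ideal.Quotient.mk m).comp (ι.codRestrict (S r) (hιS r)))
        ((Ideal.Quotient.mk m).comp (algebraMap (U r) (S r))) fun e => ?_
      refine congrArg (Ideal.Quotient.mk m) (Subtype.ext ?_)
      change algebraMap (LaurentSeries κ) B (algebraMap E _ e) = ι (algebraMap E F e)
      rw [← IsScalarTower.algebraMap_apply]
      exact (Algebra.TensorProduct.includeRight (A := LaurentSeries κ).commutes e).symm
    have e : Fin (2 ^ n) ⊕ Fin (2 ^ n) ≃ Fin (2 ^ (n + 1)) :=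
      finSumFinEquiv.trans (finCongr (by ring))
    refine ⟨fun i => c (e i), fun i => (c (e i)).2, ?_⟩
    have hc' := congrArg Subtype.val hc
    simp only at hc'
    rw [hc', dotProduct]
    simp only [AddSubmonoidClass.coe_finsetSum, SubmonoidClass.coe_pow, ← sq]
    exact e.sum_comp fun i => (c i : B) ^ 2
  obtain ⟨c₁, hc₁, e₁⟩ := key 0
  obtain ⟨c₂, hc₂, e₂⟩ := key 1
  let : Algebra ℚ B := ((algebraMap (LaurentSeries κ) B).comp
    (algebraMap ℚ (LaurentSeries κ))).toAlgebra
  obtain ⟨a, ha, e⟩ := P.exists_common (f := ι f) ((IsUnit.mk0 f hf).map ι) hc₁ hc₂ e₁ e₂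
  have hrange : ∀ i, ∃ z, ι z = a i := fun i => by
    choose z hz using fun l => hUE _ ((ha i).1 l) ((ha i).2 l)
    refine ⟨∑ l, z l • b₀ l, b.repr.injective (Finsupp.ext fun l => ?_)⟩
    rw [hι, hrepr, ← hz, Module.Basis.repr_sum_self]
  choose z hz using hrange
  have hfz : f = ∑ i, z i ^ 2 := by
    refine ι.injective ?_
    rw [← e, dotProduct, map_sum]
    exact Finset.sum_congr rfl fun i _ => by rw [map_pow, hz, sq]
  rw [hfz]
  exact mem_sumSq_of_fintype (by simp [pow_succ, mul_two]) z

end PatchingFields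

section ConcretePatching

open Polynomial PowerSeries IntermediateField

lemma exists_ringHom_adjoin {L F Ω : Type*} [Field L] [Field F] [Field Ω] [Algebra L F]
    (i : L →+* Ω) {x : F} (hx : Transcendental L x) {y : Ω}
    (hy : ∀ P : L[X], P.eval₂ i y = 0 → P = 0) :
    ∃ j : L⟮x⟯ →+* Ω, (∀ a, j (algebraMap L _ a) = i a) ∧ j (AdjoinSimple.gen L x) = y ∧
      ∀ U : Subfield Ω, (∀ a, i a ∈ U) → y ∈ U → ∀ e, j e ∈ U := by
  let := i.toAlgebra
  have hy' : Transcendental L y := by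
    rintro ⟨P, hP, h⟩
    exact hP (hy P h)
  obtain ⟨j, hj⟩ : ∃ j : L⟮x⟯ →ₐ[L] Ω, j (AdjoinSimple.gen L x) = y := by
    refine ⟨L⟮y⟯.val.comp ((RatFunc.algEquivOfTranscendental y hy').toAlgHom.comp
      (RatFunc.algEquivOfTranscendental x hx).symm.toAlgHom), ?_⟩
    have e1 := RatFunc.algEquivOfTranscendental_symm_gen x hx
    have e2 := RatFunc.algEquivOfTranscendental_X y hy'
    rw [← e1] at e2
    exact e2
  refine ⟨j, fun a => j.commutes a, hj, fun U hU hyU e => ?_⟩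
  have : ∀ z (hz : z ∈ L⟮x⟯), j ⟨z, hz⟩ ∈ U := fun z hz => by
    induction hz using IntermediateField.adjoin_induction with
    | mem z hz =>
      obtain rfl := hz
      exact (congrArg (· ∈ U) hj).mpr hyU
    | algebraMap a => exact (congrArg (· ∈ U) (j.commutes a)).mpr (hU a)
    | add z w hz hw h1 h2 =>
      exact (congrArg (· ∈ U) (map_add j ⟨z, hz⟩ ⟨w, hw⟩)).mpr (add_mem h1 h2)
    | inv z hz h => exact (congrArg (· ∈ U) (map_inv₀ j ⟨z, hz⟩)).mpr (inv_mem h)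
    | mul z w hz hw h1 h2 =>
      exact (congrArg (· ∈ U) (map_mul j ⟨z, hz⟩ ⟨w, hw⟩)).mpr (mul_mem h1 h2)
  exact this e e.2

variable {k : Type u} [Field k]

lemma toLaurent_mem_fracSubfield {A κ : Type*} [CommRing A] [Field κ] (φ : A →+* κ) (f : A⟦X⟧) :
    toLaurent φ f ∈ fracSubfield φ := mem_fracSubfield.2 ⟨f, 1, by simp, by simp⟩

lemma toLaurent_X {A κ : Type*} [CommRing A] [Field κ] (φ : A →+* κ) :
    toLaurent φ PowerSeries.X = HahnSeries.single 1 1 := by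
  simp [toLaurent]

lemma toLaurent_C {A κ : Type*} [CommRing A] [Field κ] (φ : A →+* κ) (a : A) :
    toLaurent φ (PowerSeries.C a) = HahnSeries.C (φ a) := by
  simp [toLaurent]

lemma single_mem_of_single_one_mem {κ : Type*} [Field κ] {U : Subfield (LaurentSeries κ)}
    (h : HahnSeries.single 1 1 ∈ U) (j : ℤ) : HahnSeries.single j 1 ∈ U := by
  have key : ∀ n : ℕ, (HahnSeries.single (n : ℤ) 1 : LaurentSeries κ) ∈ U := fun n => by
    have := pow_mem h n
    rw [HahnSeries.single_pow, one_pow] at this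
    simpa using this
  rcases le_or_gt 0 j with hj | hj
  · lift j to ℕ using hj; exact key j
  · obtain ⟨n, hn⟩ := Int.eq_ofNat_of_zero_le (neg_nonneg.2 hj.le)
    have := inv_mem (key n)
    rw [HahnSeries.inv_single, ← hn, inv_one, neg_neg] at this
    exact this

lemma mem_fracSubfield_of_mem_laurentAddSubgroup {A κ : Type*} [CommRing A] [Field κ]
    (φ : A →+* κ) (j : ℤ) {x : LaurentSeries κ}
    (hx : x ∈ laurentAddSubgroup φ.range.toAddSubgroup j) : x ∈ fracSubfield φ := by
  choose f hf using hx.2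
  have e : x = HahnSeries.single j 1 * toLaurent φ (PowerSeries.mk fun n => f (j + n)) := by
    ext n
    have := HahnSeries.coeff_single_mul_add (r := (1 : κ))
      (x := toLaurent φ (PowerSeries.mk fun n => f (j + n))) (a := n - j) (b := j)
    rw [sub_add_cancel, one_mul] at this
    rw [this]
    rcases lt_or_ge n j with hn | hn
    · rw [hx.1 n hn, coeff_toLaurent_neg _ _ (by omega)]
    · obtain ⟨m, rfl⟩ : ∃ m : ℕ, n = j + m := ⟨(n - j).toNat, by omega⟩
      rw [add_sub_cancel_left, coeff_toLaurent, coeff_mk, hf]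
  rw [e]
  refine mul_mem (single_mem_of_single_one_mem ?_ j) (toLaurent_mem_fracSubfield φ _)
  rw [← toLaurent_X φ]
  exact toLaurent_mem_fracSubfield φ _

lemma exists_powHom_add_polyHom (a : LaurentSeries k) :
    ∃ (f : k⟦X⟧) (P : k[X]), a = powHom k f + polyHom k P := by
  obtain ⟨j, hj⟩ := exists_mem_laurentAddSubgroup_top a
  let P : k[X] := ∑ m ∈ Finset.range ((-j).toNat + 1), monomial m (a.coeff (-m))
  have hP : ∀ m : ℕ, P.coeff m = a.coeff (-m) := fun m => by
    simp only [P, Polynomial.finsetSum_coeff, Polynomial.coeff_monomial, Finset.sum_ite_eq',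
      Finset.mem_range]
    split_ifs with h
    · rfl
    · exact (hj.1 _ (by omega)).symm
  refine ⟨PowerSeries.mk fun n => (a - polyHom k P).coeff n, P, eq_add_of_sub_eq ?_⟩
  ext n
  rcases lt_or_ge n 0 with hn | hn
  · obtain ⟨m, rfl⟩ : ∃ m : ℕ, n = -(m : ℤ) := ⟨(-n).toNat, by omega⟩
    rw [coeff_powHom_neg _ hn, HahnSeries.coeff_sub, coeff_polyHom, hP, sub_self]
  · lift n to ℕ using hn
    rw [HahnSeries.ofPowerSeries_apply_coeff, coeff_mk]

lemma exists_mem_fracSubfield_near (x : LaurentSeries (LaurentSeries k)) (j : ℤ) :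
    ∃ y ∈ fracSubfield (powHom k), x - y ∈ laurentAddSubgroup (⊤ : AddSubgroup _) j := by
  obtain ⟨N, hN⟩ := exists_mem_laurentAddSubgroup_top x
  refine ⟨∑ n ∈ Finset.Ico N j, HahnSeries.single n 1 * HahnSeries.C (x.coeff n),
    sum_mem fun n _ => mul_mem (single_mem_of_single_one_mem ?_ n) ?_, fun n hn => ?_,
    fun _ => trivial⟩
  · rw [← toLaurent_X (powHom k)]
    exact toLaurent_mem_fracSubfield _ _
  · obtain ⟨r, s, hs, e⟩ := IsFractionRing.div_surjective (A := k⟦X⟧) (x.coeff n)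
    rw [← e, map_div₀]
    exact div_mem ((toLaurent_C (powHom k) r).symm ▸ toLaurent_mem_fracSubfield _ _)
      ((toLaurent_C (powHom k) s).symm ▸ toLaurent_mem_fracSubfield _ _)
  · rw [HahnSeries.coeff_sub, HahnSeries.coeff_sum]
    simp only [coeff_mul_const, HahnSeries.coeff_single, ite_mul, one_mul, zero_mul,
      Finset.sum_ite_eq, Finset.mem_Ico]
    split_ifs with h
    · exact sub_self _
    · rw [sub_zero, hN.1 n (by omega)]

lemma map_C_compat {A κ : Type*} [CommRing A] [Field κ] {φ : A →+* κ} {c : k →+* A}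
    {c' : k →+* κ} (h : φ.comp c = c') (r : k⟦X⟧) :
    toLaurent φ (PowerSeries.map c r) = toLaurent c' r := by
  rw [← h]; ext n
  rcases lt_or_ge n 0 with hn | hn
  · rw [coeff_toLaurent_neg _ _ hn, coeff_toLaurent_neg _ _ hn]
  · lift n to ℕ using hn
    rw [coeff_toLaurent, coeff_toLaurent, PowerSeries.coeff_map, RingHom.comp_apply]

/-- The embedding of Laurent series into iterated Laurent series, in the outer variable. -/
noncomputable def outerHom (k : Type*) [Field k] :
    LaurentSeries k →+* LaurentSeries (LaurentSeries k) :=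
  IsFractionRing.lift (A := k⟦X⟧) (toLaurent_injective (φ := constHom k) HahnSeries.C_injective)

lemma outerHom_algebraMap (r : k⟦X⟧) :
    outerHom k (algebraMap k⟦X⟧ (LaurentSeries k) r) = toLaurent (constHom k) r :=
  IsFractionRing.lift_algebraMap _ _

lemma eq_zero_of_eval₂_outerHom (P : (LaurentSeries k)[X])
    (h : P.eval₂ (outerHom k) (HahnSeries.C (HahnSeries.single (-1) 1)) = 0) : P = 0 := by
  obtain ⟨b, -, hb⟩ := IsLocalization.integerNormalization_spec (nonZeroDivisors k⟦X⟧) P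
  rw [← IsLocalization.integerNormalization_eq_zero_iff (M := nonZeroDivisors k⟦X⟧) le_rfl]
  set Q := IsLocalization.integerNormalization (nonZeroDivisors k⟦X⟧) P
  have hQ : Q.eval₂ (toLaurent (constHom k)) (HahnSeries.C (HahnSeries.single (-1) 1)) = 0 := by
    have e : toLaurent (constHom k) = (outerHom k).comp (algebraMap k⟦X⟧ (LaurentSeries k)) :=
      RingHom.ext fun r => (outerHom_algebraMap r).symm
    rw [e, ← Polynomial.eval₂_map, hb, ← algebraMap_smul (LaurentSeries k) b P,
      Polynomial.eval₂_smul, h, mul_zero]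
  ext i n
  have := congrArg (fun x => HahnSeries.coeff (HahnSeries.coeff x (n : ℤ)) (-i : ℤ)) hQ
  have e : ∀ i : ℕ, (HahnSeries.C (HahnSeries.single (-1) 1) : LaurentSeries (LaurentSeries k)) ^ i
      = HahnSeries.C (HahnSeries.single (-(i : ℤ)) 1) := fun i => by
    rw [← map_pow, HahnSeries.single_pow, one_pow]; simp
  simp only [Polynomial.eval₂_eq_sum_range, HahnSeries.coeff_sum, e, coeff_mul_const,
    coeff_toLaurent] at this
  simp only [HahnSeries.C_apply, HahnSeries.single_mul_single, mul_one, zero_add,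
    HahnSeries.coeff_single, HahnSeries.coeff_zero, neg_inj, Nat.cast_inj, Finset.sum_ite_eq,
    Finset.mem_range] at this
  rw [Polynomial.coeff_zero, map_zero, ← this]
  split_ifs with h
  · rfl
  · rw [Polynomial.coeff_eq_zero_of_natDegree_lt (by omega), map_zero]

/-- Patching of representations as sums of squares over function fields. -/
theorem mem_sumSq_of_patch [CharZero k] {F : Type u} [Field F] [Algebra (LaurentSeries k) F]
    {x : F} (hx : Transcendental (LaurentSeries k) x) [FiniteDimensional (LaurentSeries k)⟮x⟯ F]
    {f : F} {n : ℕ}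
    (h₀ : ∀ (F' : Type u) [Field F'] (g : F →+* F') (φ : k⟦X⟧⟦X⟧ →+* F'), Function.Injective φ →
      (∀ r, φ (PowerSeries.map PowerSeries.C r) =
        g (algebraMap (LaurentSeries k) F (algebraMap k⟦X⟧ _ r))) →
      g x * φ (PowerSeries.C PowerSeries.X) = 1 → g f ∈ sumSq F' (2 ^ (n + 1)))
    (h₁ : ∀ (F' : Type u) [Field F'] (g : F →+* F') (φ : k[X]⟦X⟧ →+* F'), Function.Injective φ →
      (∀ r, φ (PowerSeries.map Polynomial.C r) =
        g (algebraMap (LaurentSeries k) F (algebraMap k⟦X⟧ _ r))) →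
      φ (PowerSeries.C Polynomial.X) = g x → g f ∈ sumSq F' (2 ^ (n + 1))) :
    f ∈ sumSq F (2 ^ (n + 1)) := by
  obtain ⟨j, hjL, hjx, hjU⟩ := exists_ringHom_adjoin (outerHom k) hx eq_zero_of_eval₂_outerHom
  let := j.toAlgebra
  have hj : ∀ e, algebraMap (LaurentSeries k)⟮x⟯ (LaurentSeries (LaurentSeries k)) e = j e :=
    fun e => rfl
  have : CharZero (LaurentSeries k)⟮x⟯ :=
    charZero_of_injective_ringHom (algebraMap (LaurentSeries k) _).injective
  have hL : ∀ U : Subfield (LaurentSeries (LaurentSeries k)),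
      (∀ r, toLaurent (constHom k) r ∈ U) → ∀ a, outerHom k a ∈ U := fun U hU a => by
    obtain ⟨r, s, hs, rfl⟩ := IsFractionRing.div_surjective (A := k⟦X⟧) a
    rw [map_div₀, outerHom_algebraMap, outerHom_algebraMap]
    exact div_mem (hU r) (hU s)
  have e0 : (powHom k).comp PowerSeries.C = constHom k := by ext; simp
  have e1 : (polyHom k).comp Polynomial.C = constHom k := by ext; simp [polyHom]
  have c0 : ∀ r, toLaurent (constHom k) r ∈ fracSubfield (powHom k) := fun r => by
    rw [← map_C_compat e0]; exact toLaurent_mem_fracSubfield _ _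
  have c1 : ∀ r, toLaurent (constHom k) r ∈ fracSubfield (polyHom k) := fun r => by
    rw [← map_C_compat e1]; exact toLaurent_mem_fracSubfield _ _
  have x1 : toLaurent (polyHom k) (PowerSeries.C Polynomial.X) =
      HahnSeries.C (HahnSeries.single (-1) 1) := by
    rw [toLaurent_C]; simp [polyHom]
  have x0 : HahnSeries.C (HahnSeries.single (-1) 1) *
      toLaurent (powHom k) (PowerSeries.C PowerSeries.X) = 1 := by
    rw [toLaurent_C, ← map_mul]; simp
  refine mem_sumSq_of_patching (E := (LaurentSeries k)⟮x⟯)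
    (algebraMap (LaurentSeries k) _ (algebraMap k⟦X⟧ _ PowerSeries.X)) ?_
    ![(powHom k).range.toAddSubgroup, (polyHom k).range.toAddSubgroup] ?_
    ![fracSubfield (powHom k), fracSubfield (polyHom k)] ?_ ?_ ?_ ?_ ?_
  · rw [hj, hjL, outerHom_algebraMap, toLaurent_X]
  · intro a
    obtain ⟨f, P, rfl⟩ := exists_powHom_add_polyHom a
    exact ⟨_, ⟨f, rfl⟩, _, ⟨P, rfl⟩, rfl⟩
  · rw [Fin.forall_fin_two]
    exact ⟨fun j x => mem_fracSubfield_of_mem_laurentAddSubgroup _ j,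
      fun j x => mem_fracSubfield_of_mem_laurentAddSubgroup _ j⟩
  · exact exists_mem_fracSubfield_near
  · rw [Fin.forall_fin_two]
    refine ⟨fun e => hjU _ (hL _ c0) ?_ e, fun e => hjU _ (hL _ c1) ?_ e⟩
    · rw [eq_inv_of_mul_eq_one_left x0]
      exact inv_mem (toLaurent_mem_fracSubfield _ _)
    · rw [← x1]; exact toLaurent_mem_fracSubfield _ _
  · intro z hz0 hz1
    exact fracSubfield_inf_le j.fieldRange
      (fun r => ⟨_, (hjL _).trans (outerHom_algebraMap r)⟩) ⟨_, hjx⟩ ⟨hz0, hz1⟩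
  · rw [Fin.forall_fin_two]
    constructor
    · intro F' _ g ψ hψ
      have hmem := toLaurent_mem_fracSubfield (powHom k)
      refine h₀ F' g (ψ.comp ((toLaurent (powHom k)).codRestrict _ hmem)) ?_ ?_ ?_
      · refine ψ.injective.comp fun a b h => ?_
        exact toLaurent_injective HahnSeries.ofPowerSeries_injective (congrArg Subtype.val h)
      · intro r
        refine Eq.trans ?_ (hψ (algebraMap (LaurentSeries k) _ (algebraMap k⟦X⟧ _ r)))
        refine congrArg ψ (Subtype.ext ?_)
        change toLaurent (powHom k) _ = j _
        rw [hjL, outerHom_algebraMap, map_C_compat e0]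
      · have := hψ (AdjoinSimple.gen _ x)
        change ψ _ = g x at this
        rw [← this, RingHom.comp_apply, ← map_mul, ← map_one ψ]
        refine congrArg ψ (Subtype.ext ?_)
        change j _ * toLaurent (powHom k) _ = 1
        rw [hjx, x0]
    · intro F' _ g ψ hψ
      have hmem := toLaurent_mem_fracSubfield (polyHom k)
      refine h₁ F' g (ψ.comp ((toLaurent (polyHom k)).codRestrict _ hmem)) ?_ ?_ ?_
      · refine ψ.injective.comp fun a b h => ?_
        exact toLaurent_injective polyHom_injective (congrArg Subtype.val h)
      · intro r
        refine Eq.trans ?_ (hψ (algebraMap (LaurentSeries k) _ (algebraMap k⟦X⟧ _ r)))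
        refine congrArg ψ (Subtype.ext ?_)
        change toLaurent (polyHom k) _ = j _
        rw [hjL, outerHom_algebraMap, map_C_compat e1]
      · have := hψ (AdjoinSimple.gen _ x)
        change ψ _ = g x at this
        rw [← this, RingHom.comp_apply]
        refine congrArg ψ (Subtype.ext ?_)
        change toLaurent (polyHom k) _ = j _
        rw [hjx, x1]

end ConcretePatching

section Complete

open IsLocalRing

variable (k : Type*) [Field k]

lemma maximalIdeal_powerSeries₂ : maximalIdeal (PowerSeries (PowerSeries k)) =
    Ideal.span {PowerSeries.X, PowerSeries.C PowerSeries.X} := by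
  refine le_antisymm (fun f hf => ?_) ?_
  · have h0 : ¬IsUnit (PowerSeries.constantCoeff f) := fun h =>
      hf (PowerSeries.isUnit_iff_constantCoeff.2 h)
    have h1 : PowerSeries.constantCoeff (PowerSeries.constantCoeff f) = 0 := by
      by_contra h
      exact h0 (PowerSeries.isUnit_iff_constantCoeff.2 (IsUnit.mk0 _ h))
    obtain ⟨b, hb⟩ := PowerSeries.X_dvd_iff.2 h1
    have h2 : PowerSeries.constantCoeff (f - PowerSeries.C (PowerSeries.constantCoeff f)) = 0 := by
      simp
    obtain ⟨g, hg⟩ := PowerSeries.X_dvd_iff.2 h2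
    rw [Ideal.mem_span_pair]
    refine ⟨g, PowerSeries.C b, ?_⟩
    rw [mul_comm g, ← hg, ← map_mul, mul_comm b, ← hb, sub_add_cancel]
  · rw [Ideal.span_le]
    rintro _ (rfl | rfl)
    · exact fun h => by simpa using PowerSeries.isUnit_iff_constantCoeff.1 h
    · refine fun h => ?_
      have := PowerSeries.isUnit_iff_constantCoeff.1 (PowerSeries.isUnit_iff_constantCoeff.1 h)
      simp at this

instance isAdicComplete_powerSeries₂ :
    IsAdicComplete (maximalIdeal (PowerSeries (PowerSeries k))) (PowerSeries (PowerSeries k)) := by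
  let e := (MvPowerSeries.optionEquivLeft Unit k).toRingEquiv
  have h : (Ideal.span (Set.range MvPowerSeries.X)).map e =
      maximalIdeal (PowerSeries (PowerSeries k)) := by
    rw [maximalIdeal_powerSeries₂, Ideal.map_span, ← Set.range_comp]
    congr 1
    ext z
    simp only [Set.mem_range, Function.comp_apply, Option.exists, Set.mem_insert_iff,
      Set.mem_singleton_iff, e]
    simp [eq_comm, PowerSeries.X, Unique.exists_iff]
  have := (IsAdicComplete.congr_ringEquiv (Ideal.span (Set.range MvPowerSeries.X)) e).2
    inferInstance
  rwa [h] at this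

end Complete

section ValuationBasics

theorem exists_valuation_pow_eq_of_aeval {E F Γ : Type*} [Field E] [Field F] [Algebra E F]
    [LinearOrderedCommGroupWithZero Γ] (v : Valuation F Γ) {z : F} (hz0 : z ≠ 0)
    {p : Polynomial E} (hp : p ≠ 0) (hpz : Polynomial.aeval z p = 0) :
    ∃ e : ℕ, 0 < e ∧ e ≤ p.natDegree ∧ ∃ c : E, c ≠ 0 ∧ v z ^ e = v (algebraMap E F c) := by
  classical
  have hsum : ∑ i ∈ p.support, algebraMap E F (p.coeff i) * z ^ i = 0 := by
    rw [← hpz, Polynomial.aeval_eq_sum_range, Finset.sum_subset Polynomial.supp_subset_range_natDegree_succ]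
    · simp [Algebra.smul_def]
    · intro i _ hi
      simp [Polynomial.notMem_support_iff.mp hi]
  have hterm : ∀ i ∈ p.support, v (algebraMap E F (p.coeff i) * z ^ i) ≠ 0 := by
    intro i hi
    simpa [hz0] using hi
  obtain ⟨i, hi, hmax⟩ := Finset.exists_max_image p.support
    (fun i => v (algebraMap E F (p.coeff i) * z ^ i)) (Polynomial.support_nonempty.mpr hp)
  have key : ∃ j ∈ p.support, j ≠ i ∧
      v (algebraMap E F (p.coeff j) * z ^ j) = v (algebraMap E F (p.coeff i) * z ^ i) := by
    by_contra! hcon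
    have := Valuation.map_sum_eq_of_lt v (s := p.support) (j := i)
      (f := fun i => algebraMap E F (p.coeff i) * z ^ i) hi (by
        intro j hj
        have hj' := Finset.mem_sdiff.mp hj
        exact lt_of_le_of_ne (hmax j hj'.1) (hcon j hj'.1 (by simpa using hj'.2)))
    rw [hsum, map_zero] at this
    exact hterm i hi this.symm
  obtain ⟨j, hj, hji, hv⟩ := key
  have hgen : ∀ a b : ℕ, a ∈ p.support → b ∈ p.support → a < b →
      v (algebraMap E F (p.coeff a) * z ^ a) = v (algebraMap E F (p.coeff b) * z ^ b) →
      ∃ e : ℕ, 0 < e ∧ e ≤ p.natDegree ∧ ∃ c : E, c ≠ 0 ∧ v z ^ e = v (algebraMap E F c) := by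
    intro a b ha hb hab h
    refine ⟨b - a, by omega, (Nat.sub_le b a).trans (Polynomial.le_natDegree_of_mem_supp b hb), p.coeff a / p.coeff b, div_ne_zero (by simpa using ha)
      (by simpa using hb), ?_⟩
    have hvz : v z ≠ 0 := by simpa using hz0
    have hb0 : v (algebraMap E F (p.coeff b)) ≠ 0 := by simpa using hb
    rw [map_div₀, map_div₀, eq_div_iff hb0]
    rw [map_mul, map_mul, map_pow, map_pow] at h
    apply mul_right_cancel₀ (pow_ne_zero a hvz)
    rw [h, mul_right_comm, ← pow_add, Nat.sub_add_cancel hab.le, mul_comm]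
  rcases lt_or_gt_of_ne hji with h | h
  · exact hgen j i hj hi h hv
  · exact hgen i j hi hj h hv.symm

theorem exists_valuation_pow_eq {E F Γ : Type*} [Field E] [Field F] [Algebra E F]
    [LinearOrderedCommGroupWithZero Γ] (v : Valuation F Γ) {z : F} (hz0 : z ≠ 0)
    (hz : IsAlgebraic E z) :
    ∃ e : ℕ, 0 < e ∧ ∃ c : E, c ≠ 0 ∧ v z ^ e = v (algebraMap E F c) := by
  obtain ⟨p, hp, hpz⟩ := hz
  obtain ⟨e, he, -, h⟩ := exists_valuation_pow_eq_of_aeval v hz0 hp hpz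
  exact ⟨e, he, h⟩

variable {F : Type*} [Field F]

theorem inv_notMem_of_valuation_lt_one {O : ValuationSubring F} {x : F} (hx : x ≠ 0)
    (h : O.valuation x < 1) : x⁻¹ ∉ O := by
  rw [← O.valuation_le_one_iff, map_inv₀, inv_le_one₀ ((Valuation.pos_iff _).mpr hx)]
  exact h.not_ge

theorem exists_div_mem (O : ValuationSubring F) {s : Type*} [Finite s] {c : s → F} {i₀ : s}
    (hi₀ : c i₀ ≠ 0) : ∃ i, c i ≠ 0 ∧ ∀ j, c j / c i ∈ O := by
  have := Fintype.ofFinite s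
  obtain ⟨i, -, hmax⟩ := Finset.exists_max_image Finset.univ (fun j => O.valuation (c j))
    ⟨i₀, Finset.mem_univ _⟩
  have hci : c i ≠ 0 := by
    intro h0
    have := hmax i₀ (Finset.mem_univ _)
    rw [h0, map_zero, le_zero_iff, map_eq_zero] at this
    exact hi₀ this
  refine ⟨i, hci, fun j => ?_⟩
  rw [← O.valuation_le_one_iff, map_div₀]
  exact div_le_one_of_le₀ (hmax j (Finset.mem_univ _)) zero_le

/-- The valuation ring `O` is archimedean: it has rank at most one. -/
def IsArch (O : ValuationSubring F) : Prop :=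
  ∀ a z : F, O.valuation a < 1 → ∃ n : ℕ, O.valuation (a ^ n * z) ≤ 1

theorem IsArch.eventually {O : ValuationSubring F} (hO : IsArch O) {a : F}
    (ha : O.valuation a < 1) (z : F) {δ : F} (hδ : δ ≠ 0) :
    ∀ᶠ m : ℕ in Filter.atTop, O.valuation (a ^ m * z) < O.valuation δ := by
  obtain ⟨n, hn⟩ := hO a (z / δ) ha
  filter_upwards [Filter.eventually_ge_atTop (n + 1)] with m hm
  have hδ' : 0 < O.valuation δ := by simpa [zero_lt_iff] using hδ
  obtain ⟨l, rfl⟩ := Nat.exists_eq_add_of_le hm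
  have : a ^ (n + 1 + l) * z = a ^ n * (z / δ) * (a * a ^ l) * δ := by
    field_simp
    ring
  rw [this, map_mul]
  have h2 : O.valuation (a ^ n * (z / δ) * (a * a ^ l)) < 1 := by
    rw [map_mul, map_mul O.valuation a, map_pow O.valuation a l]
    exact mul_lt_one_of_nonneg_of_lt_one_right hn zero_le
      (mul_lt_one_of_nonneg_of_lt_one_left zero_le ha (pow_le_one' ha.le l))
  calc _ < 1 * O.valuation δ := by gcongr
    _ = _ := one_mul _

theorem isArch_of_pow_eq (O : ValuationSubring F) {t : F} (ht : t ≠ 0) (ht1 : O.valuation t < 1)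
    (h : ∀ z : F, z ≠ 0 → ∃ e : ℕ, 0 < e ∧ ∃ k : ℤ, O.valuation z ^ e = O.valuation t ^ k) :
    IsArch O := by
  intro a z ha
  rcases eq_or_ne a 0 with rfl | ha0
  · exact ⟨1, by simp⟩
  rcases eq_or_ne z 0 with rfl | hz0
  · exact ⟨1, by simp⟩
  obtain ⟨e, he, k, hk⟩ := h a ha0
  obtain ⟨e', he', k', hk'⟩ := h z hz0
  have hvt : 0 < O.valuation t := by simpa [zero_lt_iff] using ht
  have hk1 : 1 ≤ k := by
    by_contra hlt
    have h1 : O.valuation t ^ k < 1 := hk ▸ pow_lt_one₀ zero_le ha he.ne'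
    have h2 : 1 ≤ O.valuation t ^ k := one_le_zpow_of_nonpos₀ hvt ht1.le (by omega)
    exact absurd h1 (not_lt.mpr h2)
  refine ⟨k'.natAbs * e, ?_⟩
  have hle : O.valuation (a ^ (k'.natAbs * e) * z) ^ (e * e') ≤ 1 := by
    have : O.valuation (a ^ (k'.natAbs * e) * z) ^ (e * e') =
        O.valuation t ^ (k * (k'.natAbs * e * e' : ℕ) + k' * (e : ℕ)) := by
      rw [map_mul, map_pow, mul_pow, zpow_add₀ hvt.ne', zpow_mul, zpow_mul, ← hk, ← hk',
        zpow_natCast, zpow_natCast]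
      simp only [← pow_mul]
      congr 2 <;> ring
    rw [this]
    have hnn : 0 ≤ k * (k'.natAbs * e * e' : ℕ) + k' * (e : ℕ) := by
      have h1 : -k' ≤ (k'.natAbs : ℤ) := by omega
      have he1 : (1 : ℤ) ≤ e := by omega
      have he1' : (1 : ℤ) ≤ e' := by omega
      rw [Nat.cast_mul, Nat.cast_mul]
      have h3 : (k'.natAbs : ℤ) * e ≤ k * ((k'.natAbs : ℤ) * e * e') := by
        have h4 : 0 ≤ (k'.natAbs : ℤ) * e := by positivity
        have h5 : 1 ≤ k * e' := by nlinarith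
        nlinarith
      have h6 : -k' * e ≤ (k'.natAbs : ℤ) * e := by gcongr
      linarith
    obtain ⟨w, hw⟩ := Int.eq_ofNat_of_zero_le hnn
    rw [hw, zpow_natCast]
    exact pow_le_one' ht1.le w
  by_contra! hgt
  exact absurd hle (not_le.mpr (one_lt_pow₀ hgt (by positivity)))

theorem IsArch.eq_of_le {O O' : ValuationSubring F} (hO : IsArch O) (hle : O ≤ O') (hO' : O' ≠ ⊤) :
    O = O' := by
  by_contra hne
  obtain ⟨z, hz', hz⟩ : ∃ z ∈ O', z ∉ O := by
    by_contra! hcon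
    exact hne (le_antisymm hle hcon)
  obtain ⟨w, hw⟩ : ∃ w, w ∉ O' := by
    by_contra! hcon
    exact hO' (eq_top_iff.mpr fun w _ => hcon w)
  have hz0 : z ≠ 0 := by
    rintro rfl
    exact hz O.zero_mem
  have hlt : O.valuation z⁻¹ < 1 := by
    rw [← O.valuation_le_one_iff, not_le] at hz
    rw [map_inv₀]
    exact inv_lt_one_of_one_lt₀ hz
  obtain ⟨n, hn⟩ := hO z⁻¹ w hlt
  rw [O.valuation_le_one_iff] at hn
  apply hw
  have : w = z ^ n * (z⁻¹ ^ n * w) := by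
    rw [← mul_assoc, ← mul_pow, mul_inv_cancel₀ hz0, one_pow, one_mul]
  rw [this]
  exact O'.mul_mem _ _ (pow_mem hz' n) (hle hn)

theorem exists_valuation_gt_lt {O O' : ValuationSubring F} (h : ¬ O ≤ O') (h' : ¬ O' ≤ O) :
    ∃ z, 1 < O.valuation z ∧ O'.valuation z < 1 := by
  obtain ⟨a, ha, ha'⟩ := Set.not_subset.mp h
  obtain ⟨b, hb', hb⟩ := Set.not_subset.mp h'
  have ha1 : O.valuation a ≤ 1 := O.valuation_le_one_iff a |>.mpr ha
  have hb1 : O'.valuation b ≤ 1 := O'.valuation_le_one_iff b |>.mpr hb'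
  have ha2 : 1 < O'.valuation a := by
    rw [← not_le, O'.valuation_le_one_iff]; exact ha'
  have hb2 : 1 < O.valuation b := by
    rw [← not_le, O.valuation_le_one_iff]; exact hb
  have ha0 : a ≠ 0 := by rintro rfl; simp at ha2
  refine ⟨b / a, ?_, ?_⟩
  · rw [map_div₀, one_lt_div₀ (by simpa [zero_lt_iff] using ha0)]
    exact ha1.trans_lt hb2
  · rw [map_div₀, div_lt_one₀ (by simpa [zero_lt_iff] using ha0)]
    exact hb1.trans_lt ha2

theorem valuation_one_add_of_gt {Γ : Type*} [LinearOrderedCommGroupWithZero Γ] (v : Valuation F Γ)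
    {z : F} (hz : 1 < v z) : v (1 + z) = v z := by
  rw [add_comm]
  exact Valuation.map_add_eq_of_lt_left v (by simpa using hz)

theorem exists_gt_one_lt_one {ι : Type*} {O : ι → ValuationSubring F} (hO : ∀ i, IsArch (O i))
    (hne : ∀ i, O i ≠ ⊤) (hinj : Function.Injective O) (i : ι) (s : Finset ι) (hi : i ∉ s) :
    ∃ z, 1 < (O i).valuation z ∧ ∀ j ∈ s, (O j).valuation z < 1 := by
  classical
  induction s using Finset.induction_on with
  | empty =>
    obtain ⟨z, hz⟩ : ∃ z, z ∉ O i := by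
      by_contra! hcon
      exact hne i (eq_top_iff.mpr fun w _ => hcon w)
    exact ⟨z, by rw [← not_le, (O i).valuation_le_one_iff]; exact hz, by simp⟩
  | insert j s hj ih =>
    rw [Finset.mem_insert, not_or] at hi
    obtain ⟨z, hz, hzs⟩ := ih hi.2
    obtain ⟨w, hw, hwj⟩ := exists_valuation_gt_lt (O := O i) (O' := O j)
      (fun h => hi.1 (hinj ((hO i).eq_of_le h (hne j))))
      (fun h => hi.1 (hinj ((hO j).eq_of_le h (hne i))).symm)
    have hev : ∀ᶠ m : ℕ in Filter.atTop, ∀ l ∈ s, (O l).valuation (z ^ m * w) < 1 := by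
      rw [Filter.eventually_all_finset]
      intro l hl
      simpa using (hO l).eventually (hzs l hl) w one_ne_zero
    obtain ⟨M, hM, hM1⟩ := (hev.and (Filter.eventually_ge_atTop 1)).exists
    rcases le_or_gt ((O j).valuation z) 1 with hzj | hzj
    · refine ⟨z ^ M * w, ?_, ?_⟩
      · rw [map_mul, map_pow]
        exact one_lt_mul_of_le_of_lt (one_le_pow_of_one_le' hz.le M) hw
      · intro l hl
        rcases Finset.mem_insert.mp hl with rfl | hl
        · rw [map_mul, map_pow]
          exact mul_lt_one_of_nonneg_of_lt_one_right (pow_le_one' hzj M) zero_le hwj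
        · exact hM l hl
    · have hfac : ∀ l, 1 < (O l).valuation z → (O l).valuation (z ^ M * w / (1 + z ^ M)) =
          (O l).valuation w := by
        intro l hl
        have h1 : 1 < (O l).valuation (z ^ M) := by
          rw [map_pow]
          exact one_lt_pow₀ hl (by omega)
        rw [map_div₀, valuation_one_add_of_gt _ h1, map_mul, mul_div_cancel_left₀]
        exact (zero_lt_one.trans h1).ne'
      refine ⟨z ^ M * w / (1 + z ^ M), by rwa [hfac i hz], ?_⟩
      intro l hl
      rcases Finset.mem_insert.mp hl with rfl | hl
      · rwa [hfac _ hzj]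
      · have h1 : (O l).valuation (z ^ M) < 1 := by
          rw [map_pow]
          exact pow_lt_one₀ zero_le (hzs l hl) (by omega)
        rw [map_div₀, Valuation.map_one_add_of_lt _ h1, div_one]
        exact hM l hl

theorem exists_approx {ι : Type*} [Finite ι] {O : ι → ValuationSubring F} (hO : ∀ i, IsArch (O i))
    (hne : ∀ i, O i ≠ ⊤) (hinj : Function.Injective O) (a δ : ι → F) (hδ : ∀ i, δ i ≠ 0) :
    ∃ z, ∀ i, (O i).valuation (z - a i) < (O i).valuation (δ i) := by
  classical
  have := Fintype.ofFinite ι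
  have hone : ∀ i, ∃ e, (O i).valuation (a i * (e - 1)) < (O i).valuation (δ i) ∧
      ∀ j, j ≠ i → (O j).valuation (a i * e) < (O j).valuation (δ j) := by
    intro i
    obtain ⟨z, hz, hzs⟩ := exists_gt_one_lt_one hO hne hinj i (Finset.univ.erase i) (by simp)
    have hz' : (O i).valuation z⁻¹ < 1 := by
      rw [map_inv₀]
      exact inv_lt_one_of_one_lt₀ hz
    have hev : ∀ᶠ m : ℕ in Filter.atTop, ∀ j ∈ Finset.univ.erase i,
        (O j).valuation (z ^ m * a i) < (O j).valuation (δ j) := by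
      rw [Filter.eventually_all_finset]
      intro j hj
      exact (hO j).eventually (hzs j hj) (a i) (hδ j)
    obtain ⟨M, ⟨hM, hM1⟩, hMi⟩ := ((hev.and (Filter.eventually_ge_atTop 1)).and
      ((hO i).eventually hz' (a i) (hδ i))).exists
    have h1 : 1 < (O i).valuation (z ^ M) := by
      rw [map_pow]
      exact one_lt_pow₀ hz (by omega)
    have hz0 : z ≠ 0 := by rintro rfl; simp at hz
    have h10 : 1 + z ^ M ≠ 0 := by
      intro h
      have := valuation_one_add_of_gt _ h1
      rw [h, map_zero] at this
      rw [← this] at h1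
      simp at h1
    refine ⟨z ^ M / (1 + z ^ M), ?_, ?_⟩
    · have : a i * (z ^ M / (1 + z ^ M) - 1) = -(a i / (1 + z ^ M)) := by
        field_simp
        ring
      rw [this, Valuation.map_neg, map_div₀, valuation_one_add_of_gt _ h1, ← map_div₀]
      rwa [inv_pow, mul_comm, ← div_eq_mul_inv] at hMi
    · intro j hj
      have h2 : (O j).valuation (z ^ M) < 1 := by
        rw [map_pow]
        exact pow_lt_one₀ zero_le (hzs j (by simpa using hj)) (by omega)
      rw [mul_div_assoc', map_div₀, Valuation.map_one_add_of_lt _ h2, div_one, mul_comm]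
      exact hM j (by simpa using hj)
  choose e he hej using hone
  refine ⟨∑ i, a i * e i, fun i => ?_⟩
  have : ∑ j, a j * e j - a i = a i * (e i - 1) + ∑ j ∈ Finset.univ.erase i, a j * e j := by
    rw [← Finset.add_sum_erase _ _ (Finset.mem_univ i)]
    ring
  rw [this]
  refine Valuation.map_add_lt _ (he i) (Valuation.map_sum_lt _ (by simpa using hδ i) ?_)
  intro j hj
  exact hej j i (Finset.ne_of_mem_erase hj).symm

end ValuationBasics

section Gauss

open Polynomial IntermediateField IsLocalRing

variable (k F : Type*) [Field k] [Field F] [Algebra (LaurentSeries k) F]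

/-- The structure map from the power series ring to a field extension of the field of Laurent
series. -/
noncomputable def serHom : PowerSeries k →+* F :=
  (algebraMap (LaurentSeries k) F).comp (algebraMap (PowerSeries k) (LaurentSeries k))

/-- The structure map from the constants to a field extension of the field of Laurent series. -/
noncomputable def baseHom : k →+* F := (serHom k F).comp PowerSeries.C

theorem serHom_injective : Function.Injective (serHom k F) :=
  (algebraMap (LaurentSeries k) F).injective.comp
    (IsFractionRing.injective (PowerSeries k) (LaurentSeries k))

variable {k F}

theorem serHom_X_ne_zero : serHom k F PowerSeries.X ≠ 0 := by
  rw [map_ne_zero_iff _ (serHom_injective k F)]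
  exact PowerSeries.X_ne_zero

variable (k) in
/-- The valuation ring `O` contains the power series ring and its maximal ideal contains the
uniformizer. -/
def Center (O : ValuationSubring F) : Prop :=
  (∀ r, serHom k F r ∈ O) ∧ O.valuation (serHom k F PowerSeries.X) < 1

variable (k) in
/-- The residue of `x` modulo `O` is transcendental over the constants. -/
def GaussAt (O : ValuationSubring F) (x : F) : Prop :=
  ∀ p : k[X], p ≠ 0 → O.valuation (p.eval₂ (baseHom k F) x) = 1

theorem Center.ne_top {O : ValuationSubring F} (hO : Center k O) : O ≠ ⊤ := by
  rintro rfl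
  have h : (⊤ : ValuationSubring F).valuation (serHom k F PowerSeries.X)⁻¹ ≤ 1 :=
    (ValuationSubring.valuation_le_one_iff _ _).mpr trivial
  rw [map_inv₀] at h
  have h0 : 0 < (⊤ : ValuationSubring F).valuation (serHom k F PowerSeries.X) := by
    rw [zero_lt_iff, Valuation.ne_zero_iff]
    exact serHom_X_ne_zero
  exact absurd h (not_le.mpr ((one_lt_inv₀ h0).mpr hO.2))

theorem GaussAt.mem {O : ValuationSubring F} {x : F} (h : GaussAt k O x) : x ∈ O := by
  rw [← O.valuation_le_one_iff]
  simpa using (h X X_ne_zero).le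

theorem Center.eval₂_mem {O : ValuationSubring F} (hO : Center k O) {x : F} (hx : x ∈ O)
    (p : (PowerSeries k)[X]) : p.eval₂ (serHom k F) x ∈ O := by
  rw [eval₂_eq_sum_range]
  exact O.toSubring.sum_mem fun i _ => O.mul_mem _ _ (hO.1 _) (pow_mem hx i)

/-- Splitting off the constant coefficients of a polynomial over the power series ring. -/
theorem exists_eq_map_C_add (p : (PowerSeries k)[X]) :
    ∃ q : (PowerSeries k)[X], p =
      (p.map PowerSeries.constantCoeff).map PowerSeries.C + C PowerSeries.X * q := by
  have : C PowerSeries.X ∣ p - (p.map PowerSeries.constantCoeff).map PowerSeries.C := by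
    rw [C_dvd_iff_dvd_coeff]
    intro i
    simp [PowerSeries.X_dvd_iff]
  obtain ⟨q, hq⟩ := this
  exact ⟨q, by rw [← hq]; ring⟩

theorem eval₂_map_C (p : k[X]) (x : F) :
    (p.map PowerSeries.C).eval₂ (serHom k F) x = p.eval₂ (baseHom k F) x := by
  rw [eval₂_map]
  rfl

theorem GaussAt.valuation_eval₂ {O : ValuationSubring F} (hO : Center k O) {x : F}
    (h : GaussAt k O x) {p : (PowerSeries k)[X]} (hp : p.map PowerSeries.constantCoeff ≠ 0) :
    O.valuation (p.eval₂ (serHom k F) x) = 1 := by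
  obtain ⟨q, hq⟩ := exists_eq_map_C_add p
  rw [hq, eval₂_add, eval₂_map_C, eval₂_mul, eval₂_C, Valuation.map_add_eq_of_lt_left, h _ hp]
  rw [h _ hp, map_mul]
  exact mul_lt_one_of_nonneg_of_lt_one_left zero_le hO.2
    ((O.valuation_le_one_iff _).mpr (hO.eval₂_mem h.mem q))

theorem exists_eq_C_X_pow_mul {p : (PowerSeries k)[X]} (hp : p ≠ 0) :
    ∃ (e : ℕ) (q : (PowerSeries k)[X]), q.map PowerSeries.constantCoeff ≠ 0 ∧
      p = C PowerSeries.X ^ e * q := by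
  obtain ⟨e, q, hq, rfl⟩ := WfDvdMonoid.max_power_factor' hp
    (show ¬ IsUnit (C PowerSeries.X : (PowerSeries k)[X]) by
      rw [isUnit_C]
      exact PowerSeries.X_prime.not_isUnit)
  refine ⟨e, q, fun h => hq ?_, rfl⟩
  obtain ⟨q', hq'⟩ := exists_eq_map_C_add q
  rw [h] at hq'
  exact ⟨q', by simpa using hq'⟩

theorem exists_eval₂_div {x z : F} (hz : z ∈ (LaurentSeries k)⟮x⟯) :
    ∃ p q : (PowerSeries k)[X], z = p.eval₂ (serHom k F) x / q.eval₂ (serHom k F) x := by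
  have key : ∀ r : (LaurentSeries k)[X], ∃ (p : (PowerSeries k)[X]) (b : PowerSeries k), b ≠ 0 ∧
      aeval x r = p.eval₂ (serHom k F) x / serHom k F b := by
    intro r
    obtain ⟨b, hbm, hb⟩ := IsLocalization.integerNormalization_spec
      (nonZeroDivisors (PowerSeries k)) r
    have hb0 : b ≠ 0 := nonZeroDivisors.ne_zero hbm
    refine ⟨IsLocalization.integerNormalization (nonZeroDivisors (PowerSeries k)) r, b, hb0, ?_⟩
    rw [eq_div_iff ((map_ne_zero_iff _ (serHom_injective k F)).mpr hb0), serHom, ← eval₂_map, hb,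
      ← IsScalarTower.algebraMap_smul (LaurentSeries k) b r,
      eval₂_smul, aeval_def, mul_comm]
    rfl
  obtain ⟨r, s, rfl⟩ := IntermediateField.mem_adjoin_simple_iff _ _ |>.mp hz
  obtain ⟨p, b, hb, hp⟩ := key r
  obtain ⟨q, c, hc, hq⟩ := key s
  have hb' := (map_ne_zero_iff _ (serHom_injective k F)).mpr hb
  have hc' := (map_ne_zero_iff _ (serHom_injective k F)).mpr hc
  refine ⟨p * C c, q * C b, ?_⟩
  rw [hp, hq, eval₂_mul, eval₂_mul, eval₂_C, eval₂_C]
  field_simp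

theorem exists_zpow_mul_div {x z : F} (hz : z ∈ (LaurentSeries k)⟮x⟯) (hz0 : z ≠ 0) :
    ∃ (e : ℤ) (p q : (PowerSeries k)[X]), p.map PowerSeries.constantCoeff ≠ 0 ∧
      q.map PowerSeries.constantCoeff ≠ 0 ∧
      z = serHom k F PowerSeries.X ^ e * (p.eval₂ (serHom k F) x / q.eval₂ (serHom k F) x) := by
  obtain ⟨p, q, rfl⟩ := exists_eval₂_div hz
  have hp : p ≠ 0 := by
    rintro rfl
    simp at hz0
  have hq : q ≠ 0 := by
    rintro rfl
    simp at hz0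
  obtain ⟨a, p', hp', rfl⟩ := exists_eq_C_X_pow_mul hp
  obtain ⟨b, q', hq', rfl⟩ := exists_eq_C_X_pow_mul hq
  refine ⟨a - b, p', q', hp', hq', ?_⟩
  have ht := serHom_X_ne_zero (k := k) (F := F)
  rw [eval₂_mul, eval₂_mul, eval₂_pow, eval₂_pow, eval₂_C, zpow_sub₀ ht, zpow_natCast, zpow_natCast,
    mul_div_mul_comm]

theorem Center.zpow_le_one_iff {O : ValuationSubring F} (hO : Center k O) (e : ℤ) :
    O.valuation (serHom k F PowerSeries.X) ^ e ≤ 1 ↔ 0 ≤ e := by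
  have h0 : 0 < O.valuation (serHom k F PowerSeries.X) := by
    rw [zero_lt_iff, Valuation.ne_zero_iff]
    exact serHom_X_ne_zero
  rw [← zpow_zero (O.valuation (serHom k F PowerSeries.X)), zpow_le_zpow_iff_right_of_lt_one₀ h0 hO.2]

theorem GaussAt.mem_of_mem {O O' : ValuationSubring F} (hO : Center k O) (hO' : Center k O') {x : F}
    (h : GaussAt k O x) (h' : GaussAt k O' x) {z : F} (hz : z ∈ (LaurentSeries k)⟮x⟯)
    (hzO : z ∈ O) : z ∈ O' := by
  rcases eq_or_ne z 0 with rfl | hz0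
  · exact O'.zero_mem
  obtain ⟨e, p, q, hp, hq, rfl⟩ := exists_zpow_mul_div hz hz0
  rw [← ValuationSubring.valuation_le_one_iff, map_mul, map_div₀, map_zpow₀] at hzO ⊢
  rw [h.valuation_eval₂ hO hp, h.valuation_eval₂ hO hq, div_one, mul_one,
    hO.zpow_le_one_iff] at hzO
  rwa [h'.valuation_eval₂ hO' hp, h'.valuation_eval₂ hO' hq, div_one, mul_one,
    hO'.zpow_le_one_iff]

theorem GaussAt.exists_pow_eq {O : ValuationSubring F} (hO : Center k O) {x : F}
    (h : GaussAt k O x) [FiniteDimensional (LaurentSeries k)⟮x⟯ F] :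
    ∃ e : ℕ, 0 < e ∧ ∀ z : F, z ≠ 0 →
      ∃ a : ℤ, O.valuation z ^ e = O.valuation (serHom k F PowerSeries.X) ^ a := by
  refine ⟨_, Nat.factorial_pos (Module.finrank (LaurentSeries k)⟮x⟯ F), fun z hz => ?_⟩
  have hint := Algebra.IsIntegral.isIntegral (R := (LaurentSeries k)⟮x⟯) z
  obtain ⟨e, he, hle, c, hc, hec⟩ := exists_valuation_pow_eq_of_aeval O.valuation hz
    (minpoly.ne_zero hint) (minpoly.aeval _ z)
  obtain ⟨a, p, q, hp, hq, hcz⟩ := exists_zpow_mul_div c.2 (by simpa using hc)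
  obtain ⟨f, hf⟩ := Nat.dvd_factorial he (hle.trans (minpoly.natDegree_le z))
  refine ⟨a * f, ?_⟩
  rw [hf, pow_mul, zpow_mul, zpow_natCast]
  congr 1
  rw [hec, IntermediateField.algebraMap_apply, hcz, map_mul, map_div₀, h.valuation_eval₂ hO hp,
    h.valuation_eval₂ hO hq, div_one, mul_one, map_zpow₀]

theorem GaussAt.isArch {O : ValuationSubring F} (hO : Center k O) {x : F}
    (h : GaussAt k O x) [FiniteDimensional (LaurentSeries k)⟮x⟯ F] : IsArch O := by
  obtain ⟨e, he, h⟩ := h.exists_pow_eq hO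
  exact isArch_of_pow_eq O serHom_X_ne_zero hO.2 fun z hz => ⟨e, he, h z hz⟩

theorem finite_setOf_gaussAt (x : F) [FiniteDimensional (LaurentSeries k)⟮x⟯ F] :
    {O : ValuationSubring F | Center k O ∧ GaussAt k O x}.Finite := by
  classical
  by_contra hinf
  obtain ⟨s, hs, hcard⟩ := Set.Infinite.exists_subset_card_eq hinf
    (Module.finrank (LaurentSeries k)⟮x⟯ F + 1)
  have hC : ∀ i : s, Center k i.1 := fun i => (hs i.2).1
  have hG : ∀ i : s, GaussAt k i.1 x := fun i => (hs i.2).2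
  choose z hz using fun i : s => exists_approx (O := fun j : s => j.1)
    (fun j => (hG j).isArch (hC j)) (fun j => (hC j).ne_top) Subtype.val_injective
    (Pi.single i 1) 1 (by simp)
  have hzi (i : s) : i.1.valuation (z i) = 1 := by
    have h1 := hz i i
    simp only [Pi.single_eq_same, Pi.one_apply, map_one] at h1
    have := Valuation.map_one_add_of_lt _ h1
    rwa [add_sub_cancel] at this
  have hzj : ∀ i j : s, j ≠ i → j.1.valuation (z i) < 1 := by
    intro i j hji
    simpa [hji] using hz i j
  have hli : LinearIndependent (LaurentSeries k)⟮x⟯ z := by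
    rw [Fintype.linearIndependent_iff]
    by_contra! hcon
    obtain ⟨c, hc, i₀, hi₀⟩ := hcon
    obtain ⟨i, hci, hmax⟩ := exists_div_mem i₀.1 (c := fun j => (c j : F))
      (i₀ := i₀) (by simpa using hi₀)
    have hmem (j l : s) : (c j / c i : F) ∈ l.1 :=
      (hG i₀).mem_of_mem (hC i₀) (hC l) (hG l)
        ((LaurentSeries k)⟮x⟯.div_mem (c j).2 (c i).2) (hmax j)
    have hsum : z i = -∑ j ∈ Finset.univ.erase i, (c j / c i : F) * z j := by
      rw [← Finset.add_sum_erase _ _ (Finset.mem_univ i)] at hc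
      simp only [Algebra.smul_def, IntermediateField.algebraMap_apply] at hc
      rw [eq_neg_iff_add_eq_zero]
      have h3 : (c i : F) * (z i + ∑ j ∈ Finset.univ.erase i, (c j / c i : F) * z j) = 0 := by
        rw [mul_add, Finset.mul_sum, ← hc]
        congr 1
        refine Finset.sum_congr rfl fun j _ => ?_
        field_simp
      exact (mul_eq_zero.mp h3).resolve_left hci
    have hlt : i.1.valuation (z i) < 1 := by
      rw [hsum, Valuation.map_neg]
      refine Valuation.map_sum_lt _ one_ne_zero fun j hj => ?_
      rw [map_mul]
      exact mul_lt_one_of_nonneg_of_lt_one_right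
        ((ValuationSubring.valuation_le_one_iff _ _).mpr (hmem j i)) zero_le
        (hzj j i (Finset.ne_of_mem_erase hj).symm)
    exact absurd (hzi i) hlt.ne
  have := hli.fintype_card_le_finrank
  rw [Fintype.card_coe, hcard] at this
  omega

/-- The structure map from the power series ring to a valuation ring. -/
noncomputable def Center.toRing {O : ValuationSubring F} (hO : Center k O) : PowerSeries k →+* O :=
  (serHom k F).codRestrict O.toSubring hO.1

/-- The map from the constants to the residue field. -/
noncomputable def Center.residueHom {O : ValuationSubring F} (hO : Center k O) :
    k →+* ResidueField O :=
  ((residue O).comp hO.toRing).comp PowerSeries.C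

theorem residue_eq_zero_iff {O : ValuationSubring F} (w : O) :
    residue O w = 0 ↔ O.valuation (w : F) < 1 := by
  rw [IsLocalRing.residue_eq_zero_iff, ValuationSubring.valuation_lt_one_iff]

theorem Center.residue_toRing {O : ValuationSubring F} (hO : Center k O) (r : PowerSeries k) :
    residue O (hO.toRing r) = hO.residueHom (PowerSeries.constantCoeff r) := by
  have h := PowerSeries.sub_const_eq_X_mul_shift r
  change _ = residue O (hO.toRing (PowerSeries.C (PowerSeries.constantCoeff r)))
  rw [← sub_eq_zero, ← map_sub, ← map_sub, h, map_mul, map_mul,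
    (residue_eq_zero_iff (hO.toRing PowerSeries.X)).mpr hO.2, zero_mul]

theorem Center.coe_eval₂ {O : ValuationSubring F} (hO : Center k O) (x : O)
    (p : (PowerSeries k)[X]) :
    ((p.eval₂ hO.toRing x : O) : F) = p.eval₂ (serHom k F) x :=
  hom_eval₂ p hO.toRing O.subtype x

theorem Center.residue_eval₂ {O : ValuationSubring F} (hO : Center k O) (x : O)
    (p : (PowerSeries k)[X]) :
    residue O (p.eval₂ hO.toRing x) =
      (p.map PowerSeries.constantCoeff).eval₂ hO.residueHom (residue O x) := by
  rw [hom_eval₂, eval₂_map]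
  congr 1
  exact RingHom.ext hO.residue_toRing

theorem Center.residue_eval₂_base {O : ValuationSubring F} (hO : Center k O) (x : O)
    (p : k[X]) :
    p.eval₂ hO.residueHom (residue O x) = 0 ↔
      O.valuation (p.eval₂ (baseHom k F) (x : F)) < 1 := by
  rw [← eval₂_map_C, ← hO.coe_eval₂, ← residue_eq_zero_iff, hO.residue_eval₂, Polynomial.map_map]
  have : (PowerSeries.constantCoeff (R := k)).comp PowerSeries.C = RingHom.id k :=
    RingHom.ext fun a => PowerSeries.constantCoeff_C a
  rw [this, Polynomial.map_id]

theorem GaussAt.isFunctionFieldOneVar {O : ValuationSubring F} (hO : Center k O) {x : F}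
    (h : GaussAt k O x) [FiniteDimensional (LaurentSeries k)⟮x⟯ F] :
    letI := hO.residueHom.toAlgebra
    IsFunctionFieldOneVar k (ResidueField O) := by
  classical
  let := hO.residueHom.toAlgebra
  let x' : O := ⟨x, h.mem⟩
  let xb : ResidueField O := residue O x'
  refine ⟨xb, ?_, ?_⟩
  · rw [transcendental_iff]
    intro p hp
    by_contra hp0
    exact ((hO.residue_eval₂_base x' p).mp hp).ne (h p hp0)
  have hresmem : ∀ c : O, (c : F) ∈ (LaurentSeries k)⟮x⟯ → residue O c ∈ k⟮xb⟯ := by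
    intro c hc
    rcases eq_or_ne (c : F) 0 with hc0 | hc0
    · have : c = 0 := Subtype.ext hc0
      rw [this, map_zero]
      exact zero_mem _
    obtain ⟨e, p, q, hp, hq, hcz⟩ := exists_zpow_mul_div hc hc0
    have hvc : O.valuation (c : F) = O.valuation (serHom k F PowerSeries.X) ^ e := by
      rw [hcz, map_mul, map_div₀, h.valuation_eval₂ hO hp, h.valuation_eval₂ hO hq, div_one,
        mul_one, map_zpow₀]
    have hle := O.valuation_le_one c
    rw [hvc, hO.zpow_le_one_iff] at hle
    rcases hle.lt_or_eq with hlt | rfl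
    · have : residue O c = 0 := by
        rw [residue_eq_zero_iff, hvc]
        obtain ⟨a, ha⟩ := Int.eq_ofNat_of_zero_le hle
        rw [ha, zpow_natCast]
        exact pow_lt_one₀ zero_le hO.2 (by omega)
      rw [this]
      exact zero_mem _
    · have hq1 := h.valuation_eval₂ hO hq
      have hmul : c * q.eval₂ hO.toRing x' = p.eval₂ hO.toRing x' := by
        apply Subtype.ext
        rw [MulMemClass.coe_mul, hO.coe_eval₂, hO.coe_eval₂, hcz, zpow_zero, one_mul,
          div_mul_cancel₀]
        intro h0
        rw [h0, map_zero] at hq1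
        exact zero_ne_one hq1
      have hq0 : (q.map PowerSeries.constantCoeff).eval₂ hO.residueHom xb ≠ 0 := by
        rw [← hO.residue_eval₂, Ne, residue_eq_zero_iff, hO.coe_eval₂]
        exact fun hlt => hlt.ne hq1
      have := congrArg (residue O) hmul
      rw [map_mul, hO.residue_eval₂, hO.residue_eval₂] at this
      rw [eq_div_of_mul_eq hq0 this]
      have hmem : ∀ p : k[X], p.eval₂ hO.residueHom xb ∈ k⟮xb⟯ := fun p =>
        IntermediateField.algebra_adjoin_le_adjoin _ _ (aeval_mem_adjoin_singleton k xb (p := p))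
      exact div_mem (hmem _) (hmem _)
  obtain ⟨w, hw⟩ := (residue_surjective (R := O)).hasRightInverse
  have hrank : Module.rank k⟮xb⟯ (ResidueField O) ≤
      (Module.finrank (LaurentSeries k)⟮x⟯ F : ℕ) := by
    refine rank_le fun s hs => ?_
    have hli : LinearIndependent (LaurentSeries k)⟮x⟯ fun i : s => (w i : F) := by
      rw [Fintype.linearIndependent_iff]
      by_contra! hcon
      obtain ⟨c, hc, i₀, hi₀⟩ := hcon
      obtain ⟨i, hci, hmem⟩ := exists_div_mem O (c := fun j => (c j : F)) (i₀ := i₀)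
        (by simpa using hi₀)
      have hsum : ∑ j : s, (⟨_, hmem j⟩ : O) * w j = 0 := by
        apply Subtype.ext
        have h3 : ∑ j : s, (c j / c i : F) * w j = 0 := by
          rw [← mul_right_inj' hci, mul_zero, Finset.mul_sum, ← hc]
          refine Finset.sum_congr rfl fun j _ => ?_
          rw [Algebra.smul_def, IntermediateField.algebraMap_apply]
          field_simp
        exact (map_sum O.subtype _ _).trans h3
      have hsum' := congrArg (residue O) hsum
      rw [map_zero, map_sum] at hsum'
      have := Fintype.linearIndependent_iff.mp hs
        (fun j => ⟨_, hresmem ⟨_, hmem j⟩ ((LaurentSeries k)⟮x⟯.div_mem (c j).2 (c i).2)⟩) (by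
          rw [← hsum']
          refine Finset.sum_congr rfl fun j _ => ?_
          rw [map_mul, hw, Algebra.smul_def, IntermediateField.algebraMap_apply]) i
      have h1 : (⟨_, hmem i⟩ : O) = 1 := Subtype.ext (div_self hci)
      rw [Subtype.ext_iff] at this
      simp only [h1, map_one] at this
      exact one_ne_zero this
    simpa using hli.fintype_card_le_finrank
  exact Module.rank_lt_aleph0_iff.mp (hrank.trans_lt Cardinal.natCast_lt_aleph0)

end Gauss

section FunctionFields

open IntermediateField

variable {K F : Type*} [Field K] [Field F] [Algebra K F]

theorem finiteDimensional_adjoin_of_transcendental {x y : F} (hx : Transcendental K x)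
    [FiniteDimensional K⟮x⟯ F] (hy : Transcendental K y) : FiniteDimensional K⟮y⟯ F := by
  have hxy : IsAlgebraic K⟮y⟯ x := isAlgebraic_adjoin_iff.mpr (.adjoin_singleton hx hy
    (isAlgebraic_adjoin_iff.mp (Algebra.IsAlgebraic.isAlgebraic y)))
  have hfin : FiniteDimensional K⟮y⟯ K⟮y⟯⟮x⟯ := adjoin.finiteDimensional hxy.isIntegral
  let f : K⟮x⟯ →+* K⟮y⟯⟮x⟯ :=
    (inclusion (F := K⟮y⟯⟮x⟯.restrictScalars K) (adjoin_simple_le_iff.mpr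
      (mem_adjoin_simple_self K⟮y⟯ x))).toRingHom
  let : Algebra K⟮x⟯ K⟮y⟯⟮x⟯ := f.toAlgebra
  have : IsScalarTower K⟮x⟯ K⟮y⟯⟮x⟯ F := .of_algebraMap_eq fun _ => rfl
  have : FiniteDimensional K⟮y⟯⟮x⟯ F := .right K⟮x⟯ K⟮y⟯⟮x⟯ F
  exact .trans K⟮y⟯ K⟮y⟯⟮x⟯ F

theorem trdeg_eq_one {x : F} (hx : Transcendental K x) [FiniteDimensional K⟮x⟯ F] :
    Algebra.trdeg K F = 1 := by
  have hind : AlgebraicIndependent K (fun _ : Unit => x) :=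
    algebraicIndependent_unique_type_iff.mpr hx
  have halg : Algebra.IsAlgebraic (Algebra.adjoin K (Set.range fun _ : Unit => x)) F := by
    rw [Set.range_const]
    exact ⟨fun z => isAlgebraic_adjoin_iff.mp (Algebra.IsAlgebraic.isAlgebraic z)⟩
  have := (hind.isTranscendenceBasis_iff_isAlgebraic.mpr halg).lift_cardinalMk_eq_trdeg
  simpa using this.symm

end FunctionFields

section GenericParameters

open IntermediateField MvPolynomial

variable {k F : Type*} [Field k] [Field F] [Algebra (LaurentSeries k) F]

theorem exists_mvPolynomial_relation {x₀ : F} (hx₀ : Transcendental (LaurentSeries k) x₀)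
    [FiniteDimensional (LaurentSeries k)⟮x₀⟯ F] (x y : F) :
    ∃ P : MvPolynomial (Fin 2) (PowerSeries k), P.map PowerSeries.constantCoeff ≠ 0 ∧
      P.eval₂ (serHom k F) ![x, y] = 0 := by
  let : Algebra (PowerSeries k) F := (serHom k F).toAlgebra
  have : IsScalarTower (PowerSeries k) (LaurentSeries k) F := .of_algebraMap_eq fun _ => rfl
  have hF : Algebra.trdeg (PowerSeries k) F = 1 := by
    have h := lift_trdeg_add_eq (PowerSeries k) (LaurentSeries k) F
    have : Algebra.IsAlgebraic (PowerSeries k) (LaurentSeries k) :=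
      IsLocalization.isAlgebraic _ (nonZeroDivisors (PowerSeries k))
    rw [trdeg_eq_zero_iff.mpr this, trdeg_eq_one hx₀] at h
    simpa using h.symm
  have hdep : ¬ AlgebraicIndependent (PowerSeries k) ![x, y] := by
    intro h
    have := h.lift_cardinalMk_le_trdeg
    rw [hF] at this
    simp at this
  rw [algebraicIndependent_iff] at hdep
  push Not at hdep
  obtain ⟨P, hP, hP0⟩ := hdep
  obtain ⟨e, Q, hQ, rfl⟩ := WfDvdMonoid.max_power_factor' hP0
    (show ¬ IsUnit (C PowerSeries.X : MvPolynomial (Fin 2) (PowerSeries k)) by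
      intro h
      have := h.map constantCoeff
      rw [constantCoeff_C] at this
      exact PowerSeries.X_prime.not_isUnit this)
  refine ⟨Q, fun h => hQ ?_, ?_⟩
  · rw [C_dvd_iff_dvd_coeff]
    intro i
    rw [PowerSeries.X_dvd_iff, ← coeff_map, h, coeff_zero]
  · rw [map_mul, map_pow, mul_eq_zero, aeval_C] at hP
    exact hP.resolve_left (pow_ne_zero _ serHom_X_ne_zero)

theorem exists_eval_ne_zero_of_fintype [Infinite k] {σ κ : Type*} [Finite κ]
    (P : κ → MvPolynomial σ k) (hP : ∀ i, P i ≠ 0) : ∃ a : σ → k, ∀ i, eval a (P i) ≠ 0 := by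
  classical
  have := Fintype.ofFinite κ
  by_contra! hcon
  have h0 : ∏ i, P i = 0 := by
    apply MvPolynomial.funext
    intro a
    obtain ⟨i, hi⟩ := hcon a
    rw [map_prod, map_zero, Finset.prod_eq_zero (Finset.mem_univ i) hi]
  exact Finset.prod_ne_zero_iff.mpr (fun i _ => hP i) h0

theorem Center.baseHom_valuation {O : ValuationSubring F} (hO : Center k O) {a : k} (ha : a ≠ 0) :
    O.valuation (baseHom k F a) = 1 := by
  have h : ∀ a, O.valuation (baseHom k F a) ≤ 1 := fun a => (O.valuation_le_one_iff _).mpr (hO.1 _)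
  refine le_antisymm (h a) ?_
  have h2 := h a⁻¹
  rw [map_inv₀, map_inv₀] at h2
  exact (inv_le_one₀ (by
    rw [zero_lt_iff, Valuation.ne_zero_iff]; exact (_root_.map_ne_zero _).mpr ha)).mp h2

/-- Relations between elements of `F` specialize at valuation rings with prescribed residues. -/
theorem Center.eval_eq_zero_of_relation {O : ValuationSubring F} (hO : Center k O) {x y : F}
    {P : MvPolynomial (Fin 2) (PowerSeries k)} (hP : P.eval₂ (serHom k F) ![x, y] = 0) {b d : k}
    (hx : O.valuation (x - baseHom k F b) < 1) (hy : O.valuation (y - baseHom k F d) < 1) :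
    eval ![b, d] (P.map PowerSeries.constantCoeff) = 0 := by
  have hmem : ∀ {x : F} {b : k}, O.valuation (x - baseHom k F b) < 1 → x ∈ O := by
    intro x b h
    have := O.add_mem _ _ ((O.valuation_le_one_iff _).mp h.le) (hO.1 (PowerSeries.C b))
    rwa [show x - baseHom k F b + serHom k F (PowerSeries.C b) = x from sub_add_cancel _ _] at this
  have hres : ∀ {x : F} {b : k} (h : O.valuation (x - baseHom k F b) < 1),
      IsLocalRing.residue O ⟨x, hmem h⟩ = hO.residueHom b := by
    intro x b h
    rw [← sub_eq_zero]
    exact (map_sub (IsLocalRing.residue O) _ _).symm.trans ((residue_eq_zero_iff _).mpr h)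
  have h1 : P.eval₂ hO.toRing ![⟨x, hmem hx⟩, ⟨y, hmem hy⟩] = 0 := by
    apply Subtype.ext
    change O.subtype _ = 0
    rw [MvPolynomial.hom_eval₂, ← hP]
    congr 1
    funext i
    fin_cases i <;> rfl
  have h2 := congrArg (IsLocalRing.residue O) h1
  rw [map_zero, MvPolynomial.hom_eval₂] at h2
  have h3 : hO.residueHom (eval ![b, d] (P.map PowerSeries.constantCoeff)) = 0 := by
    rw [← h2, eval_map, MvPolynomial.hom_eval₂]
    congr 1
    · exact RingHom.ext fun r => (hO.residue_toRing r).symm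
    · funext i
      fin_cases i
      · exact (hres hx).symm
      · exact (hres hy).symm
  exact (map_eq_zero _).mp h3

theorem one_lt_valuation_prod {K ι : Type*} [Field K] (O : ValuationSubring K)
    {s : Finset ι} {f : ι → K} (h : ∀ i ∈ s, 1 ≤ O.valuation (f i)) {j : ι} (hj : j ∈ s)
    (hfj : 1 < O.valuation (f j)) : 1 < O.valuation (∏ i ∈ s, f i) := by
  classical
  rw [← Finset.mul_prod_erase s f hj, map_mul, map_prod]
  refine lt_of_lt_of_le hfj ?_
  have h1 : 1 ≤ ∏ i ∈ s.erase j, O.valuation (f i) :=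
    Finset.one_le_prod' fun i hi => h i (Finset.mem_of_mem_erase hi)
  exact le_mul_of_one_le_right' h1

/-- A product of linear fractional transformations of given elements, with generic parameters, is
integral only where all the factors are. -/
theorem exists_generic_parameters [CharZero k] {x₀ : F}
    (hx₀ : Transcendental (LaurentSeries k) x₀)
    [FiniteDimensional (LaurentSeries k)⟮x₀⟯ F] {ι : Type*} [Fintype ι] (ε : ι → F) :
    ∃ b d : ι → k, (∀ j, b j ≠ d j ∧ ε j ≠ baseHom k F (b j) ∧ ε j ≠ baseHom k F (d j)) ∧
      ∀ e : ι → ℕ, (∀ j, e j ≠ 0) → ∀ O, Center k O →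
        (∏ j, ((ε j - baseHom k F (b j)) / (ε j - baseHom k F (d j))) ^ e j ∈ O →
          ∀ j, (ε j - baseHom k F (b j)) / (ε j - baseHom k F (d j)) ∈ O) ∧
        ((∏ j, ((ε j - baseHom k F (b j)) / (ε j - baseHom k F (d j))) ^ e j)⁻¹ ∈ O →
          ∀ j, (ε j - baseHom k F (d j)) / (ε j - baseHom k F (b j)) ∈ O) := by
  classical
  choose P hP hPe using fun i j => exists_mvPolynomial_relation hx₀ (ε i) (ε j)
  let B : ι → MvPolynomial (ι ⊕ ι) k := fun j =>
    if h : ∃ c, baseHom k F c = ε j then X (Sum.inl j) - C h.choose else 1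
  let D : ι → MvPolynomial (ι ⊕ ι) k := fun j =>
    if h : ∃ c, baseHom k F c = ε j then X (Sum.inr j) - C h.choose else 1
  have hXC : ∀ (s : ι ⊕ ι) (c : k), (X s - C c : MvPolynomial (ι ⊕ ι) k) ≠ 0 := by
    intro s c h
    have := congrArg (eval fun _ => c + 1) h
    simp at this
  have hXX : ∀ j : ι, (X (Sum.inl j) - X (Sum.inr j) : MvPolynomial (ι ⊕ ι) k) ≠ 0 := by
    intro j h
    have := congrArg (eval (Sum.elim 1 0)) h
    simp at this
  let Q : ι × ι → MvPolynomial (ι ⊕ ι) k := fun s =>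
    (if s.1 = s.2 then X (Sum.inl s.2) - X (Sum.inr s.2) else
      rename ![Sum.inl s.1, Sum.inr s.2] ((P s.1 s.2).map PowerSeries.constantCoeff)) *
    (B s.2 * D s.2)
  have hQ (s) : Q s ≠ 0 := by
    refine mul_ne_zero ?_ (mul_ne_zero ?_ ?_)
    · split_ifs
      · exact hXX _
      · rw [Ne, map_eq_zero_iff _ (rename_injective _ _)]
        · exact hP _ _
        · intro a b hab
          fin_cases a <;> fin_cases b <;> simp_all
    · simp only [B]
      split_ifs
      · exact hXC _ _
      · exact one_ne_zero
    · simp only [D]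
      split_ifs
      · exact hXC _ _
      · exact one_ne_zero
  obtain ⟨a, ha⟩ := exists_eval_ne_zero_of_fintype Q hQ
  set b : ι → k := fun j => a (Sum.inl j) with hb
  set d : ι → k := fun j => a (Sum.inr j) with hd
  have hεb : ∀ j, ε j ≠ baseHom k F (b j) := by
    intro j hj
    have hex : ∃ c, baseHom k F c = ε j := ⟨_, hj.symm⟩
    have h := ha (j, j)
    simp only [Q, map_mul] at h
    have h1 := left_ne_zero_of_mul (right_ne_zero_of_mul h)
    have hc : hex.choose = b j := (baseHom k F).injective (hex.choose_spec.trans hj)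
    simp only [B, dif_pos hex, hc] at h1
    simp [b] at h1
  have hεd : ∀ j, ε j ≠ baseHom k F (d j) := by
    intro j hj
    have hex : ∃ c, baseHom k F c = ε j := ⟨_, hj.symm⟩
    have h := ha (j, j)
    simp only [Q, map_mul] at h
    have h1 := right_ne_zero_of_mul (right_ne_zero_of_mul h)
    have hc : hex.choose = d j := (baseHom k F).injective (hex.choose_spec.trans hj)
    simp only [D, dif_pos hex, hc] at h1
    simp [d] at h1
  have hbd : ∀ j, b j ≠ d j := by
    intro j hj
    have h := left_ne_zero_of_mul ((map_mul (eval a) _ _) ▸ ha (j, j))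
    simp only [if_true, map_sub, eval_X] at h
    exact h (sub_eq_zero.mpr hj)
  have hPij : ∀ i j, i ≠ j → eval ![b i, d j] ((P i j).map PowerSeries.constantCoeff) ≠ 0 := by
    intro i j hij
    have h := left_ne_zero_of_mul ((map_mul (eval a) _ _) ▸ ha (i, j))
    simp only [if_neg hij, eval_rename] at h
    have hfun : (![b i, d j] : Fin 2 → k) = a ∘ ![Sum.inl i, Sum.inr j] := by
      funext s
      fin_cases s <;> rfl
    rwa [hfun]
  refine ⟨b, d, fun j => ⟨hbd j, hεb j, hεd j⟩, ?_⟩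
  intro e he O hO
  -- an element with a zero or pole of the linear fractional transformation has a known residue
  have hzero : ∀ {x : F} {b d : k}, b ≠ d → x ≠ baseHom k F d →
      O.valuation ((x - baseHom k F b) / (x - baseHom k F d)) < 1 →
      O.valuation (x - baseHom k F b) < 1 := by
    intro x b d hbd hxd hu
    set u := (x - baseHom k F b) / (x - baseHom k F d) with hudef
    have hxd' : x - baseHom k F d ≠ 0 := sub_ne_zero.mpr hxd
    have hu1 : O.valuation (1 - u) = 1 := by
      rw [sub_eq_add_neg]
      exact Valuation.map_one_add_of_lt _ (by rwa [Valuation.map_neg])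
    have hu1' : 1 - u ≠ 0 := by
      intro h0
      rw [h0, map_zero] at hu1
      exact zero_ne_one hu1
    have : x - baseHom k F b = u * baseHom k F (b - d) / (1 - u) := by
      rw [eq_div_iff hu1', hudef, map_sub]
      field_simp
      ring
    rw [this, map_div₀, hu1, div_one, map_mul, hO.baseHom_valuation (sub_ne_zero.mpr hbd), mul_one]
    exact hu
  have hcross : ∀ i j, O.valuation ((ε i - baseHom k F (b i)) / (ε i - baseHom k F (d i))) < 1 →
      1 < O.valuation ((ε j - baseHom k F (b j)) / (ε j - baseHom k F (d j))) → False := by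
    intro i j hi hj
    have hij : i ≠ j := by
      rintro rfl
      exact lt_asymm hi hj
    have h1 := hzero (hbd i) (hεd i) hi
    have h2 := hzero (hbd j).symm (hεb j) (by
      rw [← inv_div, map_inv₀]
      exact inv_lt_one_of_one_lt₀ hj)
    exact hPij i j hij (hO.eval_eq_zero_of_relation (hPe i j) h1 h2)
  constructor
  · intro hx j
    by_contra hj
    rw [← O.valuation_le_one_iff, not_le] at hj
    rw [← O.valuation_le_one_iff] at hx
    refine (one_lt_valuation_prod O (fun i _ => ?_) (Finset.mem_univ j) ?_).not_ge hx
    · rw [map_pow]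
      exact one_le_pow_of_one_le' (not_lt.mp fun hi => hcross i j hi hj) _
    · rw [map_pow]
      exact one_lt_pow₀ hj (he j)
  · intro hx j
    by_contra hj
    rw [← O.valuation_le_one_iff, not_le] at hj
    have hj' : O.valuation ((ε j - baseHom k F (b j)) / (ε j - baseHom k F (d j))) < 1 := by
      rw [← inv_div, map_inv₀]
      exact inv_lt_one_of_one_lt₀ hj
    rw [← O.valuation_le_one_iff, ← Finset.prod_inv_distrib] at hx
    refine (one_lt_valuation_prod O (fun i _ => ?_) (Finset.mem_univ j) ?_).not_ge hx
    · rw [← inv_pow, map_pow]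
      refine one_le_pow_of_one_le' ?_ _
      rw [map_inv₀]
      have hi : O.valuation ((ε i - baseHom k F (b i)) / (ε i - baseHom k F (d i))) ≤ 1 :=
        not_lt.mp fun hi => hcross j i hj' hi
      refine (one_le_inv₀ ?_).mpr hi
      rw [zero_lt_iff, Valuation.ne_zero_iff]
      exact div_ne_zero (sub_ne_zero.mpr (hεb i)) (sub_ne_zero.mpr (hεd i))
    · rw [← inv_pow, map_pow, inv_div]
      exact one_lt_pow₀ hj (he j)

end GenericParameters

section LocalConditions

open IntermediateField Polynomial

variable {k F : Type*} [Field k] [Field F] [Algebra (LaurentSeries k) F]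

theorem exists_finset_mem_closure {A : Type*} [CommRing A] {S : Set A} {x : A}
    (hx : x ∈ Subring.closure S) : ∃ T : Finset A, ↑T ⊆ S ∧ x ∈ Subring.closure (T : Set A) := by
  classical
  have mono : ∀ {T U : Finset A} {x}, T ⊆ U → x ∈ Subring.closure (T : Set A) →
      x ∈ Subring.closure (U : Set A) := fun h hx =>
    Subring.closure_mono (Finset.coe_subset.mpr h) hx
  induction hx using Subring.closure_induction with
  | mem x hx => exact ⟨{x}, by simpa using hx, Subring.subset_closure (by simp)⟩
  | zero => exact ⟨∅, by simp, zero_mem _⟩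
  | one => exact ⟨∅, by simp, one_mem _⟩
  | neg x _ ih =>
    obtain ⟨T, hT, h⟩ := ih
    exact ⟨T, hT, neg_mem h⟩
  | add x y _ _ ihx ihy =>
    obtain ⟨T, hT, h⟩ := ihx
    obtain ⟨U, hU, h'⟩ := ihy
    exact ⟨T ∪ U, by simp [hT, hU], add_mem (mono Finset.subset_union_left h)
      (mono Finset.subset_union_right h')⟩
  | mul x y _ _ ihx ihy =>
    obtain ⟨T, hT, h⟩ := ihx
    obtain ⟨U, hU, h'⟩ := ihy
    exact ⟨T ∪ U, by simp [hT, hU], mul_mem (mono Finset.subset_union_left h)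
      (mono Finset.subset_union_right h')⟩

theorem exists_center_of_notMem {A : Subring F} (hA : ∀ r, serHom k F r ∈ A)
    (ht : (serHom k F PowerSeries.X)⁻¹ ∉ A) :
    ∃ O : ValuationSubring F, Center k O ∧ A ≤ O.toSubring := by
  obtain ⟨O, hAO, hO⟩ := Ideal.image_subset_nonunits_valuationSubring
    (Ideal.span {(⟨serHom k F PowerSeries.X, hA _⟩ : A)}) (by
      rw [Ne, Ideal.span_singleton_eq_top, isUnit_iff_exists_inv]
      rintro ⟨b, hb⟩
      refine ht ?_
      rw [inv_eq_of_mul_eq_one_right (congrArg Subtype.val hb)]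
      exact b.2)
  refine ⟨O, ⟨fun r => hAO (hA r), ?_⟩, hAO⟩
  exact hO ⟨_, Ideal.mem_span_singleton_self _, rfl⟩

/-- Up to the maximal ideal of `O`, either `f` is a nonzero sum of `2 ^ (n + 1)` squares, or `-1` is
a sum of `2 ^ n` squares. -/
def LocallyGood (n : ℕ) (O : ValuationSubring F) (f : F) : Prop :=
  (∃ d ∈ sumSq F (2 ^ (n + 1)), d ≠ 0 ∧ O.valuation (f / d - 1) < 1) ∨
    ∃ b ∈ sumSq F (2 ^ n), O.valuation (1 + b) < 1

/-- Elements whose vanishing modulo some maximal ideal is one of the two alternatives of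
`LocallyGood`. -/
def Witness (n : ℕ) (f ε : F) : Prop :=
  (∃ d ∈ sumSq F (2 ^ (n + 1)), d ≠ 0 ∧ f = d * (1 + ε)) ∨ ∃ b ∈ sumSq F (2 ^ n), ε = 1 + b

theorem Witness.ne_zero {n : ℕ} {f ε : F} (h2 : (2 : F) ≠ 0) (h : Witness n f ε)
    (hf : f ∉ sumSq F (2 ^ (n + 1))) : ε ≠ 0 := by
  rintro rfl
  rcases h with ⟨d, hd, -, rfl⟩ | ⟨b, hb, h⟩
  · exact hf (by simpa using hd)
  · refine hf (mem_sumSq_of_neg_one_mem h2 ?_ f)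
    rwa [← eq_neg_of_add_eq_zero_right h.symm]

theorem exists_finset_witness {n : ℕ} {f : F} (h2 : (2 : F) ≠ 0)
    (hf : f ∉ sumSq F (2 ^ (n + 1))) (h : ∀ O, Center k O → LocallyGood n O f) :
    ∃ T : Finset F, (∀ ε ∈ T, Witness n f ε) ∧ (serHom k F PowerSeries.X)⁻¹ ∈
      Subring.closure (Set.range (serHom k F) ∪ {z | ∃ ε ∈ T, z = ε⁻¹}) := by
  classical
  set A := Subring.closure (Set.range (serHom k F) ∪ {z | ∃ ε, Witness n f ε ∧ z = ε⁻¹}) with hA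
  have ht : (serHom k F PowerSeries.X)⁻¹ ∈ A := by
    by_contra ht
    obtain ⟨O, hO, hAO⟩ := exists_center_of_notMem
      (fun r => Subring.subset_closure (.inl ⟨r, rfl⟩)) ht
    have key : ∀ ε, Witness n f ε → O.valuation ε < 1 → False := by
      intro ε hε hlt
      have h1 : ε⁻¹ ∈ O := hAO (Subring.subset_closure (.inr ⟨ε, hε, rfl⟩))
      exact inv_notMem_of_valuation_lt_one (hε.ne_zero h2 hf) hlt h1
    rcases h O hO with ⟨d, hd, hd0, hlt⟩ | ⟨b, hb, hlt⟩
    · refine key _ (.inl ⟨d, hd, hd0, ?_⟩) hlt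
      field_simp
      ring
    · exact key _ (.inr ⟨b, hb, rfl⟩) hlt
  obtain ⟨U, hU, hUt⟩ := exists_finset_mem_closure ht
  have hch : ∀ z ∈ U, ∃ ε, z ∈ Set.range (serHom k F) ∨ (Witness n f ε ∧ z = ε⁻¹) := by
    intro z hz
    rcases hU hz with h | ⟨ε, h⟩
    · exact ⟨0, .inl h⟩
    · exact ⟨ε, .inr h⟩
  choose! ε hε using hch
  refine ⟨(U.image ε).filter (Witness n f), fun z hz => (Finset.mem_filter.mp hz).2,
    Subring.closure_mono ?_ hUt⟩
  intro z hz
  rcases hε z hz with h | ⟨hw, h⟩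
  · exact .inl h
  · exact .inr ⟨ε z, Finset.mem_filter.mpr ⟨Finset.mem_image_of_mem _ hz, hw⟩, h⟩

/-- A transcendental element which is integral (or has integral inverse) at a center only if the
given linear fractional transformations are. -/
theorem exists_transcendental_parameter [CharZero k] {x₀ : F}
    (hx₀ : Transcendental (LaurentSeries k) x₀)
    [FiniteDimensional (LaurentSeries k)⟮x₀⟯ F] (T : Finset F) :
    ∃ (x : F) (b d : F → k), Transcendental (LaurentSeries k) x ∧ ∀ ε ∈ T,
      (b ε ≠ d ε ∧ ε ≠ baseHom k F (b ε) ∧ ε ≠ baseHom k F (d ε)) ∧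
      ∀ O, Center k O →
        (x ∈ O → (ε - baseHom k F (b ε)) / (ε - baseHom k F (d ε)) ∈ O) ∧
        (x⁻¹ ∈ O → (ε - baseHom k F (d ε)) / (ε - baseHom k F (b ε)) ∈ O) := by
  classical
  let S : Finset F := insert x₀ T
  obtain ⟨b, d, hbd, hO⟩ := exists_generic_parameters hx₀ (fun j : S => (j : F))
  let j₀ : S := ⟨x₀, Finset.mem_insert_self _ _⟩
  set u : S → F := fun j => ((j : F) - baseHom k F (b j)) / ((j : F) - baseHom k F (d j)) with hu
  have hu0 : ∀ j, u j ≠ 0 := fun j =>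
    div_ne_zero (sub_ne_zero.mpr (hbd j).2.1) (sub_ne_zero.mpr (hbd j).2.2)
  let e : S → ℕ := fun j => if j = j₀ then 2 else 1
  have hprod : ∏ j, u j ^ e j = u j₀ * ∏ j, u j ^ 1 := by
    rw [← Finset.mul_prod_erase _ _ (Finset.mem_univ j₀),
      ← Finset.mul_prod_erase _ (fun j => u j ^ 1) (Finset.mem_univ j₀),
      Finset.prod_congr rfl (g := fun j => u j ^ 1)]
    · simp only [e, if_true]
      ring
    · intro j hj
      simp only [e, if_neg (Finset.ne_of_mem_erase hj)]
  have htr : ∃ e : S → ℕ, (∀ j, e j ≠ 0) ∧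
      Transcendental (LaurentSeries k) (∏ j, u j ^ e j) := by
    by_contra! hcon
    have h1 := hcon (fun _ => 1) (fun _ => one_ne_zero)
    have h2 := hcon e (fun j => by simp only [e]; split_ifs <;> simp)
    rw [Transcendental, not_not] at h1 h2
    have hne : ∏ j, u j ^ 1 ≠ 0 := Finset.prod_ne_zero_iff.mpr fun j _ => pow_ne_zero _ (hu0 j)
    have h3 : IsAlgebraic (LaurentSeries k) (u j₀) := by
      rw [hprod] at h2
      have := h2.mul h1.inv
      rwa [mul_inv_cancel_right₀ hne] at this
    have hbase : ∀ a : k, IsAlgebraic (LaurentSeries k) (baseHom k F a) := fun a =>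
      isAlgebraic_algebraMap _
    have hxd : x₀ - baseHom k F (d j₀) ≠ 0 := sub_ne_zero.mpr (hbd j₀).2.2
    have hu1 : 1 - u j₀ ≠ 0 := by
      intro h
      have h' : u j₀ = 1 := (sub_eq_zero.mp h).symm
      rw [hu] at h'
      simp only [j₀] at h'
      rw [div_eq_one_iff_eq hxd, sub_right_inj] at h'
      exact (hbd j₀).1 ((baseHom k F).injective h')
    have : x₀ = (baseHom k F (b j₀) - baseHom k F (d j₀) * u j₀) * (1 - u j₀)⁻¹ := by
      rw [eq_mul_inv_iff_mul_eq₀ hu1]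
      have : u j₀ * (x₀ - baseHom k F (d j₀)) = x₀ - baseHom k F (b j₀) := div_mul_cancel₀ _ hxd
      linear_combination -this
    refine hx₀ ?_
    rw [this]
    exact ((hbase _).sub ((hbase _).mul h3)).mul (isAlgebraic_one.sub h3).inv
  obtain ⟨e, he, hetr⟩ := htr
  refine ⟨_, fun z => if h : z ∈ S then b ⟨z, h⟩ else 0, fun z => if h : z ∈ S then d ⟨z, h⟩ else 0,
    hetr, fun ε hε => ?_⟩
  have hS : ε ∈ S := Finset.mem_insert_of_mem hε
  simp only [dif_pos hS]
  exact ⟨hbd ⟨ε, hS⟩, fun O hc => ⟨fun h => (hO e he O hc).1 h ⟨ε, hS⟩,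
    fun h => (hO e he O hc).2 h ⟨ε, hS⟩⟩⟩

/-- Newton iteration for approximate square roots of `-1`. -/
theorem exists_one_add_valuation_le (O : ValuationSubring F) (h2 : O.valuation (2 : F) = 1) {n : ℕ}
    {b : F} (hb : b ∈ sumSq F n) (hlt : O.valuation (1 + b) < 1) (j : ℕ) :
    ∃ b' ∈ sumSq F n, O.valuation (1 + b') ≤ O.valuation ((1 + b) ^ 2 ^ j) := by
  induction j with
  | zero => exact ⟨b, hb, by simp⟩
  | succ j ih =>
    obtain ⟨c, hc, hle⟩ := ih
    have h20 : (2 : F) ≠ 0 := by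
      intro h
      rw [h, map_zero] at h2
      exact zero_ne_one h2
    have hlt' : O.valuation (1 + c) < 1 := by
      refine hle.trans_lt ?_
      rw [map_pow]
      exact pow_lt_one₀ zero_le hlt (by positivity)
    have h1 : O.valuation (1 - (1 + c) / 2) = 1 := by
      rw [sub_eq_add_neg]
      refine Valuation.map_one_add_of_lt _ ?_
      rwa [Valuation.map_neg, map_div₀, h2, div_one]
    have h10 : 1 - (1 + c) / 2 ≠ 0 := by
      intro h
      rw [h, map_zero] at h1
      exact zero_ne_one h1
    refine ⟨((1 - (1 + c) / 2)⁻¹) ^ 2 * c, sq_mul_mem_sumSq _ hc, ?_⟩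
    have : 1 + ((1 - (1 + c) / 2)⁻¹) ^ 2 * c = ((1 + c) / (2 * (1 - (1 + c) / 2))) ^ 2 := by
      have h1c : (2 - (1 + c)) ≠ 0 := by
        intro h
        apply h10
        rw [sub_eq_zero, eq_comm, div_eq_one_iff_eq h20]
        exact (sub_eq_zero.mp h).symm
      have e : 1 - (1 + c) / 2 = (2 - (1 + c)) / 2 := by field_simp
      rw [e]
      field_simp
      ring
    rw [this, map_pow, map_div₀, map_mul, h2, h1, mul_one, div_one, pow_succ 2 j, pow_mul,
      map_pow]
    exact pow_le_pow_left' hle 2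

theorem exists_div_sub_one_lt {O : ValuationSubring F} (hO : IsArch O)
    (h2 : O.valuation (2 : F) = 1) {n : ℕ} {f : F} (hf : f ≠ 0) (h : LocallyGood n O f) :
    ∃ d ∈ sumSq F (2 ^ (n + 1)), d ≠ 0 ∧ O.valuation (f / d - 1) < 1 := by
  rcases h with h | ⟨b, hb, hlt⟩
  · exact h
  have h20 : (2 : F) ≠ 0 := by
    intro h
    rw [h, map_zero] at h2
    exact zero_ne_one h2
  obtain ⟨N, hN⟩ := Filter.eventually_atTop.mp (hO.eventually hlt (((f - 1) / 2) ^ 2) hf)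
  obtain ⟨c, hc, hle⟩ := exists_one_add_valuation_le O h2 hb hlt N
  have hlt' : O.valuation (((f - 1) / 2) ^ 2 * (1 + c)) < O.valuation f := by
    refine lt_of_le_of_lt ?_ (hN (2 ^ N) Nat.lt_two_pow_self.le)
    rw [mul_comm, map_mul, map_mul]
    exact mul_le_mul_left hle _
  have hd : f + ((f - 1) / 2) ^ 2 * (1 + c) = ((f + 1) / 2) ^ 2 + ((f - 1) / 2) ^ 2 * c := by
    field_simp
    ring
  have hv : O.valuation (f + ((f - 1) / 2) ^ 2 * (1 + c)) = O.valuation f :=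
    Valuation.map_add_eq_of_lt_left _ hlt'
  have hd0 : f + ((f - 1) / 2) ^ 2 * (1 + c) ≠ 0 := by
    rw [← Valuation.ne_zero_iff O.valuation, hv, Valuation.ne_zero_iff]
    exact hf
  refine ⟨f + ((f - 1) / 2) ^ 2 * (1 + c), ?_, hd0, ?_⟩
  · rw [hd]
    refine sumSq_mono ?_ (add_mem_sumSq (sq_mem_sumSq le_rfl _) (sq_mul_mem_sumSq _ hc))
    have := Nat.one_le_two_pow (n := n)
    rw [pow_succ]
    omega
  · have : f / (f + ((f - 1) / 2) ^ 2 * (1 + c)) - 1 =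
        -(((f - 1) / 2) ^ 2 * (1 + c) / (f + ((f - 1) / 2) ^ 2 * (1 + c))) := by
      rw [← neg_div, eq_div_iff hd0, sub_mul, div_mul_cancel₀ _ hd0]
      ring
    rw [this, Valuation.map_neg, map_div₀, hv]
    exact (div_lt_one₀ (zero_lt_iff.mpr (by rwa [Valuation.ne_zero_iff]))).mpr hlt'

/-- A single sum of squares approximating `f` at finitely many independent rank one places. -/
theorem exists_common_approx {ι : Type*} [Finite ι] {O : ι → ValuationSubring F}
    (hO : ∀ i, IsArch (O i)) (hne : ∀ i, O i ≠ ⊤) (hinj : Function.Injective O)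
    (h2 : ∀ i, (O i).valuation (2 : F) ≤ 1) {m : ℕ} {f : F} (hm : 1 ≤ m)
    (h : ∀ i, ∃ d ∈ sumSq F m, d ≠ 0 ∧ (O i).valuation (f / d - 1) < 1) :
    ∃ d ∈ sumSq F m, d ≠ 0 ∧ ∀ i, (O i).valuation (f / d - 1) < 1 := by
  cases isEmpty_or_nonempty ι
  · exact ⟨1, by simpa using sq_mem_sumSq hm (1 : F), one_ne_zero, fun i => isEmptyElim i⟩
  choose d hd hd0 hlt using h
  choose a ha using hd
  have hM (i) : ∃ M : F, 1 ≤ (O i).valuation M ∧ ∀ l, (O i).valuation (a i l) ≤ (O i).valuation M := by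
    let g : Option (Fin m) → F := fun l => l.elim 1 (a i)
    obtain ⟨l, hl⟩ := Finite.exists_max fun l => (O i).valuation (g l)
    exact ⟨g l, by simpa [g] using hl none, fun l => hl (some l)⟩
  choose M hM1 hMa using hM
  have hM0 : ∀ i, M i ≠ 0 := by
    intro i h
    have := hM1 i
    rw [h, map_zero] at this
    exact zero_lt_one.not_ge this
  have hdM (i) : (O i).valuation (d i) ≤ (O i).valuation (M i) ^ 2 := by
    rw [ha i]
    refine Valuation.map_sum_le _ fun l _ => ?_
    rw [map_pow]
    exact pow_le_pow_left' (hMa i l) 2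
  choose z hz using fun l => exists_approx hO hne hinj (fun i => a i l) (fun i => d i / M i ^ 2)
    (fun i => div_ne_zero (hd0 i) (pow_ne_zero _ (hM0 i)))
  set D := ∑ l, z l ^ 2 with hD
  have hclose (i) : (O i).valuation (D - d i) < (O i).valuation (d i) := by
    have hd0' : (O i).valuation (d i) ≠ 0 := by
      rw [Valuation.ne_zero_iff]; exact hd0 i
    rw [hD, ha i, ← Finset.sum_sub_distrib, ← ha i]
    refine Valuation.map_sum_lt _ hd0' fun l _ => ?_
    have hM2 : 0 < (O i).valuation (M i) ^ 2 := by
      rw [zero_lt_iff]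
      exact pow_ne_zero _ ((Valuation.ne_zero_iff _).mpr (hM0 i))
    have h1 := hz l i
    rw [map_div₀, map_pow] at h1
    have hδ1 : (O i).valuation (d i) / (O i).valuation (M i) ^ 2 ≤ 1 :=
      (div_le_one₀ hM2).mpr (hdM i)
    have h3 : (O i).valuation (z l + a i l) ≤ (O i).valuation (M i) := by
      rw [show z l + a i l = (z l - a i l) + 2 * a i l by ring]
      refine (Valuation.map_add _ _ _).trans (max_le ((h1.le.trans hδ1).trans (hM1 i)) ?_)
      rw [map_mul]
      exact (mul_le_of_le_one_left' (h2 i)).trans (hMa i l)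
    rw [show z l ^ 2 - a i l ^ 2 = (z l - a i l) * (z l + a i l) by ring, map_mul]
    have h4 : (O i).valuation (z l - a i l) * (O i).valuation (z l + a i l) ≤
        (O i).valuation (z l - a i l) * (O i).valuation (M i) ^ 2 := by
      refine mul_le_mul_right (h3.trans ?_) _
      rw [sq]
      exact le_mul_of_one_le_right' (hM1 i)
    refine h4.trans_lt ?_
    rwa [← lt_div_iff₀ hM2]
  have hval (i) : (O i).valuation D = (O i).valuation (d i) := by
    rw [show D = d i + (D - d i) by ring]
    exact Valuation.map_add_eq_of_lt_left _ (hclose i)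
  have hD0 : D ≠ 0 := by
    obtain ⟨i⟩ := ‹Nonempty ι›
    rw [← Valuation.ne_zero_iff (O i).valuation, hval, Valuation.ne_zero_iff]
    exact hd0 i
  refine ⟨D, ⟨z, rfl⟩, hD0, fun i => ?_⟩
  have e : f / D - 1 = (d i / D) * (f / d i - 1) - (D - d i) / D := by
    have := hd0 i
    field_simp
    ring
  have hD0' : 0 < (O i).valuation D := (Valuation.pos_iff _).mpr hD0
  rw [e]
  refine Valuation.map_sub_lt _ ?_ ?_
  · rw [map_mul, map_div₀, hval, div_self (hval i ▸ hD0'.ne'), one_mul]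
    exact hlt i
  · rw [map_div₀, div_lt_one₀ hD0', hval]
    exact hclose i

/-- An element which is small at the Gauss extensions with respect to `x` is small wherever `x` is
integral and a suitable polynomial in `x` is a unit. -/
theorem exists_monic_of_gaussAt {x ε : F} (hx : Transcendental (LaurentSeries k) x) (hε : ε ≠ 0)
    (h : ∀ O, Center k O → GaussAt k O x → O.valuation ε < 1) :
    ∃ q : k[X], q.Monic ∧ ∀ O, Center k O → x ∈ O →
      O.valuation (q.eval₂ (baseHom k F) x) = 1 → O.valuation ε < 1 := by
  have hxp : ∀ p : (PowerSeries k)[X], p ≠ 0 → p.eval₂ (serHom k F) x ≠ 0 := by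
    intro p hp h0
    refine hx ⟨p.map (algebraMap (PowerSeries k) (LaurentSeries k)), ?_, ?_⟩
    · exact (Polynomial.map_ne_zero_iff (IsFractionRing.injective _ _)).mpr hp
    · rw [aeval_def, eval₂_map]
      exact h0
  set A := Subring.closure (Set.range (serHom k F) ∪ {x, ε⁻¹} ∪
    {z | ∃ q : (PowerSeries k)[X], q.map PowerSeries.constantCoeff ≠ 0 ∧
      z = (q.eval₂ (serHom k F) x)⁻¹}) with hA
  have ht : (serHom k F PowerSeries.X)⁻¹ ∈ A := by
    by_contra ht
    obtain ⟨O, hO, hAO⟩ := exists_center_of_notMem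
      (fun r => Subring.subset_closure (.inl (.inl ⟨r, rfl⟩))) ht
    have hxO : x ∈ O := hAO (Subring.subset_closure (.inl (.inr (.inl rfl))))
    have hεO : ε⁻¹ ∈ O := hAO (Subring.subset_closure (.inl (.inr (.inr rfl))))
    refine inv_notMem_of_valuation_lt_one hε (h O hO fun p hp => ?_) hεO
    have hpm : (p.map (PowerSeries.C (R := k))).map PowerSeries.constantCoeff = p := by
      rw [Polynomial.map_map]
      convert Polynomial.map_id
      ext
      simp
    have h1 := hO.eval₂_mem hxO (p.map PowerSeries.C)
    have h2 : ((p.map PowerSeries.C).eval₂ (serHom k F) x)⁻¹ ∈ O :=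
      hAO (Subring.subset_closure (.inr ⟨_, by rwa [hpm], rfl⟩))
    have h0 := hxp (p.map PowerSeries.C) ((Polynomial.map_ne_zero_iff PowerSeries.C_injective).mpr hp)
    rw [eval₂_map_C] at h1 h2 h0
    rw [← O.valuation_le_one_iff] at h1 h2
    rw [map_inv₀, inv_le_one₀ ((Valuation.pos_iff _).mpr h0)] at h2
    exact le_antisymm h1 h2
  have hrep : ∀ z ∈ A, ∃ q : (PowerSeries k)[X], q.map PowerSeries.constantCoeff ≠ 0 ∧
      ∃ P : (PowerSeries k)[X][X], z * q.eval₂ (serHom k F) x =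
        P.eval₂ (eval₂RingHom (serHom k F) x) ε⁻¹ := by
    intro z hz
    have hone : (1 : (PowerSeries k)[X]).map PowerSeries.constantCoeff ≠ 0 := by simp
    induction hz using Subring.closure_induction with
    | mem z hz =>
      rcases hz with (⟨r, rfl⟩ | rfl | rfl) | ⟨q, hq, rfl⟩
      · exact ⟨1, hone, C (C r), by simp⟩
      · exact ⟨1, hone, C X, by simp⟩
      · exact ⟨1, hone, X, by simp⟩
      · refine ⟨q, hq, 1, ?_⟩
        rw [eval₂_one, inv_mul_cancel₀]
        exact hxp q fun h => hq (by rw [h, Polynomial.map_zero])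
    | zero => exact ⟨1, hone, 0, by simp⟩
    | one => exact ⟨1, hone, 1, by simp⟩
    | neg z _ ih =>
      obtain ⟨q, hq, P, hP⟩ := ih
      exact ⟨q, hq, -P, by rw [eval₂_neg, ← hP, neg_mul]⟩
    | add z w _ _ ihz ihw =>
      obtain ⟨q, hq, P, hP⟩ := ihz
      obtain ⟨q', hq', P', hP'⟩ := ihw
      refine ⟨q * q', by rw [Polynomial.map_mul]; exact mul_ne_zero hq hq',
        P * C q' + P' * C q, ?_⟩
      rw [eval₂_add, eval₂_mul (p := P), eval₂_mul (p := P'), ← hP, ← hP', eval₂_C, eval₂_C, coe_eval₂RingHom,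
        eval₂_mul]
      ring
    | mul z w _ _ ihz ihw =>
      obtain ⟨q, hq, P, hP⟩ := ihz
      obtain ⟨q', hq', P', hP'⟩ := ihw
      refine ⟨q * q', by rw [Polynomial.map_mul]; exact mul_ne_zero hq hq', P * P', ?_⟩
      rw [eval₂_mul, eval₂_mul (p := P), ← hP, ← hP']
      ring
  obtain ⟨q, hq, P, hP⟩ := hrep _ ht
  set h := q.map PowerSeries.constantCoeff with hh
  refine ⟨h * C h.leadingCoeff⁻¹, monic_mul_leadingCoeff_inv hq, fun O hO hxO h1 => ?_⟩
  by_contra hlt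
  rw [not_lt] at hlt
  have hεO : ε⁻¹ ∈ O := by
    rw [← O.valuation_le_one_iff, map_inv₀]
    exact inv_le_one_of_one_le₀ hlt
  rw [eval₂_mul, eval₂_C, map_mul, hO.baseHom_valuation
    (inv_ne_zero (leadingCoeff_ne_zero.mpr hq)), mul_one] at h1
  obtain ⟨r, hr⟩ := exists_eq_map_C_add q
  have hqv : O.valuation (q.eval₂ (serHom k F) x) = 1 := by
    rw [hr, eval₂_add, eval₂_map_C, eval₂_mul, eval₂_C, ← h1]
    refine Valuation.map_add_eq_of_lt_left _ ?_
    rw [h1, map_mul]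
    exact mul_lt_one_of_nonneg_of_lt_one_left zero_le hO.2
      ((O.valuation_le_one_iff _).mpr (hO.eval₂_mem hxO _))
  have hPO : P.eval₂ (eval₂RingHom (serHom k F) x) ε⁻¹ ∈ O := by
    rw [eval₂_eq_sum_range]
    exact sum_mem fun i _ => mul_mem (hO.eval₂_mem hxO _) (pow_mem hεO i)
  rw [← hP, ← O.valuation_le_one_iff, map_mul, hqv, mul_one, map_inv₀,
    inv_le_one₀ ((Valuation.pos_iff _).mpr serHom_X_ne_zero)] at hPO
  exact hPO.not_gt hO.2

/-- Away from the poles of a suitable function, `x` is integral and a given polynomial in `x` is a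
unit. -/
theorem Center.of_add_inv_mem {O : ValuationSubring F} (hO : Center k O) {x : F} {q : k[X]}
    (hq : q.Monic) (hq0 : q.eval₂ (baseHom k F) x ≠ 0)
    (h : x + (q.eval₂ (baseHom k F) x)⁻¹ ∈ O) :
    x ∈ O ∧ O.valuation (q.eval₂ (baseHom k F) x) = 1 := by
  have hbase : ∀ a, baseHom k F a ∈ O := fun a => hO.1 _
  have eval_mem : ∀ {x : F}, x ∈ O → q.eval₂ (baseHom k F) x ∈ O := by
    intro x hx
    rw [eval₂_eq_sum_range]
    exact sum_mem fun i _ => mul_mem (hbase _) (pow_mem hx i)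
  have hpos : 0 < O.valuation (q.eval₂ (baseHom k F) x) :=
    (Valuation.pos_iff _).mpr hq0
  by_cases hdeg : q.natDegree = 0
  · have : q = 1 := hq.natDegree_eq_zero.mp hdeg
    subst this
    simp only [eval₂_one, inv_one] at h ⊢
    exact ⟨by simpa using sub_mem h (one_mem O), map_one _⟩
  have hint : q.eval₂ (baseHom k F) x ∈ O → x ∈ O := by
    intro hv
    let ψ : k →+* O := (baseHom k F).codRestrict O.toSubring hbase
    have hmon : (q.map ψ - C (⟨_, hv⟩ : O)).Monic := by
      refine (hq.map ψ).sub_of_left (degree_C_le.trans_lt ?_)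
      rw [hq.degree_map, ← natDegree_pos_iff_degree_pos]
      exact Nat.pos_of_ne_zero hdeg
    have : IsIntegral O x := by
      refine ⟨_, hmon, ?_⟩
      rw [eval₂_sub, eval₂_map, eval₂_C]
      exact sub_self _
    obtain ⟨y, rfl⟩ := IsIntegrallyClosed.isIntegral_iff.mp this
    exact y.2
  have hinv : x ∈ O → (q.eval₂ (baseHom k F) x)⁻¹ ∈ O := by
    intro hx
    simpa using sub_mem h hx
  rcases le_or_gt (O.valuation (q.eval₂ (baseHom k F) x)) 1 with hle | hgt
  · have hx := hint ((O.valuation_le_one_iff _).mp hle)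
    refine ⟨hx, le_antisymm hle ?_⟩
    have := (O.valuation_le_one_iff _).mpr (hinv hx)
    rwa [map_inv₀, inv_le_one₀ hpos] at this
  · exfalso
    have h1 : (q.eval₂ (baseHom k F) x)⁻¹ ∈ O := by
      rw [← O.valuation_le_one_iff, map_inv₀]
      exact inv_le_one_of_one_le₀ hgt.le
    have hx : x ∈ O := by simpa using sub_mem h h1
    exact hgt.not_ge ((O.valuation_le_one_iff _).mpr (eval_mem hx))

theorem transcendental_add_inv {x : F} (hx : Transcendental (LaurentSeries k) x) {q : k[X]}
    (hq : q.Monic) :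
    Transcendental (LaurentSeries k) (x + (q.eval₂ (baseHom k F) x)⁻¹) := by
  intro halg
  let E := algebraicClosure (LaurentSeries k) F
  let c : E := ⟨_, mem_algebraicClosure_iff.mpr halg⟩
  let ψ : k →+* E := (algebraMap (LaurentSeries k) E).comp
    ((algebraMap (PowerSeries k) (LaurentSeries k)).comp PowerSeries.C)
  have hψ : (algebraMap E F).comp ψ = baseHom k F := rfl
  have hq0 : q.eval₂ (baseHom k F) x ≠ 0 := by
    intro h0
    refine hx ⟨q.map ((algebraMap (PowerSeries k) (LaurentSeries k)).comp PowerSeries.C),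
      (hq.map _).ne_zero, ?_⟩
    rw [aeval_def, eval₂_map]
    exact h0
  have hE : IsAlgebraic E x := by
    refine ⟨(X - C c) * q.map ψ + 1, fun h0 => ?_, ?_⟩
    · have hm : ((X - C c) * q.map ψ).Monic := (monic_X_sub_C c).mul (hq.map ψ)
      have h1 : (X - C c) * q.map ψ = C (-1) := by
        rw [C_neg, C_1]
        exact eq_neg_of_add_eq_zero_left h0
      have h2 := congrArg natDegree h1
      rw [natDegree_C, (monic_X_sub_C c).natDegree_mul (hq.map ψ), natDegree_X_sub_C] at h2
      omega
    · rw [map_add, map_mul, map_sub, aeval_X, aeval_C, map_one, aeval_def, eval₂_map, hψ]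
      change (x - (x + _)) * _ + 1 = 0
      rw [sub_add_cancel_left, neg_mul, inv_mul_cancel₀ hq0, neg_add_cancel]
  exact hx (hE.restrictScalars (LaurentSeries k))

end LocalConditions

section LocalGlobal

open IntermediateField Polynomial

/-- If `1` lies in `τ V[z⁻¹]` with `τ` topologically nilpotent, then `1 + z` is a square. -/
theorem exists_sq_eq_one_add_of_mem {V : Type*} [CommRing V] {I : Ideal V} [IsAdicComplete I V]
    (h2 : IsUnit (2 : V)) {τ : V} (hτ : τ ∈ I) {F' : Type*} [Field F'] (φ : V →+* F') {z : F'}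
    (hz : z ≠ 0) {P : V[X]} (hP : 1 = φ τ * P.eval₂ φ z⁻¹) : ∃ r : F', r ^ 2 = 1 + z := by
  let : Algebra V F' := φ.toAlgebra
  obtain ⟨w, hw⟩ : IsUnit (1 - τ * P.coeff 0) := by
    have h := Ideal.mem_jacobson_bot.mp (IsAdicComplete.le_jacobson_bot I hτ) (-P.coeff 0)
    rwa [mul_neg, neg_add_eq_sub] at h
  set M := P.natDegree with hM
  let q : V[X] := ∑ i ∈ Finset.range M, C (↑w⁻¹ * τ * P.coeff (M - i)) * X ^ i
  have hqdeg : q.degree < M := by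
    rw [← mem_degreeLT]
    refine sum_mem fun i hi => mem_degreeLT.mpr ?_
    exact (degree_C_mul_X_pow_le _ _).trans_lt (by exact_mod_cast Finset.mem_range.mp hi)
  have hmon : (X ^ M - q).Monic := monic_X_pow_sub hqdeg
  have hdist : (X ^ M - q).IsDistinguishedAt I := by
    refine ⟨⟨fun {i} hi => ?_⟩, hmon⟩
    have hnat : (X ^ M - q).natDegree ≤ M :=
      natDegree_le_of_degree_le ((degree_sub_le _ _).trans (max_le (degree_X_pow_le M) hqdeg.le))
    have hi' : i ≠ M := (hi.trans_le hnat).ne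
    rw [coeff_sub, coeff_X_pow, if_neg hi', zero_sub, finsetSum_coeff]
    refine I.neg_mem (sum_mem fun j _ => ?_)
    rw [coeff_C_mul, mul_comm (↑w⁻¹ : V), mul_assoc, mul_assoc]
    exact I.mul_mem_right _ hτ
  have hroot : aeval z (X ^ M - q) = 0 := by
    have h1 : z ^ M * P.eval₂ φ z⁻¹ =
        ∑ i ∈ Finset.range M, φ (P.coeff (M - i)) * z ^ i + φ (P.coeff 0) * z ^ M := by
      rw [eval₂_eq_sum_range, Finset.mul_sum, ← Finset.sum_range_reflect, Finset.sum_range_succ]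
      simp only [Nat.add_sub_cancel, Nat.sub_self, pow_zero, mul_one]
      congr 1
      · refine Finset.sum_congr rfl fun i hi => ?_
        have hiM := Finset.mem_range.mp hi
        rw [mul_left_comm, inv_pow, ← div_eq_mul_inv, ← hM]
        congr 1
        rw [div_eq_iff (pow_ne_zero _ hz), ← pow_add]
        congr 1
        omega
      · rw [mul_comm]
    have h2 : φ (↑w⁻¹) * φ (1 - τ * P.coeff 0) = 1 := by
      rw [← hw, ← map_mul, Units.inv_mul, map_one]
    have h3 : z ^ M = φ τ * (z ^ M * P.eval₂ φ z⁻¹) := by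
      rw [mul_left_comm, ← hP, mul_one]
    rw [h1] at h3
    rw [map_sub, map_pow, aeval_X, map_sum, sub_eq_zero]
    simp only [map_mul, aeval_C, map_pow, aeval_X]
    change _ = ∑ i ∈ Finset.range M, φ _ * φ _ * φ _ * _
    simp only [mul_assoc, ← Finset.mul_sum]
    rw [map_sub, map_one, map_mul] at h2
    linear_combination (-(z ^ M)) * h2 + φ (↑w⁻¹) * h3
  obtain ⟨r, -, hr⟩ := exists_sq_eq_one_add h2 hdist hroot
  exact ⟨r, hr⟩

variable {k : Type u} {F : Type u} [Field k] [Field F] [Algebra (LaurentSeries k) F]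

/-- The condition at the part of the patching diagram where `x` is integral. -/
theorem exists_sq_eq_one_add_of_polynomial [CharZero k] {x ε : F} (hε : ε ≠ 0)
    (h : ∀ O, Center k O → x ∈ O → O.valuation ε < 1)
    {F' : Type*} [Field F'] (g : F →+* F') (φ : PowerSeries k[X] →+* F')
    (hφ : ∀ r, φ (PowerSeries.map Polynomial.C r) = g (serHom k F r))
    (hx : φ (PowerSeries.C Polynomial.X) = g x) : ∃ r : F', r ^ 2 = 1 + g ε := by
  have ht : (serHom k F PowerSeries.X)⁻¹ ∈
      Subring.closure (Set.range (serHom k F) ∪ {x, ε⁻¹}) := by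
    by_contra ht
    obtain ⟨O, hO, hAO⟩ := exists_center_of_notMem
      (fun r => Subring.subset_closure (.inl ⟨r, rfl⟩)) ht
    have hlt := h O hO (hAO (Subring.subset_closure (.inr (.inl rfl))))
    exact inv_notMem_of_valuation_lt_one hε hlt (hAO (Subring.subset_closure (.inr (.inr rfl))))
  have hle : Subring.closure (Set.range (serHom k F) ∪ {x, ε⁻¹}) ≤
      (eval₂RingHom φ (g ε)⁻¹).range.comap g := by
    rw [Subring.closure_le]
    rintro _ (⟨r, rfl⟩ | rfl | rfl)
    · exact ⟨C (PowerSeries.map Polynomial.C r), by simp [hφ]⟩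
    · exact ⟨C (PowerSeries.C Polynomial.X), by simp [hx]⟩
    · exact ⟨X, by simp⟩
  obtain ⟨P, hP⟩ := hle ht
  refine exists_sq_eq_one_add_of_mem (I := Ideal.span {(PowerSeries.X : PowerSeries k[X])}) ?_
    (Ideal.mem_span_singleton_self _) φ ((_root_.map_ne_zero g).mpr hε) (P := P) ?_
  · have : IsUnit (2 : k) := (Ne.isUnit two_ne_zero)
    have h := this.map ((PowerSeries.C (R := k[X])).comp Polynomial.C)
    rwa [map_ofNat] at h
  · have h1 : φ PowerSeries.X = g (serHom k F PowerSeries.X) := by rw [← hφ, PowerSeries.map_X]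
    rw [← coe_eval₂RingHom, hP, h1, ← map_mul, mul_inv_cancel₀ serHom_X_ne_zero, map_one]

theorem mem_or_inv_mem_of_add_inv_mul {k F' : Type*} [Field k] [Field F'] (A : Subring F')
    [IsLocalRing A] (hA : ∀ z, IsIntegral A z → z ∈ A) (β : k →+* A) {q : k[X]} (hq : q.Monic)
    {x : F'} (hq0 : q.eval₂ (A.subtype.comp β) x ≠ 0) {y : A} (hy : ¬IsUnit y)
    (hx : (x + (q.eval₂ (A.subtype.comp β) x)⁻¹) * y = 1) : x ∈ A ∨ x⁻¹ ∈ A := by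
  have hh : aeval x (q.map β) = q.eval₂ (A.subtype.comp β) x := by
    rw [aeval_def, eval₂_map]
    rfl
  refine mem_or_inv_mem_of_isRoot A hA (C y * (X * q.map β + 1) - q.map β) ?_ ⟨q.natDegree, ?_⟩
  · rw [map_sub, map_mul, map_add, map_mul, aeval_X, map_one, aeval_C, hh, sub_eq_zero]
    change (y : F') * _ = _
    field_simp at hx
    linear_combination hx
  · have h1 : (q.map β).coeff q.natDegree = 1 := by
      rw [coeff_map, coeff_natDegree, hq.leadingCoeff, map_one]
    rw [coeff_sub, h1, coeff_C_mul]
    have h2 := (IsLocalRing.isUnit_or_isUnit_one_sub_self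
      (y * (X * q.map β + 1).coeff q.natDegree)).resolve_left
      fun h => hy (isUnit_of_mul_isUnit_left h)
    rw [← neg_sub]
    exact h2.neg

theorem mem_or_inv_mem_of_moebius {F' : Type*} [Field F'] (A : Subring F')
    [IsLocalRing A] (hA : ∀ z, IsIntegral A z → z ∈ A) {a b : A} (hab : IsUnit (a - b)) {z : F'}
    (hz : z ≠ b) (h : (z - a) / (z - b) ∈ A) : z ∈ A ∨ z⁻¹ ∈ A := by
  lift (z - a) / (z - b) to A using h with w hw
  have hw' := (eq_div_iff (sub_ne_zero.mpr hz)).mp hw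
  refine mem_or_inv_mem_of_isRoot A hA (C (w - 1) * X + C (a - w * b)) ?_ ?_
  · rw [map_add, map_mul, aeval_X, aeval_C, aeval_C]
    change ((w : F') - 1) * z + (a - w * b) = 0
    linear_combination hw'
  · by_contra! hP
    have h0 := hP 0
    have h1 := hP 1
    simp only [coeff_add, coeff_C_mul, coeff_X_zero, mul_zero, coeff_C_zero, zero_add,
      coeff_X_one, mul_one, coeff_C_succ, add_zero] at h0 h1
    refine IsLocalRing.nonunits_add h0 (fun h => h1 (isUnit_of_mul_isUnit_left (y := b) h)) ?_
    convert hab using 1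
    ring

/-- The condition at the part of the patching diagram where `x` has a pole. -/
theorem mem_sumSq_of_powerSeries [CharZero k] {n : ℕ} {f x : F} {T : Finset F} {b d : F → k}
    (hT : ∀ ε ∈ T, Witness n f ε) (ht : (serHom k F PowerSeries.X)⁻¹ ∈
      Subring.closure (Set.range (serHom k F) ∪ {z | ∃ ε ∈ T, z = ε⁻¹}))
    (hbd : ∀ ε ∈ T, (b ε ≠ d ε ∧ ε ≠ baseHom k F (b ε) ∧ ε ≠ baseHom k F (d ε)) ∧
      ∀ O, Center k O →
        (x ∈ O → (ε - baseHom k F (b ε)) / (ε - baseHom k F (d ε)) ∈ O) ∧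
        (x⁻¹ ∈ O → (ε - baseHom k F (d ε)) / (ε - baseHom k F (b ε)) ∈ O))
    {q : k[X]} (hq : q.Monic) (hq0 : q.eval₂ (baseHom k F) x ≠ 0)
    {F' : Type*} [Field F'] (g : F →+* F') (φ : PowerSeries (PowerSeries k) →+* F')
    (hinj : Function.Injective φ)
    (hφ : ∀ r, φ (PowerSeries.map PowerSeries.C r) = g (serHom k F r))
    (hx : g (x + (q.eval₂ (baseHom k F) x)⁻¹) * φ (PowerSeries.C PowerSeries.X) = 1) :
    g f ∈ sumSq F' (2 ^ (n + 1)) := by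
  set V := PowerSeries (PowerSeries k)
  let : Algebra V F' := φ.toAlgebra
  have hloc : IsLocalRing (integralClosure V F') := isLocalRing_integralClosure
  let A := (integralClosure V F').toSubring
  have hlocA : IsLocalRing A := hloc
  have hVC : ∀ v, φ v ∈ A := fun v => (integralClosure V F').algebraMap_mem v
  have hIC : ∀ z : F', IsIntegral A z → z ∈ A := by
    intro z hz
    have : IsIntegral (integralClosure V F') z := hz
    exact isIntegral_trans (A := integralClosure V F') z this
  have hnu : ∀ v, ¬IsUnit v → ¬IsUnit (⟨φ v, hVC v⟩ : A) := by
    intro v hv hu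
    have : IsLocalHom (algebraMap V (integralClosure V F')) :=
      RingHom.IsIntegral.isLocalHom (algebraMap_isIntegral_iff.mpr inferInstance)
        fun a b hab => hinj (congrArg Subtype.val hab)
    exact hv (isUnit_of_map_unit (algebraMap V (integralClosure V F')) v hu)
  let β : k →+* A := (φ.codRestrict A hVC).comp (PowerSeries.C.comp PowerSeries.C)
  have hbase (a : k) : g (baseHom k F a) = β a := by
    change _ = φ (PowerSeries.C (PowerSeries.C a))
    rw [← PowerSeries.map_C, hφ]
    rfl
  have hbase' : A.subtype.comp β = g.comp (baseHom k F) := RingHom.ext fun a => (hbase a).symm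
  have hX : φ PowerSeries.X = g (serHom k F PowerSeries.X) := by rw [← hφ, PowerSeries.map_X]
  have hXu : ¬IsUnit (PowerSeries.X : V) := PowerSeries.X_prime.not_isUnit
  have hxC : g x ∈ A ∨ (g x)⁻¹ ∈ A := by
    have hev : q.eval₂ (A.subtype.comp β) (g x) = g (q.eval₂ (baseHom k F) x) := by
      rw [hbase', hom_eval₂]
    refine mem_or_inv_mem_of_add_inv_mul A hIC β hq (y := ⟨φ (PowerSeries.C PowerSeries.X), hVC _⟩)
      ?_ (hnu _ ?_) ?_
    · rw [hev]
      exact (_root_.map_ne_zero g).mpr hq0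
    · rw [PowerSeries.isUnit_iff_constantCoeff, PowerSeries.constantCoeff_C]
      exact PowerSeries.X_prime.not_isUnit
    · rw [hev, ← map_inv₀, ← map_add]
      exact hx
  have hu : ∀ z w : F, (∀ O, Center k O → z ∈ O → w ∈ O) →
      g z ∈ A → g w ∈ A := by
    intro z w hzw hz
    by_contra hw
    let RC : LocalSubring F' := ⟨A⟩
    have : IsIntegrallyClosedIn RC.toSubring F' := by
      exact Subring.isIntegrallyClosedIn_iff.mpr fun z hz => hIC z hz
    obtain ⟨W, hRW, hwW⟩ := LocalSubring.exists_le_valuationSubring_of_isIntegrallyClosedIn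
      (R := RC) hw
    refine hwW (hzw (W.comap g) ⟨fun r => ?_, ?_⟩ (hRW.1 hz))
    · change g _ ∈ W
      rw [← hφ]
      exact hRW.1 (hVC _)
    · rw [← not_le]
      intro hle
      rw [← inv_le_one₀, ← map_inv₀, ValuationSubring.valuation_le_one_iff] at hle
      · change g _ ∈ W at hle
        obtain ⟨hRW1, hRW2⟩ := hRW
        refine hnu _ hXu (isUnit_of_map_unit (Subring.inclusion hRW1) ⟨φ PowerSeries.X, hVC _⟩
          (IsUnit.of_mul_eq_one ⟨_, hle⟩ (Subtype.ext ?_)))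
        change φ PowerSeries.X * _ = 1
        rw [hX, ← map_mul, mul_inv_cancel₀ serHom_X_ne_zero, map_one]
      · exact (Valuation.pos_iff _).mpr serHom_X_ne_zero
  have hε : ∀ ε ∈ T, g ε ∈ A ∨ (g ε)⁻¹ ∈ A := by
    intro ε hε
    obtain ⟨⟨hne, hb, hd⟩, hO⟩ := hbd ε hε
    have hunit : ∀ a a' : k, a ≠ a' → IsUnit (β a - β a') := fun a a' h => by
      rw [← map_sub]
      exact (Ne.isUnit (sub_ne_zero.mpr h)).map β
    have hgne : ∀ a : k, ε ≠ baseHom k F a → g ε ≠ β a := fun a h h' =>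
      h (g.injective (h'.trans (hbase a).symm))
    rcases hxC with hxC | hxC
    · have h := hu x _ (fun O hOc => (hO O hOc).1) hxC
      rw [map_div₀, map_sub, map_sub, hbase, hbase] at h
      exact mem_or_inv_mem_of_moebius A hIC (hunit _ _ hne) (hgne _ hd) h
    · rw [← map_inv₀] at hxC
      have h := hu x⁻¹ _ (fun O hOc => (hO O hOc).2) hxC
      rw [map_div₀, map_sub, map_sub, hbase, hbase] at h
      exact mem_or_inv_mem_of_moebius A hIC (hunit _ _ hne.symm) (hgne _ hb) h
  have hex : ∃ ε ∈ T, (g ε)⁻¹ ∉ A := by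
    by_contra! hcon
    have hle : Subring.closure (Set.range (serHom k F) ∪ {z | ∃ ε ∈ T, z = ε⁻¹}) ≤
        A.comap g := by
      rw [Subring.closure_le]
      rintro _ (⟨r, rfl⟩ | ⟨ε, hεT, rfl⟩)
      · change g _ ∈ A
        rw [← hφ]
        exact hVC _
      · change g _ ∈ A
        rw [map_inv₀]
        exact hcon ε hεT
    refine hnu _ hXu (IsUnit.of_mul_eq_one ⟨_, hle ht⟩ (Subtype.ext ?_))
    change φ PowerSeries.X * g _ = 1
    rw [hX, ← map_mul, mul_inv_cancel₀ serHom_X_ne_zero, map_one]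
  obtain ⟨ε, hεT, hεC⟩ := hex
  have hεA := (hε ε hεT).resolve_right hεC
  have hV2 : IsUnit (2 : V) := by
    have h := (Ne.isUnit (two_ne_zero (α := k))).map
      ((PowerSeries.C (R := PowerSeries k)).comp PowerSeries.C)
    rwa [map_ofNat] at h
  have hεu : ¬IsUnit (⟨g ε, hεA⟩ : integralClosure V F') := by
    rintro ⟨w, hw⟩
    refine hεC ?_
    have h := congrArg Subtype.val w.mul_inv
    rw [hw] at h
    rw [inv_eq_of_mul_eq_one_right h]
    exact (w⁻¹.1).2
  have h2 : (2 : F') ≠ 0 := by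
    have h := (Ne.isUnit (two_ne_zero (α := k))).map (A.subtype.comp β)
    rw [map_ofNat] at h
    exact h.ne_zero
  rcases hT ε hεT with ⟨e, he, -, rfl⟩ | ⟨e, he, rfl⟩
  · obtain ⟨r, hr⟩ := exists_sq_eq_one_add_of_not_isUnit hV2 hεu
    have hr' : (r : F') ^ 2 = 1 + g ε := congrArg Subtype.val hr
    rw [map_mul, map_add, map_one, ← hr', mul_comm]
    exact sq_mul_mem_sumSq _ (map_mem_sumSq g he)
  · obtain ⟨r, hr⟩ := exists_sq_eq_one_add_of_not_isUnit hV2 fun h => hεu (IsUnit.neg_iff _ |>.mp h)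
    have hr' : (r : F') ^ 2 = 1 + -g (1 + e) := congrArg Subtype.val hr
    rw [map_add, map_one] at hr'
    have he0 : g e ≠ 0 := by
      intro h0
      refine hεu ?_
      convert isUnit_one using 1
      refine Subtype.ext ?_
      change g (1 + e) = 1
      rw [map_add, h0, map_one, add_zero]
    have hr0 : (r : F') ≠ 0 := fun h0 => he0 (by rw [h0] at hr'; linear_combination hr')
    refine mem_sumSq_of_neg_one_mem h2 ?_ _
    convert sq_mul_mem_sumSq (r : F')⁻¹ (map_mem_sumSq g he) using 1
    field_simp
    linear_combination -hr'

/-- The local-global principle for sums of squares with respect to the valuation rings centred at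
the maximal ideal of `k⟦t⟧`. -/
theorem mem_sumSq_of_locallyGood [CharZero k] {x₀ : F}
    (hx₀ : Transcendental (LaurentSeries k) x₀) [FiniteDimensional (LaurentSeries k)⟮x₀⟯ F]
    {n : ℕ} {f : F} (hf : f ≠ 0) (h : ∀ O, Center k O → LocallyGood n O f) :
    f ∈ sumSq F (2 ^ (n + 1)) := by
  by_contra hfn
  have : CharZero F := charZero_of_injective_ringHom (baseHom k F).injective
  obtain ⟨T, hT, ht⟩ := exists_finset_witness two_ne_zero hfn h
  obtain ⟨x, b, d, hx, hbd⟩ := exists_transcendental_parameter hx₀ T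
  have := finiteDimensional_adjoin_of_transcendental hx₀ hx
  have hfin := finite_setOf_gaussAt (k := k) x
  have := hfin.to_subtype
  have hv2 : ∀ O, Center k O → O.valuation (2 : F) = 1 := by
    intro O hO
    have h2 := hO.baseHom_valuation (two_ne_zero (α := k))
    rwa [map_ofNat] at h2
  obtain ⟨e, he, he0, hε⟩ := exists_common_approx (m := 2 ^ (n + 1)) (f := f)
    (O := fun i : {O : ValuationSubring F | Center k O ∧ GaussAt k O x} => (i : ValuationSubring F))
    (fun i => i.2.2.isArch i.2.1) (fun i => i.2.1.ne_top) Subtype.val_injective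
    (fun i => (hv2 _ i.2.1).le) Nat.one_le_two_pow
    (fun i => exists_div_sub_one_lt (i.2.2.isArch i.2.1) (hv2 _ i.2.1) hf (h _ i.2.1))
  have hfe : f = e * (1 + (f / e - 1)) := by field_simp; ring
  have hε0 : f / e - 1 ≠ 0 := by
    intro h0
    rw [h0, add_zero, mul_one] at hfe
    exact hfn (hfe ▸ he)
  obtain ⟨q, hq, hqO⟩ := exists_monic_of_gaussAt hx hε0 fun O hO hG => hε ⟨O, hO, hG⟩
  have hq0 : q.eval₂ (baseHom k F) x ≠ 0 := by
    intro h0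
    refine (transcendental_iff.mp hx) (q.map (algebraMap k (LaurentSeries k))) ?_
      |> (Polynomial.map_ne_zero hq.ne_zero)
    rw [aeval_def, eval₂_map]
    exact h0
  have hx' := transcendental_add_inv hx hq
  have := finiteDimensional_adjoin_of_transcendental hx₀ hx'
  refine hfn (mem_sumSq_of_patch hx' (fun F' _ g φ hφ hr hX => ?_) fun F' _ g φ hφ hr hX => ?_)
  · exact mem_sumSq_of_powerSeries hT ht hbd hq hq0 g φ hφ hr hX
  · obtain ⟨r, hr⟩ := exists_sq_eq_one_add_of_polynomial hε0 (fun O hO hxO =>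
      have hxq := hO.of_add_inv_mem hq hq0 hxO
      hqO O hO hxq.1 hxq.2) g φ hr hX
    rw [hfe, map_mul, map_add, map_one, ← hr, mul_comm]
    exact sq_mul_mem_sumSq _ (map_mem_sumSq g he)

end LocalGlobal

section

open Polynomial

variable {Ω : Type u} [Field Ω]

/-- The elements generated from `S` by field operations and by the adjunction of a root of a
monic polynomial which is strictly smaller than all other roots. -/
inductive HensGen (O : ValuationSubring Ω) (S : Set Ω) : Ω → Prop
  | mem {z : Ω} (hz : z ∈ S) : HensGen O S z
  | zero : HensGen O S 0
  | one : HensGen O S 1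
  | add {y z : Ω} (hy : HensGen O S y) (hz : HensGen O S z) : HensGen O S (y + z)
  | neg {z : Ω} (hz : HensGen O S z) : HensGen O S (-z)
  | mul {y z : Ω} (hy : HensGen O S y) (hz : HensGen O S z) : HensGen O S (y * z)
  | inv {z : Ω} (hz : HensGen O S z) : HensGen O S z⁻¹
  | root {z : Ω} {R : Multiset Ω}
      (hP : ∀ i, HensGen O S (((X - C z) * (R.map fun r => X - C r).prod).coeff i))
      (hR : ∀ r ∈ R, O.valuation z < O.valuation r) : HensGen O S z

/-- The subfield generated by `S` which is henselian with respect to `O`. -/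
def hensClosure (O : ValuationSubring Ω) (S : Set Ω) : Subfield Ω where
  carrier := {z | HensGen O S z}
  zero_mem' := .zero
  one_mem' := .one
  add_mem' := .add
  mul_mem' := .mul
  neg_mem' := .neg
  inv_mem' _ := .inv

/-- A root of a monic polynomial over `H` which is smaller than all other roots lies in `H`. -/
def IsHens (O : ValuationSubring Ω) (H : Subfield Ω) : Prop :=
  ∀ (z : Ω) (R : Multiset Ω),
    (∀ i, ((X - C z) * (R.map fun r => X - C r).prod).coeff i ∈ H) →
    (∀ r ∈ R, O.valuation z < O.valuation r) → z ∈ H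

variable {O : ValuationSubring Ω} {S T : Set Ω} {H : Subfield Ω}

theorem isHens_hensClosure : IsHens O (hensClosure O S) := fun _ _ hP hR => .root hP hR

theorem subset_hensClosure : S ⊆ hensClosure O S := fun _ => .mem

theorem hensClosure_le (hH : IsHens O H) (hS : S ⊆ H) : hensClosure O S ≤ H := by
  intro z hz
  change HensGen O S z at hz
  induction hz with
  | mem hz => exact hS hz
  | zero => exact zero_mem _
  | one => exact one_mem _
  | add _ _ hy hz => exact add_mem hy hz
  | neg _ hz => exact neg_mem hz
  | mul _ _ hy hz => exact mul_mem hy hz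
  | inv _ hz => exact inv_mem hz
  | root _ hR hP => exact hH _ _ hP hR

theorem hensClosure_le_of_subset (h : S ⊆ hensClosure O T) : hensClosure O S ≤ hensClosure O T :=
  hensClosure_le isHens_hensClosure h

theorem hensClosure_mono (h : S ⊆ T) : hensClosure O S ≤ hensClosure O T :=
  hensClosure_le_of_subset (h.trans subset_hensClosure)

theorem monic_X_sub_C_mul_prod (z : Ω) (R : Multiset Ω) :
    ((X - C z) * (R.map fun r => X - C r).prod).Monic :=
  (monic_X_sub_C z).mul (monic_multiset_prod_of_monic _ _ fun r _ => monic_X_sub_C r)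

theorem isHens_of_isAlgebraic (hH : ∀ z, IsAlgebraic H z → z ∈ H) : IsHens O H := by
  intro z R hP _
  have hlift : (X - C z) * (R.map fun r => X - C r).prod ∈ Polynomial.lifts H.subtype := by
    rw [Polynomial.lifts_iff_coeff_lifts]
    intro i
    exact ⟨⟨_, hP i⟩, rfl⟩
  obtain ⟨p, hp⟩ := hlift
  refine hH z ⟨p, ?_, ?_⟩
  · rintro rfl
    exact (monic_X_sub_C_mul_prod z R).ne_zero (by simpa using hp.symm)
  · have : (p.map H.subtype).eval z = 0 := by
      have hp' : p.map H.subtype = (X - C z) * (R.map fun r => X - C r).prod := hp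
      rw [hp']; simp
    rw [aeval_def, ← eval_map]
    exact this

theorem HensGen.exists_finite {z : Ω} (hz : HensGen O S z) :
    ∃ T ⊆ S, T.Finite ∧ HensGen O T z := by
  induction hz with
  | @mem z hz => exact ⟨{z}, by simpa using hz, Set.finite_singleton z, .mem rfl⟩
  | zero => exact ⟨∅, by simp, Set.finite_empty, .zero⟩
  | one => exact ⟨∅, by simp, Set.finite_empty, .one⟩
  | add _ _ hy hz =>
    obtain ⟨A, hA, hAf, hy⟩ := hy
    obtain ⟨B, hB, hBf, hz⟩ := hz
    exact ⟨A ∪ B, Set.union_subset hA hB, hAf.union hBf,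
      .add (hensClosure_mono Set.subset_union_left hy) (hensClosure_mono Set.subset_union_right hz)⟩
  | neg _ hz =>
    obtain ⟨A, hA, hAf, hz⟩ := hz
    exact ⟨A, hA, hAf, .neg hz⟩
  | mul _ _ hy hz =>
    obtain ⟨A, hA, hAf, hy⟩ := hy
    obtain ⟨B, hB, hBf, hz⟩ := hz
    exact ⟨A ∪ B, Set.union_subset hA hB, hAf.union hBf,
      .mul (hensClosure_mono Set.subset_union_left hy) (hensClosure_mono Set.subset_union_right hz)⟩
  | inv _ hz =>
    obtain ⟨A, hA, hAf, hz⟩ := hz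
    exact ⟨A, hA, hAf, .inv hz⟩
  | @root z R _ hR hP =>
    choose A hA hAf hP using hP
    set d := ((X - C z) * (R.map fun r => X - C r).prod).natDegree
    refine ⟨⋃ i ∈ Finset.range (d + 1), A i, by simpa using fun i _ => hA i,
      Set.Finite.biUnion (Finset.finite_toSet _) fun i _ => hAf i, .root (fun i => ?_) hR⟩
    by_cases hi : i ≤ d
    · exact hensClosure_mono (Set.subset_biUnion_of_mem (u := A)
        (Finset.mem_coe.mpr (Finset.mem_range_succ_iff.mpr hi))) (hP i)
    · rw [coeff_eq_zero_of_natDegree_lt (not_le.mp hi)]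
      exact .zero

theorem exists_finite_subset_hensClosure (hT : T.Finite) (h : T ⊆ hensClosure O S) :
    ∃ S' ⊆ S, S'.Finite ∧ T ⊆ hensClosure O S' := by
  have (z : T) : ∃ S' ⊆ S, S'.Finite ∧ HensGen O S' z := (show HensGen O S z from h z.2).exists_finite
  choose A hA hAf h using this
  have := hT.to_subtype
  exact ⟨⋃ z, A z, Set.iUnion_subset hA, Set.finite_iUnion hAf,
    fun z hz => hensClosure_mono (Set.subset_iUnion A ⟨z, hz⟩) (h ⟨z, hz⟩)⟩

theorem HensGen.eventually {ι : Type*} {U : Filter ι} {O' : ι → ValuationSubring Ω}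
    (hO : ∀ y z, O.valuation y < O.valuation z → ∀ᶠ i in U, (O' i).valuation y < (O' i).valuation z)
    {z : Ω} (hz : HensGen O S z) : ∀ᶠ i in U, HensGen (O' i) S z := by
  induction hz with
  | mem hz => exact .of_forall fun _ => .mem hz
  | zero => exact .of_forall fun _ => .zero
  | one => exact .of_forall fun _ => .one
  | add _ _ hy hz => filter_upwards [hy, hz] with i hy hz using .add hy hz
  | neg _ hz => filter_upwards [hz] with i hz using .neg hz
  | mul _ _ hy hz => filter_upwards [hy, hz] with i hy hz using .mul hy hz
  | inv _ hz => filter_upwards [hz] with i hz using .inv hz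
  | @root z R _ hR hP =>
    classical
    set d := ((X - C z) * (R.map fun r => X - C r).prod).natDegree
    have h1 := (Filter.eventually_all_finset (Finset.range (d + 1))).mpr fun j _ => hP j
    have h2 := (Filter.eventually_all_finset R.toFinset).mpr fun r hr =>
      hO z r (hR r (Multiset.mem_toFinset.mp hr))
    filter_upwards [h1, h2] with i h1 h2
    refine .root (fun j => ?_) fun r hr => h2 r (Multiset.mem_toFinset.mpr hr)
    by_cases hj : j ≤ d
    · exact h1 j (Finset.mem_range_succ_iff.mpr hj)
    · rw [coeff_eq_zero_of_natDegree_lt (not_le.mp hj)]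
      exact .zero

/-- The elements approximated arbitrarily well by elements of `M`. -/
def limitField (O : ValuationSubring Ω) (M : Subfield Ω) : Subfield Ω where
  carrier := {z | ∀ δ ≠ 0, ∃ c ∈ M, O.valuation (z - c) < O.valuation δ}
  zero_mem' δ hδ := ⟨0, zero_mem _, by simpa [zero_lt_iff] using hδ⟩
  one_mem' δ hδ := ⟨1, one_mem _, by simpa [zero_lt_iff] using hδ⟩
  add_mem' {a b} ha hb δ hδ := by
    obtain ⟨c, hc, hca⟩ := ha δ hδ
    obtain ⟨d, hd, hdb⟩ := hb δ hδ
    refine ⟨c + d, add_mem hc hd, ?_⟩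
    rw [add_sub_add_comm]
    exact Valuation.map_add_lt _ hca hdb
  neg_mem' {a} ha δ hδ := by
    obtain ⟨c, hc, hca⟩ := ha δ hδ
    refine ⟨-c, neg_mem hc, ?_⟩
    rwa [← neg_sub', Valuation.map_neg]
  mul_mem' {a b} ha hb δ hδ := by
    rcases eq_or_ne a 0 with rfl | ha0
    · exact ⟨0, zero_mem _, by simpa [zero_lt_iff] using hδ⟩
    obtain ⟨d, hd, hdb⟩ := hb (δ / a) (div_ne_zero hδ ha0)
    have ha0' : 0 < O.valuation a := by simpa [zero_lt_iff] using ha0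
    have hbd : O.valuation (a * (b - d)) < O.valuation δ := by
      rw [map_mul]
      rw [map_div₀, lt_div_iff₀ ha0'] at hdb
      rwa [mul_comm]
    rcases eq_or_ne d 0 with rfl | hd0
    · exact ⟨0, zero_mem _, by simpa using hbd⟩
    obtain ⟨c, hc, hca⟩ := ha (δ / d) (div_ne_zero hδ hd0)
    have hd0' : 0 < O.valuation d := by simpa [zero_lt_iff] using hd0
    rw [map_div₀, lt_div_iff₀ hd0', ← map_mul] at hca
    refine ⟨c * d, mul_mem hc hd, ?_⟩
    rw [show a * b - c * d = a * (b - d) + (a - c) * d by ring]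
    exact Valuation.map_add_lt _ hbd hca
  inv_mem' a ha δ hδ := by
    rcases eq_or_ne a 0 with rfl | ha0
    · exact ⟨0, zero_mem _, by simpa [zero_lt_iff] using hδ⟩
    have ha0' : 0 < O.valuation a := by simpa [zero_lt_iff] using ha0
    obtain ⟨ε, hε0, hε1, hε2⟩ : ∃ ε ≠ 0, O.valuation ε ≤ O.valuation a ∧
        O.valuation ε ≤ O.valuation (δ * a * a) := by
      rcases le_total (O.valuation a) (O.valuation (δ * a * a)) with h | h
      · exact ⟨a, ha0, le_rfl, h⟩
      · exact ⟨δ * a * a, by simp [hδ, ha0], h, le_rfl⟩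
    obtain ⟨c, hc, hca⟩ := ha ε hε0
    have hcv : O.valuation c = O.valuation a := by
      have := Valuation.map_sub_eq_of_lt_right O.valuation (x := a - c) (y := a)
        (hca.trans_le hε1)
      simpa using this
    have hc0 : c ≠ 0 := by
      rintro rfl
      simp [ha0'.ne] at hcv
    refine ⟨c⁻¹, inv_mem hc, ?_⟩
    rw [show a⁻¹ - c⁻¹ = -((a - c) / (a * c)) by field_simp; ring, Valuation.map_neg, map_div₀,
      map_mul, hcv, div_lt_iff₀ (mul_pos ha0' ha0')]
    simpa [mul_assoc] using hca.trans_le hε2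

theorem le_limitField (M : Subfield Ω) : M ≤ limitField O M := fun z hz δ hδ =>
  ⟨z, hz, by simpa [zero_lt_iff] using hδ⟩

theorem valuation_mul_coeff_one_le {z a : Ω} (R : Multiset Ω)
    (h : ∀ r ∈ R, O.valuation z ≤ O.valuation (a * r)) :
    O.valuation (z * (R.map fun r => X - C r).prod.coeff 1) ≤
      O.valuation (a * (R.map fun r => X - C r).prod.coeff 0) := by
  induction R using Multiset.induction_on with
  | empty => simp [coeff_one]
  | cons r R ih =>
    have ih := ih fun s hs => h s (Multiset.mem_cons_of_mem hs)
    have hr := h r (Multiset.mem_cons_self r R)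
    rw [Multiset.map_cons, Multiset.prod_cons]
    set q := (R.map fun r => X - C r).prod
    have h1 : ((X - C r) * q).coeff 1 = q.coeff 0 - r * q.coeff 1 := by
      simp [sub_mul, coeff_X_mul]
    have h0 : ((X - C r) * q).coeff 0 = -(r * q.coeff 0) := by simp
    rw [h1, h0, mul_neg, Valuation.map_neg, mul_sub]
    refine Valuation.map_sub_le (v := O.valuation) ?_ ?_
    · rw [← mul_assoc, map_mul, map_mul O.valuation (a * r)]
      gcongr
    · rw [mul_left_comm, mul_left_comm a, map_mul, map_mul O.valuation r]
      gcongr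

theorem exists_valuation_le_mul {z : Ω} (R : Multiset Ω)
    (hR : ∀ r ∈ R, O.valuation z < O.valuation r) :
    ∃ a, O.valuation a < 1 ∧ ∀ r ∈ R, O.valuation z ≤ O.valuation (a * r) := by
  induction R using Multiset.induction_on with
  | empty => exact ⟨0, by simp⟩
  | cons r R ih =>
    obtain ⟨a, ha, h⟩ := ih fun s hs => hR s (Multiset.mem_cons_of_mem hs)
    have hr := hR r (Multiset.mem_cons_self r R)
    have hr0 : 0 < O.valuation r := lt_of_le_of_lt zero_le hr
    have hr0' : r ≠ 0 := by rintro rfl; simp at hr0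
    rcases le_total (O.valuation a) (O.valuation (z / r)) with hle | hle
    · refine ⟨z / r, by rwa [map_div₀, div_lt_one₀ hr0], fun s hs => ?_⟩
      rcases Multiset.mem_cons.mp hs with rfl | hs
      · rw [div_mul_cancel₀ _ hr0']
      · refine (h s hs).trans ?_
        rw [map_mul, map_mul]
        gcongr
    · refine ⟨a, ha, fun s hs => ?_⟩
      rcases Multiset.mem_cons.mp hs with rfl | hs
      · rw [map_div₀, div_le_iff₀ hr0, ← map_mul] at hle
        exact hle
      · exact h s hs

theorem coeff_comp_X_add_C_mem {P : Polynomial Ω} (hP : ∀ i, P.coeff i ∈ H) {c : Ω} (hc : c ∈ H) (i : ℕ) :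
    (P.comp (X + C c)).coeff i ∈ H := by
  obtain ⟨p, rfl⟩ : P ∈ Polynomial.lifts H.subtype := by
    rw [Polynomial.lifts_iff_coeff_lifts]
    exact fun i => ⟨⟨_, hP i⟩, rfl⟩
  have : (Polynomial.mapRingHom H.subtype p).comp (X + C c) =
      (p.comp (X + C (⟨c, hc⟩ : H))).map H.subtype := by
    simp [Polynomial.map_comp]
  rw [this, coeff_map]
  exact ((p.comp _).coeff i).2

theorem comp_X_sub_C_mul_prod (z c : Ω) (R : Multiset Ω) :
    ((X - C z) * (R.map fun r => X - C r).prod).comp (X + C c) =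
      (X - C (z - c)) * ((R.map fun r => r - c).map fun r => X - C r).prod := by
  rw [mul_comp, multiset_prod_comp, Multiset.map_map, Multiset.map_map]
  congr 2
  · simp; ring
  · refine Multiset.map_congr rfl fun r _ => ?_
    simp; ring

theorem isHens_limitField (hO : IsArch O) (M : Subfield Ω) : IsHens O (limitField O M) := by
  intro z R hP hR
  rcases eq_or_ne z 0 with rfl | hz0
  · exact zero_mem _
  obtain ⟨a, ha, har⟩ := exists_valuation_le_mul R hR
  have key (n : ℕ) : ∃ c ∈ limitField O M, O.valuation (z - c) ≤ O.valuation (a ^ n * z) := by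
    induction n with
    | zero => exact ⟨0, zero_mem _, by simp⟩
    | succ n ih =>
      obtain ⟨c, hc, hcz⟩ := ih
      have hcz' : O.valuation (z - c) ≤ O.valuation z := hcz.trans <| by
        rw [map_mul, map_pow]
        exact mul_le_of_le_one_left' (pow_le_one' ha.le n)
      have hcv : O.valuation c ≤ O.valuation z := by
        simpa using Valuation.map_sub_le (v := O.valuation) (x := z) (y := z - c) le_rfl hcz'
      have hrc (r) (hr : r ∈ R) : O.valuation (r - c) = O.valuation r :=
        Valuation.map_sub_eq_of_lt_left O.valuation (hcv.trans_lt (hR r hr))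
      have hP' (i) := coeff_comp_X_add_C_mem hP hc i
      rw [comp_X_sub_C_mul_prod] at hP'
      set R' := R.map fun r => r - c with hR'
      set q := (R'.map fun r => X - C r).prod with hq
      have hq0 : q.coeff 0 ≠ 0 := by
        rw [coeff_zero_eq_eval_zero, hq, eval_multiset_prod, Multiset.map_map, Ne,
          Multiset.prod_eq_zero_iff, hR', Multiset.map_map, Multiset.mem_map]
        rintro ⟨r, hr, hr0⟩
        have : c = r := by simpa [sub_eq_zero] using hr0
        have h1 := hrc r hr
        rw [this, sub_self, map_zero] at h1
        exact absurd (hR r hr) (by simp [← h1])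
      have hle : O.valuation ((z - c) * q.coeff 1) ≤ O.valuation (a * q.coeff 0) := by
        refine valuation_mul_coeff_one_le R' fun r' hr' => ?_
        obtain ⟨r, hr, rfl⟩ := Multiset.mem_map.mp hr'
        rw [map_mul, hrc r hr, ← map_mul]
        exact hcz'.trans (har r hr)
      have hq0' : 0 < O.valuation (q.coeff 0) := by simpa [zero_lt_iff] using hq0
      have hlt : O.valuation ((z - c) * q.coeff 1) < O.valuation (q.coeff 0) := by
        refine hle.trans_lt ?_
        rw [map_mul]
        exact mul_lt_of_lt_one_left hq0' ha
      have hp0 : ((X - C (z - c)) * q).coeff 0 = -((z - c) * q.coeff 0) := by simp; ring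
      have hp1 : ((X - C (z - c)) * q).coeff 1 = q.coeff 0 - (z - c) * q.coeff 1 := by
        rw [sub_mul, coeff_sub, coeff_X_mul, coeff_C_mul]
      have hp1v : O.valuation (((X - C (z - c)) * q).coeff 1) = O.valuation (q.coeff 0) := by
        rw [hp1]
        exact Valuation.map_sub_eq_of_lt_left O.valuation hlt
      have hp10 : ((X - C (z - c)) * q).coeff 1 ≠ 0 := by
        intro h0
        rw [h0, map_zero] at hp1v
        exact hq0'.ne hp1v
      refine ⟨c - ((X - C (z - c)) * q).coeff 0 / ((X - C (z - c)) * q).coeff 1,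
        sub_mem hc (div_mem (hP' 0) (hP' 1)), ?_⟩
      have heq : z - (c - ((X - C (z - c)) * q).coeff 0 / ((X - C (z - c)) * q).coeff 1) =
          -((z - c) * ((z - c) * q.coeff 1) / ((X - C (z - c)) * q).coeff 1) := by
        field_simp
        rw [hp0, hp1]
        ring
      rw [heq, Valuation.map_neg, map_div₀, hp1v, div_le_iff₀ hq0', map_mul, pow_succ',
        mul_assoc a, map_mul O.valuation a, mul_comm (O.valuation a), mul_assoc, ← map_mul _ a]
      gcongr
  intro δ hδ
  obtain ⟨n, hn⟩ := (hO.eventually ha z hδ).exists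
  obtain ⟨c, hc, hcz⟩ := key n
  obtain ⟨d, hd, hdc⟩ := hc δ hδ
  refine ⟨d, hd, ?_⟩
  rw [← sub_add_sub_cancel z c d]
  exact Valuation.map_add_lt _ (hcz.trans_lt hn) hdc

theorem hensClosure_le_limitField (hO : IsArch O) (M : Subfield Ω) :
    hensClosure O M ≤ limitField O M :=
  hensClosure_le (isHens_limitField hO M) (le_limitField M)

theorem mem_of_coeff_mem_of_isRoot {P : Polynomial Ω} (hP : P.Monic) (hO : ∀ i, P.coeff i ∈ O) {r : Ω}
    (hr : P.eval r = 0) : r ∈ O := by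
  obtain ⟨p, hp, -, hpm⟩ : ∃ p : O[X], p.map O.subtype = P ∧ p.natDegree = P.natDegree ∧ p.Monic := by
    refine Polynomial.lifts_and_natDegree_eq_and_monic ?_ hP
    rw [Polynomial.lifts_iff_coeff_lifts]
    exact fun i => ⟨⟨_, hO i⟩, rfl⟩
  have hint : IsIntegral O r := ⟨p, hpm, by
    rw [← eval_map]
    exact (congrArg (eval r) hp).trans hr⟩
  obtain ⟨y, hy⟩ := IsIntegrallyClosed.isIntegral_iff.mp hint
  rw [← hy]
  exact y.2

theorem coeff_prod_X_sub_C_mem {A : Type*} [SetLike A Ω] [SubringClass A Ω] {O : A}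
    (R : Multiset Ω) (hR : ∀ r ∈ R, r ∈ O) (i : ℕ) :
    (R.map fun r => X - C r).prod.coeff i ∈ O := by
  induction R using Multiset.induction_on generalizing i with
  | empty =>
    rw [Multiset.map_zero, Multiset.prod_zero, coeff_one]
    split_ifs
    · exact one_mem _
    · exact zero_mem _
  | cons r R ih =>
    have ih := ih fun s hs => hR s (Multiset.mem_cons_of_mem hs)
    rw [Multiset.map_cons, Multiset.prod_cons, sub_mul, coeff_sub, coeff_C_mul]
    refine sub_mem ?_ (mul_mem (hR r (Multiset.mem_cons_self r R)) (ih i))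
    cases i with
    | zero => simp [zero_mem O]
    | succ i => rw [coeff_X_mul]; exact ih i

theorem IsHens.exists_root [IsAlgClosed Ω] (hH : IsHens O H) {P : Polynomial Ω} (hP : P.Monic)
    (hPH : ∀ i, P.coeff i ∈ H) (hPO : ∀ i, P.coeff i ∈ O) {c : Ω} (hcH : c ∈ H) (hcO : c ∈ O)
    (h0 : O.valuation (P.eval c) < 1) (h1 : O.valuation (P.derivative.eval c) = 1) :
    ∃ z ∈ H, P.eval z = 0 ∧ O.valuation (z - c) < 1 := by
  have hroots := (IsAlgClosed.splits P).eq_prod_roots_of_monic hP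
  have hrO (r) (hr : r ∈ P.roots) : r ∈ O :=
    mem_of_coeff_mem_of_isRoot hP hPO ((mem_roots'.mp hr).2)
  obtain ⟨r, hr, hrc⟩ : ∃ r ∈ P.roots, O.valuation (r - c) < 1 := by
    by_contra! hcon
    refine h0.not_ge ?_
    rw [hroots, eval_multiset_prod, map_multiset_prod, Multiset.map_map, Multiset.map_map]
    refine Multiset.one_le_prod fun y hy => ?_
    obtain ⟨r, hr, rfl⟩ := Multiset.mem_map.mp hy
    simpa [Valuation.map_sub_swap] using hcon r hr
  obtain ⟨R, hR⟩ := Multiset.exists_cons_of_mem hr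
  rw [hR, Multiset.map_cons, Multiset.prod_cons] at hroots
  set q := (R.map fun r => X - C r).prod with hq
  have hqc : O.valuation (q.eval c) = 1 := by
    have hd : P.derivative.eval c = q.eval c - (r - c) * q.derivative.eval c := by
      rw [hroots]; simp; ring
    have hqd : O.valuation (q.derivative.eval c) ≤ 1 := by
      rw [O.valuation_le_one_iff, eval_eq_sum]
      refine sum_mem fun i _ => mul_mem ?_ (pow_mem hcO i)
      rw [coeff_derivative]
      exact mul_mem (coeff_prod_X_sub_C_mem (O := O) R (fun s hs => hrO s (by simp [hR, hs])) _)
        (by exact_mod_cast natCast_mem O (i + 1))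
    rw [hd] at h1
    have hlt : O.valuation ((r - c) * q.derivative.eval c) < 1 := by
      rw [map_mul]
      exact mul_lt_one_of_lt_of_le hrc hqd
    have := Valuation.map_add_eq_of_lt_right O.valuation (x := (r - c) * q.derivative.eval c)
      (y := q.eval c - (r - c) * q.derivative.eval c) (by rwa [h1])
    rw [h1] at this
    simpa using this
  have hRc (s) (hs : s ∈ R) : O.valuation (s - c) = 1 := by
    have hle (u) (hu : u ∈ R) : O.valuation (u - c) ≤ 1 :=
      (O.valuation_le_one_iff _).mpr (sub_mem (hrO u (by simp [hR, hu])) hcO)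
    obtain ⟨R', rfl⟩ := Multiset.exists_cons_of_mem hs
    refine le_antisymm (hle s hs) ?_
    rw [hq, Multiset.map_cons, Multiset.prod_cons, eval_mul, map_mul, eval_multiset_prod,
      map_multiset_prod, Multiset.map_map, Multiset.map_map] at hqc
    rw [← hqc]
    have hle' : (Multiset.map ((fun x => O.valuation x) ∘ (fun p : Polynomial Ω => eval c p) ∘
        fun r => X - C r) R').prod ≤ 1 := by
      refine Multiset.prod_induction (· ≤ 1) _ (fun _ _ => mul_le_one') le_rfl fun y hy => ?_
      obtain ⟨u, hu, rfl⟩ := Multiset.mem_map.mp hy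
      simpa [Valuation.map_sub_swap] using hle u (Multiset.mem_cons_of_mem hu)
    refine (mul_le_of_le_one_right' hle').trans ?_
    simp [Valuation.map_sub_swap]
  have hmem : r - c ∈ H := by
    refine hH (r - c) (R.map fun s => s - c) ?_ ?_
    · rw [← comp_X_sub_C_mul_prod, ← hq, ← hroots]
      exact fun i => coeff_comp_X_add_C_mem hPH hcH i
    · intro s' hs'
      obtain ⟨s, hs, rfl⟩ := Multiset.mem_map.mp hs'
      rwa [hRc s hs]
  refine ⟨r, ?_, (mem_roots'.mp hr).2, hrc⟩
  simpa using add_mem hmem hcH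

end

section

open Polynomial

variable {Ω : Type u} [Field Ω] [IsAlgClosed Ω] {O : ValuationSubring Ω} {H H₂ : Subfield Ω}

theorem IsHens.valuation_algEquiv [CharZero Ω] (hH : IsHens O H)
    (σ : algebraicClosure H Ω ≃ₐ[H] algebraicClosure H Ω) (z : algebraicClosure H Ω) :
    O.valuation (σ z : Ω) = O.valuation (z : Ω) := by
  classical
  let v : algebraicClosure H Ω → O.ValueGroup := fun m => O.valuation (m : Ω)
  have hvm (a b : algebraicClosure H Ω) : v (a * b) = v a * v b := map_mul O.valuation _ _
  have hv0 (a : algebraicClosure H Ω) (ha : a ≠ 0) : 0 < v a := by simpa [v, zero_lt_iff] using ha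
  have hvprod (s : Finset (algebraicClosure H Ω)) : v (∏ r ∈ s, r) = ∏ r ∈ s, v r := by
    induction s using Finset.induction_on with
    | empty => simp [v]
    | insert a s ha ih => rw [Finset.prod_insert ha, Finset.prod_insert ha, hvm, ih]
  change v (σ z) = v z
  rcases eq_or_ne z 0 with rfl | hz0
  · simp
  have hmon : (minpoly H z).Monic := minpoly.monic (Algebra.IsIntegral.isIntegral z)
  set s := ((minpoly H z).map (algebraMap H (algebraicClosure H Ω))).roots.toFinset with hs
  have hs_mem (r : algebraicClosure H Ω) : r ∈ s ↔ aeval r (minpoly H z) = 0 := by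
    rw [hs, Multiset.mem_toFinset, mem_roots (hmon.map _).ne_zero, IsRoot.def, eval_map_algebraMap]
  have hσs (τ : algebraicClosure H Ω ≃ₐ[H] algebraicClosure H Ω) (r : algebraicClosure H Ω) (hr : r ∈ s) : τ r ∈ s := by
    rw [hs_mem] at hr ⊢
    rw [aeval_algHom_apply, hr, map_zero]
  have hs0 (r : algebraicClosure H Ω) (hr : r ∈ s) : r ≠ 0 := by
    obtain ⟨τ, rfl⟩ := minpoly.exists_algEquiv_of_root'
      (Algebra.IsAlgebraic.isAlgebraic (R := H) z) ((hs_mem r).mp hr)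
    simpa using hz0
  obtain ⟨z₀, hz₀, hmin⟩ := Finset.exists_min_image s v ⟨z, (hs_mem z).mpr (minpoly.aeval H z)⟩
  set S := s.filter fun r => v r = v z₀ with hS
  have key (τ : algebraicClosure H Ω ≃ₐ[H] algebraicClosure H Ω) (h : v (τ (∏ r ∈ S, r)) ≤ v (∏ r ∈ S, r)) : S.image τ = S := by
    refine Finset.eq_of_subset_of_card_le ?_
      (Finset.card_image_of_injective S τ.injective).ge
    by_contra hcon
    obtain ⟨r', hr', hr'S⟩ := Finset.not_subset.mp hcon
    obtain ⟨r, hr, rfl⟩ := Finset.mem_image.mp hr'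
    refine h.not_gt ?_
    rw [map_prod, ← Finset.prod_image (f := fun r => r) (g := fun r => τ r) τ.injective.injOn,
      hvprod, hvprod, Finset.prod_image τ.injective.injOn]
    have hS' (r) (hr : r ∈ S) : r ∈ s ∧ v r = v z₀ := Finset.mem_filter.mp hr
    refine Finset.prod_lt_prod (fun r hr => hv0 _ (hs0 r (hS' r hr).1)) (fun r hr => ?_) ⟨r, hr, ?_⟩
    · rw [(hS' r hr).2]
      exact hmin _ (hσs τ r (hS' r hr).1)
    · rw [(hS' r hr).2]
      refine lt_of_le_of_ne (hmin _ (hσs τ r (hS' r hr).1)) fun heq => hr'S ?_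
      exact Finset.mem_filter.mpr ⟨hσs τ r (hS' r hr).1, heq.symm⟩
  set θ := ∏ r ∈ S, r with hθ
  have hθH : (θ : Ω) ∈ H := by
    have hint : IsIntegral H (θ : Ω) := θ.2
    have hroot : (θ : Ω) ∈ ((minpoly H (θ : Ω)).map (algebraMap H Ω)).roots := by
      rw [mem_roots ((minpoly.monic hint).map _).ne_zero, IsRoot.def, eval_map_algebraMap,
        minpoly.aeval]
    obtain ⟨R, hR⟩ := Multiset.exists_cons_of_mem hroot
    have hsplit := (IsAlgClosed.splits ((minpoly H (θ : Ω)).map (algebraMap H Ω)))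
      |>.eq_prod_roots_of_monic ((minpoly.monic hint).map _)
    rw [hR, Multiset.map_cons, Multiset.prod_cons] at hsplit
    have hnd : ((minpoly H (θ : Ω)).map (algebraMap H Ω)).roots.Nodup :=
      nodup_roots (minpoly.irreducible hint).separable.map
    rw [hR, Multiset.nodup_cons] at hnd
    refine hH θ R (fun i => ?_) fun r hr => ?_
    · rw [← hsplit, coeff_map]
      exact ((minpoly H (θ : Ω)).coeff i).2
    · have hr' : r ∈ ((minpoly H (θ : Ω)).map (algebraMap H Ω)).roots := by rw [hR]; simp [hr]
      have hroot : aeval r (minpoly H (θ : Ω)) = 0 := by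
        simpa [IsRoot.def, eval_map_algebraMap] using (mem_roots'.mp hr').2
      have hrM : r ∈ algebraicClosure H Ω := by
        rw [mem_algebraicClosure_iff]
        exact ⟨_, (minpoly.monic hint).ne_zero, hroot⟩
      have hmp : minpoly H (θ : Ω) = minpoly H θ :=
        minpoly.algebraMap_eq (algebraMap (algebraicClosure H Ω) Ω).injective θ
      have hrootM : aeval (⟨r, hrM⟩ : algebraicClosure H Ω) (minpoly H θ) = 0 := by
        apply (algebraMap (algebraicClosure H Ω) Ω).injective
        rw [← aeval_algebraMap_apply, map_zero, ← hmp]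
        exact hroot
      obtain ⟨τ, hτ⟩ := minpoly.exists_algEquiv_of_root'
        (Algebra.IsAlgebraic.isAlgebraic (R := H) θ) hrootM
      by_contra! hle
      have hτθ : v (τ θ) ≤ v θ := by rw [hτ]; exact hle
      have himg := key τ hτθ
      have : τ θ = θ := by
        rw [hθ, map_prod, ← Finset.prod_image (f := fun r => r) (g := fun r => τ r)
          τ.injective.injOn, himg]
      rw [this] at hτ
      have hr2 : r = (θ : Ω) := by rw [hτ]
      exact hnd.1 (hr2 ▸ hr)
  have hall (τ : algebraicClosure H Ω ≃ₐ[H] algebraicClosure H Ω) : v (τ z₀) = v z₀ := by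
    have hfix : τ θ = θ := by
      have : θ = algebraMap H (algebraicClosure H Ω) ⟨_, hθH⟩ := rfl
      rw [this, AlgEquiv.commutes]
    have himg := key τ (by rw [hfix])
    have : τ z₀ ∈ S := himg ▸ Finset.mem_image_of_mem τ (Finset.mem_filter.mpr ⟨hz₀, rfl⟩)
    exact (Finset.mem_filter.mp this).2
  obtain ⟨τ, hτ⟩ := minpoly.exists_algEquiv_of_root'
      (Algebra.IsAlgebraic.isAlgebraic (R := H) z) ((hs_mem z₀).mp hz₀)
  have hz : z = τ.symm z₀ := by rw [← hτ]; simp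
  rw [hz, hall]
  exact hall (τ.symm.trans σ)

theorem IsHens.valuation_eq_of_isRoot [CharZero Ω] (hH : IsHens O H) {z r : Ω}
    (hz : IsIntegral H z) (hr : aeval r (minpoly H z) = 0) {c : Ω} (hc : c ∈ H) :
    O.valuation (r - c) = O.valuation (z - c) := by
  have hrM : r ∈ algebraicClosure H Ω := by
    rw [mem_algebraicClosure_iff]
    exact ⟨_, (minpoly.monic hz).ne_zero, hr⟩
  have hmp : minpoly H z = minpoly H (⟨z, hz⟩ : algebraicClosure H Ω) :=
    minpoly.algebraMap_eq (algebraMap (algebraicClosure H Ω) Ω).injective ⟨z, hz⟩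
  have hrootM : aeval (⟨r, hrM⟩ : algebraicClosure H Ω)
      (minpoly H (⟨z, hz⟩ : algebraicClosure H Ω)) = 0 := by
    apply (algebraMap (algebraicClosure H Ω) Ω).injective
    rw [← aeval_algebraMap_apply, map_zero, ← hmp]
    exact hr
  obtain ⟨τ, hτ⟩ := minpoly.exists_algEquiv_of_root'
    (Algebra.IsAlgebraic.isAlgebraic (R := H) (⟨z, hz⟩ : algebraicClosure H Ω)) hrootM
  have := hH.valuation_algEquiv τ (⟨z, hz⟩ - algebraMap H _ ⟨c, hc⟩)
  rw [map_sub, AlgEquiv.commutes, hτ] at this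
  exact this

theorem IsHens.mem_of_forall_exists [CharZero Ω] (hn : ∀ n : ℕ, n ≠ 0 → O.valuation (n : Ω) = 1)
    (hH : IsHens O H) (hle : H ≤ H₂)
    (h : ∀ z ∈ H₂, z ≠ 0 → ∃ s ∈ H, O.valuation (z - s) < O.valuation z) {z : Ω} (hz : z ∈ H₂)
    (hza : IsIntegral H z) : z ∈ H := by
  set p := (minpoly H z).map (algebraMap H Ω) with hp
  have hpm : p.Monic := (minpoly.monic hza).map _
  have hd : p.natDegree ≠ 0 := by
    rw [hp, natDegree_map]
    exact (minpoly.natDegree_pos hza).ne'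
  have hd' : (p.natDegree : Ω) ≠ 0 := by exact_mod_cast hd
  have hsum : p.roots.sum ∈ H := by
    have h1 := (IsAlgClosed.splits p).nextCoeff_eq_neg_sum_roots_of_monic hpm
    have h2 : p.nextCoeff ∈ H := by
      rw [nextCoeff_of_natDegree_pos (Nat.pos_of_ne_zero hd), hp, coeff_map]
      exact ((minpoly H z).coeff _).2
    rw [h1] at h2
    simpa using neg_mem h2
  set c := p.roots.sum / p.natDegree with hc
  have hcH : c ∈ H := div_mem hsum (natCast_mem H _)
  by_cases hzc : z - c = 0
  · rwa [sub_eq_zero.mp hzc]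
  obtain ⟨s, hs, hzs⟩ := h (z - c) (sub_mem hz (hle hcH)) hzc
  have hsv : O.valuation s = O.valuation (z - c) := by
    have := Valuation.map_sub_eq_of_lt_left O.valuation hzs
    simpa using this
  have hroot (r) (hr : r ∈ p.roots) : O.valuation (r - (c + s)) < O.valuation s := by
    have hr' : aeval r (minpoly H z) = 0 := by
      have := (mem_roots'.mp hr).2
      rwa [hp, IsRoot.def, eval_map_algebraMap] at this
    rw [hH.valuation_eq_of_isRoot hza hr' (add_mem hcH hs), hsv]
    simpa [sub_sub] using hzs
  have hs0 : 0 < O.valuation s := by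
    rw [hsv]
    simpa [zero_lt_iff] using hzc
  have hlt : O.valuation (p.roots.map fun r => r - (c + s)).sum < O.valuation s := by
    refine Multiset.sum_induction (fun y => O.valuation y < O.valuation s) _
      (fun _ _ => Valuation.map_add_lt _) (by simpa using hs0) fun y hy => ?_
    obtain ⟨r, hr, rfl⟩ := Multiset.mem_map.mp hy
    exact hroot r hr
  have heq : (p.roots.map fun r => r - (c + s)).sum = -(p.natDegree * s) := by
    rw [Multiset.sum_map_sub, Multiset.map_id', Multiset.map_const', Multiset.sum_replicate,
      ← (IsAlgClosed.splits p).natDegree_eq_card_roots, nsmul_eq_mul, hc]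
    field_simp
    ring
  rw [heq, Valuation.map_neg, map_mul, hn _ hd, one_mul] at hlt
  exact absurd hlt (lt_irrefl _)

theorem IsHens.exists_pow_eq (hn : ∀ n : ℕ, n ≠ 0 → O.valuation (n : Ω) = 1) (hH : IsHens O H)
    {z w : Ω} (hz : z ∈ H) (hw : w ∈ H) (hz0 : z ≠ 0) {e : ℕ} (he : 0 < e)
    (h : O.valuation (z ^ e - w) < O.valuation (z ^ e)) :
    ∃ s ∈ H, s ^ e = w ∧ O.valuation (z - s) < O.valuation z := by
  have hze : 0 < O.valuation (z ^ e) := (Valuation.pos_iff _).mpr (pow_ne_zero e hz0)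
  have hv : O.valuation (1 - w / z ^ e) < 1 := by
    rwa [one_sub_div (pow_ne_zero e hz0), map_div₀, div_lt_one₀ hze]
  have hwO : w / z ^ e ∈ O := by
    rw [← O.valuation_le_one_iff]
    simpa using Valuation.map_sub_le (v := O.valuation) (x := 1) (y := 1 - w / z ^ e) (g := 1)
      (by simp) hv.le
  obtain ⟨ρ, hρ, hroot, hρ1⟩ := hH.exists_root (P := X ^ e - C (w / z ^ e)) (c := 1)
    (monic_X_pow_sub_C _ he.ne')
    (fun i => by
      rw [coeff_sub, coeff_X_pow, coeff_C]
      refine sub_mem ?_ ?_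
      · split_ifs; exacts [one_mem _, zero_mem _]
      · split_ifs; exacts [div_mem hw (pow_mem hz e), zero_mem _])
    (fun i => by
      rw [coeff_sub, coeff_X_pow, coeff_C]
      refine sub_mem ?_ ?_
      · split_ifs; exacts [one_mem _, zero_mem _]
      · split_ifs; exacts [hwO, zero_mem _]) (one_mem _) (one_mem _)
    (by simpa using hv) (by simpa [derivative_X_pow] using hn e he.ne')
  refine ⟨z * ρ, mul_mem hz hρ, ?_, ?_⟩
  · have : ρ ^ e = w / z ^ e := by simpa [sub_eq_zero] using hroot
    rw [mul_pow, this]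
    field_simp
  · rw [show z - z * ρ = z * -(ρ - 1) by ring, map_mul, Valuation.map_neg]
    exact mul_lt_of_lt_one_right (by simpa [zero_lt_iff] using hz0) hρ1

/-- The residue of `z` is algebraic over `K₀`. -/
def ResAlg (O : ValuationSubring Ω) (K₀ : Subfield Ω) (z : Ω) : Prop :=
  ∃ P : Polynomial K₀, P.Monic ∧ O.valuation (aeval z P) < 1

theorem IsHens.exists_isAlgebraic_of_resAlg
    (hn : ∀ n : ℕ, n ≠ 0 → O.valuation (n : Ω) = 1) (hH : IsHens O H) {K₀ : Subfield Ω}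
    (hK : K₀ ≤ H) (hKO : ∀ a ∈ K₀, a ∈ O) {z : Ω} (hz : z ∈ H) (hz1 : O.valuation z = 1)
    (hres : ResAlg O K₀ z) :
    ∃ m ∈ H, IsAlgebraic K₀ m ∧ O.valuation (z - m) < 1 := by
  classical
  have hex : ∃ d, ∃ P : Polynomial K₀, P.Monic ∧ O.valuation (aeval z P) < 1 ∧ P.natDegree = d := by
    obtain ⟨P, hP, h⟩ := hres
    exact ⟨_, P, hP, h, rfl⟩
  obtain ⟨P, hPm, hPz, hPd⟩ := Nat.find_spec hex
  have hzO : z ∈ O := (O.valuation_le_one_iff z).mp hz1.le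
  have hd0 : P.natDegree ≠ 0 := by
    intro h0
    rw [hPm.natDegree_eq_zero.mp h0] at hPz
    simp at hPz
  have : CharZero K₀ := by
    refine charZero_of_inj_zero fun n hn0 => ?_
    by_contra hne
    have h1 := hn n hne
    have : (n : Ω) = 0 := by simpa using congrArg (algebraMap K₀ Ω) hn0
    simp [this] at h1
  have hdK : (P.natDegree : K₀) ≠ 0 := by exact_mod_cast hd0
  have hderiv : O.valuation (aeval z P.derivative) = 1 := by
    refine le_antisymm ?_ ?_
    · rw [O.valuation_le_one_iff, aeval_eq_sum_range]
      refine sum_mem fun i _ => ?_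
      rw [Algebra.smul_def]
      exact mul_mem (hKO _ (P.derivative.coeff i).2) (pow_mem hzO i)
    · by_contra! hlt
      have hlead : P.derivative.coeff (P.natDegree - 1) = P.natDegree := by
        rw [coeff_derivative, Nat.sub_add_cancel (Nat.pos_of_ne_zero hd0), hPm.coeff_natDegree,
          one_mul]
        exact_mod_cast Nat.sub_add_cancel (Nat.pos_of_ne_zero hd0)
      have hdeg : P.derivative.natDegree = P.natDegree - 1 :=
        le_antisymm (natDegree_derivative_le P) (le_natDegree_of_ne_zero (by rwa [hlead]))
      refine Nat.find_min hex (m := P.natDegree - 1) (by omega)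
        ⟨C (P.natDegree : K₀)⁻¹ * P.derivative, ?_, ?_, ?_⟩
      · rw [Monic, leadingCoeff_mul, leadingCoeff_C, leadingCoeff, hdeg, hlead, inv_mul_cancel₀ hdK]
      · rw [map_mul, aeval_C, map_mul, map_inv₀, map_inv₀, map_natCast, hn _ hd0]
        simpa using hlt
      · rw [natDegree_C_mul (inv_ne_zero hdK), hdeg]
  have hcoe (i) : (P.map (algebraMap K₀ Ω)).coeff i ∈ K₀ := by
    rw [coeff_map]
    exact (P.coeff i).2
  obtain ⟨m, hm, hroot, hmz⟩ := hH.exists_root (P := P.map (algebraMap K₀ Ω)) (hPm.map _)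
    (fun i => hK (hcoe i)) (fun i => hKO _ (hcoe i)) hz hzO (by rwa [eval_map_algebraMap])
    (by rwa [derivative_map, eval_map_algebraMap])
  refine ⟨m, hm, ⟨P, hPm.ne_zero, by rwa [eval_map_algebraMap] at hroot⟩, ?_⟩
  rwa [Valuation.map_sub_swap]

end

section

open Polynomial IsLocalRing

variable {Ω : Type u} [Field Ω] {O : ValuationSubring Ω}

theorem isAlgebraic_of_subfield_le {B H : Subfield Ω} (h : B ≤ H) {z : Ω} (hz : IsAlgebraic B z) :
    IsAlgebraic H z := by
  obtain ⟨p, hp, hpz⟩ := hz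
  refine ⟨p.map (Subfield.inclusion h), (Polynomial.map_ne_zero_iff
    (Subfield.inclusion h).injective).mpr hp, ?_⟩
  rw [aeval_def, eval₂_map]
  exact hpz

theorem resAlg_iff {K₀ : Subfield Ω} (hK : ∀ a ∈ K₀, a ∈ O) (z : O) :
    ResAlg O K₀ z ↔ ((residue O).comp
      (K₀.subtype.codRestrict O.toSubring fun a => hK a a.2)).IsIntegralElem
        (residue O z) := by
  refine exists_congr fun P => and_congr_right fun _ => ?_
  rw [← hom_eval₂, residue_eq_zero_iff]
  have : ((eval₂ (K₀.subtype.codRestrict O.toSubring fun a => hK a a.2) z P : O) : Ω) =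
      aeval (z : Ω) P := hom_eval₂ P _ O.subtype z
  rw [this]

theorem ResAlg.of_isAlgebraic {K₀ B : Subfield Ω} (hK : ∀ a ∈ K₀, a ∈ O)
    (hB : ∀ b ∈ B, O.valuation b = 1 → ResAlg O K₀ b) {z : Ω} (hz : IsAlgebraic B z)
    (hz1 : O.valuation z = 1) : ResAlg O K₀ z := by
  classical
  have hzO : z ∈ O := (O.valuation_le_one_iff z).mp hz1.le
  obtain ⟨p, hp, hpz⟩ := hz
  obtain ⟨j, hj, hmax⟩ := Finset.exists_max_image p.support
    (fun i => O.valuation (p.coeff i : Ω)) (by simpa using hp)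
  have hj0 : p.coeff j ≠ 0 := mem_support_iff.mp hj
  have hjv : 0 < O.valuation (p.coeff j : Ω) := by simpa [zero_lt_iff] using hj0
  obtain ⟨q, hq⟩ : (C (p.coeff j)⁻¹ * p).map (algebraMap B Ω) ∈ Polynomial.lifts O.subtype := by
    rw [Polynomial.lifts_iff_coeff_lifts]
    intro i
    rw [coeff_map, coeff_C_mul]
    refine ⟨⟨_, ?_⟩, rfl⟩
    rw [← O.valuation_le_one_iff]
    change O.valuation ((p.coeff j : Ω)⁻¹ * p.coeff i) ≤ 1
    rw [map_mul, map_inv₀, ← div_eq_inv_mul, div_le_one₀ hjv]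
    by_cases hi : i ∈ p.support
    · exact hmax i hi
    · rw [notMem_support_iff.mp hi]; simp
  have hqi (i) : (q.coeff i : Ω) = (p.coeff j : Ω)⁻¹ * p.coeff i := by
    have := congrArg (fun f => coeff f i) hq
    simp only [coe_mapRingHom, coeff_map, coeff_C_mul, map_mul, map_inv₀] at this
    exact this
  have hqz : q.eval ⟨z, hzO⟩ = 0 := by
    apply O.subtype_injective
    rw [← eval_map_apply, map_zero]
    have hq' : q.map O.subtype = (C (p.coeff j)⁻¹ * p).map (algebraMap B Ω) := hq
    rw [hq', eval_map_algebraMap, map_mul]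
    simp [hpz]
  rw [resAlg_iff hK ⟨z, hzO⟩]
  let _ := ((residue O).comp
      (K₀.subtype.codRestrict O.toSubring fun a => hK a a.2)).toAlgebra
  have hcoe (i) : residue O (q.coeff i) ∈
      algebraicClosure K₀ (ResidueField O) := by
    rcases eq_or_ne (residue O (q.coeff i)) 0 with h0 | h0
    · rw [h0]; exact zero_mem _
    · have h1 : O.valuation (q.coeff i : Ω) = 1 :=
        le_antisymm ((O.valuation_le_one_iff _).mpr (q.coeff i).2)
          (not_lt.mp fun h => h0 ((residue_eq_zero_iff _).mpr h))
      exact (resAlg_iff hK _).mp (hB _ (by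
        rw [hqi]
        exact mul_mem (inv_mem (p.coeff j).2) (p.coeff i).2) h1)
  obtain ⟨Q, hQ⟩ : q.map (residue O) ∈ Polynomial.lifts
      (algebraMap (algebraicClosure K₀ (ResidueField O)) (ResidueField O)) := by
    rw [Polynomial.lifts_iff_coeff_lifts]
    intro i
    rw [coeff_map]
    exact ⟨⟨_, hcoe i⟩, rfl⟩
  have hQ' : Q.map (algebraMap (algebraicClosure K₀ (ResidueField O))
      (ResidueField O)) = q.map (residue O) := hQ
  have halg : IsAlgebraic (algebraicClosure K₀ (ResidueField O))
      (residue O ⟨z, hzO⟩) := by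
    refine ⟨Q, ?_, ?_⟩
    · rintro rfl
      have h1 : (q.map (residue O)).coeff j = 1 := by
        rw [coeff_map]
        have : q.coeff j = 1 := by
          apply O.subtype_injective
          change (q.coeff j : Ω) = 1
          rw [hqi, inv_mul_cancel₀]
          exact fun h => hj0 (Subtype.ext h)
        rw [this, map_one]
      rw [← hQ', Polynomial.map_zero, coeff_zero] at h1
      exact zero_ne_one h1
    · rw [← eval_map_algebraMap, hQ', eval_map_apply, hqz, map_zero]
  have hbot := algebraicClosure.algebraicClosure_eq_bot K₀ (ResidueField O)
  rw [← mem_algebraicClosure_iff, hbot, IntermediateField.mem_bot] at halg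
  obtain ⟨y, hy⟩ := halg
  rw [← hy]
  exact y.2

theorem exists_cyclic_reduction {H A : Subfield Ω} (hA : ∀ z, IsAlgebraic A z → z ∈ A) {τ : Ω}
    (hτ : τ ∈ H) (hτ0 : τ ≠ 0) {S : Set Ω} (hS : S.Finite)
    (h : ∀ s ∈ S, s ∈ H ∧ s ≠ 0 ∧ ∃ e : ℕ, 0 < e ∧ ∃ b : ℤ, ∃ m ∈ A, s ^ e = τ ^ b * m) :
    ∃ s ∈ H, s ≠ 0 ∧ (∃ e : ℕ, 0 < e ∧ ∃ m ∈ A, s ^ e = τ * m) ∧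
      ∀ s' ∈ S, ∃ i : ℤ, ∃ m ∈ A, s' = m * s ^ i := by
  induction S, hS using Set.Finite.induction_on with
  | empty => exact ⟨τ, hτ, hτ0, ⟨1, one_pos, 1, one_mem _, by simp⟩, by simp⟩
  | @insert s' S _ _ ih =>
    obtain ⟨s, hsH, hs0, ⟨e, he, m, hm, hsm⟩, hSs⟩ := ih fun r hr => h r (Set.mem_insert_of_mem _ hr)
    obtain ⟨hs'H, hs'0, e', he', b, m', hm', hs'm⟩ := h s' (Set.mem_insert _ _)
    have hm0 : m ≠ 0 := by rintro rfl; simp [hs0, he.ne'] at hsm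
    set g := Int.gcd (e' : ℤ) (e * b) with hg
    have hg0 : 0 < g := Int.gcd_pos_of_ne_zero_left _ (by exact_mod_cast he'.ne')
    obtain ⟨e₁, he₁⟩ : (g : ℤ) ∣ e' := Int.gcd_dvd_left ..
    obtain ⟨b₁, hb₁⟩ : (g : ℤ) ∣ e * b := Int.gcd_dvd_right ..
    have hg0' : (0 : ℤ) < g := by exact_mod_cast hg0
    have he₁0 : 0 < e₁ := pos_of_mul_pos_right
      (by rw [← he₁]; exact_mod_cast he') hg0'.le
    obtain ⟨u, v, huv⟩ : ∃ u v : ℤ, u * e₁ + v * b₁ = 1 := by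
      refine ⟨Int.gcdA e' (e * b), Int.gcdB e' (e * b), ?_⟩
      have := Int.gcd_eq_gcd_ab (e' : ℤ) (e * b)
      rw [← hg] at this
      refine mul_left_cancel₀ hg0'.ne' ?_
      calc (g : ℤ) * (_ * e₁ + _ * b₁) = (g * e₁) * Int.gcdA e' (e * b)
          + (g * b₁) * Int.gcdB e' (e * b) := by ring
        _ = g * 1 := by rw [← he₁, ← hb₁, mul_one, this]
    set α := s' ^ e₁ / s ^ b₁ with hα
    have hα0 : α ≠ 0 := div_ne_zero (zpow_ne_zero _ hs'0) (zpow_ne_zero _ hs0)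
    have hαA : α ∈ A := by
      refine hA α ⟨X ^ g - C (⟨m' / m ^ b, div_mem hm' (zpow_mem hm b)⟩ : A),
        X_pow_sub_C_ne_zero hg0 _, ?_⟩
      have h1 : s' ^ (e₁ * g) = τ ^ b * m' := by
        rw [mul_comm, ← he₁, zpow_natCast, hs'm]
      have h2 : s ^ (b₁ * g) = τ ^ b * m ^ b := by
        rw [mul_comm, ← hb₁, zpow_mul, zpow_natCast, hsm, mul_zpow]
      have h3 : α ^ g = m' / m ^ b := by
        rw [hα, div_pow, ← zpow_natCast, ← zpow_natCast (s ^ b₁), ← zpow_mul, ← zpow_mul, h1, h2,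
          mul_div_mul_left _ _ (zpow_ne_zero _ hτ0)]
      rw [map_sub, map_pow, aeval_X, aeval_C, h3]
      exact sub_self _
    have hs'e : s' ^ e₁ = α * s ^ b₁ := by
      rw [hα, div_mul_cancel₀ _ (zpow_ne_zero _ hs0)]
    have hq1 : (s ^ u * s' ^ v) ^ e₁ = α ^ v * s := by
      rw [mul_zpow, ← zpow_mul, ← zpow_mul, mul_comm v, zpow_mul s', hs'e, mul_zpow, ← zpow_mul,
        mul_left_comm, ← zpow_add₀ hs0, mul_comm b₁, huv, zpow_one]
    have hq2 : (s ^ u * s' ^ v) ^ b₁ = α ^ (-u) * s' := by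
      have : s ^ b₁ = α⁻¹ * s' ^ e₁ := by rw [hs'e, inv_mul_cancel_left₀ hα0]
      rw [mul_zpow, ← zpow_mul, ← zpow_mul, mul_comm u, zpow_mul s, this, mul_zpow, ← zpow_mul,
        mul_assoc, ← zpow_add₀ hs'0, mul_comm e₁, huv, zpow_one, inv_zpow, zpow_neg]
    have hq0 : s ^ u * s' ^ v ≠ 0 := mul_ne_zero (zpow_ne_zero _ hs0) (zpow_ne_zero _ hs'0)
    refine ⟨s ^ u * s' ^ v, mul_mem (zpow_mem hsH _) (zpow_mem hs'H _), hq0,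
      ⟨e₁.toNat * e, Nat.mul_pos (by omega) he, (α ^ v) ^ e * m,
        mul_mem (pow_mem (zpow_mem hαA _) _) hm, ?_⟩, ?_⟩
    · have : (s ^ u * s' ^ v) ^ e₁.toNat = α ^ v * s := by
        rw [← zpow_natCast, Int.toNat_of_nonneg he₁0.le, hq1]
      rw [pow_mul, this, mul_pow, hsm]
      ring
    · intro r hr
      rcases Set.mem_insert_iff.mp hr with rfl | hr
      · refine ⟨b₁, α ^ u, zpow_mem hαA _, ?_⟩
        rw [hq2, ← mul_assoc, ← zpow_add₀ hα0, add_neg_cancel, zpow_zero, one_mul]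
      · obtain ⟨i, c, hc, rfl⟩ := hSs r hr
        refine ⟨e₁ * i, c * (α ^ (-v)) ^ i, mul_mem hc (zpow_mem (zpow_mem hαA _) _), ?_⟩
        rw [zpow_mul, hq1, mul_assoc, ← mul_zpow, ← mul_assoc, ← zpow_add₀ hα0, neg_add_cancel,
          zpow_zero, one_mul]

theorem exists_hens_generators [IsAlgClosed Ω] [CharZero Ω]
    (hn : ∀ n : ℕ, n ≠ 0 → O.valuation (n : Ω) = 1) {A B K₀ H : Subfield Ω} (hH : IsHens O H)
    (hBH : B ≤ H) (hA : ∀ z, IsAlgebraic A z → z ∈ A) (hKH : K₀ ≤ H) (hKA : K₀ ≤ A)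
    (hK : ∀ a ∈ K₀, a ∈ O) (hB : ∀ b ∈ B, O.valuation b = 1 → ResAlg O K₀ b) {τ : Ω}
    (hτB : τ ∈ B) (hτ0 : τ ≠ 0)
    (hV : ∀ b ∈ B, b ≠ 0 → ∃ e : ℕ, 0 < e ∧ ∃ i : ℤ, ∃ m ∈ B, m ∈ A ∧
      O.valuation b ^ e = O.valuation (τ ^ i * m)) (hHB : ∀ z ∈ H, IsAlgebraic B z)
    {B₀ : Subfield Ω} (hB₀ : B₀ ≤ H) {T : Set Ω} (hT : T.Finite) (hTH : T ⊆ H)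
    (hTB : ∀ z ∈ T, IsAlgebraic B₀ z) :
    ∃ M : Set Ω, M.Finite ∧ M ⊆ H ∧ M ⊆ A ∧ ∃ s ∈ H, s ≠ 0 ∧
      (∃ e : ℕ, 0 < e ∧ ∃ m ∈ H, m ∈ A ∧ s ^ e = τ * m) ∧
      T ⊆ hensClosure O (B₀ ∪ M ∪ {s}) := by
  have hpow {z : Ω} (hzH : z ∈ H) (hz0 : z ≠ 0) :
      ∃ e : ℕ, 0 < e ∧ ∃ i : ℤ, ∃ m ∈ H, m ∈ A ∧
        O.valuation (z ^ e - τ ^ i * m) < O.valuation (z ^ e) := by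
    obtain ⟨e, he, b, hb0, hzb⟩ := exists_valuation_pow_eq O.valuation hz0 (hHB z hzH)
    obtain ⟨e', he', i, m, hmB, hmA, hbm⟩ := hV b b.2 (by simpa using hb0)
    have hzm : O.valuation (z ^ (e * e')) = O.valuation (τ ^ i * m) := by
      rw [map_pow, pow_mul, hzb, ← hbm]
      rfl
    have hze : 0 < O.valuation (z ^ (e * e')) :=
      (Valuation.pos_iff _).mpr (pow_ne_zero _ hz0)
    have hτm : τ ^ i * m ≠ 0 := by
      rw [← Valuation.ne_zero_iff O.valuation, ← hzm]
      exact hze.ne'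
    have hτmB : τ ^ i * m ∈ B := mul_mem (zpow_mem hτB i) hmB
    set w := z ^ (e * e') / (τ ^ i * m) with hw
    have hw1 : O.valuation w = 1 := by
      rw [hw, map_div₀, hzm, div_self]
      rw [← hzm]
      exact hze.ne'
    have hwalg : IsAlgebraic B w := by
      rw [hw, div_eq_mul_inv]
      exact ((hHB z hzH).pow _).mul (isAlgebraic_algebraMap (⟨_, inv_mem hτmB⟩ : B))
    have hwH : w ∈ H := div_mem (pow_mem hzH _) (hBH hτmB)
    obtain ⟨m', hm'H, hm'K, hm'⟩ := hH.exists_isAlgebraic_of_resAlg hn hKH hK hwH hw1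
      (ResAlg.of_isAlgebraic hK hB hwalg hw1)
    refine ⟨e * e', Nat.mul_pos he he', i, m * m', mul_mem (hBH hmB) hm'H,
      mul_mem hmA (hA _ (isAlgebraic_of_subfield_le hKA hm'K)), ?_⟩
    rw [show z ^ (e * e') - τ ^ i * (m * m') = (τ ^ i * m) * (w - m') by
        rw [mul_sub, hw, mul_div_cancel₀ _ hτm, mul_assoc],
      map_mul, ← hzm]
    exact mul_lt_of_lt_one_right hze hm'
  classical
  have hτ : τ ∈ H := hBH hτB
  set S : Set Ω := {s | s ∈ H ∧ s ≠ 0 ∧ ∃ e : ℕ, 0 < e ∧ ∃ b : ℤ, ∃ m ∈ A, s ^ e = τ ^ b * m}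
    with hS
  have hSH : hensClosure O (B₀ ∪ S) ≤ H :=
    hensClosure_le hH (Set.union_subset hB₀ fun s hs => hs.1)
  have hTS : T ⊆ hensClosure O (B₀ ∪ S) := by
    intro z hz
    refine isHens_hensClosure.mem_of_forall_exists hn hSH (fun y hy hy0 => ?_) (hTH hz)
      (isAlgebraic_of_subfield_le (fun y hy => subset_hensClosure (Or.inl hy)) (hTB z hz)).isIntegral
    obtain ⟨e, he, i, m, hmH, hmA, hm⟩ := hpow hy hy0
    obtain ⟨s, hsH, hse, hys⟩ := hH.exists_pow_eq hn hy (mul_mem (zpow_mem hτ i) hmH) hy0 he hm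
    have hs0 : s ≠ 0 := by
      rintro rfl
      rw [sub_zero] at hys
      exact lt_irrefl _ hys
    exact ⟨s, subset_hensClosure (Or.inr ⟨hsH, hs0, e, he, i, m, hmA, hse⟩), hys⟩
  obtain ⟨S', hS', hS'f, hTS'⟩ := exists_finite_subset_hensClosure hT hTS
  obtain ⟨s, hsH, hs0, ⟨e, he, m, hm, hsm⟩, hSs⟩ := exists_cyclic_reduction hA hτ hτ0
    (S := S' ∩ S) (hS'f.inter_of_left _) fun s hs => hs.2
  choose! i c hc hcs using hSs
  refine ⟨c '' (S' ∩ S), (hS'f.inter_of_left _).image c, ?_, ?_, s, hsH, hs0, ⟨e, he, m, ?_, hm, hsm⟩,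
    hTS'.trans (hensClosure_le_of_subset ?_)⟩
  · rintro _ ⟨r, hr, rfl⟩
    have : c r = r / s ^ i r := by
      rw [eq_div_iff (zpow_ne_zero _ hs0), ← hcs r hr]
    rw [this]
    exact div_mem hr.2.1 (zpow_mem hsH _)
  · rintro _ ⟨r, hr, rfl⟩
    exact hc r hr
  · have : m = s ^ e / τ := by rw [hsm, mul_div_cancel_left₀ _ hτ0]
    rw [this]
    exact div_mem (pow_mem hsH _) hτ
  · intro r hr
    rcases hS' hr with hrB | hrS
    · exact subset_hensClosure (Or.inl (Or.inl hrB))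
    · have hr' : r ∈ S' ∩ S := ⟨hr, hrS⟩
      have h1 : c r ∈ hensClosure O (B₀ ∪ c '' (S' ∩ S) ∪ {s}) :=
        subset_hensClosure (Or.inl (Or.inr ⟨r, hr', rfl⟩))
      have h2 : s ∈ hensClosure O (B₀ ∪ c '' (S' ∩ S) ∪ {s}) := subset_hensClosure (Or.inr rfl)
      have := mul_mem h1 (zpow_mem h2 (i r))
      rwa [← hcs r hr'] at this

/-- The relative algebraic closure of a subfield. -/
noncomputable def relAlg (E : Subfield Ω) : Subfield Ω := (algebraicClosure E Ω).toSubfield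

theorem mem_relAlg {E : Subfield Ω} {z : Ω} : z ∈ relAlg E ↔ IsAlgebraic E z :=
  mem_algebraicClosure_iff

theorem le_relAlg (E : Subfield Ω) : E ≤ relAlg E := fun z hz =>
  mem_relAlg.mpr (isAlgebraic_algebraMap (⟨z, hz⟩ : E))

theorem mem_relAlg_of_isAlgebraic {E : Subfield Ω} {z : Ω} (hz : IsAlgebraic (relAlg E) z) :
    z ∈ relAlg E := by
  have h : z ∈ algebraicClosure (algebraicClosure E Ω) Ω :=
    mem_algebraicClosure_iff.mpr hz
  rw [algebraicClosure.algebraicClosure_eq_bot, IntermediateField.mem_bot] at h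
  obtain ⟨w, rfl⟩ := h
  exact w.2

theorem relAlg_le {E E' : Subfield Ω} (h : E ≤ relAlg E') : relAlg E ≤ relAlg E' := fun _ hz =>
  mem_relAlg_of_isAlgebraic (isAlgebraic_of_subfield_le h (mem_relAlg.mp hz))

theorem hensClosure_le_relAlg {E : Subfield Ω} {S : Set Ω} (hS : S ⊆ relAlg E) :
    hensClosure O S ≤ relAlg E :=
  hensClosure_le (isHens_of_isAlgebraic fun _ => mem_relAlg_of_isAlgebraic) hS

theorem mem_relAlg_of_pow {E : Subfield Ω} {z : Ω} {e : ℕ} (he : 0 < e) (hz : z ^ e ∈ relAlg E) :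
    z ∈ relAlg E :=
  mem_relAlg.mpr (IsAlgebraic.of_pow he (mem_relAlg.mp hz))

theorem mem_closure_insert {C : Subfield Ω} {y b : Ω}
    (hb : b ∈ Subfield.closure ((C : Set Ω) ∪ {y})) :
    ∃ p q : Polynomial C, b = aeval y p / aeval y q := by
  rw [Subfield.mem_closure_iff] at hb
  have hr : ∀ z ∈ Subring.closure ((C : Set Ω) ∪ {y}), ∃ p : Polynomial C, aeval y p = z := by
    intro z hz
    have : Subring.closure ((C : Set Ω) ∪ {y}) ≤ (aeval (R := C) y).toRingHom.range := by
      rw [Subring.closure_le, Set.union_subset_iff, Set.singleton_subset_iff]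
      exact ⟨fun c hc => ⟨Polynomial.C ⟨c, hc⟩, by simp; rfl⟩, ⟨X, by simp⟩⟩
    exact this hz
  obtain ⟨p, hp, q, hq, rfl⟩ := hb
  obtain ⟨p, rfl⟩ := hr p hp
  obtain ⟨q, rfl⟩ := hr q hq
  exact ⟨p, q, rfl⟩

theorem valuation_sub_div_lt {a a' b b' : Ω} (h : O.valuation (a - a') < O.valuation a)
    (h' : O.valuation (b - b') < O.valuation b) :
    O.valuation (a / b - a' / b') < O.valuation (a / b) := by
  have hb : b ≠ 0 := by rintro rfl; simp at h'
  have hv : O.valuation b' = O.valuation b := by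
    have := O.valuation.map_sub_eq_of_lt_left h'
    rwa [sub_sub_cancel] at this
  have hb' : b' ≠ 0 := by
    rw [← O.valuation.ne_zero_iff, hv, O.valuation.ne_zero_iff]
    exact hb
  have hbv : 0 < O.valuation b := O.valuation.pos_iff.mpr hb
  have e : a / b - a' / b' = ((a - a') * b' - a' * (b - b') + 0) / (b * b') + (a - a') * 0 := by
    field_simp
    ring
  have hav : O.valuation a' = O.valuation a := by
    have := O.valuation.map_sub_eq_of_lt_left h
    rwa [sub_sub_cancel] at this
  rw [e, add_zero, mul_zero, add_zero, map_div₀, map_div₀, map_mul, hv,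
    div_lt_div_iff₀ (mul_pos hbv hbv) hbv, ← mul_assoc]
  refine mul_lt_mul_of_pos_right ?_ hbv
  have hav0 : 0 < O.valuation a := lt_of_le_of_lt zero_le h
  refine O.valuation.map_sub_lt ?_ ?_
  · rw [map_mul, hv]
    exact mul_lt_mul_of_pos_right h hbv
  · rw [map_mul, hav]
    exact mul_lt_mul_of_pos_left h' hav0

/-- If no power of `y` has a value in the value group of `C`, then every nonzero element of `C(y)`
is approximated by a monomial. -/
theorem exists_zpow_of_mem_closure {C : Subfield Ω} {y : Ω} (hy0 : y ≠ 0)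
    (hy : ∀ e : ℕ, 0 < e → ∀ c ∈ C, c ≠ 0 → O.valuation y ^ e ≠ O.valuation c) {b : Ω}
    (hb : b ∈ Subfield.closure ((C : Set Ω) ∪ {y})) (hb0 : b ≠ 0) :
    ∃ i : ℤ, ∃ c ∈ C, c ≠ 0 ∧ O.valuation (b - c * y ^ i) < O.valuation b := by
  have hyv : O.valuation y ≠ 0 := O.valuation.ne_zero_iff.mpr hy0
  have key : ∀ i j : ℕ, i < j → ∀ c d : C, c ≠ 0 → d ≠ 0 →
      O.valuation ((c : Ω) * y ^ i) ≠ O.valuation ((d : Ω) * y ^ j) := by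
    intro i j hij c d hc hd h
    have hd' : (d : Ω) ≠ 0 := by simpa using hd
    refine hy (j - i) (by omega) (c / d) (div_mem c.2 d.2) (div_ne_zero (by simpa using hc) hd') ?_
    rw [map_div₀, eq_div_iff (O.valuation.ne_zero_iff.mpr hd')]
    refine mul_right_cancel₀ (pow_ne_zero i hyv) ?_
    rw [map_mul, map_mul, map_pow, map_pow] at h
    rw [h, mul_right_comm, ← pow_add, Nat.sub_add_cancel hij.le, mul_comm]
  have poly : ∀ p : Polynomial C, aeval y p ≠ 0 → ∃ i : ℕ, ∃ c : C, c ≠ 0 ∧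
      O.valuation (aeval y p - c * y ^ i) < O.valuation (aeval y p) := by
    intro p hp
    have hp0 : p ≠ 0 := by rintro rfl; simp at hp
    obtain ⟨i, hi, hmax⟩ := p.support.exists_max_image
      (fun i => O.valuation ((p.coeff i : Ω) * y ^ i)) (by simpa using hp0)
    have hs : aeval y p - p.coeff i * y ^ i = ∑ j ∈ p.support.erase i, (p.coeff j : Ω) * y ^ j := by
      rw [sub_eq_iff_eq_add, Finset.sum_erase_add _ _ hi, aeval_def, eval₂_eq_sum,
        Polynomial.sum]
      rfl
    have hci : p.coeff i ≠ 0 := by simpa using hi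
    have hlt : O.valuation (aeval y p - p.coeff i * y ^ i) < O.valuation (p.coeff i * y ^ i) := by
      rw [hs]
      refine O.valuation.map_sum_lt ?_ fun j hj => ?_
      · exact O.valuation.ne_zero_iff.mpr
          (mul_ne_zero (by simpa using hci) (pow_ne_zero i hy0))
      · obtain ⟨hne, hj⟩ := Finset.mem_erase.mp hj
        refine lt_of_le_of_ne (hmax j hj) ?_
        have hcj : p.coeff j ≠ 0 := by simpa using hj
        rcases hne.lt_or_gt with h | h
        · exact key j i h _ _ hcj hci
        · exact (key i j h _ _ hci hcj).symm
    refine ⟨i, p.coeff i, hci, ?_⟩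
    rwa [← sub_add_cancel (aeval y p) (p.coeff i * y ^ i),
      O.valuation.map_add_eq_of_lt_right hlt, sub_add_cancel]
  obtain ⟨p, q, rfl⟩ := mem_closure_insert hb
  obtain ⟨hp, hq⟩ := div_ne_zero_iff.mp hb0
  obtain ⟨i, c, hc, hci⟩ := poly p hp
  obtain ⟨j, d, hd, hdj⟩ := poly q hq
  refine ⟨i - j, c / d, div_mem c.2 d.2, div_ne_zero (by simpa using hc) (by simpa using hd), ?_⟩
  have := valuation_sub_div_lt hci hdj
  rwa [mul_div_mul_comm, ← zpow_natCast y i, ← zpow_natCast y j, ← zpow_sub₀ hy0] at this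

theorem valuation_eq_of_sub_lt {a b : Ω} (h : O.valuation (a - b) < O.valuation a) :
    O.valuation b = O.valuation a := by
  have := O.valuation.map_sub_eq_of_lt_left h
  rwa [sub_sub_cancel] at this

theorem resAlg_of_sub_lt {K₀ : Subfield Ω} {a b : Ω} (hb : b ∈ K₀)
    (h : O.valuation (a - b) < 1) : ResAlg O K₀ a :=
  ⟨X - C ⟨b, hb⟩, monic_X_sub_C _, by
    rw [map_sub, aeval_X, aeval_C]
    exact h⟩

variable {C N K₀ : Subfield Ω} {T : Set Ω}

/-- The elements of `T` lie in the henselization of a function field in one variable `s` over a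
finite extension of `C`, inside the henselization of `N`. -/
def UnifBy (O : ValuationSubring Ω) (C N : Subfield Ω) (T : Set Ω) : Prop :=
  ∃ M : Set Ω, M.Finite ∧ M ⊆ hensClosure O N ∧ M ⊆ relAlg C ∧
    ∃ s ∈ hensClosure O N, s ∉ relAlg C ∧ T ⊆ hensClosure O (C ∪ M ∪ {s})

theorem mem_closure_union_singleton {x : Ω} : x ∈ Subfield.closure ((C : Set Ω) ∪ {x}) :=
  Subfield.subset_closure (Or.inr rfl)

theorem le_closure_union_singleton {x : Ω} : C ≤ Subfield.closure ((C : Set Ω) ∪ {x}) :=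
  fun _ hz => Subfield.subset_closure (Or.inl hz)

theorem closure_union_singleton_le {x : Ω} (hC : C ≤ N) (hx : x ∈ N) :
    Subfield.closure ((C : Set Ω) ∪ {x}) ≤ N :=
  Subfield.closure_le.mpr (Set.union_subset hC (Set.singleton_subset_iff.mpr hx))

theorem valuation_eq_one_of_mem (hK : ∀ a ∈ K₀, a ∈ O) {a : Ω} (ha : a ∈ K₀) (ha0 : a ≠ 0) :
    O.valuation a = 1 := by
  refine le_antisymm ((O.valuation_le_one_iff a).mpr (hK a ha)) ?_
  have h := (O.valuation_le_one_iff _).mpr (hK _ (inv_mem ha))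
  rwa [map_inv₀, inv_le_one₀ (O.valuation.pos_iff.mpr ha0)] at h

theorem valuation_eq_one_of_mem_relAlg (hK : ∀ a ∈ K₀, a ∈ O) {a : Ω} (ha : a ∈ relAlg K₀)
    (ha0 : a ≠ 0) : O.valuation a = 1 := by
  obtain ⟨e, he, c, hc, h⟩ := exists_valuation_pow_eq O.valuation ha0 (mem_relAlg.mp ha)
  have h1 : O.valuation (c : Ω) = 1 := valuation_eq_one_of_mem hK c.2 (by simpa using hc)
  exact (pow_left_inj₀ zero_le zero_le he.ne').mp (by rw [h, one_pow]; exact h1)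

variable [IsAlgClosed Ω] [CharZero Ω]

theorem unifBy_of_resAlg (hn : ∀ n : ℕ, n ≠ 0 → O.valuation (n : Ω) = 1) (hKC : K₀ ≤ C)
    (hCN : C ≤ N) (hK : ∀ a ∈ K₀, a ∈ O) (hB : ∀ b ∈ N, O.valuation b = 1 → ResAlg O K₀ b)
    (htr : ∀ x, x ∉ relAlg C → ∀ z, z ∈ relAlg (Subfield.closure ((C : Set Ω) ∪ {x})))
    {x : Ω} (hxN : x ∈ N) (hx : x ∉ relAlg C) (hT : T.Finite) (hTN : T ⊆ N) :
    UnifBy O C N T := by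
  have hNH : N ≤ hensClosure O N := subset_hensClosure
  have hHB : ∀ z ∈ hensClosure O (N : Set Ω), IsAlgebraic N z := fun z hz =>
    mem_relAlg.mp (relAlg_le ((closure_union_singleton_le hCN hxN).trans (le_relAlg N)) (htr x hx z))
  by_cases hA : ∀ b ∈ N, b ≠ 0 → ∃ e : ℕ, 0 < e ∧ ∃ c ∈ C, O.valuation b ^ e = O.valuation c
  · obtain ⟨M, hM, hMH, hMA, s, hsH, hs0, ⟨e, he, m, hmH, hmA, hsm⟩, hTM⟩ :=
      exists_hens_generators hn isHens_hensClosure hNH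
        (fun z => mem_relAlg_of_isAlgebraic (E := C)) (hKC.trans (hCN.trans hNH))
        (hKC.trans (le_relAlg C)) hK hB N.one_mem one_ne_zero (fun b hb hb0 => by
          obtain ⟨e, he, c, hc, h⟩ := hA b hb hb0
          exact ⟨e, he, 1, c, hCN hc, le_relAlg C hc, by simpa using h⟩) hHB
        (B₀ := Subfield.closure ((C : Set Ω) ∪ {x}))
        ((closure_union_singleton_le hCN hxN).trans hNH) hT (hTN.trans hNH)
        fun z _ => mem_relAlg.mp (htr x hx z)
    rw [one_mul] at hsm
    refine ⟨M ∪ {s}, hM.union (Set.finite_singleton s),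
      Set.union_subset hMH (Set.singleton_subset_iff.mpr hsH),
      Set.union_subset hMA (Set.singleton_subset_iff.mpr (mem_relAlg_of_pow he (hsm ▸ hmA))), x,
      hNH hxN, hx, hTM.trans (hensClosure_le_of_subset ?_)⟩
    refine Set.union_subset (Set.union_subset (closure_union_singleton_le ?_ ?_) ?_) ?_
    · exact fun z hz => subset_hensClosure (Or.inl (Or.inl hz))
    · exact subset_hensClosure (Or.inr rfl)
    · exact fun z hz => subset_hensClosure (Or.inl (Or.inr (Or.inl hz)))
    · exact fun z hz => subset_hensClosure (Or.inl (Or.inr (Or.inr hz)))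
  · push Not at hA
    obtain ⟨y, hyN, hy0, hy⟩ := hA
    have hyC : y ∉ relAlg C := fun h => by
      obtain ⟨e, he, c, -, h⟩ := exists_valuation_pow_eq O.valuation hy0 (mem_relAlg.mp h)
      exact hy e he c c.2 h
    obtain ⟨M, hM, hMH, hMA, s, hsH, hs0, ⟨e, he, m, hmH, hmA, hsm⟩, hTM⟩ :=
      exists_hens_generators hn isHens_hensClosure hNH
        (fun z => mem_relAlg_of_isAlgebraic (E := C)) (hKC.trans (hCN.trans hNH))
        (hKC.trans (le_relAlg C)) hK hB hyN hy0 (fun b hb hb0 => by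
          obtain ⟨e, he, b', hb', h⟩ := exists_valuation_pow_eq O.valuation hb0
            (mem_relAlg.mp (htr y hyC b))
          obtain ⟨i, c, hc, hc0, h'⟩ := exists_zpow_of_mem_closure hy0
            (fun e he c hc _ => hy e he c hc) b'.2 (by simpa using hb')
          refine ⟨e, he, i, c, hCN hc, le_relAlg C hc, ?_⟩
          rw [h, mul_comm]
          exact (valuation_eq_of_sub_lt h').symm) hHB
        (B₀ := Subfield.closure ((C : Set Ω) ∪ {y}))
        ((closure_union_singleton_le hCN hyN).trans hNH) hT (hTN.trans hNH)
        fun z _ => mem_relAlg.mp (htr y hyC z)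
    have hm0 : m ≠ 0 := by
      rintro rfl
      rw [mul_zero] at hsm
      exact hs0 (pow_eq_zero_iff he.ne' |>.mp hsm)
    have hyeq : y = s ^ e / m := eq_div_of_mul_eq hm0 hsm.symm
    refine ⟨M ∪ {m}, hM.union (Set.finite_singleton m),
      Set.union_subset hMH (Set.singleton_subset_iff.mpr hmH),
      Set.union_subset hMA (Set.singleton_subset_iff.mpr hmA), s, hsH, fun h => hyC ?_,
      hTM.trans (hensClosure_le_of_subset ?_)⟩
    · rw [hyeq]
      exact div_mem (pow_mem h e) hmA
    refine Set.union_subset (Set.union_subset (closure_union_singleton_le ?_ ?_) ?_) ?_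
    · exact fun z hz => subset_hensClosure (Or.inl (Or.inl hz))
    · rw [hyeq]
      refine div_mem (pow_mem ?_ e) ?_
      · exact subset_hensClosure (Or.inr rfl)
      · exact subset_hensClosure (Or.inl (Or.inr (Or.inr rfl)))
    · exact fun z hz => subset_hensClosure (Or.inl (Or.inr (Or.inl hz)))
    · exact fun z hz => subset_hensClosure (Or.inr hz)

/-- Descent from the Gauss extension to a valuation at which `x` is residually algebraic. -/
theorem unifBy_of_not_gauss (hn : ∀ n : ℕ, n ≠ 0 → O.valuation (n : Ω) = 1) (hKC : K₀ ≤ C)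
    (hCN : C ≤ N) (hK : ∀ a ∈ K₀, a ∈ O) {t x : Ω} (ht : t ∈ C)
    (hxN : x ∈ N) (hx : x ∉ relAlg C) {M : Set Ω} (hM : M.Finite) (hMH : M ⊆ hensClosure O N)
    (hMA : M ⊆ relAlg (Subfield.closure ((K₀ : Set Ω) ∪ {x}))) {s m : Ω} (hs : s ∈ hensClosure O N)
    {e : ℕ} (he : 0 < e) (hm : m ∈ hensClosure O N)
    (hmA : m ∈ relAlg (Subfield.closure ((K₀ : Set Ω) ∪ {x}))) (hm1 : O.valuation m = 1)
    (hsm : s ^ e = t * m)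
    (hTM : T ⊆ hensClosure O (Subfield.closure ((C : Set Ω) ∪ {x}) ∪ M ∪ {s}))
    (hp : ∃ p : Polynomial K₀, p ≠ 0 ∧ O.valuation (aeval x p) ≠ 1) : UnifBy O C N T := by
  have hKx : K₀ ≤ Subfield.closure ((K₀ : Set Ω) ∪ {x}) := le_closure_union_singleton
  have hx' : x ∉ relAlg K₀ := fun h => hx (relAlg_le (hKC.trans (le_relAlg C)) h)
  obtain ⟨y, hyx, hxy, hy0, hy1⟩ : ∃ y, y ∈ Subfield.closure ((K₀ : Set Ω) ∪ {x}) ∧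
      x ∈ relAlg (Subfield.closure ((K₀ : Set Ω) ∪ {y})) ∧ y ≠ 0 ∧ O.valuation y < 1 := by
    obtain ⟨p, hp0, hp1⟩ := hp
    have hpx : aeval x p ∈ Subfield.closure ((K₀ : Set Ω) ∪ {x}) := by
      rw [aeval_eq_sum_range]
      exact sum_mem fun i _ => mul_mem (hKx (p.coeff i).2) (pow_mem mem_closure_union_singleton i)
    have hpx0 : aeval x p ≠ 0 := fun h => hx' (mem_relAlg.mpr ⟨p, hp0, h⟩)
    have hxp : ∀ E : Subfield Ω, K₀ ≤ E → aeval x p ∈ E → x ∈ relAlg E := by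
      intro E hE hpE
      refine mem_relAlg.mpr ⟨p.map (Subfield.inclusion hE) - Polynomial.C ⟨aeval x p, hpE⟩, ?_, ?_⟩
      · intro h
        rw [sub_eq_zero] at h
        have hd : p.natDegree = 0 := by
          rw [← natDegree_map (Subfield.inclusion hE), h, natDegree_C]
        refine hp1 ?_
        rw [eq_C_of_natDegree_eq_zero hd, aeval_C] at hpx0 ⊢
        exact valuation_eq_one_of_mem hK (p.coeff 0).2 hpx0
      · rw [map_sub, aeval_C, aeval_def, eval₂_map]
        exact sub_self _
    have hpv : 0 < O.valuation (aeval x p) := O.valuation.pos_iff.mpr hpx0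
    rcases hp1.lt_or_gt with h | h
    · exact ⟨_, hpx, hxp _ le_closure_union_singleton mem_closure_union_singleton, hpx0, h⟩
    · refine ⟨_, inv_mem hpx, hxp _ le_closure_union_singleton ?_, inv_ne_zero hpx0, ?_⟩
      · exact inv_mem_iff.mp mem_closure_union_singleton
      · rw [map_inv₀]
        exact (inv_lt_one₀ hpv).mpr h
  have hyv : 0 < O.valuation y := O.valuation.pos_iff.mpr hy0
  set B : Subfield Ω := Subfield.closure ((K₀ : Set Ω) ∪ {y}) with hBdef
  have hKB : K₀ ≤ B := le_closure_union_singleton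
  have hyB : y ∈ B := mem_closure_union_singleton
  have hxB : relAlg (Subfield.closure ((K₀ : Set Ω) ∪ {x})) ≤ relAlg B :=
    relAlg_le (closure_union_singleton_le (hKB.trans (le_relAlg B)) hxy)
  set S : Set Ω := M ∪ {x, m} with hS
  have hSf : S.Finite := hM.union (by simp)
  set H := hensClosure O ((K₀ : Set Ω) ∪ S) with hH
  have hSH : S ⊆ H := fun z hz => subset_hensClosure (Or.inr hz)
  have hKH : K₀ ≤ H := fun z hz => subset_hensClosure (Or.inl hz)
  have hxH : x ∈ H := hSH (by simp [hS])
  have hmH : m ∈ H := hSH (by simp [hS])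
  have hyH : y ∈ H := closure_union_singleton_le hKH hxH hyx
  have hBH : B ≤ H := closure_union_singleton_le hKH hyH
  have hHN : H ≤ hensClosure O N := by
    refine hensClosure_le_of_subset (Set.union_subset
      (fun z hz => subset_hensClosure (hCN (hKC hz))) (Set.union_subset hMH ?_))
    rintro z (rfl | rfl)
    exacts [subset_hensClosure hxN, hm]
  have hSB : S ⊆ relAlg B := by
    refine Set.union_subset (hMA.trans hxB) ?_
    rintro z (rfl | rfl)
    exacts [hxy, hxB hmA]
  have hHB : H ≤ relAlg B :=
    hensClosure_le_relAlg (Set.union_subset (hKB.trans (le_relAlg B)) hSB)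
  have hmon : ∀ b ∈ B, b ≠ 0 → ∃ i : ℤ, ∃ c ∈ K₀, c ≠ 0 ∧
      O.valuation (b - c * y ^ i) < O.valuation b := fun b hb hb0 =>
    exists_zpow_of_mem_closure hy0 (fun e he c hc hc0 => by
      rw [valuation_eq_one_of_mem hK hc hc0]
      exact (pow_lt_one₀ zero_le hy1 he.ne').ne) hb hb0
  have hres : ∀ b ∈ B, O.valuation b = 1 → ResAlg O K₀ b := by
    intro b hb hb1
    obtain ⟨i, c, hc, hc0, h⟩ := hmon b hb (by rintro rfl; simp at hb1)
    have hv := valuation_eq_of_sub_lt h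
    rw [map_mul, valuation_eq_one_of_mem hK hc hc0, one_mul, hb1, map_zpow₀] at hv
    have hi : i = 0 := (zpow_eq_one_iff_right₀ hyv.le hy1.ne).mp hv
    subst hi
    rw [zpow_zero, mul_one, hb1] at h
    exact resAlg_of_sub_lt hc h
  obtain ⟨M', hM', hMH', hMA', s', hsH', hs0', ⟨e', he', m', hmH', hmA', hsm'⟩, hSM'⟩ :=
    exists_hens_generators hn isHens_hensClosure hBH
      (fun z => mem_relAlg_of_isAlgebraic (E := K₀)) hKH (le_relAlg K₀) hK hres hyB hy0
      (fun b hb hb0 => by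
        obtain ⟨i, c, hc, hc0, h⟩ := hmon b hb hb0
        refine ⟨1, one_pos, i, c, hKB hc, le_relAlg K₀ hc, ?_⟩
        rw [pow_one, mul_comm]
        exact (valuation_eq_of_sub_lt h).symm) (fun z hz => mem_relAlg.mp (hHB hz)) hBH hSf hSH
      fun z hz => mem_relAlg.mp (hSB hz)
  have hKA : relAlg K₀ ≤ relAlg C := relAlg_le (hKC.trans (le_relAlg C))
  obtain ⟨l, hlH, hlA, hl⟩ := (isHens_hensClosure : IsHens O H).exists_isAlgebraic_of_resAlg hn hKH
    hK hmH hm1 (.of_isAlgebraic hK hres (mem_relAlg.mp (hHB hmH)) hm1)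
  have hl1 : O.valuation l = 1 := (valuation_eq_of_sub_lt (hm1 ▸ hl)).trans hm1
  have hl0 : l ≠ 0 := by rintro rfl; simp at hl1
  obtain ⟨ρ, hρH, hρ, hρ1⟩ := (isHens_hensClosure : IsHens O H).exists_pow_eq hn
    H.one_mem (div_mem hmH hlH) one_ne_zero he (by
      rw [one_pow, one_sub_div hl0, map_div₀, hl1, map_one, div_one, Valuation.map_sub_swap]
      exact hl)
  have hρ0 : ρ ≠ 0 := by
    rintro rfl
    simp at hρ1
  have hm0 : m' ≠ 0 := by
    rintro rfl
    rw [mul_zero] at hsm'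
    exact hs0' (pow_eq_zero_iff he'.ne' |>.mp hsm')
  have hm00 : m ≠ 0 := by rintro rfl; simp at hm1
  have hs1 : (s / ρ) ^ e = t * l := by
    rw [div_pow, hsm, hρ]
    field_simp
  set M'' : Set Ω := M' ∪ {m', s / ρ} with hM''
  set D := hensClosure O ((C : Set Ω) ∪ M'' ∪ {s'}) with hD
  have hCD : C ≤ D := fun z hz => subset_hensClosure (Or.inl (Or.inl hz))
  have hMD : M'' ⊆ D := fun z hz => subset_hensClosure (Or.inl (Or.inr hz))
  have hsD : s' ∈ D := subset_hensClosure (Or.inr rfl)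
  have hyeq : y = s' ^ e' / m' := eq_div_of_mul_eq hm0 hsm'.symm
  have hyD : y ∈ D := hyeq ▸ div_mem (pow_mem hsD e') (hMD (by simp [hM'']))
  have hSD : S ⊆ D := hSM'.trans (hensClosure_le_of_subset (Set.union_subset (Set.union_subset
    (closure_union_singleton_le (hKC.trans hCD) hyD)
    (fun z hz => hMD (Or.inl hz))) (Set.singleton_subset_iff.mpr hsD)))
  have hHD : H ≤ D := hensClosure_le_of_subset (Set.union_subset (hKC.trans hCD) hSD)
  refine ⟨M'', hM'.union (by simp), Set.union_subset (hMH'.trans hHN) ?_,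
    Set.union_subset (hMA'.trans hKA) ?_, s', hHN hsH', fun h => hx ?_,
    hTM.trans (hensClosure_le_of_subset (Set.union_subset (Set.union_subset
      (closure_union_singleton_le hCD (hHD hxH)) ((Set.subset_union_left).trans hSD))
      (Set.singleton_subset_iff.mpr ?_)))⟩
  · rintro z (rfl | rfl)
    exacts [hHN hmH', div_mem hs (hHN hρH)]
  · rintro z (rfl | rfl)
    · exact hKA hmA'
    · exact mem_relAlg_of_pow he (hs1 ▸ mul_mem (le_relAlg C ht) (hKA (mem_relAlg.mpr hlA)))
  · exact relAlg_le (closure_union_singleton_le (hKC.trans (le_relAlg C))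
      (hyeq ▸ div_mem (pow_mem h e') (hKA hmA'))) hxy
  · exact div_mul_cancel₀ s hρ0 ▸ mul_mem (hMD (by simp [hM''])) (hHD hρH)

end

section

open Polynomial IntermediateField

variable {k : Type*} {Ω : Type u} [Field k] [Field Ω] [Algebra (LaurentSeries k) Ω]
  {O : ValuationSubring Ω} {x : Ω}

theorem mem_relAlg_fieldRange {L : Type*} [Field L] [Algebra L Ω] {z : Ω} :
    z ∈ relAlg (algebraMap L Ω).fieldRange ↔ IsAlgebraic L z := by
  have h (q : L[X]) :
      aeval z (q.map (algebraMap L Ω).rangeRestrictField) = aeval z q := by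
    rw [aeval_def, eval₂_map]
    rfl
  rw [mem_relAlg]
  constructor
  · rintro ⟨p, hp, hpz⟩
    obtain ⟨q, rfl⟩ := map_surjective _ (algebraMap L Ω).rangeRestrictField_bijective.2 p
    exact ⟨q, by rintro rfl; simp at hp, h q ▸ hpz⟩
  · rintro ⟨q, hq, hqz⟩
    exact ⟨_, (Polynomial.map_ne_zero_iff (algebraMap L Ω).rangeRestrictField.injective).mpr hq,
      (h q).trans hqz⟩

theorem GaussAt.transcendental (hO : Center k O) (h : GaussAt k O x) :
    Transcendental (LaurentSeries k) x := by
  let _ : Algebra (PowerSeries k) Ω := (serHom k Ω).toAlgebra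
  have : IsScalarTower (PowerSeries k) (LaurentSeries k) Ω := .of_algebraMap_eq fun _ => rfl
  intro hx
  obtain ⟨p, hp, hpx⟩ := (IsFractionRing.isAlgebraic_iff (PowerSeries k) (LaurentSeries k) Ω).mpr hx
  obtain ⟨n, p, hp', rfl⟩ := exists_eq_C_X_pow_mul hp
  rw [aeval_def, eval₂_mul, eval₂_pow, eval₂_C] at hpx
  have h1 := h.valuation_eval₂ hO hp'
  rcases mul_eq_zero.mp hpx with h0 | h0
  · exact pow_ne_zero n serHom_X_ne_zero h0
  · change p.eval₂ (serHom k Ω) x = 0 at h0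
    rw [h0] at h1
    simp at h1

theorem GaussAt.valuation_sub_lt (hO : Center k O) (h : GaussAt k O x) {p : (PowerSeries k)[X]}
    (hp : p.map PowerSeries.constantCoeff ≠ 0) :
    O.valuation (p.eval₂ (serHom k Ω) x -
      (p.map PowerSeries.constantCoeff).eval₂ (baseHom k Ω) x) <
        O.valuation (p.eval₂ (serHom k Ω) x) := by
  rw [h.valuation_eval₂ hO hp]
  obtain ⟨q, hq⟩ := exists_eq_map_C_add p
  nth_rw 1 [hq]
  rw [eval₂_add, eval₂_map_C, add_sub_cancel_left, eval₂_mul, eval₂_C, map_mul]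
  exact mul_lt_one_of_lt_of_le hO.2 ((O.valuation_le_one_iff _).mpr (hO.eval₂_mem h.mem q))

theorem Center.valuation_natCast [CharZero k] (hO : Center k O) {n : ℕ} (hn : n ≠ 0) :
    O.valuation (n : Ω) = 1 := by
  rw [← map_natCast (baseHom k Ω)]
  exact hO.baseHom_valuation (Nat.cast_ne_zero.mpr hn)

theorem aeval_map_rangeRestrict (p : k[X]) (x : Ω) :
    aeval x (p.map (baseHom k Ω).rangeRestrictField) = p.eval₂ (baseHom k Ω) x := by
  rw [aeval_def, eval₂_map]
  rfl

theorem gaussAt_of_not_resAlg (hO : Center k O) (hx : O.valuation x = 1)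
    (h : ¬ ResAlg O (baseHom k Ω).fieldRange x) : GaussAt k O x := by
  intro p hp
  refine le_antisymm ?_ (not_lt.mp fun h1 => h ?_)
  · rw [O.valuation_le_one_iff, ← eval₂_map_C]
    exact hO.eval₂_mem ((O.valuation_le_one_iff x).mp hx.le) _
  · refine ⟨(C p.leadingCoeff⁻¹ * p).map (baseHom k Ω).rangeRestrictField,
      (monic_C_mul_of_mul_leadingCoeff_eq_one
        (inv_mul_cancel₀ (leadingCoeff_ne_zero.mpr hp))).map _, ?_⟩
    rw [aeval_map_rangeRestrict, eval₂_mul, eval₂_C, map_mul,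
      hO.baseHom_valuation (inv_ne_zero (leadingCoeff_ne_zero.mpr hp)), one_mul]
    exact h1

section Ultralimit

variable {ι : Type*} (U : Ultrafilter ι) (V : ι → ValuationSubring Ω)

/-- The limit of a family of valuation rings along an ultrafilter. -/
def ultralimit : ValuationSubring Ω where
  carrier := {z | ∀ᶠ i in U, z ∈ V i}
  zero_mem' := .of_forall fun i => (V i).zero_mem
  one_mem' := .of_forall fun i => (V i).one_mem
  add_mem' hy hz := (hy.and hz).mono fun i h => (V i).add_mem _ _ h.1 h.2
  mul_mem' hy hz := (hy.and hz).mono fun i h => (V i).mul_mem _ _ h.1 h.2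
  neg_mem' hz := hz.mono fun i h => (V i).neg_mem _ h
  mem_or_inv_mem' z := Ultrafilter.eventually_or.mp (.of_forall fun i => (V i).mem_or_inv_mem z)

variable {U V}

theorem mem_ultralimit {z : Ω} : z ∈ ultralimit U V ↔ ∀ᶠ i in U, z ∈ V i := Iff.rfl

theorem eventually_valuation_lt {y z : Ω}
    (h : (ultralimit U V).valuation y < (ultralimit U V).valuation z) :
    ∀ᶠ i in U, (V i).valuation y < (V i).valuation z := by
  have hz : z ≠ 0 := by rintro rfl; simp at h
  by_cases hy : y = 0
  · subst hy
    refine .of_forall fun i => ?_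
    rw [map_zero, zero_lt_iff]
    exact (V i).valuation.ne_zero_iff.mpr hz
  have key : ∀ W : ValuationSubring Ω, W.valuation y < W.valuation z ↔ z / y ∉ W := fun W => by
    rw [← W.valuation_le_one_iff, map_div₀, not_le,
      one_lt_div₀ (W.valuation.pos_iff.mpr hy)]
  simp only [key] at h ⊢
  exact Ultrafilter.eventually_not.mpr h

theorem HensGen.eventually_ultralimit {S : Set Ω} {z : Ω} (hz : z ∈ hensClosure (ultralimit U V) S) :
    ∀ᶠ i in U, z ∈ hensClosure (V i) S :=
  HensGen.eventually (fun _ _ => eventually_valuation_lt) hz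

theorem eventually_subset_hensClosure {S T : Set Ω} (hT : T.Finite)
    (h : T ⊆ hensClosure (ultralimit U V) S) : ∀ᶠ i in U, T ⊆ hensClosure (V i) S :=
  (Filter.eventually_all_finite hT).mpr fun _ hz => HensGen.eventually_ultralimit (h hz)

theorem center_ultralimit (hV : ∀ i, Center k (V i)) : Center k (ultralimit U V) := by
  have key : ∀ W : ValuationSubring Ω, W.valuation (serHom k Ω PowerSeries.X) < 1 ↔
      (serHom k Ω PowerSeries.X)⁻¹ ∉ W := fun W => by
    rw [← W.valuation_le_one_iff, map_inv₀, not_le,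
      one_lt_inv₀ (W.valuation.pos_iff.mpr serHom_X_ne_zero)]
  refine ⟨fun r => .of_forall fun i => (hV i).1 r, (key _).mpr ?_⟩
  exact Ultrafilter.eventually_not.mp (.of_forall fun i => (key _).mp (hV i).2)

end Ultralimit

variable [IsAlgClosed Ω] [CharZero k] {ι : Type*} [Infinite ι] {V : ι → ValuationSubring Ω}
  {N : Subfield Ω} {T : Set Ω}

theorem exists_unifBy (hV : ∀ i, Center k (V i)) (hCN : (algebraMap (LaurentSeries k) Ω).fieldRange ≤ N)
    (hV' : ∀ y ∈ N, {i | GaussAt k (V i) y}.Finite)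
    (htr : ∀ y, y ∉ relAlg (algebraMap (LaurentSeries k) Ω).fieldRange → ∀ z, z ∈ relAlg
      (Subfield.closure (((algebraMap (LaurentSeries k) Ω).fieldRange : Set Ω) ∪ {y})))
    (hxN : x ∈ N) (hx : x ∉ relAlg (algebraMap (LaurentSeries k) Ω).fieldRange)
    (hT : T.Finite) (hTN : T ⊆ N) :
    ∃ i, UnifBy (V i) (algebraMap (LaurentSeries k) Ω).fieldRange N T := by
  have : CharZero Ω := (RingHom.charZero_iff (baseHom k Ω).injective).mp inferInstance
  set C := (algebraMap (LaurentSeries k) Ω).fieldRange with hC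
  set K₀ := (baseHom k Ω).fieldRange with hK₀
  have hKC : K₀ ≤ C := by
    rintro _ ⟨a, rfl⟩
    exact ⟨_, rfl⟩
  set U : Ultrafilter ι := Filter.hyperfilter ι
  set O := ultralimit U V
  have hO : Center k O := center_ultralimit hV
  have hK : ∀ W : ValuationSubring Ω, Center k W → ∀ a ∈ K₀, a ∈ W := by
    rintro W hW _ ⟨a, rfl⟩
    exact hW.1 _
  by_cases hB : ∀ b ∈ N, O.valuation b = 1 → ResAlg O K₀ b
  · obtain ⟨M, hM, hMN, hMC, s, hsN, hsC, hTM⟩ := unifBy_of_resAlg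
      (fun n hn => hO.valuation_natCast hn) hKC hCN (hK O hO) hB htr hxN hx hT hTN
    obtain ⟨i, h1, h2, h3⟩ := ((eventually_subset_hensClosure hM hMN).and
      ((HensGen.eventually_ultralimit hsN).and (eventually_subset_hensClosure hT hTM))).exists
    exact ⟨i, M, hM, h1, hMC, s, h2, hsC, h3⟩
  push Not at hB
  obtain ⟨y, hyN, hy1, hy⟩ := hB
  have hg := gaussAt_of_not_resAlg hO hy1 hy
  have hyC : y ∉ relAlg C := fun h => hg.transcendental hO (mem_relAlg_fieldRange.mp h)
  set t := serHom k Ω PowerSeries.X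
  have htC : t ∈ C := ⟨_, rfl⟩
  have ht0 : t ≠ 0 := serHom_X_ne_zero
  have htv : 0 < O.valuation t := O.valuation.pos_iff.mpr ht0
  set B := Subfield.closure ((C : Set Ω) ∪ {y}) with hBdef
  set κ := Subfield.closure ((K₀ : Set Ω) ∪ {y}) with hκdef
  have hκB : κ ≤ B := closure_union_singleton_le (hKC.trans le_closure_union_singleton)
    mem_closure_union_singleton
  have hBN : B ≤ N := closure_union_singleton_le hCN hyN
  have hNH : N ≤ hensClosure O N := subset_hensClosure
  have hpκ : ∀ p : k[X], p.eval₂ (baseHom k Ω) y ∈ κ := fun p => by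
    rw [eval₂_eq_sum_range]
    exact sum_mem fun i _ => mul_mem (le_closure_union_singleton ⟨_, rfl⟩)
      (pow_mem mem_closure_union_singleton i)
  have hκO : ∀ a ∈ κ, a ∈ O := by
    intro a ha
    obtain ⟨p, q, rfl⟩ := mem_closure_insert ha
    obtain ⟨p, rfl⟩ := map_surjective _ (baseHom k Ω).rangeRestrictField_bijective.2 p
    obtain ⟨q, rfl⟩ := map_surjective _ (baseHom k Ω).rangeRestrictField_bijective.2 q
    rw [aeval_map_rangeRestrict, aeval_map_rangeRestrict]
    by_cases hq : q = 0
    · simp [hq]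
    · by_cases hp : p = 0
      · simp [hp]
      rw [← O.valuation_le_one_iff, map_div₀, hg q hq, hg p hp, div_one]
  have hmon : ∀ b ∈ B, b ≠ 0 → ∃ i : ℤ, O.valuation b = O.valuation t ^ i ∧
      (i = 0 → ∃ c ∈ κ, O.valuation (b - c) < O.valuation b) := by
    intro b hb hb0
    obtain ⟨i, p, q, hp, hq, rfl⟩ := exists_zpow_mul_div (k := k) (x := y) (z := b) hb hb0
    refine ⟨i, ?_, fun hi => ⟨_, div_mem (hpκ (p.map PowerSeries.constantCoeff))
      (hpκ (q.map PowerSeries.constantCoeff)), ?_⟩⟩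
    · rw [map_mul, map_div₀, map_zpow₀, hg.valuation_eval₂ hO hp, hg.valuation_eval₂ hO hq,
        div_one, mul_one]
    · rw [hi, zpow_zero, one_mul]
      exact valuation_sub_div_lt (hg.valuation_sub_lt hO hp) (hg.valuation_sub_lt hO hq)
  obtain ⟨M, hM, hMH, hMA, s, hsH, hs0, ⟨e, he, m, hmH, hmA, hsm⟩, hTM⟩ :=
    exists_hens_generators (fun n hn => hO.valuation_natCast hn) isHens_hensClosure (hBN.trans hNH)
      (fun z => mem_relAlg_of_isAlgebraic (E := κ)) (hκB.trans (hBN.trans hNH)) (le_relAlg κ) hκO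
      (fun b hb hb1 => by
        obtain ⟨i, hi, h⟩ := hmon b hb (by rintro rfl; simp at hb1)
        rw [hb1] at hi
        obtain ⟨c, hc, h⟩ := h ((zpow_eq_one_iff_right₀ htv.le hO.2.ne).mp hi.symm)
        exact resAlg_of_sub_lt hc (hb1 ▸ h))
      (le_closure_union_singleton htC) ht0 (fun b hb hb0 => by
        obtain ⟨i, hi, -⟩ := hmon b hb hb0
        exact ⟨1, one_pos, i, 1, B.one_mem, (relAlg κ).one_mem, by
          rw [pow_one, mul_one, map_zpow₀, hi]⟩)
      (fun z _ => mem_relAlg.mp (htr y hyC z)) (hBN.trans hNH) hT (hTN.trans hNH)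
      fun z _ => mem_relAlg.mp (htr y hyC z)
  have hm0 : m ≠ 0 := by
    rintro rfl
    rw [mul_zero] at hsm
    exact hs0 (pow_eq_zero_iff he.ne' |>.mp hsm)
  have hm1 : O.valuation m = 1 := valuation_eq_one_of_mem_relAlg hκO hmA hm0
  have hmO : m ∈ O ∧ m⁻¹ ∈ O := by
    rw [← O.valuation_le_one_iff, ← O.valuation_le_one_iff, map_inv₀, hm1, inv_one]
    exact ⟨le_rfl, le_rfl⟩
  obtain ⟨i, h1, h2, h3, h4, h5, h6, h7⟩ := ((eventually_subset_hensClosure hM hMH).and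
    ((HensGen.eventually_ultralimit hsH).and ((eventually_subset_hensClosure hT hTM).and
    ((HensGen.eventually_ultralimit hmH).and ((mem_ultralimit.mp hmO.1).and
    ((mem_ultralimit.mp hmO.2).and (Filter.hyperfilter_le_cofinite
      (hV' y hyN).compl_mem_cofinite))))))).exists
  refine ⟨i, unifBy_of_not_gauss (fun n hn => (hV i).valuation_natCast hn) hKC hCN (hK _ (hV i)) htC
    hyN hyC hM h1 hMA h2 he h4 hmA ?_ hsm h3 ?_⟩
  · refine le_antisymm (((V i).valuation_le_one_iff _).mpr h5) ?_
    rw [← (V i).valuation_le_one_iff, map_inv₀] at h6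
    rwa [inv_le_one₀ (zero_lt_iff.mpr (Valuation.ne_zero_iff _ |>.mpr hm0))] at h6
  · have h8 : ¬ GaussAt k (V i) y := h7
    rw [GaussAt] at h8
    push Not at h8
    obtain ⟨p, hp, hp1⟩ := h8
    exact ⟨p.map (baseHom k Ω).rangeRestrictField,
      (Polynomial.map_ne_zero_iff (baseHom k Ω).rangeRestrictField.injective).mpr hp,
      by rwa [aeval_map_rangeRestrict]⟩

end

section

open IntermediateField IsLocalRing

section Comap

variable {F Ω : Type*} [Field F] [Field Ω] {O : ValuationSubring Ω} {j : F →+* Ω}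

theorem valuation_comap_le {a b : F} : (O.comap j).valuation a ≤ (O.comap j).valuation b ↔
    O.valuation (j a) ≤ O.valuation (j b) := by
  rcases eq_or_ne b 0 with rfl | hb
  · simp
  have h1 : (O.comap j).valuation b ≠ 0 := (Valuation.ne_zero_iff _).mpr hb
  have h2 : O.valuation (j b) ≠ 0 := (Valuation.ne_zero_iff _).mpr ((map_ne_zero j).mpr hb)
  rw [← div_le_one₀ (zero_lt_iff.mpr h1), ← div_le_one₀ (zero_lt_iff.mpr h2), ← map_div₀, ← map_div₀,
    ← map_div₀, ValuationSubring.valuation_le_one_iff, ValuationSubring.valuation_le_one_iff]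
  rfl

theorem valuation_comap_lt {a b : F} : (O.comap j).valuation a < (O.comap j).valuation b ↔
    O.valuation (j a) < O.valuation (j b) := by
  rw [← not_le, ← not_le, valuation_comap_le]

theorem valuation_comap_eq {a b : F} : (O.comap j).valuation a = (O.comap j).valuation b ↔
    O.valuation (j a) = O.valuation (j b) := by
  rw [le_antisymm_iff, le_antisymm_iff, valuation_comap_le, valuation_comap_le]

theorem valuation_comap_lt_one {a : F} : (O.comap j).valuation a < 1 ↔ O.valuation (j a) < 1 := by
  simpa using valuation_comap_lt (O := O) (j := j) (a := a) (b := 1)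

theorem valuation_comap_eq_one {a : F} : (O.comap j).valuation a = 1 ↔ O.valuation (j a) = 1 := by
  simpa using valuation_comap_eq (O := O) (j := j) (a := a) (b := 1)

variable (O j) in
/-- The homomorphism from the preimage of `O` to the residue field of `O`. -/
noncomputable def comapResidue : O.comap j →+* ResidueField O :=
  (residue O).comp ((j.comp (O.comap j).subtype).codRestrict O.toSubring fun z => z.2)

theorem comapResidue_eq_zero_iff {z : O.comap j} :
    comapResidue O j z = 0 ↔ O.valuation (j z) < 1 :=
  residue_eq_zero_iff _

theorem isUnit_of_comapResidue_ne_zero {z : O.comap j} (hz : comapResidue O j z ≠ 0) : IsUnit z := by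
  rw [ne_eq, comapResidue_eq_zero_iff, not_lt] at hz
  rw [ValuationSubring.valuation_eq_one_iff, valuation_comap_eq_one]
  exact le_antisymm ((O.valuation_le_one_iff _).mpr z.2) hz

theorem comapResidue_eq_iff {F' : Type*} [Field F'] {j' : F' →+* Ω} {z : O.comap j}
    {z' : O.comap j'} :
    comapResidue O j z = comapResidue O j' z' ↔ O.valuation (j z - j' z') < 1 := by
  rw [← sub_eq_zero]
  change residue O _ - residue O _ = 0 ↔ _
  rw [← map_sub, residue_eq_zero_iff]
  rfl

theorem good_of_approx {E : Type*} [Field E] {φ : E →+* Ω} {n : ℕ}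
    (hE : sums E ⊆ sumSq E (2 ^ (n + 1)))
    (h1 : ∀ a, ∀ δ ≠ 0, ∃ b, O.valuation (φ a - j b) < O.valuation δ)
    (h2 : ∀ b, ∀ δ ≠ 0, ∃ a, O.valuation (j b - φ a) < O.valuation δ)
    {z₀ : F} (hz₀ : z₀ ≠ 0) (hlt : (O.comap j).valuation z₀ < 1)
    (hz : ∀ z, (O.comap j).valuation z < 1 → (O.comap j).valuation z ≤ (O.comap j).valuation z₀)
    (h0 : (2 : ResidueField (O.comap j)) ≠ 0) : Good n (ResidueField (O.comap j)) := by
  have : IsLocalHom (comapResidue O j) :=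
    ⟨fun z hz => isUnit_of_comapResidue_ne_zero hz.ne_zero⟩
  set r := ResidueField.lift (comapResidue O j)
  have hr (z) : r (residue _ z) = comapResidue O j z := rfl
  have hφr (a : O.comap φ) : comapResidue O φ a ∈ r.range := by
    obtain ⟨b, hb⟩ := h1 a 1 one_ne_zero
    rw [map_one] at hb
    have hbO : j b ∈ O := by
      have := O.sub_mem a.2 ((O.valuation_le_one_iff _).mp hb.le)
      rwa [sub_sub_cancel] at this
    exact ⟨residue _ ⟨b, hbO⟩, ((hr _).trans (comapResidue_eq_iff.mpr hb).symm)⟩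
  let e : ResidueField (O.comap j) ≃+* r.range := RingEquiv.ofBijective r.rangeRestrict
    ⟨fun a b h => r.injective (congr_arg Subtype.val h), r.rangeRestrict_surjective⟩
  let ψ : O.comap φ →+* ResidueField (O.comap j) :=
    (e.symm : r.range →+* ResidueField (O.comap j)).comp ((comapResidue O φ).codRestrict r.range hφr)
  have hψ (a) : r (ψ a) = comapResidue O φ a :=
    congr_arg Subtype.val (e.apply_symm_apply ⟨comapResidue O φ a, hφr a⟩)
  have hψ0 (a) : ψ a = 0 ↔ O.valuation (φ a) < 1 := by
    rw [← map_eq_zero r, hψ, comapResidue_eq_zero_iff]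
  obtain ⟨p, hp⟩ := h2 z₀ (j z₀) ((map_ne_zero j).mpr hz₀)
  have hpv := valuation_eq_of_sub_lt hp
  rw [valuation_comap_lt_one] at hlt
  refine good_of_discrete hE (O.comap φ) ψ (fun a ha => ?_) (fun b => ?_)
    ⟨p, (O.valuation_le_one_iff _).mp (hpv ▸ hlt.le)⟩ ?_ ((hψ0 _).mpr (hpv.trans_lt hlt)) ?_ h0
  · refine isUnit_of_comapResidue_ne_zero ?_
    rwa [← hψ, map_ne_zero]
  · obtain ⟨b, rfl⟩ := residue_surjective b
    obtain ⟨a, ha⟩ := h2 b 1 one_ne_zero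
    rw [map_one] at ha
    have haO : φ a ∈ O := by
      have := O.sub_mem b.2 ((O.valuation_le_one_iff _).mp ha.le)
      rwa [sub_sub_cancel] at this
    refine ⟨⟨a, haO⟩, r.injective ?_⟩
    rw [hψ, hr]
    exact (comapResidue_eq_iff.mpr ha).symm
  · intro h
    have : p = 0 := congr_arg Subtype.val h
    rw [this, map_zero, map_zero, eq_comm, map_eq_zero, map_eq_zero] at hpv
    exact hz₀ hpv
  · intro a ha
    rw [hψ0] at ha
    have hp0 : φ p ≠ 0 := by
      rw [← Valuation.ne_zero_iff O.valuation, hpv, Valuation.ne_zero_iff, map_ne_zero]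
      exact hz₀
    have hle : O.valuation (φ a) ≤ O.valuation (φ p) := by
      rcases eq_or_ne (a : E) 0 with h | h
      · simp [h]
      obtain ⟨b, hb⟩ := h1 a (φ a) ((map_ne_zero φ).mpr h)
      have hbv := valuation_eq_of_sub_lt hb
      rw [← hbv, hpv, ← valuation_comap_le]
      exact hz b (valuation_comap_lt_one.mpr (hbv.trans_lt ha))
    refine ⟨⟨a / p, (O.valuation_le_one_iff _).mp ?_⟩, Subtype.ext ?_⟩
    · rw [map_div₀, map_div₀]
      exact div_le_one_of_le₀ hle zero_le
    · exact (mul_div_cancel₀ _ ((map_ne_zero φ).mp hp0)).symm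

end Comap

variable {k F : Type u} [Field k] [Field F] [Algebra (LaurentSeries k) F]

theorem GaussAt.exists_uniformizer {O : ValuationSubring F} (hO : Center k O) {x : F}
    [FiniteDimensional (LaurentSeries k)⟮x⟯ F] (hx : GaussAt k O x) :
    ∃ z₀ : F, z₀ ≠ 0 ∧ O.valuation z₀ < 1 ∧
      ∀ z, O.valuation z < 1 → O.valuation z ≤ O.valuation z₀ := by
  classical
  obtain ⟨e, he, h⟩ := hx.exists_pow_eq hO
  have ht0 : 0 < O.valuation (serHom k F PowerSeries.X) :=
    (Valuation.pos_iff _).mpr serHom_X_ne_zero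
  have hpos {z : F} (hz0 : z ≠ 0) (hz : O.valuation z < 1) : ∃ a : ℕ,
      O.valuation z ^ e = O.valuation (serHom k F PowerSeries.X) ^ a := by
    obtain ⟨a, ha⟩ := h z hz0
    have : 0 < a := by
      by_contra! hle
      have h1 := one_le_zpow_of_nonpos₀ ht0 hO.2.le hle
      exact absurd h1 (not_le.mpr (ha ▸ pow_lt_one₀ zero_le hz he.ne'))
    lift a to ℕ using this.le
    exact ⟨a, by exact_mod_cast ha⟩
  have hex : ∃ a : ℕ, ∃ z : F, z ≠ 0 ∧ O.valuation z < 1 ∧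
      O.valuation z ^ e = O.valuation (serHom k F PowerSeries.X) ^ a :=
    ⟨e, _, serHom_X_ne_zero, hO.2, rfl⟩
  obtain ⟨z₀, hz₀, hlt, hz₀a⟩ := Nat.find_spec hex
  refine ⟨z₀, hz₀, hlt, fun z hz => ?_⟩
  rcases eq_or_ne z 0 with rfl | hz0
  · simp
  obtain ⟨a, ha⟩ := hpos hz0 hz
  rw [← pow_le_pow_iff_left₀ zero_le zero_le he.ne', ha, hz₀a]
  exact pow_le_pow_of_le_one zero_le hO.2.le (Nat.find_min' hex ⟨z, hz0, hz, ha⟩)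

theorem good_of_not_gauss [CharZero k] {n : ℕ} (hk : LevelBound n k) {O : ValuationSubring F}
    (hO : Center k O) (h : ∀ x, ¬ GaussAt k O x) : Good n (ResidueField O) := by
  let _ := hO.residueHom.toAlgebra
  have : CharZero (ResidueField O) := charZero_of_injective_algebraMap hO.residueHom.injective
  have : Algebra.IsAlgebraic k (ResidueField O) := by
    refine ⟨fun r => ?_⟩
    obtain ⟨x, rfl⟩ := residue_surjective r
    have := h x
    simp only [GaussAt, not_forall] at this
    obtain ⟨p, hp, hpx⟩ := this
    refine ⟨p, hp, (hO.residue_eval₂_base x p).mpr (lt_of_le_of_ne ?_ hpx)⟩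
    rw [← eval₂_map_C, O.valuation_le_one_iff]
    exact hO.eval₂_mem x.2 _
  exact ⟨hk _, (hk.of_isAlgebraic (l := ResidueField O)).sums_subset⟩

theorem exists_comap_eq {F Ω : Type*} [Field F] [Field Ω] (j : F →+* Ω) (O : ValuationSubring F) :
    ∃ V : ValuationSubring Ω, V.comap j = O := by
  obtain ⟨V, hV, hloc⟩ := (O.toLocalSubring.map j).exists_le_valuationSubring
  refine ⟨V, le_antisymm (fun z hz => ?_) fun z hz => hV ⟨z, hz, rfl⟩⟩
  by_contra hzO
  have hz0 : z ≠ 0 := fun h => hzO (h ▸ O.zero_mem)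
  have hzi : z⁻¹ ∈ O := (O.mem_or_inv_mem z).resolve_left hzO
  obtain ⟨u, hu⟩ := (hloc.map_nonunit ⟨j z⁻¹, z⁻¹, hzi, rfl⟩ (IsUnit.of_mul_eq_one ⟨j z, hz⟩
    (Subtype.ext (by simp [hz0])))).exists_right_inv
  obtain ⟨y, hy, hyu⟩ := u.2
  have h : j z⁻¹ * j y = 1 := by
    rw [hyu]
    exact congr_arg Subtype.val hu
  rw [← map_mul, map_eq_one_iff j j.injective, inv_mul_eq_one₀ hz0] at h
  exact hzO (h ▸ hy)

section Scalar

variable {Ω : Type u} [Field Ω] [Algebra (LaurentSeries k) Ω] [Algebra F Ω]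
  [IsScalarTower (LaurentSeries k) F Ω]

theorem algebraMap_serHom (r : PowerSeries k) : algebraMap F Ω (serHom k F r) = serHom k Ω r :=
  (IsScalarTower.algebraMap_apply (LaurentSeries k) F Ω _).symm

theorem center_comap {O : ValuationSubring Ω} :
    Center k (O.comap (algebraMap F Ω)) ↔ Center k O := by
  simp [Center, valuation_comap_lt_one, ValuationSubring.mem_comap, algebraMap_serHom]

theorem gaussAt_comap {O : ValuationSubring Ω} {x : F} :
    GaussAt k (O.comap (algebraMap F Ω)) x ↔ GaussAt k O (algebraMap F Ω x) := by
  have : (algebraMap F Ω).comp (baseHom k F) = baseHom k Ω :=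
    RingHom.ext fun _ => algebraMap_serHom _
  simp only [GaussAt, valuation_comap_eq_one, Polynomial.hom_eval₂, this]

theorem Center.charZero [CharZero k] {O : ValuationSubring F} (hO : Center k O) :
    CharZero (ResidueField O) :=
  (RingHom.charZero_iff hO.residueHom.injective).mp inferInstance

theorem GaussAt.isArch_of_comap [Algebra.IsAlgebraic F Ω] {O : ValuationSubring Ω}
    (hO : Center k O) {x : F} [FiniteDimensional (LaurentSeries k)⟮x⟯ F]
    (hx : GaussAt k (O.comap (algebraMap F Ω)) x) : IsArch O := by
  refine isArch_of_pow_eq O serHom_X_ne_zero hO.2 fun z hz => ?_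
  obtain ⟨e, he, c, hc, hzc⟩ := exists_valuation_pow_eq O.valuation hz
    (Algebra.IsAlgebraic.isAlgebraic (R := F) z)
  obtain ⟨e', he', h⟩ := hx.exists_pow_eq (center_comap.mpr hO)
  obtain ⟨a, ha⟩ := h c hc
  refine ⟨e * e', mul_pos he he', a, ?_⟩
  rw [← map_pow, ← map_zpow₀, valuation_comap_eq, map_pow, map_zpow₀, algebraMap_serHom] at ha
  rw [pow_mul, hzc, ← map_pow, ha, map_zpow₀]

theorem good_of_unifBy [CharZero k] [Algebra.IsAlgebraic F Ω] {n : ℕ}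
    (hL : LevelBound n (LaurentSeries k)) {O : ValuationSubring Ω} (hO : Center k O) {x : F}
    [FiniteDimensional (LaurentSeries k)⟮x⟯ F] (hx : GaussAt k (O.comap (algebraMap F Ω)) x)
    {T : Set Ω} (hT : (algebraMap F Ω).fieldRange ≤
      Subfield.closure ((algebraMap (LaurentSeries k) Ω).fieldRange ∪ T))
    (h : UnifBy O (algebraMap (LaurentSeries k) Ω).fieldRange (algebraMap F Ω).fieldRange T) :
    Good n (ResidueField (O.comap (algebraMap F Ω))) := by
  have hOF : Center k (O.comap (algebraMap F Ω)) := center_comap.mpr hO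
  have := hOF.charZero
  have hArch := hx.isArch_of_comap hO
  obtain ⟨M, -, hMH, hMC, s, hsH, hsC, hTH⟩ := h
  set C := (algebraMap (LaurentSeries k) Ω).fieldRange with hC
  set N := (algebraMap F Ω).fieldRange with hN
  have hCN : C ≤ N := by
    rintro _ ⟨c, rfl⟩
    exact ⟨algebraMap _ F c, (IsScalarTower.algebraMap_apply (LaurentSeries k) F Ω c).symm⟩
  set B := Subfield.closure ((C : Set Ω) ∪ M) with hB
  have hBC : B ≤ relAlg C := Subfield.closure_le.mpr (Set.union_subset (le_relAlg C) hMC)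
  have hBH : B ≤ hensClosure O N := Subfield.closure_le.mpr
    (Set.union_subset (fun c hc => subset_hensClosure (hCN hc)) hMH)
  have hCB (c) : algebraMap (LaurentSeries k) Ω c ∈ B := Subfield.subset_closure (Or.inl ⟨c, rfl⟩)
  let _ : Algebra (LaurentSeries k) B := ((algebraMap (LaurentSeries k) Ω).codRestrict B hCB).toAlgebra
  have : IsScalarTower (LaurentSeries k) B Ω := .of_algebraMap_eq fun _ => rfl
  have : Algebra.IsAlgebraic (LaurentSeries k) B := ⟨fun b =>
    (isAlgebraic_algebraMap_iff (algebraMap B Ω).injective).mp (mem_relAlg_fieldRange.mp (hBC b.2))⟩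
  have : CharZero Ω := (RingHom.charZero_iff (baseHom k Ω).injective).mp inferInstance
  have : CharZero B := (RingHom.charZero_iff B.subtype.injective).mpr inferInstance
  have hs : Function.Injective (Polynomial.aeval (R := B) s : Polynomial B →+* Ω) :=
    transcendental_iff_injective.mp fun h => hsC (relAlg_le hBC (mem_relAlg.mpr h))
  let φ : RatFunc B →+* Ω := IsFractionRing.lift hs
  have hφ (p) : φ (algebraMap (Polynomial B) _ p) = Polynomial.aeval s p :=
    IsFractionRing.lift_algebraMap hs p
  have hφH : φ.fieldRange ≤ hensClosure O N := by
    have hp (p : Polynomial B) : Polynomial.aeval s p ∈ hensClosure O (N : Set Ω) := by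
      rw [Polynomial.aeval_eq_sum_range]
      refine sum_mem fun i _ => ?_
      rw [Algebra.smul_def]
      exact mul_mem (hBH (p.coeff i).2) (pow_mem hsH i)
    rintro _ ⟨a, rfl⟩
    obtain ⟨p, q, -, rfl⟩ := IsFractionRing.div_surjective (A := Polynomial B) a
    rw [map_div₀, hφ, hφ]
    exact div_mem (hp p) (hp q)
  have hBφ : B ≤ φ.fieldRange := fun b hb => ⟨algebraMap (Polynomial B) _ (.C ⟨b, hb⟩), by
    rw [hφ, Polynomial.aeval_C]
    rfl⟩
  have hNH : N ≤ hensClosure O φ.fieldRange := by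
    refine hT.trans (Subfield.closure_le.mpr (Set.union_subset ?_ ?_))
    · rintro _ ⟨c, rfl⟩
      exact subset_hensClosure (hBφ (hCB c))
    · refine hTH.trans (hensClosure_mono (Set.union_subset (Subfield.subset_closure.trans hBφ) ?_))
      rintro _ rfl
      exact ⟨algebraMap (Polynomial B) _ .X, by rw [hφ, Polynomial.aeval_X]⟩
  obtain ⟨z₀, hz₀, hlt, hz⟩ := hx.exists_uniformizer hOF
  refine good_of_approx (φ := φ) (hL.of_isAlgebraic (l := B)).sums_ratFunc_subset
    (fun a δ hδ => ?_) (fun b δ hδ => ?_) hz₀ hlt hz two_ne_zero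
  · obtain ⟨_, ⟨b, rfl⟩, hb⟩ := hensClosure_le_limitField hArch N (hφH ⟨a, rfl⟩) δ hδ
    exact ⟨b, hb⟩
  · obtain ⟨_, ⟨a, rfl⟩, ha⟩ := hensClosure_le_limitField hArch φ.fieldRange (hNH ⟨b, rfl⟩) δ hδ
    exact ⟨a, ha⟩

end Scalar

theorem mem_relAlg_closure {K Ω : Type*} [Field K] [Field Ω] [Algebra K Ω] {y z : Ω} :
    z ∈ relAlg (Subfield.closure (((algebraMap K Ω).fieldRange : Set Ω) ∪ {y})) ↔
      IsAlgebraic K⟮y⟯ z := mem_relAlg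

theorem fieldRange_adjoin_le {K F Ω : Type*} [Field K] [Field F] [Field Ω] [Algebra K F]
    [Algebra K Ω] [Algebra F Ω] [IsScalarTower K F Ω] {x : F} :
    (algebraMap K⟮x⟯ Ω).fieldRange ≤
      Subfield.closure (((algebraMap K Ω).fieldRange : Set Ω) ∪ {algebraMap F Ω x}) := by
  rintro _ ⟨w, rfl⟩
  suffices h : K⟮x⟯.toSubfield ≤ (Subfield.closure
    (((algebraMap K Ω).fieldRange : Set Ω) ∪ {algebraMap F Ω x})).comap (algebraMap F Ω) from h w.2
  refine Subfield.closure_le.mpr ?_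
  rintro _ (⟨c, rfl⟩ | rfl)
  · exact Subfield.subset_closure (Or.inl ⟨c, IsScalarTower.algebraMap_apply K F Ω c⟩)
  · exact mem_closure_union_singleton

theorem mem_relAlg_closure_of_transcendental {K F Ω : Type*} [Field K] [Field F] [Field Ω]
    [Algebra K F] [Algebra K Ω] [Algebra F Ω] [IsScalarTower K F Ω] [Algebra.IsAlgebraic F Ω]
    {x : F} (hx : Transcendental K x) [FiniteDimensional K⟮x⟯ F] {y : Ω}
    (hy : y ∉ relAlg (algebraMap K Ω).fieldRange) (z : Ω) :
    z ∈ relAlg (Subfield.closure (((algebraMap K Ω).fieldRange : Set Ω) ∪ {y})) := by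
  rw [mem_relAlg_fieldRange] at hy
  have := Algebra.IsAlgebraic.trans K⟮x⟯ F Ω
  refine relAlg_le (fieldRange_adjoin_le.trans (Subfield.closure_le.mpr (Set.union_subset
    (fun c hc => le_relAlg _ (Subfield.subset_closure (Or.inl hc))) ?_)))
    (mem_relAlg_fieldRange.mpr (Algebra.IsAlgebraic.isAlgebraic (R := K⟮x⟯) z))
  rintro _ rfl
  exact mem_relAlg_closure.mpr (isAlgebraic_adjoin_iff.mpr (.adjoin_singleton hx hy
    (isAlgebraic_adjoin_iff.mp (Algebra.IsAlgebraic.isAlgebraic y))))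

theorem finite_bad [CharZero k] {n : ℕ} (hk : LevelBound n k) {x₀ : F}
    (hx₀ : Transcendental (LaurentSeries k) x₀) [FiniteDimensional (LaurentSeries k)⟮x₀⟯ F] :
    {O : ValuationSubring F | Center k O ∧ ¬ Good n (ResidueField O)}.Finite := by
  by_contra hinf
  have := Set.infinite_coe_iff.mpr hinf
  have hfd {y : F} (hy : Transcendental (LaurentSeries k) y) :=
    finiteDimensional_adjoin_of_transcendental hx₀ hy
  let Ω := AlgebraicClosure F
  let j := algebraMap F Ω
  choose V hV using fun i : {O : ValuationSubring F | Center k O ∧ ¬ Good n (ResidueField O)} =>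
    exists_comap_eq j i.1
  have hVc (i) : Center k (V i) := center_comap.mp ((hV i).symm ▸ i.2.1)
  obtain ⟨S, hS⟩ := Module.Finite.fg_top (R := (LaurentSeries k)⟮x₀⟯) (M := F)
  set T : Set Ω := j '' insert x₀ S
  have hT : j.fieldRange ≤ Subfield.closure ((algebraMap (LaurentSeries k) Ω).fieldRange ∪ T) := by
    rintro _ ⟨f, rfl⟩
    have hf : f ∈ Submodule.span (LaurentSeries k)⟮x₀⟯ (S : Set F) := hS ▸ trivial
    induction hf using Submodule.span_induction with
    | mem f hf => exact Subfield.subset_closure (Or.inr ⟨f, Or.inr hf, rfl⟩)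
    | zero => simp
    | add f g _ _ hf hg => rw [map_add]; exact add_mem hf hg
    | smul c f _ hf =>
      rw [Algebra.smul_def, map_mul]
      refine mul_mem (Subfield.closure_mono (Set.union_subset_union_right _ ?_)
        (fieldRange_adjoin_le ⟨c, rfl⟩)) hf
      exact Set.singleton_subset_iff.mpr ⟨x₀, Or.inl rfl, rfl⟩
  obtain ⟨i, hi⟩ := exists_unifBy (T := T) (N := j.fieldRange) (x := j x₀) hVc
    (by
      rintro _ ⟨c, rfl⟩
      exact ⟨algebraMap _ F c, (IsScalarTower.algebraMap_apply (LaurentSeries k) F Ω c).symm⟩)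
    (by
      rintro _ ⟨y, rfl⟩
      by_cases hy : Transcendental (LaurentSeries k) y
      · have := hfd hy
        refine ((finite_setOf_gaussAt (k := k) y).preimage
          Subtype.val_injective.injOn).subset fun i hi => ⟨i.2.1, ?_⟩
        rw [← hV i]
        exact gaussAt_comap.mpr hi
      · refine Set.finite_empty.subset fun i hi => hy ?_
        exact (gaussAt_comap.mpr hi).transcendental (center_comap.mpr (hVc i)))
    (fun y hy => mem_relAlg_closure_of_transcendental hx₀ hy) ⟨x₀, rfl⟩
    (fun h => (transcendental_algebraMap_iff j.injective).mpr hx₀ (mem_relAlg_fieldRange.mp h))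
    ((S.finite_toSet.insert x₀).image j) (by
      rintro _ ⟨f, -, rfl⟩
      exact ⟨f, rfl⟩)
  refine i.2.2 ?_
  by_cases hg : ∃ x, GaussAt k i.1 x
  · obtain ⟨x, hx⟩ := hg
    have := hfd (hx.transcendental i.2.1)
    rw [← hV i] at hx ⊢
    exact good_of_unifBy hk.laurentSeries (hVc i) hx hT hi
  · exact good_of_not_gauss hk i.2.1 (not_exists.mp hg)

end

section Glue

open IsLocalRing

variable {F : Type*} [Field F] {O : ValuationSubring F} {H : Subring (ResidueField O)}

theorem residue_eq_residue_iff {a b : O} :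
    residue O a = residue O b ↔ O.valuation (a - b : F) < 1 := by
  rw [← sub_eq_zero, ← map_sub, residue_eq_zero_iff]
  rfl

theorem exists_approx_sumSq {N : ℕ} {z : O} (hz : residue O z ≠ 0)
    (hzN : residue O z ∈ sumSq (ResidueField O) N) :
    ∃ d ∈ sumSq F N, d ≠ 0 ∧ O.valuation (z / d - 1) < 1 := by
  obtain ⟨f, hf⟩ := hzN
  choose g hg using fun i => residue_surjective (f i)
  have hd : residue O z = residue O (∑ i, g i ^ 2) := by simp [hf, hg]
  have hd1 : O.valuation ((∑ i, g i ^ 2 : O) : F) = 1 := by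
    rw [← ValuationSubring.valuation_eq_one_iff, ← residue_ne_zero_iff_isUnit, ← hd]
    exact hz
  have hd0 : ((∑ i, g i ^ 2 : O) : F) ≠ 0 := by
    rw [← Valuation.ne_zero_iff O.valuation, hd1]
    exact one_ne_zero
  refine ⟨_, ⟨fun i => (g i : F), by push_cast; rfl⟩, hd0, ?_⟩
  rw [div_sub_one hd0, map_div₀, hd1, div_one]
  exact residue_eq_residue_iff.mp hd

theorem residue_mem_sums (h2 : (2 : ResidueField O) ≠ 0) {z : O} (hz : (z : F) ∈ sums F)
    (hz0 : residue O z ≠ 0) : residue O z ∈ sums (ResidueField O) := by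
  obtain ⟨N, hN⟩ := mem_sums.1 hz
  rcases residue_mem_sumSq O (residue O) (fun z => (residue_ne_zero_iff_isUnit z).mp) hN hz0 with
    h | ⟨b, hb, h⟩
  · exact sumSq_subset_sums _ h
  · obtain ⟨l, hl⟩ := mem_sums.1 (neg_one_mem_sums_of_map_eq_zero _ b hb h)
    exact sumSq_subset_sums _ (mem_sumSq_of_neg_one_mem h2 (sumSq_mono Nat.lt_two_pow_self.le hl) _)

theorem locallyGood_of_good {n : ℕ} (h : Good n (ResidueField O)) {f : F} (hf : f ∈ sums F)
    (hf0 : f ≠ 0) : LocallyGood n O f := by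
  obtain ⟨N, hN⟩ := mem_sums.1 hf
  obtain ⟨e, he, b, hb, rfl⟩ := exists_eq_sq_mul_sum O hN hf0
  by_cases hs : residue O (∑ i, b i ^ 2) = 0
  · obtain ⟨c, hc⟩ := h.1 (neg_one_mem_sums_of_map_eq_zero _ b hb hs)
    choose g hg using fun i => residue_surjective (c i)
    refine Or.inr ⟨_, ⟨fun i => (g i : F), rfl⟩, ?_⟩
    have := (residue_eq_zero_iff (1 + ∑ i, g i ^ 2)).mp (by simp [hg, ← hc])
    simpa using this
  · obtain ⟨d, hd, hd0, hlt⟩ := exists_approx_sumSq hs (h.2 (map_mem_sums _ (sum_sq_mem_sums _ b)))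
    refine Or.inl ⟨e ^ 2 * d, sq_mul_mem_sumSq e hd, mul_ne_zero (pow_ne_zero 2 he) hd0, ?_⟩
    rwa [mul_div_mul_left _ _ (pow_ne_zero 2 he)]

variable (O H) in
/-- The elements of `O` with residue in `H`. -/
def residuePullback : Subring F := (H.comap (residue O)).map O.subtype

theorem mem_residuePullback {y : F} :
    y ∈ residuePullback O H ↔ ∃ h : y ∈ O, residue O ⟨y, h⟩ ∈ H := by
  refine ⟨?_, fun ⟨h, h'⟩ => ⟨⟨y, h⟩, h', rfl⟩⟩
  rintro ⟨z, hz, rfl⟩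
  exact ⟨z.2, hz⟩

theorem mem_residuePullback_of_sub_lt {y z : F} (hy : y ∈ residuePullback O H)
    (h : O.valuation (z - y) < 1) : z ∈ residuePullback O H := by
  obtain ⟨hO, hH⟩ := mem_residuePullback.mp hy
  have hz : z ∈ O := by
    simpa using O.add_mem _ _ ((O.valuation_le_one_iff _).mp h.le) hO
  refine mem_residuePullback.mpr ⟨hz, ?_⟩
  have e : residue O ⟨z, hz⟩ = residue O ⟨y, hO⟩ := residue_eq_residue_iff.mpr h
  rwa [e]

theorem div_sub_lt {x y c : F} (hc : c ≠ 0) (h : O.valuation (x - y * c) < O.valuation c) :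
    O.valuation (x / c - y) < 1 := by
  rw [div_sub' hc, map_div₀, mul_comm]
  exact (div_lt_one₀ ((Valuation.pos_iff _).mpr hc)).mpr h

variable (O H) in
/-- The residue map restricted to the elements of `O` with residue in `H`. -/
noncomputable def pullbackResidue : residuePullback O H →+* H :=
  ((residue O).comp ((residuePullback O H).subtype.codRestrict O.toSubring
    fun z => (mem_residuePullback.mp z.2).1)).codRestrict H fun z => (mem_residuePullback.mp z.2).2

theorem pullbackResidue_eq_iff {y z : residuePullback O H} :
    pullbackResidue O H y = pullbackResidue O H z ↔ O.valuation (y - z : F) < 1 :=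
  Subtype.ext_iff.trans residue_eq_residue_iff

theorem pullbackResidue_surjective : Function.Surjective (pullbackResidue O H) := by
  rintro ⟨b, hb⟩
  obtain ⟨a, rfl⟩ := residue_surjective b
  exact ⟨⟨a, a, hb, rfl⟩, rfl⟩

theorem exists_bezout_residuePullback [IsBezout H] (hH : IsFractionSubring H) (a b : F)
    (hab : a ≠ 0 ∨ b ≠ 0) : ∃ c, ∃ p q r s : residuePullback O H,
      c ≠ 0 ∧ a = c * p ∧ b = c * q ∧ (p * r + q * s : F) = 1 := by
  wlog hle : O.valuation b ≤ O.valuation a generalizing a b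
  · obtain ⟨c, p, q, r, s, hc, h1, h2, h3⟩ := this b a hab.symm (le_of_not_ge hle)
    exact ⟨c, q, p, s, r, hc, h2, h1, (add_comm _ _).trans h3⟩
  have ha : a ≠ 0 := by
    rintro rfl
    simp at hle
    simp [hle] at hab
  have hba : b / a ∈ O := by
    rw [← O.valuation_le_one_iff, map_div₀]
    exact div_le_one_of_le₀ hle zero_le
  obtain ⟨β, d, hd, hβ⟩ := hH (residue O ⟨b / a, hba⟩)
  obtain ⟨γ, hγ⟩ := IsBezout.span_pair_isPrincipal d β
  change _ = Ideal.span {γ} at hγ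
  obtain ⟨p, hp⟩ := Ideal.mem_span_singleton'.mp (hγ ▸ Ideal.mem_span_pair.mpr ⟨1, 0, by simp⟩ : d ∈ _)
  obtain ⟨q, hq⟩ := Ideal.mem_span_singleton'.mp (hγ ▸ Ideal.mem_span_pair.mpr ⟨0, 1, by simp⟩ : β ∈ _)
  obtain ⟨r, s, hrs⟩ := Ideal.mem_span_pair.mp (hγ.symm ▸ Ideal.mem_span_singleton_self γ)
  obtain ⟨p, rfl⟩ := pullbackResidue_surjective p
  obtain ⟨q, rfl⟩ := pullbackResidue_surjective q
  obtain ⟨r, rfl⟩ := pullbackResidue_surjective r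
  obtain ⟨s, rfl⟩ := pullbackResidue_surjective s
  have hO (z : residuePullback O H) : (z : F) ∈ O := (mem_residuePullback.mp z.2).1
  have hd' : (d : ResidueField O) ≠ 0 := fun h => hd (Subtype.ext h)
  let c : O := ⟨r, hO r⟩ + ⟨b / a, hba⟩ * ⟨s, hO s⟩
  replace hrs : residue O c * d = γ := by
    rw [← hrs, map_add, map_mul, add_mul, mul_right_comm, hβ, mul_comm (β : ResidueField O)]
    rfl
  have hpc : residue O 1 = residue O (⟨p, hO p⟩ * c) := by
    refine mul_right_cancel₀ hd' ?_
    rw [map_one, one_mul, map_mul, mul_assoc, hrs, ← hp]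
    rfl
  have hqc : residue O ⟨b / a, hba⟩ = residue O (⟨q, hO q⟩ * c) := by
    refine mul_right_cancel₀ hd' ?_
    rw [hβ, map_mul, mul_assoc, hrs, ← hq]
    rfl
  have hc1 : O.valuation (c : F) = 1 := by
    rw [← ValuationSubring.valuation_eq_one_iff, ← residue_ne_zero_iff_isUnit]
    intro h
    simp [h] at hpc
  have hc0 : (c : F) ≠ 0 := by
    rw [← Valuation.ne_zero_iff O.valuation, hc1]
    exact one_ne_zero
  rw [residue_eq_residue_iff] at hpc hqc
  refine ⟨a * c, ⟨1 / c, mem_residuePullback_of_sub_lt p.2 (div_sub_lt hc0 (hc1 ▸ hpc))⟩,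
    ⟨b / a / c, mem_residuePullback_of_sub_lt q.2 (div_sub_lt hc0 (hc1 ▸ hqc))⟩, r, s,
    mul_ne_zero ha hc0, by field_simp, by field_simp, ?_⟩
  have : (c : F) = r + b / a * s := rfl
  rw [div_mul_eq_mul_div, div_mul_eq_mul_div, one_mul, ← add_div, ← this, div_self hc0]

section Product

variable {ι : Type*}

theorem semilocal_of_surjective [Finite ι] {A : Type*} [CommRing A] {B : ι → Type*} [∀ i, CommRing (B i)]
    (ρ : ∀ i, A →+* B i) (hs : ∀ b : ∀ i, B i, ∃ a, ∀ i, ρ i a = b i)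
    (hu : ∀ a, (∀ i, IsUnit (ρ i a)) → IsUnit a) (h : ∀ i, Semilocal (B i)) : Semilocal A := by
  classical
  have := Fintype.ofFinite ι
  refine (Set.finite_iUnion fun i => (h i).image (Ideal.comap (ρ i))).subset fun M hM => ?_
  by_contra hMc
  simp only [Set.mem_iUnion, Set.mem_image, not_exists, not_and] at hMc
  have hy (i) : ∃ y ∈ M, ρ i y = 1 := by
    by_contra! hy
    have hsur : Function.Surjective (ρ i) := fun b =>
      (hs (Function.update 0 i b)).imp fun a ha => by simpa using ha i
    obtain ⟨N, hN, hMN⟩ := Ideal.exists_le_maximal (M.map (ρ i)) (by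
      rw [Ideal.ne_top_iff_one, Ideal.mem_map_iff_of_surjective _ hsur]
      exact fun ⟨y, hyM, h⟩ => hy y hyM h)
    exact hMc i N hN (hM.eq_of_le (Ideal.comap_ne_top _ hN.ne_top)
      (Ideal.map_le_iff_le_comap.mp hMN)).symm
  choose y hyM hy using hy
  choose e he using fun i => hs (Pi.single i 1)
  refine hM.ne_top (Ideal.eq_top_of_isUnit_mem _
    (M.sum_mem fun i (_ : i ∈ Finset.univ) => M.mul_mem_left (e i) (hyM i)) (hu _ fun i => ?_))
  rw [map_sum, Finset.sum_eq_single i]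
  · simp [he, hy]
  · intro j _ hj
    simp [he, hj.symm]
  · simp

theorem sqEffOrder_of_surjective {F : Type*} [CommRing F] {H : Subring F} {κ : ι → Type*}
    [∀ i, CommRing (κ i)] {H' : ∀ i, Subring (κ i)} (ρ : ∀ i, H →+* H' i)
    (hs : ∀ b : ∀ i, H' i, ∃ a, ∀ i, ρ i a = b i) (hu : ∀ a, (∀ i, IsUnit (ρ i a)) → IsUnit a)
    {m : ℕ} (h : ∀ i, SqEffOrder (H' i) m) : SqEffOrder H m := by
  refine ⟨fun x hx => hu _ fun i => ?_, ?_⟩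
  · rw [map_add, map_one]
    exact (h i).1 _ (map_mem_sumSq (ρ i) hx)
  choose x hx hxJ using fun i => (h i).2
  choose f hf using hx
  choose g hg using fun l => hs fun i => f i l
  refine ⟨_, ⟨g, rfl⟩, Ideal.mem_jacobson_bot.mpr fun y => hu _ fun i => ?_⟩
  have : ρ i (∑ l, g l ^ 2) = x i := by simp [hf, hg]
  rw [map_add, map_mul, map_add, map_one, this]
  exact Ideal.mem_jacobson_bot.mp (hxJ i) _

theorem isNEffective_of_residueField [Finite ι] [Nonempty ι] {O : ι → ValuationSubring F}
    (hO : ∀ i, IsArch (O i)) (hne : ∀ i, O i ≠ ⊤) (hinj : Function.Injective O) {t : F} (ht0 : t ≠ 0)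
    (ht : ∀ i, (O i).valuation t < 1) (h2 : ∀ i, (2 : ResidueField (O i)) ≠ 0) {m : ℕ}
    (hF : ∀ f ∈ sums F, f ≠ 0 → (∀ i, ∃ d ∈ sumSq F (2 ^ m), d ≠ 0 ∧
      (O i).valuation (f / d - 1) < 1) → f ∈ sumSq F (2 ^ m))
    (hκ : ∀ i, IsNEffective m (ResidueField (O i))) : IsNEffective m F := by
  choose H' hfr hsl hbz hsq hps using hκ
  set H := ⨅ i, residuePullback (O i) (H' i) with hH
  have hmem {y} : y ∈ H ↔ ∀ i, y ∈ residuePullback (O i) (H' i) := Subring.mem_iInf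
  let ρ (i) : H →+* H' i :=
    (pullbackResidue (O i) (H' i)).comp (Subring.inclusion (iInf_le _ i))
  have hlift (y : ∀ i, residuePullback (O i) (H' i)) :
      ∃ z : H, ∀ i, ρ i z = pullbackResidue _ _ (y i) := by
    obtain ⟨z, hz⟩ := exists_approx hO hne hinj (fun i => y i) (fun _ => 1) (by simp)
    simp only [map_one] at hz
    exact ⟨⟨z, hmem.mpr fun i => mem_residuePullback_of_sub_lt (y i).2 (hz i)⟩,
      fun i => pullbackResidue_eq_iff.mpr (hz i)⟩
  have hs (b : ∀ i, H' i) : ∃ a, ∀ i, ρ i a = b i := by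
    choose y hy using fun i => pullbackResidue_surjective (b i)
    simpa only [hy] using hlift y
  have hu (y : H) (hy : ∀ i, IsUnit (ρ i y)) : IsUnit y := by
    have hy0 : (y : F) ≠ 0 := by
      intro h
      obtain ⟨i⟩ := ‹Nonempty ι›
      exact (hy i).ne_zero (by rw [show y = 0 from Subtype.ext h, map_zero])
    refine IsUnit.of_mul_eq_one ⟨(y : F)⁻¹, hmem.mpr fun i => ?_⟩ (Subtype.ext (mul_inv_cancel₀ hy0))
    obtain ⟨w, hw⟩ := (hy i).exists_left_inv
    obtain ⟨w, rfl⟩ := pullbackResidue_surjective w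
    have hyO := (mem_residuePullback.mp (hmem.mp y.2 i)).1
    have hy1 : (O i).valuation (y : F) = 1 := by
      refine ((O i).valuation_eq_one_iff ⟨y, hyO⟩).mp ((residue_ne_zero_iff_isUnit _).mp fun h => ?_)
      exact (hy i).ne_zero (Subtype.ext h)
    rw [← one_div]
    refine mem_residuePullback_of_sub_lt w.2 (div_sub_lt hy0 ?_)
    rw [hy1]
    exact pullbackResidue_eq_iff.mp (((map_one _).trans hw.symm).trans
      (map_mul (pullbackResidue (O i) (H' i)) w ⟨y, hmem.mp y.2 i⟩).symm)
  refine ⟨H, fun x => ?_, semilocal_of_surjective ρ hs hu hsl,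
    IsBezout.iff_span_pair_isPrincipal.mpr fun a b => ?_, sqEffOrder_of_surjective ρ hs hu hsq,
    pstar_le_iff.mpr fun h hh hhs => hF h hhs (fun h0 => hh.ne_zero (Subtype.ext h0)) fun i => ?_⟩
  · obtain ⟨N, hN⟩ := (Filter.eventually_all.mpr fun i => ((hO i).eventually (ht i) x one_ne_zero).and
      ((hO i).eventually (ht i) 1 one_ne_zero)).exists
    simp only [map_one, mul_one] at hN
    have hlt {y : F} (hy : ∀ i, (O i).valuation y < 1) : y ∈ H := hmem.mpr fun i =>
      mem_residuePullback_of_sub_lt (zero_mem _) (by simpa using hy i)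
    exact ⟨⟨_, hlt fun i => (hN i).1⟩, ⟨_, hlt fun i => (hN i).2⟩,
      fun h => pow_ne_zero N ht0 (congr_arg Subtype.val h), mul_comm _ _⟩
  · by_cases hab : (a : F) ≠ 0 ∨ (b : F) ≠ 0
    · choose c p q r s hc ha hb hpq using fun i =>
        have := hbz i; exists_bezout_residuePullback (hfr i) (a : F) b hab
      obtain ⟨g, hg⟩ := exists_approx hO hne hinj c c hc
      have hgv (i) : (O i).valuation g = (O i).valuation (c i) :=
        valuation_eq_of_sub_lt (by rw [Valuation.map_sub_swap]; exact hg i)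
      have hg0 : g ≠ 0 := by
        obtain ⟨i⟩ := ‹Nonempty ι›
        rw [← Valuation.ne_zero_iff (O i).valuation, hgv, Valuation.ne_zero_iff]
        exact hc i
      have hdiv {x : F} {p : ∀ i, residuePullback (O i) (H' i)} (hx : ∀ i, x = c i * p i) (i) :
          (O i).valuation (x / g - p i) < 1 := by
        refine div_sub_lt hg0 ?_
        rw [hx i, mul_comm, ← mul_sub, map_mul, Valuation.map_sub_swap, hgv]
        exact (mul_le_of_le_one_left' (((O i).valuation_le_one_iff _).mpr
          (mem_residuePullback.mp (p i).2).1)).trans_lt (hg i)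
      let A : H := ⟨a / g, hmem.mpr fun i => mem_residuePullback_of_sub_lt (p i).2 (hdiv ha i)⟩
      let B : H := ⟨b / g, hmem.mpr fun i => mem_residuePullback_of_sub_lt (q i).2 (hdiv hb i)⟩
      obtain ⟨r', hr⟩ := hlift r
      obtain ⟨s', hs'⟩ := hlift s
      obtain ⟨w, hw⟩ := (hu (A * r' + B * s') fun i => by
        have hA : ρ i A = pullbackResidue _ _ (p i) := pullbackResidue_eq_iff.mpr (hdiv ha i)
        have hB : ρ i B = pullbackResidue _ _ (q i) := pullbackResidue_eq_iff.mpr (hdiv hb i)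
        rw [map_add, map_mul, map_mul, hA, hB, hr, hs', ← map_mul, ← map_mul, ← map_add,
          show p i * r i + q i * s i = 1 from Subtype.ext (hpq i), map_one]
        exact isUnit_one).exists_right_inv
      replace hw : (a / g * r' + b / g * s' : F) * w = 1 := congr_arg Subtype.val hw
      have ha' : (a : F) = g * (a / g) := by field_simp
      have hb' : (b : F) = g * (b / g) := by field_simp
      refine ⟨⟨a * r' + b * s', le_antisymm (Ideal.span_le.mpr (Set.pair_subset ?_ ?_))
        (Ideal.span_le.mpr (Set.singleton_subset_iff.mpr
          (Ideal.mem_span_pair.mpr ⟨r', s', by ring⟩)))⟩⟩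
      · refine Ideal.mem_span_singleton'.mpr ⟨A * w, Subtype.ext ?_⟩
        change (a / g * w * (a * r' + b * s') : F) = a
        linear_combination a * hw
      · refine Ideal.mem_span_singleton'.mpr ⟨B * w, Subtype.ext ?_⟩
        change (b / g * w * (a * r' + b * s') : F) = b
        linear_combination b * hw
    · push Not at hab
      obtain ⟨rfl, rfl⟩ : a = 0 ∧ b = 0 := ⟨Subtype.ext hab.1, Subtype.ext hab.2⟩
      exact ⟨0, by simp⟩
  · have h0 : residue (O i) ⟨h, (mem_residuePullback.mp (hmem.mp h.2 i)).1⟩ ≠ 0 :=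
      fun h0 => (hh.map (ρ i)).ne_zero (Subtype.ext h0)
    exact exists_approx_sumSq h0
      (pstar_le_iff.mp (hps i) (ρ i h) (hh.map (ρ i)) (residue_mem_sums (h2 i) hhs h0))

end Product

theorem isNEffective_of_not_good {κ : Type*} [Field κ] {n : ℕ} (h : ¬ Good n κ)
    (hp : ((2 ^ (n + 1) : ℕ) : ℕ∞) < pyth κ → IsNEffective (n + 1) κ) : IsNEffective (n + 1) κ := by
  by_cases hs : sums κ ⊆ sumSq κ (2 ^ (n + 1))
  swap
  · exact hp (not_le.mp (mt pyth_le_iff.mp hs))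
  obtain ⟨h1, h2⟩ : (-1 : κ) ∈ sums κ ∧ (-1 : κ) ∉ sumSq κ (2 ^ n) := by
    by_contra h'
    exact h ⟨fun a => by_contra fun b => h' ⟨a, b⟩, hs⟩
  have hfield : IsField (⊤ : Subring κ) := Subring.topEquiv.toMulEquiv.isField (Field.toIsField κ)
  have := Ring.isField_iff_isSimpleOrder_ideal.mp hfield
  have := hfield.isPrincipalIdealRing
  refine ⟨⊤, fun x => ⟨⟨x, trivial⟩, 1, one_ne_zero, mul_one x⟩,
    (Set.finite_singleton ⊥).subset fun I hI => (eq_bot_or_eq_top I).resolve_right hI.ne_top,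
    inferInstance,
    ⟨fun x ⟨f, hf⟩ => ?_, -1, map_mem_sumSq (Subring.topEquiv (R := κ)).symm.toRingHom (hs h1), by simp⟩,
    pstar_le_iff.mpr fun h _ hh => hs hh⟩
  by_contra hx
  have hx0 : 1 + (x : κ) = 0 := by
    by_contra h0
    obtain ⟨y, hy⟩ := hfield.mul_inv_cancel (a := 1 + x) fun h' => h0 (congr_arg Subtype.val h')
    exact hx (.of_mul_eq_one y hy)
  have e : 2 ^ (n + 1) - 1 + 1 = 2 ^ (n + 1) := Nat.sub_add_cancel Nat.one_le_two_pow
  refine h2 (neg_one_mem_sumSq_of_isotropic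
    ((Fin.cons 1 fun i => (f i : κ) : Fin (_ + 1) → κ) ∘ Fin.cast e.symm) ⟨Fin.cast e 0, by simp⟩ ?_)
  rw [← (finCongr e).sum_comp, Fin.sum_univ_succ, ← hx0, hf]
  simp

end Glue

section LaurentSeries

open IsLocalRing

theorem LevelBound.isNEffective {k F : Type u} [Field k] [CharZero k] [Field F]
    [Algebra (LaurentSeries k) F] {n : ℕ} (hk : LevelBound n k)
    (hF : IsFunctionFieldOneVar (LaurentSeries k) F)
    (hκ : ∀ (κ : Type u) [Field κ] [Algebra k κ], IsFunctionFieldOneVar k κ →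
      ((2 ^ (n + 1) : ℕ) : ℕ∞) < pyth κ → IsNEffective (n + 1) κ)
    (hp : ((2 ^ (n + 1) : ℕ) : ℕ∞) < pyth F) : IsNEffective (n + 1) F := by
  obtain ⟨x₀, hx₀, _⟩ := hF
  let Bad := {O : ValuationSubring F // Center k O ∧ ¬ Good n (ResidueField O)}
  have : Finite Bad := (finite_bad hk hx₀).to_subtype
  have hg (O : Bad) : ∃ x, GaussAt k O.1 x := by
    by_contra! h
    exact O.2.2 (good_of_not_gauss hk O.2.1 h)
  choose x hx using hg
  have hfd (O : Bad) :=
    finiteDimensional_adjoin_of_transcendental hx₀ ((hx O).transcendental O.2.1)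
  have hlgp : ∀ f ∈ sums F, f ≠ 0 → (∀ O : Bad, ∃ d ∈ sumSq F (2 ^ (n + 1)), d ≠ 0 ∧
      O.1.valuation (f / d - 1) < 1) → f ∈ sumSq F (2 ^ (n + 1)) := by
    intro f hf hf0 h
    refine mem_sumSq_of_locallyGood hx₀ hf0 fun O hO => ?_
    by_cases hg : Good n (ResidueField O)
    · exact locallyGood_of_good hg hf hf0
    · exact Or.inl (h ⟨O, hO, hg⟩)
  have : Nonempty Bad := by
    by_contra hne
    refine hp.not_ge (pyth_le_iff.mpr fun f hf => ?_)
    rcases eq_or_ne f 0 with rfl | hf0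
    · exact zero_mem_sumSq _
    · exact hlgp f hf hf0 fun O => (hne ⟨O⟩).elim
  refine isNEffective_of_residueField (fun O => (hx O).isArch O.2.1) (fun O => O.2.1.ne_top)
    Subtype.val_injective serHom_X_ne_zero (fun O => O.2.1.2)
    (fun O => have := O.2.1.charZero; two_ne_zero) hlgp fun O => ?_
  let _ := O.2.1.residueHom.toAlgebra
  exact isNEffective_of_not_good O.2.2 (hκ _ ((hx O).isFunctionFieldOneVar O.2.1))

end LaurentSeries

theorem statement17 (n : ℕ) (K : Type u) [Field K] (hK : IsPnField n K) :
    IsPnField n (LaurentSeries K) := by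
  obtain ⟨hp, hF⟩ := hK
  rw [pyth_le_iff] at hp
  by_cases hall : ∀ (F : Type u) [Field F], (K →+* F) → sums F ⊆ sumSq F (2 ^ (n + 1))
  · let j : K →+* LaurentSeries K := HahnSeries.C
    exact ⟨pyth_le_iff.mpr (hall _ ((algebraMap _ (RatFunc (LaurentSeries K))).comp j)),
      fun F _ _ _ h => absurd (pyth_le_iff.mpr (hall F ((algebraMap _ F).comp j))) h.not_ge⟩
  have h2 : (2 : K) ≠ 0 := by
    refine fun h2 => hall fun F _ j x hx => ?_
    have := CharTwo.of_one_ne_zero_of_two_eq_zero (one_ne_zero (α := F))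
      (by rw [← map_ofNat j 2, h2, map_zero])
    obtain ⟨l, f, rfl⟩ := mem_sums.1 hx
    rw [← CharTwo.sum_sq]
    exact sq_mem_sumSq Nat.one_le_two_pow _
  have hr : (-1 : K) ∉ sums K := by
    refine fun hr => hall fun F _ j x _ => mem_sumSq_of_neg_one_mem ?_ ?_ x
    · rw [← map_ofNat j 2]
      exact (map_ne_zero j).mpr h2
    · simpa using map_mem_sumSq j ((good_of_sums_ratFunc_subset hp h2).1 hr)
  have : CharZero K := charZero_of_inj_zero fun l hl => by
    by_contra hl0
    obtain ⟨l, rfl⟩ := Nat.exists_eq_succ_of_ne_zero hl0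
    refine hr (mem_sums.2 ⟨l, fun _ => 1, ?_⟩)
    simp only [one_pow, Finset.sum_const, Finset.card_univ, Fintype.card_fin, nsmul_one]
    push_cast at hl
    linear_combination -hl
  have hk := levelBound_of_sums_subset hp
  exact ⟨pyth_le_iff.mpr hk.laurentSeries.sums_ratFunc_subset,
    fun F _ _ h => hk.isNEffective h fun κ _ _ => hF κ⟩

end SosPaper
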